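/- Let k be a field and let I be an ideal in Q = k[x_1,…,x_t] generated by monomials of degree at least 2, with minimal monomial generating set M, and let R = Q/I. Then the denominator of the multigraded Poincaré series of R is given by b_R(x,z) = 1 + Σ_{S ∈ sat(M)} m_S · (−z)^{c(S)+2} · H̃(Δ'_S; k)(z), where the sum runs over all non-empty saturated subsets S of M. -/

import Mathlib

noncomputable section
attribute [local instance] Classical.propDecidable

namespace MonomialRings

/-- Monomials in variables indexed by `σ`, represented by their exponent vectors. -/
abbrev Mon (σ : Type*) := σ → ℕ

/-- Two monomials have a non-trivial common factor. -/
def NCF {σ : Type*} (a b : Mon σ) : Prop := ∃ i, a i ≠ 0 ∧ b i ≠ 0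

/-- Adjacency in the graph associated to a set of monomials: edges go between distinct
monomials having a non-trivial common factor. -/
def mAdj {σ : Type*} (a b : Mon σ) : Prop := a ≠ b ∧ NCF a b

/-- `a` and `b` are joined by a path inside `S`. -/
def ConnIn {σ : Type*} (S : Finset (Mon σ)) (a b : Mon σ) : Prop :=
  a ∈ S ∧ b ∈ S ∧ Relation.ReflTransGen (fun u v => u ∈ S ∧ v ∈ S ∧ mAdj u v) a b

/-- A monomial set is connected (in particular nonempty). -/
def IsConnected {σ : Type*} (S : Finset (Mon σ)) : Prop :=
  S.Nonempty ∧ ∀ a ∈ S, ∀ b ∈ S, ConnIn S a b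

/-- The connected component of `a` in `S`. -/
def compOf {σ : Type*} (S : Finset (Mon σ)) (a : Mon σ) : Finset (Mon σ) :=
  S.filter (fun b => ConnIn S a b)

/-- The set of connected components of a monomial set. -/
def components {σ : Type*} (S : Finset (Mon σ)) : Finset (Finset (Mon σ)) :=
  S.image (compOf S)

/-- The number of connected components of a monomial set. -/
def ncomp {σ : Type*} (S : Finset (Mon σ)) : ℕ := (components S).card

/-- The least common multiple `m_S` of a finite set of monomials (`m_∅ = 1`). -/
def mlcm {σ : Type*} (S : Finset (Mon σ)) : Mon σ := S.sup id

/-- `S` is saturated in `M`: for all `m ∈ M` and every connected subset `T ⊆ S`,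
`m ∣ m_T` implies `m ∈ S`. -/
def Saturated {σ : Type*} (M S : Finset (Mon σ)) : Prop :=
  S ⊆ M ∧ ∀ m ∈ M, ∀ T ⊆ S, IsConnected T → m ≤ mlcm T → m ∈ S

/-- The set `sat M` of non-empty saturated subsets of `M`. -/
def satSets {σ : Type*} (M : Finset (Mon σ)) : Finset (Finset (Mon σ)) :=
  M.powerset.filter (fun S => S.Nonempty ∧ Saturated M S)

/-- The saturation `S̄` of `S` in `M`. -/
def saturation {σ : Type*} (M S : Finset (Mon σ)) : Finset (Mon σ) :=
  M.filter (fun m => ∃ C ∈ components S, m ≤ mlcm C)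

/-- The simplicial complex `Δ'_S`: faces are the `T ⊆ S` with `m_T ≠ m_S`, or such that
`S_i ∩ T` is disconnected for some connected component `S_i` of `S`. -/
def dprime {σ : Type*} (S : Finset (Mon σ)) : Set (Finset (Mon σ)) :=
  {T | T ⊆ S ∧ (mlcm T ≠ mlcm S ∨ ∃ C ∈ components S, ¬ IsConnected (C ∩ T))}

/-- The simplicial complex `Δ_N`: faces are the `S ⊆ N` with `m_S ≠ m_N` or `S`
disconnected. -/
def dcomplex {σ : Type*} (N : Finset (Mon σ)) : Set (Finset (Mon σ)) :=
  {T | T ⊆ N ∧ (mlcm T ≠ mlcm N ∨ ¬ IsConnected T)}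

/-- A discrete monomial set: the monomials are pairwise without common factors. -/
def Discrete {σ : Type*} (S : Finset (Mon σ)) : Prop :=
  ∀ a ∈ S, ∀ b ∈ S, a ≠ b → ¬ NCF a b

/-- The lcm-lattice of the monomial set `M` (as a finite set of monomials,
ordered by divisibility i.e. by `≤` on exponent vectors). -/
def lcmLattice {σ : Type*} (M : Finset (Mon σ)) : Finset (Mon σ) :=
  M.powerset.image mlcm

/-- `M_l`: the set of monomials in `M` dividing the monomial `l`. -/
def divisorsIn {σ : Type*} (M : Finset (Mon σ)) (l : Mon σ) : Finset (Mon σ) :=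
  M.filter (fun m => m ≤ l)

/-- `M_N`: the set of monomials in `M` dividing some monomial of `N`. -/
def divisorsInSet {σ : Type*} (M N : Finset (Mon σ)) : Finset (Mon σ) :=
  M.filter (fun m => ∃ l ∈ N, m ≤ l)

/-- An antichain of monomials (the minimal generating set of the monomial ideal
it generates). -/
def IsAntichain' {σ : Type*} (M : Finset (Mon σ)) : Prop :=
  ∀ m ∈ M, ∀ n ∈ M, m ≤ n → m = n

/-- total degree of a monomial -/
def mdeg {t : ℕ} (m : Mon (Fin t)) : ℕ := ∑ i, m i

end MonomialRings
namespace MonomialRings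

/-- An auxiliary (classically chosen) linear order on any type, used to orient simplices. -/
def vOrd (V : Type*) : LinearOrder V := IsWellOrder.linearOrder WellOrderingRel

/-- The position of a vertex `x` inside a face `F` (w.r.t. the auxiliary order). -/
def rankIn {V : Type*} (F : Finset V) (x : V) : ℕ :=
  (F.filter (fun y => (vOrd V).lt y x)).card

/-- The boundary of a single oriented simplex. -/
def bdryAux (k : Type*) [Field k] {V : Type*} (F : Finset V) : Finset V →₀ k :=
  ∑ x ∈ F, ((-1 : k) ^ (rankIn F x)) • Finsupp.single (F.erase x) (1 : k)

/-- The simplicial boundary operator on the module spanned by all finite subsets of `V`. -/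
def bdry (k : Type*) [Field k] (V : Type*) :
    (Finset V →₀ k) →ₗ[k] (Finset V →₀ k) :=
  Finsupp.linearCombination k (bdryAux k)

/-- The subspace of chains of a simplicial complex `Δ` spanned by the faces with `n`
vertices (i.e. of dimension `n - 1`). -/
def chainSub (k : Type*) [Field k] {V : Type*} (Δ : Set (Finset V)) (n : ℕ) :
    Submodule k (Finset V →₀ k) :=
  Submodule.span k ((fun F => Finsupp.single F (1 : k)) '' {F | F ∈ Δ ∧ F.card = n})

/-- Reduced cycles of `Δ` in the degree of faces with `n` vertices. -/
def cycles (k : Type*) [Field k] {V : Type*} (Δ : Set (Finset V)) (n : ℕ) :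
    Submodule k (Finset V →₀ k) :=
  chainSub k Δ n ⊓ LinearMap.ker (bdry k V)

/-- Reduced boundaries of `Δ` in the degree of faces with `n` vertices. -/
def bdries (k : Type*) [Field k] {V : Type*} (Δ : Set (Finset V)) (n : ℕ) :
    Submodule k (Finset V →₀ k) :=
  Submodule.map (bdry k V) (chainSub k Δ (n + 1))

/-- `dim_k H̃_{n-1}(Δ; k)`: the dimension of the reduced homology of `Δ` in the degree of
faces with `n` vertices (homological dimension `n - 1`; `n = 0` corresponds to `H̃₋₁`). -/
def hdim (k : Type*) [Field k] {V : Type*} (Δ : Set (Finset V)) (n : ℕ) : ℕ :=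
  Module.finrank k ↥(cycles k Δ n) - Module.finrank k ↥(bdries k Δ n)

/-- `hdim` with integer index (`0` below the allowed range). -/
def hdimZ (k : Type*) [Field k] {V : Type*} (Δ : Set (Finset V)) (n : ℤ) : ℕ :=
  if 0 ≤ n then hdim k Δ n.toNat else 0

/-- The subquotient `K / (B ∩ K)` of a module, used to form homology. -/
def subquot (k : Type*) [Field k] {M : Type*} [AddCommGroup M] [Module k M]
    (K B : Submodule k M) :=
  ↥K ⧸ B.comap K.subtype

instance (k : Type*) [Field k] {M : Type*} [AddCommGroup M] [Module k M]
    (K B : Submodule k M) : AddCommGroup (subquot k K B) := by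
  unfold subquot; infer_instance

instance (k : Type*) [Field k] {M : Type*} [AddCommGroup M] [Module k M]
    (K B : Submodule k M) : Module k (subquot k K B) := by
  unfold subquot; infer_instance

/-- The reduced homology `H̃_{n-1}(Δ; k)` itself, as a `k`-module. -/
def homologyMod (k : Type*) [Field k] {V : Type*} (Δ : Set (Finset V)) (n : ℕ) :=
  subquot k (cycles k Δ n) (bdries k Δ n)

instance (k : Type*) [Field k] {V : Type*} (Δ : Set (Finset V)) (n : ℕ) :
    AddCommGroup (homologyMod k Δ n) := by
  unfold homologyMod; infer_instance

instance (k : Type*) [Field k] {V : Type*} (Δ : Set (Finset V)) (n : ℕ) :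
    Module k (homologyMod k Δ n) := by
  unfold homologyMod; infer_instance

/-- The generating function `H̃(Δ;k)(z) = ∑ᵢ dim_k H̃ᵢ(Δ;k) zⁱ` of the reduced homology of a
complex all of whose faces have at most `bound` vertices, as a Laurent polynomial
(the `H̃₋₁` term contributes `z⁻¹`). -/
def hgen (k : Type*) [Field k] {V : Type*} (Δ : Set (Finset V)) (bound : ℕ) :
    LaurentPolynomial ℤ :=
  ∑ n ∈ Finset.range (bound + 1), (hdim k Δ n : ℤ) • LaurentPolynomial.T ((n : ℤ) - 1)

/-- The order complex of a subset `P` of a partially ordered type: its faces are the finite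
chains contained in `P`. -/
def orderComplex {V : Type*} [PartialOrder V] (P : Set V) : Set (Finset V) :=
  {F | ↑F ⊆ P ∧ IsChain (· ≤ ·) (F : Set V)}

end MonomialRings
namespace MonomialRings

/-! ### The multigraded Poincaré series, via the bar resolution

For a monomial ring `R = k[x₁,…,x_t]/I`, the multigraded vector spaces `Tor^R_{i,α}(k,k)`
are computed by the (normalized) bar resolution of `k` over `R`.  The monomial ring is
determined by the set `J` of exponents of monomials lying in `I`; `R` has `k`-basis the
monomials `x^β` with `β ∉ J`, and the degree-`(i,α)` part of the bar complex has basis the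
lists `[β₁,…,β_i]` of nonzero exponent vectors not in `J` with `β₁ + ⋯ + β_i = α`. -/

/-- Lists forming the basis of the multigraded piece of the bar complex. -/
def barBasis {σ : Type*} (J : Set (Mon σ)) (i : ℕ) (α : Mon σ) : Set (List (Mon σ)) :=
  {l | l.length = i ∧ l.sum = α ∧ ∀ β ∈ l, β ≠ 0 ∧ β ∉ J}

/-- Merging the entries at positions `j` and `j+1` of a list. -/
def mergeAt {σ : Type*} (l : List (Mon σ)) (j : ℕ) : List (Mon σ) :=
  l.take j ++ [l.getD j 0 + l.getD (j + 1) 0] ++ l.drop (j + 2)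

/-- The bar differential on a basis element. -/
def barAux (k : Type*) [Field k] {σ : Type*} (J : Set (Mon σ)) (l : List (Mon σ)) :
    List (Mon σ) →₀ k :=
  ∑ j ∈ Finset.range (l.length - 1),
    if l.getD j 0 + l.getD (j + 1) 0 ∉ J then
      ((-1 : k) ^ (j + 1)) • Finsupp.single (mergeAt l j) (1 : k)
    else 0

/-- The bar differential. -/
def barD (k : Type*) [Field k] {σ : Type*} (J : Set (Mon σ)) :
    (List (Mon σ) →₀ k) →ₗ[k] (List (Mon σ) →₀ k) :=
  Finsupp.linearCombination k (barAux k J)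

/-- The degree-`(i,α)` part of the bar complex. -/
def barSub (k : Type*) [Field k] {σ : Type*} (J : Set (Mon σ)) (i : ℕ) (α : Mon σ) :
    Submodule k (List (Mon σ) →₀ k) :=
  Submodule.span k ((fun l => Finsupp.single l (1 : k)) '' barBasis J i α)

/-- `dim_k Tor^R_{i,α}(k,k)` for the monomial ring `R` determined by `J`. -/
def torDim (k : Type*) [Field k] {σ : Type*} (J : Set (Mon σ)) (i : ℕ) (α : Mon σ) : ℕ :=
  Module.finrank k ↥(barSub k J i α ⊓ LinearMap.ker (barD k J))
    - Module.finrank k ↥(Submodule.map (barD k J) (barSub k J (i + 1) α))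

/-- The set of exponent vectors of monomials lying in the ideal `I`. -/
def expSet {t : ℕ} {k : Type*} [Field k] (I : Ideal (MvPolynomial (Fin t) k)) :
    Set (Mon (Fin t)) :=
  {β | MvPolynomial.monomial (Finsupp.equivFunOnFinite.symm β) (1 : k) ∈ I}

/-- The exponent (in `ℕ^t × ℕ`) of the monomial `x^α z^d`; the extra variable `none`
is the homological variable `z`. -/
def expOf {t : ℕ} (α : Mon (Fin t)) (d : ℕ) : Option (Fin t) →₀ ℕ :=
  Finsupp.equivFunOnFinite.symm (fun o => Option.elim o d α)

/-- The multigraded Poincaré series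
`P^R_k(x,z) = ∑_{i,α} dim_k Tor^R_{i,α}(k,k) x^α z^i` of the monomial ring `R`
determined by `J`, as a formal power series in `x₁,…,x_t` and `z` (the variable `none`). -/
def poincareSeries (k : Type*) [Field k] {t : ℕ} (J : Set (Mon (Fin t))) :
    MvPowerSeries (Option (Fin t)) ℤ :=
  fun e => (torDim k J (e none) (fun i => e (some i)) : ℤ)

/-- The statement that `b` is the Backelin denominator of the Poincaré series:
`P^R_k(x,z) = ∏ᵢ(1+xᵢz) / b(x,z)`. -/
def IsDenominator (k : Type*) [Field k] {t : ℕ} (J : Set (Mon (Fin t)))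
    (b : MvPolynomial (Option (Fin t)) ℤ) : Prop :=
  (b : MvPowerSeries (Option (Fin t)) ℤ) * poincareSeries k J
    = ∏ i : Fin t, (1 + MvPowerSeries.X (some i) * MvPowerSeries.X none)

/-- The multigraded ideal of a monomial set: the exponents `β` with `x^m ∣ x^β` for some
`m ∈ M`. -/
def upperSet {σ : Type*} (M : Finset (Mon σ)) : Set (Mon σ) :=
  {β | ∃ m ∈ M, m ≤ β}

/-- `I` is the monomial ideal generated by the monomial set `M`. -/
def IsMonomialIdealOf {t : ℕ} {k : Type*} [Field k] (M : Finset (Mon (Fin t)))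
    (I : Ideal (MvPolynomial (Fin t) k)) : Prop :=
  I = Ideal.span ((fun m => MvPolynomial.monomial (Finsupp.equivFunOnFinite.symm m) (1 : k)) '' ↑M)

/-- The specialization `b(z) = b(1,…,1,z)` of a polynomial in `x₁,…,x_t,z`. -/
def zSpecialize {t : ℕ} (b : MvPolynomial (Option (Fin t)) ℤ) : Polynomial ℤ :=
  MvPolynomial.aeval (fun o : Option (Fin t) => Option.elim o Polynomial.X (fun _ => 1)) b

end MonomialRings
namespace MonomialRings

/-- The polynomial
`1 + ∑_{S ∈ sat(M)} m_S (-z)^{c(S)+2} H̃(Δ'_S;k)(z)`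
of Theorem (main formula); the summand for `S` and homological dimension `n - 1`
contributes `(-1)^{c(S)} dim_k H̃_{n-1}(Δ'_S;k) · x^{m_S} z^{c(S)+n+1}`. -/
def bFormula (k : Type*) [Field k] {t : ℕ} (M : Finset (Mon (Fin t))) :
    MvPolynomial (Option (Fin t)) ℤ :=
  1 + ∑ S ∈ satSets M, ∑ n ∈ Finset.range (S.card + 1),
      MvPolynomial.monomial (expOf (mlcm S) (ncomp S + n + 1))
        ((-1 : ℤ) ^ (ncomp S) * (hdim k (dprime S) n : ℤ))

end MonomialRings

namespace MonomialRings

section LinearAlgebra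

variable {k : Type*} [Field k] {E E' : Type*} [AddCommGroup E] [Module k E]
  [AddCommGroup E'] [Module k E']

/-- The dimension of the homology at `W₁` of `W₂ → W₁ → W₀`, for subspaces of a space with an
operator `D`. -/
def homDim (D : E →ₗ[k] E) (W₁ W₂ : Submodule k E) : ℤ :=
  (Module.finrank k ↥(W₁ ⊓ LinearMap.ker D) : ℤ) - Module.finrank k ↥(W₂.map D)

lemma finrank_inf_ker_add_finrank_map (D : E →ₗ[k] E') (W : Submodule k E)
    [FiniteDimensional k W] :
    Module.finrank k ↥(W ⊓ LinearMap.ker D) + Module.finrank k ↥(W.map D)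
      = Module.finrank k W := by
  have h := LinearMap.finrank_range_add_finrank_ker (D.domRestrict W)
  rw [LinearMap.range_domRestrict] at h
  have h2 : (LinearMap.ker (D.domRestrict W)).map W.subtype = W ⊓ LinearMap.ker D := by
    rw [LinearMap.domRestrict, LinearMap.ker_comp, Submodule.map_comap_subtype]
  rw [← h2, LinearEquiv.finrank_eq (Submodule.equivMapOfInjective W.subtype
    W.injective_subtype _).symm]
  omega

lemma finrank_sup_of_disjoint (A B : Submodule k E) [FiniteDimensional k A]
    [FiniteDimensional k B] (h : Disjoint A B) :
    Module.finrank k ↥(A ⊔ B) = Module.finrank k A + Module.finrank k B := by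
  have := Submodule.finrank_sup_add_finrank_inf_eq A B
  rw [h.eq_bot, finrank_bot] at this
  omega

lemma homDim_eq_zero (D : E →ₗ[k] E) (W₁ W₂ : Submodule k E)
    (hc : ∀ y ∈ W₂, D y ∈ W₁) (hDD : ∀ x, D (D x) = 0)
    (hex : ∀ x ∈ W₁, D x = 0 → ∃ y ∈ W₂, D y = x) : homDim D W₁ W₂ = 0 := by
  have : W₁ ⊓ LinearMap.ker D = W₂.map D := by
    ext x
    constructor
    · rintro ⟨h1, h2⟩
      obtain ⟨y, hy, rfl⟩ := hex x h1 h2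
      exact ⟨y, hy, rfl⟩
    · rintro ⟨y, hy, rfl⟩
      exact ⟨hc y hy, hDD y⟩
  rw [homDim, this, sub_self]

lemma homDim_toNat (D : E →ₗ[k] E) (W₁ W₂ : Submodule k E) [FiniteDimensional k W₁]
    (hc : ∀ y ∈ W₂, D y ∈ W₁) (hDD : ∀ y ∈ W₂, D (D y) = 0) :
    ((Module.finrank k ↥(W₁ ⊓ LinearMap.ker D) - Module.finrank k ↥(W₂.map D) : ℕ) : ℤ)
      = homDim D W₁ W₂ := by
  have hle : W₂.map D ≤ W₁ ⊓ LinearMap.ker D := by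
    rintro _ ⟨y, hy, rfl⟩
    exact ⟨hc y hy, hDD y hy⟩
  have : FiniteDimensional k ↥(W₁ ⊓ LinearMap.ker D) :=
    Submodule.finiteDimensional_of_le inf_le_left
  have := Submodule.finrank_mono hle
  rw [homDim]
  omega

lemma filtration_cycle_count (D D₀ : E →ₗ[k] E) (P₁ Q₀ Q₁ G₀ G₁ : Submodule k E)
    [FiniteDimensional k P₁]
    (hP₁ : P₁ = G₁ ⊔ Q₁) (hd₁ : Disjoint G₁ Q₁) (hd₀ : Disjoint G₀ Q₀)
    (hDD : ∀ x, D (D x) = 0) (hQ₁ : ∀ x ∈ Q₁, D x ∈ Q₀) (hG₁ : ∀ x ∈ G₁, D₀ x ∈ G₀)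
    (hDG₁ : ∀ x ∈ G₁, D x - D₀ x ∈ Q₀)
    (hex : ∀ x ∈ Q₀, D x = 0 → ∃ y ∈ P₁, D y = x) :
    Module.finrank k ↥(G₁ ⊓ LinearMap.ker D₀) + Module.finrank k Q₁
      = Module.finrank k ↥(P₁ ⊓ LinearMap.ker D) + Module.finrank k ↥(Q₀ ⊓ LinearMap.ker D) := by
  have hGP : G₁ ≤ P₁ := hP₁ ▸ le_sup_left
  have hQP : Q₁ ≤ P₁ := hP₁ ▸ le_sup_right
  set K : Submodule k E := P₁ ⊓ Q₀.comap D with hK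
  have : FiniteDimensional k K := Submodule.finiteDimensional_of_le inf_le_left
  have : FiniteDimensional k Q₁ := Submodule.finiteDimensional_of_le hQP
  have : FiniteDimensional k ↥(G₁ ⊓ LinearMap.ker D₀) :=
    Submodule.finiteDimensional_of_le (inf_le_left.trans hGP)
  have h1 := finrank_inf_ker_add_finrank_map D K
  have h2 : K ⊓ LinearMap.ker D = P₁ ⊓ LinearMap.ker D := by
    ext x
    simp only [hK, Submodule.mem_inf, Submodule.mem_comap, LinearMap.mem_ker]
    constructor
    · rintro ⟨⟨a, -⟩, c⟩; exact ⟨a, c⟩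
    · rintro ⟨a, c⟩; exact ⟨⟨a, c ▸ Q₀.zero_mem⟩, c⟩
  have h3 : K.map D = Q₀ ⊓ LinearMap.ker D := by
    ext x
    simp only [hK, Submodule.mem_inf, Submodule.mem_map, Submodule.mem_comap, LinearMap.mem_ker]
    constructor
    · rintro ⟨y, ⟨-, hy⟩, rfl⟩; exact ⟨hy, hDD y⟩
    · rintro ⟨hx, hx0⟩
      obtain ⟨y, hy, rfl⟩ := hex x hx hx0
      exact ⟨y, ⟨hy, hx⟩, rfl⟩
  have h4 : K = (G₁ ⊓ LinearMap.ker D₀) ⊔ Q₁ := by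
    apply le_antisymm
    · rintro x ⟨hx, hx'⟩
      rw [hP₁] at hx
      obtain ⟨g, hg, q, hq, rfl⟩ := Submodule.mem_sup.1 hx
      refine Submodule.add_mem_sup ⟨hg, ?_⟩ hq
      have e : D₀ g = D (g + q) - (D g - D₀ g) - D q := by rw [map_add]; abel
      have : D₀ g ∈ Q₀ := by
        rw [e]
        exact Q₀.sub_mem (Q₀.sub_mem hx' (hDG₁ g hg)) (hQ₁ q hq)
      exact (Submodule.disjoint_def.1 hd₀) _ (hG₁ g hg) this
    · refine sup_le ?_ ?_
      · rintro g ⟨hg, hg0⟩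
        refine ⟨hGP hg, ?_⟩
        have := hDG₁ g hg
        rw [LinearMap.mem_ker.1 hg0, sub_zero] at this
        exact this
      · intro q hq
        exact ⟨hQP hq, hQ₁ q hq⟩
  have h5 := finrank_sup_of_disjoint (G₁ ⊓ LinearMap.ker D₀) Q₁ (hd₁.mono_left inf_le_left)
  rw [← h4] at h5
  rw [h2, h3] at h1
  omega

/-- If every cycle of the subcomplex `Q` bounds in `P`, the long exact sequence of
`0 → Q → P → G → 0` splits into short ones. -/
lemma homDim_graded_piece (D D₀ : E →ₗ[k] E) (P₁ P₂ Q₀ Q₁ Q₂ G₀ G₁ G₂ : Submodule k E)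
    [FiniteDimensional k P₁] [FiniteDimensional k P₂]
    (hP₁ : P₁ = G₁ ⊔ Q₁) (hP₂ : P₂ = G₂ ⊔ Q₂)
    (hd₀ : Disjoint G₀ Q₀) (hd₁ : Disjoint G₁ Q₁) (hd₂ : Disjoint G₂ Q₂)
    (hDD : ∀ x, D (D x) = 0)
    (hQ₁ : ∀ x ∈ Q₁, D x ∈ Q₀) (hQ₂ : ∀ x ∈ Q₂, D x ∈ Q₁)
    (hG₁ : ∀ x ∈ G₁, D₀ x ∈ G₀) (hG₂ : ∀ x ∈ G₂, D₀ x ∈ G₁)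
    (hDG₁ : ∀ x ∈ G₁, D x - D₀ x ∈ Q₀) (hDG₂ : ∀ x ∈ G₂, D x - D₀ x ∈ Q₁)
    (hex₀ : ∀ x ∈ Q₀, D x = 0 → ∃ y ∈ P₁, D y = x)
    (hex₁ : ∀ x ∈ Q₁, D x = 0 → ∃ y ∈ P₂, D y = x) :
    homDim D₀ G₁ G₂ = homDim D P₁ P₂ + homDim D Q₀ Q₁ := by
  have hGP : G₂ ≤ P₂ := hP₂ ▸ le_sup_left
  have hQP : Q₂ ≤ P₂ := hP₂ ▸ le_sup_right
  have : FiniteDimensional k Q₁ := Submodule.finiteDimensional_of_le (hP₁ ▸ le_sup_right)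
  have : FiniteDimensional k G₂ := Submodule.finiteDimensional_of_le hGP
  have : FiniteDimensional k Q₂ := Submodule.finiteDimensional_of_le hQP
  have a1 := filtration_cycle_count D D₀ P₁ Q₀ Q₁ G₀ G₁ hP₁ hd₁ hd₀ hDD hQ₁ hG₁ hDG₁ hex₀
  have a2 := filtration_cycle_count D D₀ P₂ Q₁ Q₂ G₁ G₂ hP₂ hd₂ hd₁ hDD hQ₂ hG₂ hDG₂ hex₁
  have b1 := finrank_inf_ker_add_finrank_map D₀ G₂
  have b2 := finrank_inf_ker_add_finrank_map D P₂
  have b3 := finrank_inf_ker_add_finrank_map D Q₁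
  have b4 := finrank_sup_of_disjoint G₂ Q₂ hd₂
  rw [← hP₂] at b4
  simp only [homDim]
  omega

/-- Homology dimensions are transported by a linear map that is injective on the complex. -/
lemma homDim_transport (f : E →ₗ[k] E') (D : E →ₗ[k] E) (D' : E' →ₗ[k] E')
    (W₁ W₂ U : Submodule k E) (W₁' W₂' : Submodule k E')
    (hW₁' : W₁' = W₁.map f) (hW₂' : W₂' = W₂.map f)
    (h₁ : W₁ ≤ U) (hU₁ : ∀ x ∈ W₁, D x ∈ U) (hU₂ : ∀ x ∈ W₂, D x ∈ U)
    (hinj : ∀ x ∈ U, f x = 0 → x = 0)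
    (hc₁ : ∀ x ∈ W₁, f (D x) = D' (f x)) (hc₂ : ∀ x ∈ W₂, f (D x) = D' (f x)) :
    homDim D' W₁' W₂' = homDim D W₁ W₂ := by
  have key : ∀ V : Submodule k E, V ≤ U → Module.finrank k ↥(V.map f) = Module.finrank k V := by
    intro V hV
    have hi : Function.Injective (f.domRestrict V) := by
      rw [injective_iff_map_eq_zero]
      intro x hx
      exact Subtype.ext (hinj x (hV x.2) hx)
    rw [← LinearMap.range_domRestrict]
    exact LinearMap.finrank_range_of_inj hi
  have e1 : W₁' ⊓ LinearMap.ker D' = (W₁ ⊓ LinearMap.ker D).map f := by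
    ext y
    constructor
    · rintro ⟨hy, hy0⟩
      rw [hW₁'] at hy
      obtain ⟨x, hx, rfl⟩ := hy
      refine ⟨x, ⟨hx, hinj _ (hU₁ x hx) ?_⟩, rfl⟩
      rw [hc₁ x hx]; exact hy0
    · rintro ⟨x, ⟨hx, hx0⟩, rfl⟩
      refine ⟨hW₁' ▸ ⟨x, hx, rfl⟩, ?_⟩
      change D' (f x) = 0
      rw [← hc₁ x hx, LinearMap.mem_ker.1 hx0, map_zero]
  have e2 : W₂'.map D' = (W₂.map D).map f := by
    subst hW₂'
    ext y
    constructor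
    · rintro ⟨_, ⟨x, hx, rfl⟩, rfl⟩
      exact ⟨D x, ⟨x, hx, rfl⟩, hc₂ x hx⟩
    · rintro ⟨_, ⟨x, hx, rfl⟩, rfl⟩
      exact ⟨f x, ⟨x, hx, rfl⟩, (hc₂ x hx).symm⟩
  rw [homDim, homDim, e1, e2, key _ (inf_le_left.trans h₁), key]
  rintro _ ⟨x, hx, rfl⟩
  exact hU₂ x hx

variable {ι : Type*}

lemma finiteDimensional_supported {s : Set ι} (hs : s.Finite) :
    FiniteDimensional k ↥(Finsupp.supported k k s) := by
  have : Finite s := hs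
  have : FiniteDimensional k (s →₀ k) := inferInstance
  exact LinearEquiv.finiteDimensional (Finsupp.supportedEquivFinsupp (M := k) (R := k) s).symm

lemma finrank_supported {s : Set ι} (hs : s.Finite) :
    Module.finrank k ↥(Finsupp.supported k k s) = s.ncard := by
  have : Fintype s := hs.fintype
  rw [LinearEquiv.finrank_eq (Finsupp.supportedEquivFinsupp (M := k) (R := k) s),
    Module.finrank_finsupp_self, Set.ncard_eq_toFinset_card', Set.toFinset_card]

lemma supported_induction {s : Set ι} {W : Submodule k E} (f : (ι →₀ k) →ₗ[k] E)
    (h : ∀ a ∈ s, f (Finsupp.single a 1) ∈ W) {x : ι →₀ k} (hx : x ∈ Finsupp.supported k k s) :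
    f x ∈ W := by
  rw [Finsupp.supported_eq_span_single] at hx
  have : Submodule.span k ((fun i => Finsupp.single i (1 : k)) '' s) ≤ W.comap f := by
    rw [Submodule.span_le]
    rintro _ ⟨a, ha, rfl⟩
    exact h a ha
  exact this hx

lemma eq_on_supported {s : Set ι} (f g : (ι →₀ k) →ₗ[k] E)
    (h : ∀ a ∈ s, f (Finsupp.single a 1) = g (Finsupp.single a 1)) {x : ι →₀ k}
    (hx : x ∈ Finsupp.supported k k s) : f x = g x := by
  have := supported_induction (W := (⊥ : Submodule k E)) (f - g) (s := s) (x := x)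
    (by intro a ha; simp [h a ha]) hx
  simpa [sub_eq_zero] using this

lemma single_mem_supported {s : Set ι} {a : ι} (h : a ∈ s) (c : k) :
    Finsupp.single a c ∈ Finsupp.supported k k s :=
  Finsupp.single_mem_supported k c h

/-- A unitriangular operator on a finite set of basis elements is surjective. -/
lemma triangular_surjective {r : Type*} [PartialOrder r] {s : Set ι} (hs : s.Finite)
    (u : (ι →₀ k) →ₗ[k] (ι →₀ k)) (ρ : ι → r)
    (hu : ∀ a ∈ s, u (Finsupp.single a 1) - Finsupp.single a 1
      ∈ Finsupp.supported k k {b | b ∈ s ∧ ρ a < ρ b})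
    {x : ι →₀ k} (hx : x ∈ Finsupp.supported k k s) :
    ∃ y ∈ Finsupp.supported k k s, u y = x := by
  have key : ∀ a ∈ s, Finsupp.single a (1 : k) ∈ (Finsupp.supported k k s).map u := by
    have : Finite s := hs
    have hwf : WellFounded (fun a b : s => ρ b.1 < ρ a.1) := by
      have : IsTrans s (fun a b : s => ρ b.1 < ρ a.1) := ⟨fun a b c h1 h2 => h2.trans h1⟩
      have : Std.Irrefl (fun a b : s => ρ b.1 < ρ a.1) := ⟨fun a h => lt_irrefl _ h⟩
      exact Finite.wellFounded_of_trans_of_irrefl _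
    intro a ha
    have := hwf.induction (C := fun a : s => Finsupp.single a.1 (1 : k) ∈
      (Finsupp.supported k k s).map u) ⟨a, ha⟩ ?_
    · exact this
    · rintro ⟨a, ha⟩ ih
      have h1 : u (Finsupp.single a 1) - Finsupp.single a 1 ∈ (Finsupp.supported k k s).map u := by
        have := supported_induction (W := (Finsupp.supported k k s).map u) LinearMap.id
          (fun b hb => ih ⟨b, hb.1⟩ hb.2) (hu a ha)
        exact this
      have h2 : u (Finsupp.single a 1) ∈ (Finsupp.supported k k s).map u :=
        ⟨_, single_mem_supported ha 1, rfl⟩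
      have := Submodule.sub_mem _ h2 h1
      simpa using this
  have := supported_induction (W := (Finsupp.supported k k s).map u) LinearMap.id key hx
  exact this

lemma triangular_injective {r : Type*} [PartialOrder r] {s : Set ι} (hs : s.Finite)
    (u : (ι →₀ k) →ₗ[k] (ι →₀ k)) (ρ : ι → r)
    (hu : ∀ a ∈ s, u (Finsupp.single a 1) - Finsupp.single a 1
      ∈ Finsupp.supported k k {b | b ∈ s ∧ ρ a < ρ b})
    {x : ι →₀ k} (hx : x ∈ Finsupp.supported k k s) (h0 : u x = 0) : x = 0 := by
  have := finiteDimensional_supported (k := k) hs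
  have hmap : ∀ x ∈ Finsupp.supported k k s, u x ∈ Finsupp.supported k k s := by
    intro x hx
    refine supported_induction u (fun a ha => ?_) hx
    have h1 := Finsupp.supported_mono (M := k) (R := k)
      (fun b (hb : b ∈ {b | b ∈ s ∧ ρ a < ρ b}) => hb.1)
      (hu a ha)
    have := Submodule.add_mem _ h1 (single_mem_supported ha (1 : k))
    simpa using this
  let v := u.restrict hmap
  have hv : Function.Surjective v := by
    rintro ⟨x, hx⟩
    obtain ⟨y, hy, rfl⟩ := triangular_surjective hs u ρ hu hx
    exact ⟨⟨y, hy⟩, rfl⟩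
  have hi : Function.Injective v :=
    (LinearMap.injective_iff_surjective (K := k) (V := Finsupp.supported k k s) (f := v)).2 hv
  have : (⟨x, hx⟩ : Finsupp.supported k k s) = 0 := hi (by
    rw [map_zero]; exact Subtype.ext h0)
  exact congrArg Subtype.val this

/-- A subcomplex bounds as soon as it admits a homotopy `h` with `D h + h D` unitriangular. -/
lemma bounds_of_triangular_homotopy {r : Type*} [PartialOrder r] {s s₀ s₁ : Set ι}
    (hs₀ : s₀.Finite) (hs₁ : s₁.Finite) (D h : (ι →₀ k) →ₗ[k] (ι →₀ k)) (ρ : ι → r)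
    (hDD : ∀ x, D (D x) = 0)
    (hD : ∀ a ∈ s₁, D (Finsupp.single a 1) ∈ Finsupp.supported k k s₀)
    (hh : ∀ a ∈ s₁, h (Finsupp.single a 1) ∈ Finsupp.supported k k s)
    (hu₀ : ∀ a ∈ s₀, D (h (Finsupp.single a 1)) + h (D (Finsupp.single a 1)) - Finsupp.single a 1
      ∈ Finsupp.supported k k {b | b ∈ s₀ ∧ ρ a < ρ b})
    (hu₁ : ∀ a ∈ s₁, D (h (Finsupp.single a 1)) + h (D (Finsupp.single a 1)) - Finsupp.single a 1
      ∈ Finsupp.supported k k {b | b ∈ s₁ ∧ ρ a < ρ b})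
    (x : ι →₀ k) (hx : x ∈ Finsupp.supported k k s₁) (hDx : D x = 0) :
    ∃ y ∈ Finsupp.supported k k s, D y = x := by
  let u : (ι →₀ k) →ₗ[k] (ι →₀ k) := D ∘ₗ h + h ∘ₗ D
  obtain ⟨z, hz, hzx⟩ := triangular_surjective hs₁ u ρ hu₁ hx
  have hDz : D z = 0 := by
    refine triangular_injective hs₀ u ρ hu₀ (supported_induction D hD hz) ?_
    have : u (D z) = D (u z) := by simp [u, hDD]
    rw [this, hzx, hDx]
  refine ⟨h z, supported_induction h hh hz, ?_⟩
  have : u z = D (h z) + h (D z) := rfl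
  rw [← hzx, this, hDz, map_zero, add_zero]

lemma supported_sup_of_partition {s t u : Set ι} (h : s = t ∪ u) :
    Finsupp.supported k k s = Finsupp.supported k k t ⊔ Finsupp.supported k k u := by
  rw [h, Finsupp.supported_union]

lemma disjoint_supported {t u : Set ι} (h : Disjoint t u) :
    Disjoint (Finsupp.supported k k t) (Finsupp.supported k k u) :=
  Finsupp.disjoint_supported_supported h

end LinearAlgebra

end MonomialRings

namespace MonomialRings

section ListCalculus

variable {k : Type*} [Field k] {Γ : Type*}

/-- Linear extension of a map defined on basis elements. -/
def linExt {ι E : Type*} [AddCommGroup E] [Module k E] (f : ι → E) : (ι →₀ k) →ₗ[k] E :=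
  Finsupp.linearCombination k f

@[simp] lemma linExt_single {ι E : Type*} [AddCommGroup E] [Module k E] (f : ι → E) (a : ι)
    (c : k) :
    linExt f (Finsupp.single a c) = c • f a := by
  simp [linExt]

lemma linearMap_eq_of_single {ι E : Type*} [AddCommGroup E] [Module k E]
    {f g : (ι →₀ k) →ₗ[k] E}
    (h : ∀ a, f (Finsupp.single a 1) = g (Finsupp.single a 1)) (x : ι →₀ k) : f x = g x :=
  eq_on_supported (s := Set.univ) f g (fun a _ => h a)
    (by rw [Finsupp.supported_univ]; trivial)

/-- Prepending a letter to lists. -/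
def consL (a : Γ) : (List Γ →₀ k) →ₗ[k] (List Γ →₀ k) :=
  linExt fun l => Finsupp.single (a :: l) 1

@[simp] lemma consL_single (a : Γ) (l : List Γ) (c : k) :
    consL a (Finsupp.single l c) = Finsupp.single (a :: l) c := by
  simp [consL]

/-- Prepending a combination of letters to lists. -/
def consS : (Γ →₀ k) →ₗ[k] (List Γ →₀ k) →ₗ[k] (List Γ →₀ k) :=
  linExt (consL (k := k))

@[simp] lemma consS_single (a : Γ) (c : k) (x : List Γ →₀ k) :
    consS (Finsupp.single a c) x = c • consL a x := by
  simp [consS]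

/-- The operator `a :: l ↦ -(d a) :: l + ε(a) a :: Der l`. -/
def derAux (d : Γ → Γ →₀ k) (ε : Γ → k) : List Γ → (List Γ →₀ k)
  | [] => 0
  | a :: l => -consS (d a) (Finsupp.single l 1) + ε a • consL a (derAux d ε l)

/-- The extension of an operator on letters to a signed derivation on lists. -/
def der (d : Γ → Γ →₀ k) (ε : Γ → k) : (List Γ →₀ k) →ₗ[k] (List Γ →₀ k) := linExt (derAux d ε)

@[simp] lemma der_nil (d : Γ → Γ →₀ k) (ε : Γ → k) (c : k) :
    der d ε (Finsupp.single [] c) = 0 := by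
  simp [der, derAux]

lemma der_cons (d : Γ → Γ →₀ k) (ε : Γ → k) (a : Γ) (x : List Γ →₀ k) :
    der d ε (consL a x) = -consS (d a) x + ε a • consL a (der d ε x) := by
  refine linearMap_eq_of_single (f := der d ε ∘ₗ consL a)
    (g := -consS (d a) + ε a • (consL a ∘ₗ der d ε)) (fun l => ?_) x
  simp [der, derAux]

/-- Multiplying the head of a list by a letter. -/
def mulHead (c : Γ → Γ → k) (mul : Γ → Γ → Γ) (a : Γ) :
    (List Γ →₀ k) →ₗ[k] (List Γ →₀ k) :=
  linExt fun
    | [] => 0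
    | b :: l => Finsupp.single (mul a b :: l) (c a b)

@[simp] lemma mulHead_nil (c : Γ → Γ → k) (mul : Γ → Γ → Γ) (a : Γ) (r : k) :
    mulHead c mul a (Finsupp.single [] r) = 0 := by
  simp [mulHead]

lemma mulHead_cons (c : Γ → Γ → k) (mul : Γ → Γ → Γ) (a b : Γ) (x : List Γ →₀ k) :
    mulHead c mul a (consL b x) = c a b • consL (mul a b) x := by
  refine linearMap_eq_of_single (f := mulHead c mul a ∘ₗ consL b)
    (g := c a b • consL (mul a b)) (fun l => ?_) x
  simp [mulHead]

/-- The bar operator: `a :: l ↦ ε(a) a :: barMul l + ε(a) (a * head l) :: tail l`. -/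
def barMulAux (c : Γ → Γ → k) (mul : Γ → Γ → Γ) (ε : Γ → k) : List Γ → (List Γ →₀ k)
  | [] => 0
  | a :: l => ε a • consL a (barMulAux c mul ε l) + ε a • mulHead c mul a (Finsupp.single l 1)

/-- The part of the bar differential that multiplies adjacent letters. -/
def barMul (c : Γ → Γ → k) (mul : Γ → Γ → Γ) (ε : Γ → k) :
    (List Γ →₀ k) →ₗ[k] (List Γ →₀ k) :=
  linExt (barMulAux c mul ε)

@[simp] lemma barMul_nil (c : Γ → Γ → k) (mul : Γ → Γ → Γ) (ε : Γ → k) (r : k) :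
    barMul c mul ε (Finsupp.single [] r) = 0 := by
  simp [barMul, barMulAux]

lemma barMul_cons (c : Γ → Γ → k) (mul : Γ → Γ → Γ) (ε : Γ → k) (a : Γ) (x : List Γ →₀ k) :
    barMul c mul ε (consL a x) = ε a • consL a (barMul c mul ε x) + ε a • mulHead c mul a x := by
  refine linearMap_eq_of_single (f := barMul c mul ε ∘ₗ consL a)
    (g := ε a • (consL a ∘ₗ barMul c mul ε) + ε a • mulHead c mul a) (fun l => ?_) x
  simp [barMul, barMulAux]

/-- Left multiplication of letters. -/
def mulL (c : Γ → Γ → k) (mul : Γ → Γ → Γ) (a : Γ) : (Γ →₀ k) →ₗ[k] (Γ →₀ k) :=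
  linExt fun b => Finsupp.single (mul a b) (c a b)

/-- Right multiplication of letters. -/
def mulR (c : Γ → Γ → k) (mul : Γ → Γ → Γ) (b : Γ) : (Γ →₀ k) →ₗ[k] (Γ →₀ k) :=
  linExt fun a => Finsupp.single (mul a b) (c a b)

lemma mulHead_consS (c : Γ → Γ → k) (mul : Γ → Γ → Γ) (a : Γ) (y : Γ →₀ k) (x : List Γ →₀ k) :
    mulHead c mul a (consS y x) = consS (mulL c mul a y) x := by
  refine linearMap_eq_of_single (f := mulHead c mul a ∘ₗ consS.flip x)
    (g := consS.flip x ∘ₗ mulL c mul a) (fun b => ?_) y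
  simp [mulL, mulHead_cons]

/-- The bar differential of a dga with a given basis of its augmentation ideal squares to
zero. -/
theorem der_add_barMul_sq (d : Γ → Γ →₀ k) (ε : Γ → k) (c : Γ → Γ → k) (mul : Γ → Γ → Γ)
    (hε : ∀ a, ε a * ε a = 1) (hdε : ∀ a, ∀ b ∈ (d a).support, ε b = -ε a)
    (hdd : ∀ a, linExt d (d a) = 0) (hcε : ∀ a b, c a b ≠ 0 → ε (mul a b) = -(ε a * ε b))
    (hleib : ∀ a b, c a b • d (mul a b) = mulR c mul b (d a) - ε a • mulL c mul a (d b))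
    (hassoc : ∀ a b e, mul (mul a b) e = mul a (mul b e))
    (hc : ∀ a b e, c a b * c (mul a b) e = c b e * c a (mul b e)) (x : List Γ →₀ k) :
    (der d ε + barMul c mul ε) ((der d ε + barMul c mul ε) x) = 0 := by
  set D := der d ε + barMul c mul ε with hD
  have Dnil : ∀ r : k, D (Finsupp.single [] r) = 0 := by intro r; simp [hD]
  have Dcons : ∀ a (x : List Γ →₀ k), D (consL a x)
      = -consS (d a) x + ε a • consL a (D x) + ε a • mulHead c mul a x := by
    intro a x
    simp only [hD, LinearMap.add_apply, der_cons, barMul_cons, map_add, smul_add]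
    abel
  have DconsS : ∀ (e : k) (y : Γ →₀ k) (x : List Γ →₀ k), (∀ b ∈ y.support, ε b = e) →
      D (consS y x) = -consS (linExt d y) x + e • consS y (D x)
        + e • (linExt (fun a => mulHead c mul a x) : (Γ →₀ k) →ₗ[k] (List Γ →₀ k)) y := by
    intro e y x hy
    have := eq_on_supported (s := {b | ε b = e}) (D ∘ₗ consS.flip x)
      (-(consS.flip x ∘ₗ linExt d) + e • consS.flip (D x) +
        e • (linExt (fun a => mulHead c mul a x) : (Γ →₀ k) →ₗ[k] (List Γ →₀ k))) (x := y) ?_ ?_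
    · simpa using this
    · intro a ha
      have ha' : ε a = e := ha
      simp [Dcons, ha']
    · rw [Finsupp.mem_supported]
      intro b hb
      exact hy b hb
  have mulRS : ∀ b (y : Γ →₀ k) (x : List Γ →₀ k),
      (linExt (fun a => mulHead c mul a (consL b x)) : (Γ →₀ k) →ₗ[k] (List Γ →₀ k)) y
        = consS (mulR c mul b y) x := by
    intro b y x
    refine linearMap_eq_of_single (g := consS.flip x ∘ₗ mulR c mul b) (fun a => ?_) y
    simp [mulR, mulHead_cons]
  have mulmul : ∀ a b (x : List Γ →₀ k), mulHead c mul a (mulHead c mul b x)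
      = c a b • mulHead c mul (mul a b) x := by
    intro a b x
    refine linearMap_eq_of_single (f := mulHead c mul a ∘ₗ mulHead c mul b)
      (g := c a b • mulHead c mul (mul a b)) (fun l => ?_) x
    cases l with
    | nil => simp
    | cons e l =>
      simp only [LinearMap.comp_apply, LinearMap.smul_apply]
      rw [← consL_single, mulHead_cons, map_smul, mulHead_cons, mulHead_cons, smul_smul, smul_smul,
        hc, hassoc]
  refine linearMap_eq_of_single (f := D ∘ₗ D) (g := 0) (fun l => ?_) x
  simp only [LinearMap.comp_apply, LinearMap.zero_apply]
  induction l with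
  | nil => rw [Dnil, map_zero]
  | cons a l ih =>
    rw [← consL_single, Dcons, map_add, map_add, map_neg, map_smul, map_smul, Dcons,
      DconsS (-ε a) (d a) _ (hdε a), hdd, ih]
    simp only [map_zero, LinearMap.zero_apply, neg_zero, zero_add, smul_zero, add_zero, smul_add,
      smul_smul, hε, one_smul]
    cases l with
    | nil =>
      have : (fun a => mulHead c mul a (Finsupp.single [] (1 : k))) = 0 := by ext1 a; simp
      rw [this]
      simp [Dnil, linExt]
    | cons b l =>
      rw [← consL_single, mulRS, mulHead_cons, Dcons, map_smul, Dcons]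
      simp only [map_add, map_neg, map_smul, mulHead_cons, mulHead_consS, mulmul, smul_add,
        smul_neg, smul_smul]
      by_cases h : c a b = 0
      · have := hleib a b
        rw [h, zero_smul, eq_comm, sub_eq_zero] at this
        rw [this]
        simp only [h, map_smul, LinearMap.smul_apply, smul_smul, hε, mul_zero, zero_mul, zero_smul,
          neg_mul, neg_zero]
        module
      · have h1 := hleib a b
        have h2 : c a b • consS (d (mul a b)) (Finsupp.single l (1 : k)) =
            consS (mulR c mul b (d a)) (Finsupp.single l 1)
              - ε a • consS (mulL c mul a (d b)) (Finsupp.single l 1) := by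
          rw [← LinearMap.smul_apply, ← map_smul, h1]
          simp
        rw [hcε a b h]
        generalize consS (d (mul a b)) (Finsupp.single l (1 : k)) = X at *
        generalize consS (mulR c mul b (d a)) (Finsupp.single l (1 : k)) = Y at *
        generalize consS (mulL c mul a (d b)) (Finsupp.single l (1 : k)) = Z at *
        linear_combination (norm := module) (-ε a) • h2 + hε a • (Z
          - (ε b * c a b) • consL (mul a b) (D (Finsupp.single l 1))
          - (ε b * c a b) • mulHead c mul (mul a b) (Finsupp.single l 1))

end ListCalculus

end MonomialRings

namespace MonomialRings

/-- Multiplicative data on a set `Γ` of letters, each of which has a type, i.e. a multiset of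
elements of `Θ`. A letter splits uniquely along its type, products of letters are nonzero exactly
when their types commute, and the operator `d` is a derivation preserving types. -/
structure SplitData (k Γ Θ : Type*) [Field k] where
  /-- the type of a letter -/
  τ : Γ → Multiset Θ
  /-- an additive size -/
  sz : Γ → ℕ
  /-- the sign of a letter -/
  ε : Γ → k
  /-- structure constants of the product -/
  c : Γ → Γ → k
  /-- the product -/
  mul : Γ → Γ → Γ
  /-- the differential -/
  d : Γ → Γ →₀ k
  /-- the commutation relation -/
  comm : Θ → Θ → Prop
  comm_symm : ∀ {x y}, comm x y → comm y x
  τ_ne : ∀ a, τ a ≠ 0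
  ε_sq : ∀ a, ε a * ε a = 1
  c_ne : ∀ {a b}, c a b ≠ 0 ↔ ∀ x ∈ τ a, ∀ y ∈ τ b, comm x y
  τ_mul : ∀ {a b}, c a b ≠ 0 → τ (mul a b) = τ a + τ b
  sz_mul : ∀ {a b}, c a b ≠ 0 → sz (mul a b) = sz a + sz b
  ε_mul : ∀ {a b}, c a b ≠ 0 → ε (mul a b) = -(ε a * ε b)
  mul_assoc : ∀ a b e, mul (mul a b) e = mul a (mul b e)
  c_assoc : ∀ a b e, c a b * c (mul a b) e = c b e * c a (mul b e)
  d_ε : ∀ {a b}, b ∈ (d a).support → ε b = -ε a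
  d_τ : ∀ {a b}, b ∈ (d a).support → τ b = τ a
  leibniz : ∀ {a b}, c a b ≠ 0 →
    c a b • d (mul a b) = mulR c mul b (d a) - ε a • mulL c mul a (d b)
  d_pure : ∀ {a x}, comm x x → (∀ y ∈ τ a, y = x) → d a = 0
  split_exists : ∀ {a x}, x ∈ τ a → ¬ (∀ y ∈ τ a, y = x) →
    ∃ b g, a = mul b g ∧ c b g ≠ 0 ∧ x ∉ τ b ∧ ∀ y ∈ τ g, y = x
  split_unique : ∀ {x b g b' g'}, mul b g = mul b' g' → c b g ≠ 0 → c b' g' ≠ 0 →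
    x ∉ τ b → (∀ y ∈ τ g, y = x) → x ∉ τ b' → (∀ y ∈ τ g', y = x) → b = b' ∧ g = g'
  pure_split_exists : ∀ {a x}, (∀ y ∈ τ a, y = x) → (τ a).card ≠ 1 →
    ∃ b g, a = mul b g ∧ c b g ≠ 0 ∧ (τ b).card = 1
  pure_split_unique : ∀ {x b g b' g'}, mul b g = mul b' g' → c b g ≠ 0 → c b' g' ≠ 0 →
    (∀ y ∈ τ b, y = x) → (∀ y ∈ τ g, y = x) → (∀ y ∈ τ b', y = x) → (∀ y ∈ τ g', y = x) →
    (τ b).card = 1 → (τ b').card = 1 → b = b' ∧ g = g'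

namespace SplitData

variable {k Γ Θ : Type*} [Field k] (X : SplitData k Γ Θ)

/-- All constituents of the type of `a` are equal to `x`. -/
def Pure (x : Θ) (a : Γ) : Prop := ∀ y ∈ X.τ a, y = x

/-- The multiplicity with which `x` can be moved to the front of a list. -/
def mult (x : Θ) : List Γ → ℕ
  | [] => 0
  | a :: l => (X.τ a).count x + if ∀ y ∈ X.τ a, X.comm x y then mult x l else 0

/-- Quantities invariant under merging of adjacent letters. -/
def inv (L : List Γ) : (Θ → ℕ) × Multiset Θ × ℕ :=
  (fun x => X.mult x L, (L.map X.τ).sum, (L.map X.sz).sum)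

lemma inv_cons {l l' : List Γ} (a : Γ) (h : X.inv l = X.inv l') :
    X.inv (a :: l) = X.inv (a :: l') := by
  simp only [inv, Prod.mk.injEq, funext_iff] at h
  simp [inv, mult, h]

lemma mult_of_inv {l l' : List Γ} (h : X.inv l = X.inv l') (x : Θ) : X.mult x l = X.mult x l' := by
  simp only [inv, Prod.mk.injEq, funext_iff] at h
  exact h.1 x

lemma inv_mul {a b : Γ} (h : X.c a b ≠ 0) (l : List Γ) :
    X.inv (X.mul a b :: l) = X.inv (a :: b :: l) := by
  simp only [inv, Prod.mk.injEq, List.map_cons, List.sum_cons, X.τ_mul h, X.sz_mul h, add_assoc,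
    and_true]
  funext x
  simp only [mult, X.τ_mul h, Multiset.count_add, Multiset.mem_add, add_assoc]
  congr 1
  by_cases h1 : ∀ y ∈ X.τ a, X.comm x y
  · rw [if_pos h1]
    congr 1
    by_cases h2 : ∀ y ∈ X.τ b, X.comm x y
    · rw [if_pos h2, if_pos (by rintro y (hy | hy); exacts [h1 y hy, h2 y hy])]
    · rw [if_neg h2, if_neg (fun h' => h2 fun y hy => h' y (Or.inr hy))]
  · rw [if_neg h1, if_neg (fun h' => h1 fun y hy => h' y (Or.inl hy)), add_zero,
      Multiset.count_eq_zero]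
    intro hx
    exact h1 fun y hy => X.comm_symm (X.c_ne.1 h y hy x hx)

/-- The index of the first letter whose type contains `x`. -/
def idx (x : Θ) : List Γ → ℕ
  | [] => 0
  | a :: l => if x ∈ X.τ a then 0 else idx x l + 1

/-- The splitting of a letter into a part not containing `x` and a pure part. -/
def splitPair (x : Θ) (a : Γ) : Γ × Γ :=
  if h : ∃ b g, a = X.mul b g ∧ X.c b g ≠ 0 ∧ x ∉ X.τ b ∧ ∀ y ∈ X.τ g, y = x
  then (h.choose, h.choose_spec.choose) else (a, a)

/-- The splitting of a pure letter with a first factor of weight one. -/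
def pureSplit (a : Γ) : Γ × Γ :=
  if h : ∃ b g, a = X.mul b g ∧ X.c b g ≠ 0 ∧ (X.τ b).card = 1
  then (h.choose, h.choose_spec.choose) else (a, a)

lemma splitPair_spec {x : Θ} {a : Γ} (hx : x ∈ X.τ a) (hp : ¬ X.Pure x a) :
    ∃ b g, X.splitPair x a = (b, g) ∧ a = X.mul b g ∧ X.c b g ≠ 0 ∧ x ∉ X.τ b ∧ X.Pure x g := by
  have h := X.split_exists hx hp
  refine ⟨h.choose, h.choose_spec.choose, ?_, h.choose_spec.choose_spec⟩
  rw [splitPair, dif_pos h]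

lemma pureSplit_spec {x : Θ} {a : Γ} (hp : X.Pure x a) (hc : (X.τ a).card ≠ 1) :
    ∃ b g, X.pureSplit a = (b, g) ∧ a = X.mul b g ∧ X.c b g ≠ 0 ∧ (X.τ b).card = 1 := by
  have h := X.pure_split_exists hp hc
  refine ⟨h.choose, h.choose_spec.choose, ?_, h.choose_spec.choose_spec⟩
  rw [pureSplit, dif_pos h]

lemma mem_of_pure {x : Θ} {a : Γ} (h : X.Pure x a) : x ∈ X.τ a := by
  obtain ⟨y, hy⟩ := Multiset.exists_mem_of_ne_zero (X.τ_ne a)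
  exact h y hy ▸ hy

lemma pure_mul {x : Θ} {a b : Γ} (h : X.c a b ≠ 0) :
    X.Pure x (X.mul a b) ↔ X.Pure x a ∧ X.Pure x b := by
  simp only [Pure, X.τ_mul h, Multiset.mem_add]
  exact ⟨fun h' => ⟨fun y hy => h' y (Or.inl hy), fun y hy => h' y (Or.inr hy)⟩,
    fun h' y hy => hy.elim (h'.1 y) (h'.2 y)⟩

lemma splitPair_mul {x : Θ} {b g : Γ} (h : X.c b g ≠ 0) (hb : x ∉ X.τ b) (hg : X.Pure x g) :
    X.splitPair x (X.mul b g) = (b, g) := by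
  have hx : x ∈ X.τ (X.mul b g) := by
    rw [X.τ_mul h]; exact Multiset.mem_add.2 (Or.inr (X.mem_of_pure hg))
  have hp : ¬ X.Pure x (X.mul b g) := fun h' => hb (X.mem_of_pure ((X.pure_mul h).1 h').1)
  obtain ⟨b', g', e, h1, h2, h3, h4⟩ := X.splitPair_spec hx hp
  obtain ⟨rfl, rfl⟩ := X.split_unique h1 h h2 hb hg h3 h4
  exact e

lemma pureSplit_mul {x : Θ} {b g : Γ} (h : X.c b g ≠ 0) (hb : X.Pure x b) (hg : X.Pure x g)
    (hc : (X.τ b).card = 1) : X.pureSplit (X.mul b g) = (b, g) := by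
  have hp : X.Pure x (X.mul b g) := (X.pure_mul h).2 ⟨hb, hg⟩
  have hne : (X.τ (X.mul b g)).card ≠ 1 := by
    rw [X.τ_mul h, Multiset.card_add, hc]
    have := Multiset.card_pos.2 (X.τ_ne g)
    omega
  obtain ⟨b', g', e, h1, h2, h3⟩ := X.pureSplit_spec hp hne
  have hp' := (X.pure_mul h2).1 (h1 ▸ hp)
  obtain ⟨rfl, rfl⟩ := X.pure_split_unique h1 h h2 hb hg hp'.1 hp'.2 hc h3
  exact e

/-- Splitting the first letter containing `x`. -/
def splitAux (x : Θ) : List Γ → (List Γ →₀ k)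
  | [] => 0
  | a :: l => if x ∈ X.τ a then
      if X.Pure x a then 0 else
        Finsupp.single ((X.splitPair x a).1 :: (X.splitPair x a).2 :: l)
          (X.ε (X.splitPair x a).1 * (X.c (X.splitPair x a).1 (X.splitPair x a).2)⁻¹)
    else X.ε a • consL a (splitAux x l)

/-- Linear extension of `splitAux`. -/
def split (x : Θ) : (List Γ →₀ k) →ₗ[k] (List Γ →₀ k) := linExt (X.splitAux x)

lemma split_cons_not_mem {x : Θ} {a : Γ} (h : x ∉ X.τ a) (y : List Γ →₀ k) :
    X.split x (consL a y) = X.ε a • consL a (X.split x y) := by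
  refine linearMap_eq_of_single (f := X.split x ∘ₗ consL a)
    (g := X.ε a • (consL a ∘ₗ X.split x)) (fun l => ?_) y
  simp [split, splitAux, h]

lemma split_cons_pure {x : Θ} {a : Γ} (h : X.Pure x a) (y : List Γ →₀ k) :
    X.split x (consL a y) = 0 := by
  refine linearMap_eq_of_single (f := X.split x ∘ₗ consL a) (g := 0) (fun l => ?_) y
  simp [split, splitAux, h, X.mem_of_pure h]

lemma split_cons_mul {x : Θ} {b g : Γ} (h : X.c b g ≠ 0) (hb : x ∉ X.τ b) (hg : X.Pure x g)
    (y : List Γ →₀ k) :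
    X.split x (consL (X.mul b g) y) = (X.ε b * (X.c b g)⁻¹) • consL b (consL g y) := by
  refine linearMap_eq_of_single (f := X.split x ∘ₗ consL (X.mul b g))
    (g := (X.ε b * (X.c b g)⁻¹) • (consL b ∘ₗ consL g)) (fun l => ?_) y
  have hx : x ∈ X.τ (X.mul b g) := by
    rw [X.τ_mul h]; exact Multiset.mem_add.2 (Or.inr (X.mem_of_pure hg))
  have hp : ¬ X.Pure x (X.mul b g) := fun h' => hb (X.mem_of_pure ((X.pure_mul h).1 h').1)
  simp [split, splitAux, hx, hp, X.splitPair_mul h hb hg]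

/-- The splitting used when `x` can be moved to the front at least twice. -/
def splitTwoAux (x : Θ) : List Γ → (List Γ →₀ k)
  | [] => 0
  | a :: l => if X.Pure x a then
      if (X.τ a).card = 1 then X.ε a • consL a (X.splitAux x l) else
        Finsupp.single ((X.pureSplit a).1 :: (X.pureSplit a).2 :: l)
          (X.ε (X.pureSplit a).1 * (X.c (X.pureSplit a).1 (X.pureSplit a).2)⁻¹)
    else X.splitAux x (a :: l)

/-- Linear extension of `splitTwoAux`. -/
def splitTwo (x : Θ) : (List Γ →₀ k) →ₗ[k] (List Γ →₀ k) := linExt (X.splitTwoAux x)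

lemma splitTwo_cons_pure_one {x : Θ} {a : Γ} (h : X.Pure x a) (hc : (X.τ a).card = 1)
    (y : List Γ →₀ k) : X.splitTwo x (consL a y) = X.ε a • consL a (X.split x y) := by
  refine linearMap_eq_of_single (f := X.splitTwo x ∘ₗ consL a)
    (g := X.ε a • (consL a ∘ₗ X.split x)) (fun l => ?_) y
  simp [split, splitTwo, splitTwoAux, h, hc]

lemma splitTwo_cons_mul {x : Θ} {b g : Γ} (h : X.c b g ≠ 0) (hb : X.Pure x b) (hg : X.Pure x g)
    (hc : (X.τ b).card = 1) (y : List Γ →₀ k) :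
    X.splitTwo x (consL (X.mul b g) y) = (X.ε b * (X.c b g)⁻¹) • consL b (consL g y) := by
  refine linearMap_eq_of_single (f := X.splitTwo x ∘ₗ consL (X.mul b g))
    (g := (X.ε b * (X.c b g)⁻¹) • (consL b ∘ₗ consL g)) (fun l => ?_) y
  have hp : X.Pure x (X.mul b g) := (X.pure_mul h).2 ⟨hb, hg⟩
  have hne : (X.τ (X.mul b g)).card ≠ 1 := by
    rw [X.τ_mul h, Multiset.card_add, hc]
    have := Multiset.card_pos.2 (X.τ_ne g)
    omega
  simp [splitTwo, splitTwoAux, hp, hne, X.pureSplit_mul h hb hg hc]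

lemma splitTwo_cons_not_pure {x : Θ} {a : Γ} (h : ¬ X.Pure x a) (y : List Γ →₀ k) :
    X.splitTwo x (consL a y) = X.split x (consL a y) := by
  refine linearMap_eq_of_single (f := X.splitTwo x ∘ₗ consL a)
    (g := X.split x ∘ₗ consL a) (fun l => ?_) y
  simp [splitTwo, split, splitTwoAux, h]

variable [Nonempty Θ]

/-- A constituent that can be moved to the front, depending only on the multiplicities. -/
def lead (L : List Γ) : Θ := Classical.epsilon fun x => 1 ≤ X.mult x L

/-- The contracting homotopy on lists. -/
def homAux : List Γ → (List Γ →₀ k)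
  | [] => 0
  | a :: l => if 2 ≤ X.mult (X.lead (a :: l)) (a :: l) then X.splitTwoAux (X.lead (a :: l)) (a :: l)
      else if X.Pure (X.lead (a :: l)) a then X.ε a • consL a (homAux l)
      else X.splitAux (X.lead (a :: l)) (a :: l)

/-- Linear extension of `homAux`. -/
def hom : (List Γ →₀ k) →ₗ[k] (List Γ →₀ k) := linExt X.homAux

/-- The form of `homAux` when `x` is the leading constituent and can be moved to the front only
once. -/
def homOneAux (x : Θ) : List Γ → (List Γ →₀ k)
  | [] => 0
  | a :: l => if X.Pure x a then X.ε a • consL a (X.homAux l) else X.splitAux x (a :: l)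

/-- Linear extension of `homOneAux`. -/
def homOne (x : Θ) : (List Γ →₀ k) →ₗ[k] (List Γ →₀ k) := linExt (X.homOneAux x)

lemma homOne_cons_pure {x : Θ} {a : Γ} (h : X.Pure x a) (y : List Γ →₀ k) :
    X.homOne x (consL a y) = X.ε a • consL a (X.hom y) := by
  refine linearMap_eq_of_single (f := X.homOne x ∘ₗ consL a)
    (g := X.ε a • (consL a ∘ₗ X.hom)) (fun l => ?_) y
  simp [hom, homOne, homOneAux, h]

lemma homOne_cons_not_pure {x : Θ} {a : Γ} (h : ¬ X.Pure x a) (y : List Γ →₀ k) :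
    X.homOne x (consL a y) = X.split x (consL a y) := by
  refine linearMap_eq_of_single (f := X.homOne x ∘ₗ consL a)
    (g := X.split x ∘ₗ consL a) (fun l => ?_) y
  simp [split, homOne, homOneAux, h]

lemma lead_of_inv {l l' : List Γ} (h : ∀ x, X.mult x l = X.mult x l') : X.lead l = X.lead l' := by
  simp only [lead, h]

lemma one_le_mult_lead {L : List Γ} (h : L ≠ []) : 1 ≤ X.mult (X.lead L) L := by
  refine Classical.epsilon_spec (p := fun x => 1 ≤ X.mult x L) ?_
  cases L with
  | nil => exact absurd rfl h
  | cons a l =>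
    obtain ⟨y, hy⟩ := Multiset.exists_mem_of_ne_zero (X.τ_ne a)
    exact ⟨y, by have := Multiset.one_le_count_iff_mem.2 hy; rw [mult]; omega⟩

lemma hom_eq_of_mult (L : List Γ) {y : List Γ →₀ k}
    (hy : y ∈ Finsupp.supported k k {L' | ∀ x, X.mult x L' = X.mult x L}) :
    X.hom y = if 2 ≤ X.mult (X.lead L) L then X.splitTwo (X.lead L) y
      else X.homOne (X.lead L) y := by
  have := eq_on_supported (X.hom) (if 2 ≤ X.mult (X.lead L) L then X.splitTwo (X.lead L)
      else X.homOne (X.lead L)) ?_ hy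
  · rw [this]; split_ifs <;> rfl
  · intro L' hL'
    have e := X.lead_of_inv hL'
    cases L' with
    | nil => split_ifs <;> simp [hom, homAux, splitTwo, splitTwoAux, homOne, homOneAux]
    | cons a l =>
      have hL'' : ∀ x, X.mult x (a :: l) = X.mult x L := hL'
      simp only [hom, linExt_single, one_smul, homAux, e, hL'']
      split_ifs <;> simp_all [splitTwo, homOne, homOneAux]

end SplitData

end MonomialRings

namespace MonomialRings

section Supported

variable {k : Type*} [Field k] {Γ : Type*}

lemma consL_mem_supported {s t : Set (List Γ)} {a : Γ} (h : ∀ l ∈ s, a :: l ∈ t)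
    {y : List Γ →₀ k} (hy : y ∈ Finsupp.supported k k s) :
    consL a y ∈ Finsupp.supported k k t :=
  supported_induction _ (fun l hl => by
    rw [consL_single]; exact single_mem_supported (h l hl) 1) hy

lemma consS_mem_supported {s t : Set (List Γ)} {v : Γ →₀ k}
    (h : ∀ a ∈ v.support, ∀ l ∈ s, a :: l ∈ t)
    {y : List Γ →₀ k} (hy : y ∈ Finsupp.supported k k s) :
    consS v y ∈ Finsupp.supported k k t := by
  refine supported_induction (s := (v.support : Set Γ)) (consS.flip y) (fun a ha => ?_)
    (by rw [Finsupp.mem_supported])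
  simpa using consL_mem_supported (h a ha) hy

lemma mulHead_mem_supported {c : Γ → Γ → k} {mul : Γ → Γ → Γ} {s t : Set (List Γ)} {a : Γ}
    (h : ∀ b l, b :: l ∈ s → c a b ≠ 0 → mul a b :: l ∈ t)
    {y : List Γ →₀ k} (hy : y ∈ Finsupp.supported k k s) :
    mulHead c mul a y ∈ Finsupp.supported k k t := by
  refine supported_induction _ (fun l hl => ?_) hy
  cases l with
  | nil => simp
  | cons b l =>
    rw [← consL_single, mulHead_cons, consL_single]
    by_cases hc : c a b = 0
    · simp [hc]
    · exact Submodule.smul_mem _ _ (single_mem_supported (h b l hl hc) 1)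

end Supported

namespace SplitData

variable {k Γ Θ : Type*} [Field k] (X : SplitData k Γ Θ)

/-- The bar operator of the product. -/
def bm : (List Γ →₀ k) →ₗ[k] (List Γ →₀ k) := barMul X.c X.mul X.ε

/-- The derivation on lists. -/
def dr : (List Γ →₀ k) →ₗ[k] (List Γ →₀ k) := der X.d X.ε

lemma bm_cons (a : Γ) (y : List Γ →₀ k) :
    X.bm (consL a y) = X.ε a • consL a (X.bm y) + X.ε a • mulHead X.c X.mul a y :=
  barMul_cons _ _ _ _ _

lemma dr_cons (a : Γ) (y : List Γ →₀ k) :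
    X.dr (consL a y) = -consS (X.d a) y + X.ε a • consL a (X.dr y) :=
  der_cons _ _ _ _

lemma ne_of_d {a b : Γ} (h : b ∈ (X.d a).support) {g : Γ} (hc : X.c a g ≠ 0) :
    X.c b g ≠ 0 := by
  rw [X.c_ne, X.d_τ h]
  exact X.c_ne.1 hc

lemma ne_of_d' {a b : Γ} (h : b ∈ (X.d a).support) {g : Γ} (hc : X.c g a ≠ 0) :
    X.c g b ≠ 0 := by
  rw [X.c_ne, X.d_τ h]
  exact X.c_ne.1 hc

lemma pure_of_d {a b : Γ} {x : Θ} (h : b ∈ (X.d a).support) :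
    X.Pure x b ↔ X.Pure x a := by
  rw [Pure, X.d_τ h, Pure]

lemma op_consS {f : (List Γ →₀ k) →ₗ[k] (List Γ →₀ k)} {v : Γ →₀ k} {y : List Γ →₀ k}
    {F : (Γ →₀ k) →ₗ[k] (List Γ →₀ k)}
    (h : ∀ b ∈ v.support, f (consL b y) = F (Finsupp.single b 1)) :
    f (consS v y) = F v := by
  have := eq_on_supported (s := (v.support : Set Γ)) (f ∘ₗ consS.flip y) F (x := v)
    (fun a ha => by simpa using h a ha) (by rw [Finsupp.mem_supported])
  simpa using this

lemma split_consS_mul {x : Θ} {b g : Γ} (h : X.c b g ≠ 0) (hb : x ∉ X.τ b) (hg : X.Pure x g)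
    (y : List Γ →₀ k) :
    X.split x (consS (X.d (X.mul b g)) y) =
      (X.ε b * (X.c b g)⁻¹) • (-consS (X.d b) (consL g y)
        - X.ε b • consL b (consS (X.d g) y)) := by
  have e1 : X.split x (consS (mulR X.c X.mul g (X.d b)) y) =
      -X.ε b • consS (X.d b) (consL g y) := by
    have := eq_on_supported (s := ((X.d b).support : Set Γ))
      (X.split x ∘ₗ consS.flip y ∘ₗ mulR X.c X.mul g) (-X.ε b • consS.flip (consL g y))
      (x := X.d b) (fun a ha => ?_) (by rw [Finsupp.mem_supported])
    · simpa using this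
    · have hc := X.ne_of_d ha h
      simp only [LinearMap.comp_apply, mulR, linExt_single, one_smul, LinearMap.flip_apply,
        consS_single, map_smul, LinearMap.smul_apply]
      rw [X.split_cons_mul hc (by rwa [X.d_τ ha]) hg, X.d_ε ha, smul_smul]
      congr 1
      field_simp
  have e2 : X.split x (consS (mulL X.c X.mul b (X.d g)) y) = X.ε b • consL b (consS (X.d g) y) := by
    have := eq_on_supported (s := ((X.d g).support : Set Γ))
      (X.split x ∘ₗ consS.flip y ∘ₗ mulL X.c X.mul b) (X.ε b • (consL b ∘ₗ consS.flip y))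
      (x := X.d g) (fun a ha => ?_) (by rw [Finsupp.mem_supported])
    · simpa using this
    · have hc := X.ne_of_d' ha h
      simp only [LinearMap.comp_apply, mulL, linExt_single, one_smul, LinearMap.flip_apply,
        consS_single, map_smul, LinearMap.smul_apply]
      rw [X.split_cons_mul hc hb ((X.pure_of_d ha).2 hg), smul_smul]
      congr 1
      field_simp
  have e3 : X.d (X.mul b g) = (X.c b g)⁻¹ •
      (mulR X.c X.mul g (X.d b) - X.ε b • mulL X.c X.mul b (X.d g)) := by
    rw [← X.leibniz h, smul_smul, inv_mul_cancel₀ h, one_smul]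
  rw [e3]
  simp only [map_smul, map_sub, LinearMap.smul_apply, LinearMap.sub_apply, e1, e2]
  module

lemma dr_split (x : Θ) (y : List Γ →₀ k) : X.dr (X.split x y) + X.split x (X.dr y) = 0 := by
  refine linearMap_eq_of_single (f := X.dr ∘ₗ X.split x + X.split x ∘ₗ X.dr) (g := 0)
    (fun l => ?_) y
  simp only [LinearMap.comp_apply, LinearMap.zero_apply, LinearMap.add_apply]
  induction l with
  | nil => simp [split, splitAux, dr]
  | cons a l ih =>
    rw [← consL_single, dr_cons]
    by_cases hx : x ∈ X.τ a
    · by_cases hp : X.Pure x a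
      · rw [split_cons_pure _ hp, map_add, map_smul, split_cons_pure _ hp, map_neg,
          op_consS (F := 0)]
        · simp
        · intro b hb
          rw [split_cons_pure _ ((X.pure_of_d hb).2 hp)]; rfl
      · obtain ⟨b, g, -, rfl, hc, hb, hg⟩ := X.splitPair_spec hx hp
        rw [X.split_cons_mul hc hb hg, map_add, map_smul, map_neg, X.split_consS_mul hc hb hg,
          map_smul, X.split_cons_mul hc hb hg, dr_cons, dr_cons, X.ε_mul hc]
        simp only [map_add, map_smul, map_neg]
        module
    · rw [X.split_cons_not_mem hx, map_smul, dr_cons, map_add, map_smul, map_neg,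
        X.split_cons_not_mem hx, op_consS (F := -X.ε a • consS.flip
            (X.split x (Finsupp.single l 1)))]
      · simp only [LinearMap.smul_apply, LinearMap.flip_apply]
        rw [eq_neg_of_add_eq_zero_left ih]
        simp only [map_neg]
        module
      · intro b hb
        rw [X.split_cons_not_mem (by rwa [X.d_τ hb]), X.d_ε hb]
        simp

lemma dr_splitTwo (x : Θ) (y : List Γ →₀ k) :
    X.dr (X.splitTwo x y) + X.splitTwo x (X.dr y) = 0 := by
  refine linearMap_eq_of_single (f := X.dr ∘ₗ X.splitTwo x + X.splitTwo x ∘ₗ X.dr) (g := 0)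
    (fun l => ?_) y
  simp only [LinearMap.comp_apply, LinearMap.zero_apply, LinearMap.add_apply]
  cases l with
  | nil => simp [splitTwo, splitTwoAux, dr]
  | cons a l =>
    rw [← consL_single]
    by_cases hp : X.Pure x a
    · by_cases h1 : (X.τ a).card = 1
      · rw [dr_cons, X.splitTwo_cons_pure_one hp h1, map_smul, dr_cons, map_add, map_smul, map_neg,
          X.splitTwo_cons_pure_one hp h1,
          op_consS (F := -X.ε a • consS.flip (X.split x (Finsupp.single l 1)))]
        · simp only [LinearMap.smul_apply, LinearMap.flip_apply]
          rw [eq_neg_of_add_eq_zero_left (X.dr_split x (Finsupp.single l 1))]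
          simp only [map_neg]
          module
        · intro b hb
          rw [X.splitTwo_cons_pure_one ((X.pure_of_d hb).2 hp) (by rwa [X.d_τ hb]), X.d_ε hb]
          simp
      · obtain ⟨b, g, -, rfl, hc, hb⟩ := X.pureSplit_spec hp h1
        have hp' := (X.pure_mul hc).1 hp
        have hcomm : X.comm x x := X.c_ne.1 hc x (X.mem_of_pure hp'.1) x (X.mem_of_pure hp'.2)
        rw [dr_cons, X.splitTwo_cons_mul hc hp'.1 hp'.2 hb, X.d_pure hcomm hp, map_add, map_smul,
          map_smul, X.splitTwo_cons_mul hc hp'.1 hp'.2 hb, dr_cons, X.d_pure hcomm hp'.1, dr_cons,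
          X.d_pure hcomm hp'.2, X.ε_mul hc]
        simp only [map_smul, map_zero, LinearMap.zero_apply, neg_zero, zero_add]
        module
    · rw [X.splitTwo_cons_not_pure hp]
      have h2 : X.splitTwo x (X.dr (consL a (Finsupp.single l 1)))
          = X.split x (X.dr (consL a (Finsupp.single l 1))) := by
        rw [dr_cons, map_add, map_add, map_smul, map_smul, X.splitTwo_cons_not_pure hp, map_neg,
          map_neg, op_consS (F := (X.split x ∘ₗ consS.flip (Finsupp.single l 1)))]
        · simp
        · intro b hb
          rw [X.splitTwo_cons_not_pure (by rwa [X.pure_of_d hb])]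
          simp
      rw [h2, dr_split]

lemma mult_of_map {l l' : List Γ} (h : l.map X.τ = l'.map X.τ) (x : Θ) :
    X.mult x l = X.mult x l' := by
  induction l generalizing l' with
  | nil =>
    cases l' with
    | nil => rfl
    | cons b l' => simp at h
  | cons a l ih =>
    cases l' with
    | nil => simp at h
    | cons b l' =>
      simp only [List.map_cons, List.cons.injEq] at h
      simp only [mult, h.1, ih h.2]

lemma dr_mem_supported (L : List Γ) : X.dr (Finsupp.single L 1)
    ∈ Finsupp.supported k k {L' | L'.map X.τ = L.map X.τ} := by
  induction L with
  | nil => simp [dr]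
  | cons a l ih =>
    rw [← consL_single, dr_cons]
    refine Submodule.add_mem _ (Submodule.neg_mem _ ?_) (Submodule.smul_mem _ _ ?_)
    · refine consS_mem_supported (s := {l}) ?_
        (single_mem_supported (Set.mem_singleton l) 1)
      rintro b hb _ rfl
      simp [X.d_τ hb]
    · refine consL_mem_supported ?_ ih
      intro l' hl'
      simpa using hl'

variable [Nonempty Θ]

/-- The homotopy anticommutes with the derivation. -/
theorem dr_hom (y : List Γ →₀ k) : X.dr (X.hom y) + X.hom (X.dr y) = 0 := by
  refine linearMap_eq_of_single (f := X.dr ∘ₗ X.hom + X.hom ∘ₗ X.dr) (g := 0)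
    (fun l => ?_) y
  simp only [LinearMap.comp_apply, LinearMap.zero_apply, LinearMap.add_apply]
  induction l with
  | nil => simp [hom, homAux, dr]
  | cons a l ih =>
    rw [X.hom_eq_of_mult (a :: l) (y := Finsupp.single (a :: l) 1)
        (single_mem_supported (by simp) 1),
      X.hom_eq_of_mult (a :: l) (y := X.dr (Finsupp.single (a :: l) 1))
        (Finsupp.supported_mono (fun L' hL' => X.mult_of_map hL') (X.dr_mem_supported _))]
    generalize X.lead (a :: l) = x
    split_ifs
    · exact X.dr_splitTwo x _
    · rw [← consL_single]
      by_cases hp : X.Pure x a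
      · rw [dr_cons, X.homOne_cons_pure hp, map_smul, dr_cons, map_add, map_smul, map_neg,
          X.homOne_cons_pure hp,
          op_consS (F := -X.ε a • consS.flip (X.hom (Finsupp.single l 1)))]
        · simp only [LinearMap.smul_apply, LinearMap.flip_apply]
          rw [eq_neg_of_add_eq_zero_left ih]
          simp only [map_neg]
          module
        · intro b hb
          rw [X.homOne_cons_pure ((X.pure_of_d hb).2 hp), X.d_ε hb]
          simp
      · rw [X.homOne_cons_not_pure hp]
        have h2 : X.homOne x (X.dr (consL a (Finsupp.single l 1)))
            = X.split x (X.dr (consL a (Finsupp.single l 1))) := by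
          rw [dr_cons, map_add, map_add, map_smul, map_smul, X.homOne_cons_not_pure hp, map_neg,
            map_neg, op_consS (F := (X.split x ∘ₗ consS.flip (Finsupp.single l 1)))]
          · simp
          · intro b hb
            rw [X.homOne_cons_not_pure (by rwa [X.pure_of_d hb])]
            simp
        rw [h2, dr_split]

end SplitData

end MonomialRings

namespace MonomialRings

namespace SplitData

variable {k Γ Θ : Type*} [Field k] (X : SplitData k Γ Θ)

lemma bm_mem_supported (L : List Γ) : X.bm (Finsupp.single L 1)
    ∈ Finsupp.supported k k {L' | X.inv L' = X.inv L ∧ L'.length + 1 = L.length} := by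
  induction L with
  | nil => simp [bm]
  | cons a l ih =>
    rw [← consL_single, bm_cons]
    refine Submodule.add_mem _ (Submodule.smul_mem _ _ ?_) (Submodule.smul_mem _ _ ?_)
    · refine consL_mem_supported ?_ ih
      rintro l' ⟨h1, h2⟩
      exact ⟨X.inv_cons a h1, by simp [h2]⟩
    · refine mulHead_mem_supported (s := {l}) ?_ (single_mem_supported (Set.mem_singleton l) 1)
      rintro b l' rfl hc
      exact ⟨X.inv_mul hc l', by simp⟩

lemma idx_cons_of_mem {x : Θ} {a : Γ} (h : x ∈ X.τ a) (l : List Γ) : X.idx x (a :: l) = 0 := by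
  simp [idx, h]

lemma idx_cons_of_not_mem {x : Θ} {a : Γ} (h : x ∉ X.τ a) (l : List Γ) :
    X.idx x (a :: l) = X.idx x l + 1 := by
  simp [idx, h]

lemma split_mem_supported (x : Θ) (L : List Γ) : X.split x (Finsupp.single L 1)
    ∈ Finsupp.supported k k
      {L' | X.inv L' = X.inv L ∧ L'.length = L.length + 1 ∧ X.idx x L' = X.idx x L + 1} := by
  induction L with
  | nil => simp [split, splitAux]
  | cons a l ih =>
    rw [← consL_single]
    by_cases hx : x ∈ X.τ a
    · by_cases hp : X.Pure x a
      · rw [X.split_cons_pure hp]; exact Submodule.zero_mem _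
      · obtain ⟨b, g, -, rfl, hc, hb, hg⟩ := X.splitPair_spec hx hp
        rw [X.split_cons_mul hc hb hg, consL_single, consL_single]
        refine Submodule.smul_mem _ _ (single_mem_supported (Set.mem_ofPred.2
          ⟨(X.inv_mul hc l).symm, by simp, ?_⟩) 1)
        rw [X.idx_cons_of_not_mem hb, X.idx_cons_of_mem (X.mem_of_pure hg), X.idx_cons_of_mem hx]
    · rw [X.split_cons_not_mem hx]
      refine Submodule.smul_mem _ _ (consL_mem_supported ?_ ih)
      rintro l' ⟨h1, h2, h3⟩
      refine ⟨X.inv_cons a h1, by simp [h2], ?_⟩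
      rw [X.idx_cons_of_not_mem hx, X.idx_cons_of_not_mem hx, h3]

/-- The operator `D h + h D` for the bar operator and `h = split x`. -/
def splitBox (x : Θ) : (List Γ →₀ k) →ₗ[k] (List Γ →₀ k) := X.bm ∘ₗ X.split x + X.split x ∘ₗ X.bm

lemma splitBox_apply (x : Θ) (y : List Γ →₀ k) :
    X.splitBox x y = X.bm (X.split x y) + X.split x (X.bm y) := rfl

lemma splitBox_cons_not_mem {x : Θ} {a : Γ} (h : x ∉ X.τ a) (y : List Γ →₀ k) :
    X.splitBox x (consL a y) = consL a (X.splitBox x y)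
      + (mulHead X.c X.mul a (X.split x y) + X.ε a • X.split x (mulHead X.c X.mul a y)) := by
  have := X.ε_sq a
  simp only [splitBox_apply, X.split_cons_not_mem h, map_smul, bm_cons, map_add, smul_add,
    smul_smul, this, one_smul]
  abel

/-- The lists with the same invariants as `L` in which `x` occurs later. -/
def later (x : Θ) (L : List Γ) : Set (List Γ) :=
  {L' | X.inv L' = X.inv L ∧ L'.length = L.length ∧ X.idx x L < X.idx x L'}

lemma split_mulHead_mem {x : Θ} {a : Γ} (hx : x ∈ X.τ a) (l : List Γ) :
    X.split x (mulHead X.c X.mul a (Finsupp.single l 1))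
      ∈ Finsupp.supported k k (X.later x (a :: l)) := by
  cases l with
  | nil => simp
  | cons b l =>
    rw [← consL_single, mulHead_cons, map_smul, consL_single]
    by_cases hc : X.c a b = 0
    · simp [hc]
    · refine Submodule.smul_mem _ _ (Finsupp.supported_mono ?_ (X.split_mem_supported x _))
      rintro L' ⟨h1, h2, h3⟩
      refine ⟨h1.trans (X.inv_mul hc l), by simpa using h2, ?_⟩
      rw [h3, X.idx_cons_of_mem hx]
      omega

lemma mulHead_split_cancel {x : Θ} {a b : Γ} (ha : x ∉ X.τ a) (hcomm : ∀ y ∈ X.τ a, X.comm x y)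
    (l : List Γ) :
    mulHead X.c X.mul a (X.split x (Finsupp.single (b :: l) 1))
        + X.ε a • X.split x (mulHead X.c X.mul a (Finsupp.single (b :: l) 1))
      = if X.Pure x b then Finsupp.single (a :: b :: l) 1 else 0 := by
  rw [← consL_single b, mulHead_cons, map_smul]
  have comm_pure : ∀ {g}, X.Pure x g → X.c a g ≠ 0 := by
    intro g hg
    rw [X.c_ne]
    intro y hy z hz
    rw [hg z hz]
    exact X.comm_symm (hcomm y hy)
  by_cases hb : x ∈ X.τ b
  · by_cases hp : X.Pure x b
    · have hc := comm_pure hp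
      rw [X.split_cons_pure hp, X.split_cons_mul hc ha hp, if_pos hp, consL_single, consL_single,
        map_zero, zero_add, smul_smul, smul_smul]
      have : X.ε a * X.c a b * (X.ε a * (X.c a b)⁻¹) = 1 := by
        have := X.ε_sq a
        field_simp
        linear_combination this
      rw [this, one_smul]
    · obtain ⟨b', g, -, rfl, hc, hb', hg⟩ := X.splitPair_spec hb hp
      rw [if_neg hp, X.split_cons_mul hc hb' hg, map_smul, mulHead_cons]
      have hassoc := X.c_assoc a b' g
      by_cases h0 : X.c a b' = 0
      · have : X.c a (X.mul b' g) = 0 := by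
          rw [h0, zero_mul, eq_comm, mul_eq_zero] at hassoc
          exact hassoc.resolve_left hc
        simp [h0, this]
      · have hag := comm_pure hg
        have h1 : X.c (X.mul a b') g ≠ 0 := by
          rw [X.c_ne, X.τ_mul h0]
          intro y hy
          rcases Multiset.mem_add.1 hy with hy | hy
          · exact X.c_ne.1 hag y hy
          · exact X.c_ne.1 hc y hy
        have h2 : x ∉ X.τ (X.mul a b') := by
          rw [X.τ_mul h0, Multiset.mem_add]
          tauto
        rw [← X.mul_assoc, X.split_cons_mul h1 h2 hg, X.ε_mul h0, smul_smul, smul_smul, smul_smul,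
          ← add_smul]
        convert zero_smul k _
        have := X.ε_sq a
        field_simp
        linear_combination (-X.c (X.mul b' g) a * 0) * this + X.ε b' * hassoc
          - X.ε b' * X.c b' g * X.c a (X.mul b' g) * this
  · have hp : ¬ X.Pure x b := fun h => hb (X.mem_of_pure h)
    rw [if_neg hp, X.split_cons_not_mem hb, map_smul, mulHead_cons]
    by_cases hc : X.c a b = 0
    · simp [hc]
    · rw [X.split_cons_not_mem (by rw [X.τ_mul hc, Multiset.mem_add]; tauto), X.ε_mul hc, smul_smul,
        smul_smul, smul_smul, ← add_smul]
      convert zero_smul k _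
      linear_combination (-X.ε b * X.c a b) * X.ε_sq a

lemma splitBox_triangular_of_mem {x : Θ} {a : Γ} (hx : x ∈ X.τ a) (l : List Γ) :
    X.splitBox x (Finsupp.single (a :: l) 1)
        - (if X.Pure x a then 0 else Finsupp.single (a :: l) 1)
      ∈ Finsupp.supported k k (X.later x (a :: l)) := by
  have key := X.split_mulHead_mem hx l
  by_cases hp : X.Pure x a
  · rw [if_pos hp, sub_zero, splitBox_apply, ← consL_single, X.split_cons_pure hp, map_zero,
      zero_add, bm_cons, map_add, map_smul, map_smul, X.split_cons_pure hp, smul_zero, zero_add]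
    exact Submodule.smul_mem _ _ key
  · obtain ⟨b, g, -, rfl, hc, hb, hg⟩ := X.splitPair_spec hx hp
    have hb1 : X.ε b * X.ε b = 1 := X.ε_sq b
    have hg1 : X.ε g * X.ε g = 1 := X.ε_sq g
    have e : X.splitBox x (consL (X.mul b g) (Finsupp.single l 1))
        - consL (X.mul b g) (Finsupp.single l (1 : k))
        = (X.ε g * (X.c b g)⁻¹) • consL b (mulHead X.c X.mul g (Finsupp.single l 1))
          + X.ε (X.mul b g) • X.split x (mulHead X.c X.mul (X.mul b g) (Finsupp.single l 1)) := by
      rw [splitBox_apply, X.split_cons_mul hc hb hg, bm_cons, map_add, map_smul, map_smul, map_smul,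
        X.split_cons_mul hc hb hg, bm_cons, bm_cons, mulHead_cons, X.ε_mul hc]
      simp only [map_add, map_smul]
      have h1 : X.ε b * (X.c b g)⁻¹ * (X.ε b * X.c b g) = 1 := by field_simp; linear_combination hb1
      linear_combination (norm := module)
        h1 • consL (X.mul b g) (Finsupp.single l (1 : k))
        + ((X.c b g)⁻¹ * X.ε g) • (hb1 • consL b (mulHead X.c X.mul g (Finsupp.single l (1 : k))))
    rw [if_neg hp, ← consL_single, e]
    refine Submodule.add_mem _ (Submodule.smul_mem _ _ ?_) (Submodule.smul_mem _ _ key)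
    refine consL_mem_supported (s := {l' | X.inv l' = X.inv (g :: l) ∧ l'.length = l.length
      ∧ X.idx x l' = 0}) ?_ (mulHead_mem_supported (s := {l}) ?_
        (single_mem_supported (Set.mem_singleton l) 1))
    · rintro l' ⟨h1, h2, h3⟩
      refine ⟨(X.inv_cons b h1).trans (X.inv_mul hc l).symm, by simp [h2], ?_⟩
      rw [X.idx_cons_of_mem hx, X.idx_cons_of_not_mem hb]
      omega
    · rintro e l' rfl hge
      refine ⟨X.inv_mul hge l', rfl, X.idx_cons_of_mem ?_ _⟩
      rw [X.τ_mul hge]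
      exact Multiset.mem_add.2 (Or.inl (X.mem_of_pure hg))

lemma splitBox_triangular (x : Θ) (a : Γ) (l : List Γ) (h : 1 ≤ X.mult x (a :: l)) :
    X.splitBox x (Finsupp.single (a :: l) 1)
        - (if X.Pure x a then 0 else Finsupp.single (a :: l) 1)
      ∈ Finsupp.supported k k (X.later x (a :: l)) := by
  induction l generalizing a with
  | nil =>
    by_cases hx : x ∈ X.τ a
    · exact X.splitBox_triangular_of_mem hx []
    · simp [mult, hx] at h
  | cons b l ih =>
    by_cases hx : x ∈ X.τ a
    · exact X.splitBox_triangular_of_mem hx _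
    · have hp : ¬ X.Pure x a := fun h => hx (X.mem_of_pure h)
      rw [mult, Multiset.count_eq_zero.2 hx, zero_add] at h
      have hcomm : ∀ y ∈ X.τ a, X.comm x y := by
        by_contra hc
        rw [if_neg hc] at h
        omega
      rw [if_pos hcomm] at h
      rw [if_neg hp, ← consL_single a, X.splitBox_cons_not_mem hx, X.mulHead_split_cancel hx hcomm]
      have e : consL a (X.splitBox x (Finsupp.single (b :: l) 1))
          + (if X.Pure x b then Finsupp.single (a :: b :: l) 1 else 0)
          - consL a (Finsupp.single (b :: l) 1)
          = consL a (X.splitBox x (Finsupp.single (b :: l) (1 : k))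
            - if X.Pure x b then 0 else Finsupp.single (b :: l) 1) := by
        rw [map_sub]
        split_ifs
        · rw [map_zero, consL_single]; abel
        · rw [add_zero]
      rw [e]
      refine consL_mem_supported ?_ (ih b h)
      rintro l' ⟨h1, h2, h3⟩
      refine ⟨X.inv_cons a h1, by simpa using h2, ?_⟩
      rw [X.idx_cons_of_not_mem hx, X.idx_cons_of_not_mem hx]
      omega

end SplitData

end MonomialRings

namespace MonomialRings

namespace SplitData

variable {k Γ Θ : Type*} [Field k] (X : SplitData k Γ Θ)

/-- The lists with the same invariants as `L` and with `n` additional letters. -/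
def like (L : List Γ) (n : ℕ) : Set (List Γ) :=
  {L' | X.inv L' = X.inv L ∧ L'.length = L.length + n}

lemma cons_mem_like {a : Γ} {l L : List Γ} {n : ℕ} (h : l ∈ X.like L n) :
    a :: l ∈ X.like (a :: L) n :=
  ⟨X.inv_cons a h.1, by simp [h.2]; omega⟩

lemma mulHead_mem_like {a : Γ} {L : List Γ} {y : List Γ →₀ k} {n : ℕ}
    {s : Set (List Γ)}
    (h : ∀ b l, b :: l ∈ s → X.c a b ≠ 0 → b :: l ∈ X.like L (n + 1) →
      X.mul a b :: l ∈ X.like (a :: L) n → X.mul a b :: l ∈ s)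
    (hs : y ∈ Finsupp.supported k k (X.like L (n + 1) ∩ s)) :
    mulHead X.c X.mul a y ∈ Finsupp.supported k k (X.like (a :: L) n ∩ s) := by
  refine mulHead_mem_supported ?_ hs
  rintro b l ⟨⟨h1, h2⟩, h3⟩ hc
  have : X.mul a b :: l ∈ X.like (a :: L) n :=
    ⟨(X.inv_mul hc l).trans (X.inv_cons a h1), by simp at h2 ⊢; omega⟩
  exact ⟨this, h b l h3 hc ⟨h1, h2⟩ this⟩

/-- Lists whose head exists and is not pure of type `x`. -/
def npHead (x : Θ) : Set (List Γ) := {L | ∃ a l, L = a :: l ∧ ¬ X.Pure x a}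

lemma npHead_of_idx {x : Θ} {L : List Γ} (h : 0 < X.idx x L) : L ∈ X.npHead x := by
  cases L with
  | nil => simp [idx] at h
  | cons a l =>
    refine ⟨a, l, rfl, fun hp => ?_⟩
    rw [X.idx_cons_of_mem (X.mem_of_pure hp)] at h
    omega

lemma split_mem_like (x : Θ) (L : List Γ) : X.split x (Finsupp.single L 1)
    ∈ Finsupp.supported k k (X.like L 1 ∩ X.npHead x) :=
  Finsupp.supported_mono (fun L' h => Set.mem_inter (show L' ∈ X.like L 1 from ⟨h.1, h.2.1⟩)
    (X.npHead_of_idx (by rw [h.2.2]; omega))) (X.split_mem_supported x L)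

lemma split_mulHead_mem_like (x : Θ) (a : Γ) (l : List Γ) :
    X.split x (mulHead X.c X.mul a (Finsupp.single l 1))
      ∈ Finsupp.supported k k (X.like (a :: l) 0 ∩ X.npHead x) := by
  cases l with
  | nil => simp
  | cons b l =>
    rw [← consL_single, mulHead_cons, map_smul, consL_single]
    by_cases hc : X.c a b = 0
    · simp [hc]
    · refine Submodule.smul_mem _ _ (Finsupp.supported_mono ?_ (X.split_mem_like x _))
      rintro L' ⟨⟨h1, h2⟩, h3⟩
      exact ⟨⟨h1.trans (X.inv_mul hc l), by simpa using h2⟩, h3⟩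

lemma mulHead_split_mem_like (x : Θ) (a : Γ) (l : List Γ) :
    mulHead X.c X.mul a (X.split x (Finsupp.single l 1))
      ∈ Finsupp.supported k k (X.like (a :: l) 0 ∩ X.npHead x) := by
  refine X.mulHead_mem_like ?_ (X.split_mem_like x l)
  rintro b l' ⟨_, _, e, hp⟩ hc - -
  cases e
  exact ⟨_, _, rfl, fun h => hp ((X.pure_mul hc).1 h).2⟩

/-- Rank function for the homotopy `splitTwo x`. -/
def rhoTwo (x : Θ) : List Γ → List ℕ
  | [] => []
  | a :: l => if X.Pure x a then if (X.τ a).card = 1 then [1, X.idx x l] else [0]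
      else [2, X.idx x (a :: l)]

lemma rhoTwo_of_npHead {x : Θ} {L : List Γ} (h : L ∈ X.npHead x) :
    X.rhoTwo x L = [2, X.idx x L] := by
  obtain ⟨a, l, rfl, hp⟩ := h
  simp [rhoTwo, hp]

lemma comm_self_of_mult {x : Θ} {a : Γ} {l : List Γ} (hp : X.Pure x a) (hc : (X.τ a).card = 1)
    (h : 2 ≤ X.mult x (a :: l)) : X.comm x x ∧ 1 ≤ X.mult x l := by
  rw [mult] at h
  have h1 := (Multiset.count_le_card x (X.τ a))
  split_ifs at h with h2
  · exact ⟨h2 x (X.mem_of_pure hp), by omega⟩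
  · omega

lemma bm_np {f : (List Γ →₀ k) →ₗ[k] (List Γ →₀ k)} {x : Θ}
    (hf : ∀ a, ¬ X.Pure x a → ∀ y, f (consL a y) = X.split x (consL a y))
    {a : Γ} (hp : ¬ X.Pure x a) (l : List Γ) :
    X.bm (f (Finsupp.single (a :: l) 1)) + f (X.bm (Finsupp.single (a :: l) 1))
      = X.splitBox x (Finsupp.single (a :: l) 1) := by
  rw [splitBox_apply, ← consL_single, hf a hp, bm_cons, map_add, map_add, map_smul, map_smul,
    map_smul, map_smul, hf a hp]
  cases l with
  | nil => simp
  | cons b l =>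
    rw [← consL_single, mulHead_cons, map_smul, map_smul]
    by_cases hc : X.c a b = 0
    · simp [hc]
    · rw [hf _ (fun h => hp ((X.pure_mul hc).1 h).1)]

lemma splitTwo_triangular (x : Θ) (L : List Γ) (h : 2 ≤ X.mult x L) :
    X.bm (X.splitTwo x (Finsupp.single L 1)) + X.splitTwo x (X.bm (Finsupp.single L 1))
        - Finsupp.single L 1
      ∈ Finsupp.supported k k (X.like L 0 ∩ {L' | X.rhoTwo x L < X.rhoTwo x L'}) := by
  cases L with
  | nil => simp [mult] at h
  | cons a l =>
    by_cases hp : X.Pure x a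
    swap
    · rw [X.bm_np (fun a ha => X.splitTwo_cons_not_pure ha) hp]
      have := X.splitBox_triangular x a l (by omega)
      rw [if_neg hp] at this
      refine Finsupp.supported_mono ?_ this
      rintro L' ⟨h1, h2, h3⟩
      refine ⟨⟨h1, h2⟩, ?_⟩
      rw [Set.mem_ofPred]
      rw [X.rhoTwo_of_npHead (L := L') (X.npHead_of_idx (by omega)),
        X.rhoTwo_of_npHead ⟨a, l, rfl, hp⟩]
      exact List.Lex.cons (List.Lex.rel h3)
    have np_mono : ∀ {n} {L' : List Γ}, n ≤ 1 → ∀ r, L' ∈ X.npHead x → n :: r < X.rhoTwo x L' := by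
      intro n L' hn r hL'
      rw [X.rhoTwo_of_npHead hL']
      exact List.Lex.rel (by omega)
    by_cases hc : (X.τ a).card = 1
    · obtain ⟨hxx, hm⟩ := X.comm_self_of_mult hp hc h
      have hrho : X.rhoTwo x (a :: l) = [1, X.idx x l] := by simp [rhoTwo, hp, hc]
      have ha1 : X.ε a * X.ε a = 1 := X.ε_sq a
      have e : X.bm (X.splitTwo x (Finsupp.single (a :: l) 1))
          + X.splitTwo x (X.bm (Finsupp.single (a :: l) 1))
          = consL a (X.splitBox x (Finsupp.single l 1))
            + mulHead X.c X.mul a (X.split x (Finsupp.single l 1))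
            + X.ε a • X.splitTwo x (mulHead X.c X.mul a (Finsupp.single l 1)) := by
        rw [← consL_single, X.splitTwo_cons_pure_one hp hc, map_smul, bm_cons, bm_cons, map_add,
          map_smul, map_smul, X.splitTwo_cons_pure_one hp hc, splitBox_apply, map_add]
        linear_combination (norm := module) ha1 • (consL a (X.bm (X.split x (Finsupp.single l 1)))
          + consL a (X.split x (X.bm (Finsupp.single l 1)))
          + mulHead X.c X.mul a (X.split x (Finsupp.single l 1)))
      rw [e]
      cases l with
      | nil => simp [mult] at hm
      | cons b l =>
        have hbox := X.splitBox_triangular x b l hm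
        have hsub : ∀ L' ∈ X.later x (b :: l), a :: L' ∈ X.like (a :: b :: l) 0
            ∩ {L' | X.rhoTwo x (a :: b :: l) < X.rhoTwo x L'} := by
          rintro L' ⟨h1, h2, h3⟩
          refine ⟨X.cons_mem_like ⟨h1, h2⟩, ?_⟩
          rw [Set.mem_ofPred]
          rw [hrho]
          rw [show X.rhoTwo x (a :: L') = [1, X.idx x L'] by simp [rhoTwo, hp, hc]]
          exact List.Lex.cons (List.Lex.rel h3)
        have hnp : ∀ L' ∈ X.like (a :: b :: l) 0 ∩ X.npHead x, L' ∈ X.like (a :: b :: l) 0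
            ∩ {L' | X.rhoTwo x (a :: b :: l) < X.rhoTwo x L'} := by
          rintro L' ⟨h1, h2⟩
          refine ⟨h1, ?_⟩
          rw [Set.mem_ofPred]
          rw [hrho]
          exact np_mono le_rfl _ h2
        by_cases hb : X.Pure x b
        · have hab : X.c a b ≠ 0 := by
            rw [X.c_ne]
            intro y hy z hz
            rw [hp y hy, hb z hz]
            exact hxx
          rw [if_pos hb, sub_zero] at hbox
          have e1 : X.split x (Finsupp.single (b :: l) (1 : k)) = 0 := by
            rw [← consL_single, X.split_cons_pure hb]
          have e2 : X.ε a • X.splitTwo x (mulHead X.c X.mul a (Finsupp.single (b :: l) (1 : k)))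
              = Finsupp.single (a :: b :: l) 1 := by
            rw [← consL_single, mulHead_cons, map_smul, X.splitTwo_cons_mul hab hp hb hc, smul_smul,
              smul_smul, consL_single, consL_single]
            have : X.ε a * X.c a b * (X.ε a * (X.c a b)⁻¹) = 1 := by
              field_simp
              linear_combination ha1
            rw [this, one_smul]
          rw [e1, e2, map_zero, add_zero, add_sub_cancel_right]
          exact consL_mem_supported hsub hbox
        · rw [if_neg hb] at hbox
          have e3 : consL a (X.splitBox x (Finsupp.single (b :: l) (1 : k)))
                + mulHead X.c X.mul a (X.split x (Finsupp.single (b :: l) 1))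
                + X.ε a • X.splitTwo x (mulHead X.c X.mul a (Finsupp.single (b :: l) 1))
                - Finsupp.single (a :: b :: l) 1
              = consL a (X.splitBox x (Finsupp.single (b :: l) 1) - Finsupp.single (b :: l) 1)
                + mulHead X.c X.mul a (X.split x (Finsupp.single (b :: l) 1))
                + X.ε a • X.splitTwo x (mulHead X.c X.mul a (Finsupp.single (b :: l) 1)) := by
            rw [map_sub, consL_single]; abel
          rw [e3]
          refine Submodule.add_mem _ (Submodule.add_mem _ (consL_mem_supported hsub hbox)
            (Finsupp.supported_mono hnp (X.mulHead_split_mem_like x a (b :: l))))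
            (Submodule.smul_mem _ _ (Finsupp.supported_mono hnp ?_))
          have := X.split_mulHead_mem_like x a (b :: l)
          rw [← consL_single, mulHead_cons, map_smul] at this ⊢
          by_cases hab : X.c a b = 0
          · simp [hab]
          · rwa [X.splitTwo_cons_not_pure (fun h => hb ((X.pure_mul hab).1 h).2)]
    · obtain ⟨s, p, -, rfl, hsp, hs1⟩ := X.pureSplit_spec hp hc
      obtain ⟨hs, hp'⟩ := (X.pure_mul hsp).1 hp
      have hrho : X.rhoTwo x (X.mul s p :: l) = [0] := by simp [rhoTwo, hp, hc]
      have e : X.bm (X.splitTwo x (Finsupp.single (X.mul s p :: l) 1))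
          + X.splitTwo x (X.bm (Finsupp.single (X.mul s p :: l) 1))
          - Finsupp.single (X.mul s p :: l) 1
          = (X.ε p * (X.c s p)⁻¹) • consL s (mulHead X.c X.mul p (Finsupp.single l 1))
            + X.ε (X.mul s p) • X.splitTwo x
              (mulHead X.c X.mul (X.mul s p) (Finsupp.single l 1)) := by
        have ha1 : X.ε s * X.ε s = 1 := X.ε_sq s
        rw [← consL_single, X.splitTwo_cons_mul hsp hs hp' hs1, map_smul, bm_cons, bm_cons, bm_cons,
          mulHead_cons, X.ε_mul hsp]
        simp only [map_add, map_smul]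
        rw [X.splitTwo_cons_mul hsp hs hp' hs1]
        have h1 : X.ε s * (X.c s p)⁻¹ * (X.ε s * X.c s p) = 1 := by
          field_simp; linear_combination ha1
        linear_combination (norm := module)
          h1 • consL (X.mul s p) (Finsupp.single l (1 : k)) + ((X.c s p)⁻¹ * X.ε p) •
          (ha1 • consL s (mulHead X.c X.mul p (Finsupp.single l (1 : k))))
      rw [e]
      have hsub : ∀ L' : List Γ, X.inv (s :: L') = X.inv (X.mul s p :: l) →
          L'.length = l.length → s :: L' ∈ X.like (X.mul s p :: l) 0 ∩
            {L' | X.rhoTwo x (X.mul s p :: l) < X.rhoTwo x L'} := by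
        intro L' h1 h2
        refine ⟨⟨h1, by simp [h2]⟩, ?_⟩
        rw [Set.mem_ofPred]
        rw [hrho]
        have : X.rhoTwo x (s :: L') = [1, X.idx x L'] := by simp [rhoTwo, hs, hs1]
        rw [this]
        exact List.Lex.rel (by omega)
      refine Submodule.add_mem _ (Submodule.smul_mem _ _ ?_) (Submodule.smul_mem _ _ ?_)
      · refine consL_mem_supported (s := {L' | X.inv L' = X.inv (p :: l) ∧ L'.length = l.length}) ?_
          (mulHead_mem_supported (s := {l}) ?_ (single_mem_supported (Set.mem_singleton l) 1))
        · rintro L' ⟨h1, h2⟩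
          exact hsub L' ((X.inv_cons s h1).trans (X.inv_mul hsp l).symm) h2
        · rintro b l' rfl hc
          exact ⟨X.inv_mul hc l', rfl⟩
      · cases l with
        | nil => simp
        | cons b l =>
          by_cases hb : X.Pure x b
          · rw [← consL_single, mulHead_cons, map_smul]
            by_cases hab : X.c (X.mul s p) b = 0
            · simp [hab]
            · have hassoc := X.c_assoc s p b
              have h3 : X.c p b * X.c s (X.mul p b) ≠ 0 := by
                rw [← hassoc]; exact mul_ne_zero hsp hab
              have hpb : X.c p b ≠ 0 := left_ne_zero_of_mul h3
              have hspb : X.c s (X.mul p b) ≠ 0 := right_ne_zero_of_mul h3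
              rw [X.mul_assoc, X.splitTwo_cons_mul hspb hs ((X.pure_mul hpb).2 ⟨hp', hb⟩) hs1,
                consL_single, consL_single]
              refine Submodule.smul_mem _ _ (Submodule.smul_mem _ _
                (single_mem_supported (hsub _ ?_ (by simp)) 1))
              rw [← X.inv_mul hspb, ← X.mul_assoc, X.inv_mul hab]
          · have := X.split_mulHead_mem_like x (X.mul s p) (b :: l)
            rw [← consL_single, mulHead_cons, map_smul] at this ⊢
            by_cases hab : X.c (X.mul s p) b = 0
            · simp [hab]
            · rw [X.splitTwo_cons_not_pure (fun h => hb ((X.pure_mul hab).1 h).2)]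
              refine Finsupp.supported_mono ?_ this
              rintro L' ⟨h1, h2⟩
              refine ⟨h1, ?_⟩
              rw [Set.mem_ofPred]
              rw [hrho]
              exact np_mono (by omega) _ h2


lemma splitTwo_mem_like (x : Θ) (L : List Γ) : X.splitTwo x (Finsupp.single L 1)
    ∈ Finsupp.supported k k (X.like L 1) := by
  cases L with
  | nil => simp [splitTwo, splitTwoAux]
  | cons a l =>
    have hs := fun L => Finsupp.supported_mono Set.inter_subset_left (X.split_mem_like x L)
    rw [← consL_single]
    by_cases hp : X.Pure x a
    · by_cases hc : (X.τ a).card = 1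
      · rw [X.splitTwo_cons_pure_one hp hc]
        exact Submodule.smul_mem _ _ (consL_mem_supported (fun l' h => X.cons_mem_like h) (hs l))
      · obtain ⟨s, p, -, rfl, hsp, hs1⟩ := X.pureSplit_spec hp hc
        obtain ⟨h1, h2⟩ := (X.pure_mul hsp).1 hp
        rw [X.splitTwo_cons_mul hsp h1 h2 hs1, consL_single, consL_single]
        refine Submodule.smul_mem _ _ (single_mem_supported (s := X.like (X.mul s p :: l) 1) ?_ 1)
        exact ⟨(X.inv_mul hsp l).symm, rfl⟩
    · rw [X.splitTwo_cons_not_pure hp, consL_single]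
      exact hs _

variable [Nonempty Θ]

/-- Rank function for the homotopy `hom`. -/
def rho : List Γ → List ℕ
  | [] => []
  | a :: l => if 2 ≤ X.mult (X.lead (a :: l)) (a :: l) then X.rhoTwo (X.lead (a :: l)) (a :: l)
      else if X.Pure (X.lead (a :: l)) a then 0 :: rho l else [1, X.idx (X.lead (a :: l)) (a :: l)]

lemma hom_mem_like (L : List Γ) : X.hom (Finsupp.single L 1)
    ∈ Finsupp.supported k k (X.like L 1) := by
  induction L with
  | nil => simp [hom, homAux]
  | cons a l ih =>
    rw [X.hom_eq_of_mult (a :: l) (single_mem_supported (by simp) 1)]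
    generalize X.lead (a :: l) = x
    split_ifs
    · exact X.splitTwo_mem_like x _
    · rw [← consL_single]
      by_cases hp : X.Pure x a
      · rw [X.homOne_cons_pure hp]
        exact Submodule.smul_mem _ _ (consL_mem_supported (fun l' h => X.cons_mem_like h) ih)
      · rw [X.homOne_cons_not_pure hp, consL_single]
        exact Finsupp.supported_mono Set.inter_subset_left (X.split_mem_like x _)

lemma rho_of_inv {L L' : List Γ} (h : X.inv L' = X.inv L) (hL : 2 ≤ X.mult (X.lead L) L) :
    X.rho L' = X.rhoTwo (X.lead L) L' := by
  have e := X.lead_of_inv (X.mult_of_inv h)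
  cases L' with
  | nil => rfl
  | cons a l => rw [rho, e, X.mult_of_inv h, if_pos hL]

lemma rho_cons_of_inv {a : Γ} {l L : List Γ} (h : X.inv (a :: l) = X.inv L)
    (hL : ¬ 2 ≤ X.mult (X.lead L) L) :
    X.rho (a :: l) = if X.Pure (X.lead L) a then 0 :: X.rho l
      else [1, X.idx (X.lead L) (a :: l)] := by
  have e := X.lead_of_inv (X.mult_of_inv h)
  rw [rho, e, X.mult_of_inv h, if_neg hL]

/-- On lists that are not maximally split, the bar operator and the homotopy `hom` satisfy the
homotopy relation up to lists of larger rank. -/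
theorem hom_triangular (L : List Γ) (h : L.length < ((L.map X.τ).sum).card) :
    X.bm (X.hom (Finsupp.single L 1)) + X.hom (X.bm (Finsupp.single L 1)) - Finsupp.single L 1
      ∈ Finsupp.supported k k (X.like L 0 ∩ {L' | X.rho L < X.rho L'}) := by
  induction L with
  | nil => simp at h
  | cons a l ih =>
    rw [X.hom_eq_of_mult (a :: l) (single_mem_supported (by simp) 1),
      X.hom_eq_of_mult (a :: l) (Finsupp.supported_mono
        (fun L' hL' => X.mult_of_inv hL'.1) (X.bm_mem_supported _))]
    by_cases h2 : 2 ≤ X.mult (X.lead (a :: l)) (a :: l)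
    · rw [if_pos h2, if_pos h2]
      refine Finsupp.supported_mono ?_ (X.splitTwo_triangular _ _ h2)
      rintro L' ⟨h3, h4⟩
      refine ⟨h3, ?_⟩
      rw [Set.mem_ofPred]
      rw [X.rho_of_inv h3.1 h2, X.rho_of_inv rfl h2]
      exact h4
    · rw [if_neg h2, if_neg h2]
      have h1 := X.one_le_mult_lead (List.cons_ne_nil a l)
      have hrho := fun {b} {l'} (h : X.inv (b :: l') = X.inv (a :: l)) =>
        X.rho_cons_of_inv h h2
      generalize X.lead (a :: l) = x at *
      by_cases hp : X.Pure x a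
      swap
      · rw [X.bm_np (fun a ha => X.homOne_cons_not_pure ha) hp]
        have := X.splitBox_triangular x a l h1
        rw [if_neg hp] at this
        refine Finsupp.supported_mono ?_ this
        rintro L' ⟨h4, h5, h6⟩
        refine ⟨⟨h4, h5⟩, ?_⟩
        rw [Set.mem_ofPred]
        obtain ⟨b, l', rfl, hb⟩ := X.npHead_of_idx (lt_of_le_of_lt (Nat.zero_le _) h6)
        rw [hrho h4, if_neg hb, hrho rfl, if_neg hp]
        exact List.Lex.cons (List.Lex.rel h6)
      have ha1 : X.ε a * X.ε a = 1 := X.ε_sq a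
      have hcard : (X.τ a).card = 1 := by
        rw [mult] at h2
        have h3 : (X.τ a).count x = (X.τ a).card := Multiset.count_eq_card.2
            (fun y hy => (hp y hy).symm)
        have := Multiset.card_pos.2 (X.τ_ne a)
        omega
      have e : X.bm (X.homOne x (Finsupp.single (a :: l) 1))
          + X.homOne x (X.bm (Finsupp.single (a :: l) 1)) - Finsupp.single (a :: l) 1
          = consL a (X.bm (X.hom (Finsupp.single l 1)) + X.hom (X.bm (Finsupp.single l 1))
              - Finsupp.single l 1)
            + mulHead X.c X.mul a (X.hom (Finsupp.single l 1))
            + X.ε a • X.homOne x (mulHead X.c X.mul a (Finsupp.single l 1)) := by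
        rw [← consL_single, X.homOne_cons_pure hp, map_smul, bm_cons, bm_cons, map_add, map_smul,
          map_smul, X.homOne_cons_pure hp, map_sub, map_add]
        linear_combination (norm := module) ha1 • (consL a (X.bm (X.hom (Finsupp.single l 1)))
          + consL a (X.hom (X.bm (Finsupp.single l 1)))
          + mulHead X.c X.mul a (X.hom (Finsupp.single l 1)))
      have hnp : ∀ {b} {l' : List Γ}, X.c a b ≠ 0 → X.inv (X.mul a b :: l') = X.inv (a :: l) →
          ¬ X.Pure x (X.mul a b) := by
        intro b l' hc hi hpp
        have h3 := X.mult_of_inv hi x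
        rw [mult, X.τ_mul hc, Multiset.count_add] at h3
        have h4 := Multiset.one_le_count_iff_mem.2 (X.mem_of_pure hp)
        have h5 := Multiset.one_le_count_iff_mem.2 (X.mem_of_pure ((X.pure_mul hc).1 hpp).2)
        omega
      have hsub : ∀ L' ∈ X.like (a :: l) 0 ∩ X.npHead x,
          L' ∈ X.like (a :: l) 0 ∩ {L' | X.rho (a :: l) < X.rho L'} := by
        rintro _ ⟨h3, b, l', rfl, hb⟩
        refine ⟨h3, ?_⟩
        rw [Set.mem_ofPred]
        rw [hrho h3.1, if_neg hb, hrho rfl, if_pos hp]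
        exact List.Lex.rel (by omega)
      rw [e]
      refine Submodule.add_mem _ (Submodule.add_mem _ ?_ ?_) (Submodule.smul_mem _ _ ?_)
      · refine consL_mem_supported ?_ (ih ?_)
        · rintro l' ⟨h3, h4⟩
          have h5 := X.cons_mem_like (a := a) h3
          refine ⟨h5, ?_⟩
          rw [Set.mem_ofPred]
          rw [hrho rfl, hrho h5.1, if_pos hp, if_pos hp]
          exact List.Lex.cons h4
        · simp only [List.length_cons, List.map_cons, List.sum_cons, Multiset.card_add, hcard] at h
          omega
      · refine Finsupp.supported_mono hsub (mulHead_mem_supported ?_ (X.hom_mem_like l))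
        rintro b l' ⟨h3, h4⟩ hc
        have h5 : X.inv (X.mul a b :: l') = X.inv (a :: l) := (X.inv_mul hc l').trans
            (X.inv_cons a h3)
        exact ⟨⟨h5, by simpa using h4⟩, _, _, rfl, hnp hc h5⟩
      · cases l with
        | nil => simp
        | cons b l =>
          have := Finsupp.supported_mono hsub (X.split_mulHead_mem_like x a (b :: l))
          rw [← consL_single, mulHead_cons, map_smul] at this ⊢
          by_cases hab : X.c a b = 0
          · simp [hab]
          · rwa [X.homOne_cons_not_pure (hnp hab (X.inv_mul hab l))]

end SplitData

end MonomialRings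

namespace MonomialRings

section NormalForm

variable {k : Type*} [Field k] {Γ K : Type*}

/-- A change of basis bringing a homogeneous differential `d` to a normal form: apart from the
harmonic basis elements, the differential admits a contracting homotopy `s`. -/
structure NormalForm (d : Γ → Γ →₀ k) (key : Γ → K) (deg : Γ → ℕ) (Λ : Type*) where
  /-- the key of a basis element -/
  key' : Λ → K
  /-- the degree of a basis element -/
  deg' : Λ → ℕ
  /-- the transported differential -/
  d' : Λ → Λ →₀ k
  /-- the contracting homotopy -/
  s : Λ → Λ →₀ k
  /-- the harmonic basis elements -/
  harm : Set Λ
  /-- the change of basis -/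
  ψ : Λ → Γ →₀ k
  /-- the inverse change of basis -/
  φ : Γ → Λ →₀ k
  ψφ : ∀ a, linExt ψ (φ a) = Finsupp.single a 1
  φψ : ∀ x, linExt φ (ψ x) = Finsupp.single x 1
  ψ_hom : ∀ x, ∀ a ∈ (ψ x).support, key a = key' x ∧ deg a = deg' x
  φ_hom : ∀ a, ∀ x ∈ (φ a).support, key' x = key a ∧ deg' x = deg a
  comm : ∀ a, linExt φ (d a) = linExt d' (φ a)
  d'_hom : ∀ x, ∀ y ∈ (d' x).support, key' y = key' x ∧ deg' y + 1 = deg' x ∧ y ∉ harm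
  d'_harm : ∀ x ∈ harm, d' x = 0
  s_hom : ∀ x, ∀ y ∈ (s x).support, key' y = key' x ∧ deg' y = deg' x + 1 ∧ y ∉ harm
  s_d : ∀ x ∉ harm, linExt d' (s x) + linExt s (d' x) = Finsupp.single x 1

lemma exists_relative_compl {E : Type*} [AddCommGroup E] [Module k E] {A B : Submodule k E}
    (h : A ≤ B) : ∃ C ≤ B, A ⊓ C = ⊥ ∧ A ⊔ C = B := by
  obtain ⟨C, hC⟩ := A.exists_isCompl
  refine ⟨C ⊓ B, inf_le_right, ?_, ?_⟩
  · rw [← inf_assoc, hC.inf_eq_bot, bot_inf_eq]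
  · rw [← sup_inf_assoc_of_le C h, hC.sup_eq_top, top_inf_eq]

/-- A basis of a finite-dimensional subspace. -/
def finBasisSub {E : Type*} [AddCommGroup E] [Module k E] (V : Submodule k E)
    [FiniteDimensional k V] : Module.Basis (Fin (Module.finrank k V)) k V :=
  Module.finBasis k V

/-- The span of the basis elements with given key and degree. -/
def piece (k : Type*) [Field k] {Γ K : Type*} (key : Γ → K) (deg : Γ → ℕ) (κ : K) (n : ℕ) :
    Submodule k (Γ →₀ k) :=
  Finsupp.supported k k {a | key a = κ ∧ deg a = n}

variable {d : Γ → Γ →₀ k} {key : Γ → K} {deg : Γ → ℕ}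

lemma linExt_mem_piece (hd : ∀ a, ∀ b ∈ (d a).support, key b = key a ∧ deg b + 1 = deg a)
    {κ : K} {n : ℕ} {x : Γ →₀ k} (hx : x ∈ piece k key deg κ (n + 1)) :
    linExt d x ∈ piece k key deg κ n := by
  refine supported_induction _ (fun a ha => ?_) hx
  rw [linExt_single, one_smul, piece, Finsupp.mem_supported]
  intro b hb
  obtain ⟨h1, h2⟩ := hd a b hb
  obtain ⟨h3, h4⟩ := ha
  exact ⟨h1.trans h3, by omega⟩

lemma linExt_piece_zero (hd : ∀ a, ∀ b ∈ (d a).support, key b = key a ∧ deg b + 1 = deg a)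
    {κ : K} {x : Γ →₀ k} (hx : x ∈ piece k key deg κ 0) : linExt d x = 0 := by
  have := supported_induction (W := ⊥) (linExt d) (fun a ha => ?_) hx
  · simpa using this
  · rw [linExt_single, one_smul, Submodule.mem_bot, ← Finsupp.support_eq_empty,
      Finset.eq_empty_iff_forall_notMem]
    intro b hb
    have := (hd a b hb).2
    obtain ⟨h3, h4⟩ := ha
    omega

lemma linExt_sq (hdd : ∀ a, linExt d (d a) = 0) (x : Γ →₀ k) : linExt d (linExt d x) = 0 :=
  linearMap_eq_of_single (f := linExt d ∘ₗ linExt d) (g := 0) (fun a => by simp [hdd]) x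

/-- Bases of the homogeneous pieces adapted to the differential. -/
lemma exists_adapted_basis (hd : ∀ a, ∀ b ∈ (d a).support, key b = key a ∧ deg b + 1 = deg a)
    (hdd : ∀ a, linExt d (d a) = 0) (hfin : ∀ κ n, {a | key a = κ ∧ deg a = n}.Finite) :
    ∃ (I J : K → ℕ → Type) (u : ∀ κ n, I κ n → (Γ →₀ k))
      (b : ∀ κ n, Module.Basis (I κ n ⊕ (J κ n ⊕ I κ (n + 1))) k (piece k key deg κ n)),
      (∀ κ n i, (b κ n (Sum.inl i) : Γ →₀ k) = u κ n i) ∧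
      (∀ κ n j, linExt d (b κ n (Sum.inr (Sum.inl j)) : Γ →₀ k) = 0) ∧
      (∀ κ n i, (b κ n (Sum.inr (Sum.inr i)) : Γ →₀ k) = linExt d (u κ (n + 1) i)) ∧
      ∀ κ, IsEmpty (I κ 0) := by
  set D : (Γ →₀ k) →ₗ[k] (Γ →₀ k) := linExt d with hD
  set C := piece k key deg with hC
  set Z : K → ℕ → Submodule k (Γ →₀ k) := fun κ n => C κ n ⊓ LinearMap.ker D with hZ
  have hBZ : ∀ κ n, (C κ (n + 1)).map D ≤ Z κ n := by
    rintro κ n _ ⟨x, hx, rfl⟩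
    exact ⟨linExt_mem_piece hd hx, linExt_sq hdd x⟩
  have hZC : ∀ κ n, Z κ n ≤ C κ n := fun κ n => inf_le_left
  choose H hHZ hHd hHs using fun κ n => exists_relative_compl (hBZ κ n)
  choose U hUC hUd hUs using fun κ n => exists_relative_compl (hZC κ n)
  have fd : ∀ κ n, FiniteDimensional k (C κ n) := fun κ n => finiteDimensional_supported (hfin κ n)
  have fU : ∀ κ n, FiniteDimensional k (U κ n) := fun κ n =>
    Submodule.finiteDimensional_of_le (hUC κ n)
  have fH : ∀ κ n, FiniteDimensional k (H κ n) := fun κ n =>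
    Submodule.finiteDimensional_of_le ((hHZ κ n).trans (hZC κ n))
  let f : ∀ κ n, (U κ n × (H κ n × U κ (n + 1))) →ₗ[k] (Γ →₀ k) := fun κ n =>
    LinearMap.coprod (U κ n).subtype
      (LinearMap.coprod (H κ n).subtype (D ∘ₗ (U κ (n + 1)).subtype))
  have hf : ∀ κ n x, f κ n x = (x.1 : Γ →₀ k) + (x.2.1 + D x.2.2) := fun κ n x => by simp [f]
  have hfinj : ∀ κ n, Function.Injective (f κ n) := by
    intro κ n
    rw [injective_iff_map_eq_zero]
    rintro ⟨⟨x, hx⟩, ⟨y, hy⟩, ⟨z, hz⟩⟩ h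
    rw [hf] at h
    simp only at h
    have hDz : D z ∈ (C κ (n + 1)).map D := ⟨z, hUC _ _ hz, rfl⟩
    have hx0 : x = 0 := by
      have h1 : x ∈ Z κ n := by
        rw [eq_neg_of_add_eq_zero_left h]
        exact neg_mem (add_mem (hHZ _ _ hy) (hBZ _ _ hDz))
      have : x ∈ Z κ n ⊓ U κ n := ⟨h1, hx⟩
      rwa [hUd] at this
    rw [hx0, zero_add] at h
    have hy0 : y = 0 := by
      have h1 : y ∈ (C κ (n + 1)).map D := by
        rw [eq_neg_of_add_eq_zero_left h]
        exact neg_mem hDz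
      have : y ∈ (C κ (n + 1)).map D ⊓ H κ n := ⟨h1, hy⟩
      rwa [hHd] at this
    rw [hy0, zero_add] at h
    have hz0 : z = 0 := by
      have : z ∈ Z κ (n + 1) ⊓ U κ (n + 1) := ⟨⟨hUC _ _ hz, h⟩, hz⟩
      rwa [hUd] at this
    subst hx0 hy0 hz0
    rfl
  have hfrange : ∀ κ n, LinearMap.range (f κ n) = C κ n := by
    intro κ n
    apply le_antisymm
    · rintro _ ⟨x, rfl⟩
      rw [hf]
      exact add_mem (hUC _ _ x.1.2) (add_mem (hZC _ _ (hHZ _ _ x.2.1.2))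
        (hZC _ _ (hBZ _ _ ⟨_, hUC _ _ x.2.2.2, rfl⟩)))
    · intro x hx
      rw [← hUs κ n] at hx
      obtain ⟨y, hy, w, hw, rfl⟩ := Submodule.mem_sup.1 hx
      rw [← hHs κ n] at hy
      obtain ⟨_, ⟨v, hv, rfl⟩, t, ht, rfl⟩ := Submodule.mem_sup.1 hy
      have hv' : v ∈ C κ (n + 1) := hv
      rw [← hUs κ (n + 1)] at hv'
      obtain ⟨p, hp, q, hq, rfl⟩ := Submodule.mem_sup.1 hv'
      refine ⟨(⟨w, hw⟩, ⟨t, ht⟩, ⟨q, hq⟩), ?_⟩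
      rw [hf, map_add, show D p = 0 from hp.2]
      simp only
      abel
  let e : ∀ κ n, (U κ n × (H κ n × U κ (n + 1))) ≃ₗ[k] C κ n := fun κ n =>
    (LinearEquiv.ofInjective (f κ n) (hfinj κ n)).trans (LinearEquiv.ofEq _ _ (hfrange κ n))
  have he : ∀ κ n x, ((e κ n x : C κ n) : Γ →₀ k) = f κ n x := fun κ n x => rfl
  let bU := fun (κ : K) (n : ℕ) => finBasisSub (U κ n)
  let bH := fun (κ : K) (n : ℕ) => finBasisSub (H κ n)
  refine ⟨fun κ n => Fin (Module.finrank k (U κ n)), fun κ n => Fin (Module.finrank k (H κ n)),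
    fun κ n i => bU κ n i, fun κ n => ((bU κ n).prod ((bH κ n).prod (bU κ (n + 1)))).map (e κ n),
    ?_, ?_, ?_, ?_⟩
  · intro κ n i
    rw [Module.Basis.map_apply, he, hf]
    simp
  · intro κ n i
    rw [Module.Basis.map_apply, he, hf]
    simpa using (hHZ _ _ (bH κ n i).2).2
  · intro κ n i
    rw [Module.Basis.map_apply, he, hf]
    simp
  · intro κ
    have : U κ 0 = ⊥ := by
      rw [← hUd κ 0, eq_comm, inf_eq_right]
      intro x hx
      exact ⟨hUC _ _ hx, linExt_piece_zero hd (hUC _ _ hx)⟩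
    beta_reduce
    rw [this, finrank_bot]
    infer_instance

theorem exists_normalForm (hd : ∀ a, ∀ b ∈ (d a).support, key b = key a ∧ deg b + 1 = deg a)
    (hdd : ∀ a, linExt d (d a) = 0) (hfin : ∀ κ n, {a | key a = κ ∧ deg a = n}.Finite) :
    ∃ (I J : K → ℕ → Type), Nonempty (NormalForm d key deg
      (Σ p : K × ℕ, (I p.1 p.2 ⊕ (J p.1 p.2 ⊕ I p.1 (p.2 + 1))))) := by
  obtain ⟨I, J, u, b, hu, hh, hB, hI⟩ := exists_adapted_basis hd hdd hfin
  refine ⟨I, J, ⟨?_⟩⟩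
  set Λ := (Σ p : K × ℕ, (I p.1 p.2 ⊕ (J p.1 p.2 ⊕ I p.1 (p.2 + 1)))) with hΛ
  let ψ : Λ → Γ →₀ k := fun x => b x.1.1 x.1.2 x.2
  have mem : ∀ a, Finsupp.single a (1 : k) ∈ piece k key deg (key a) (deg a) := fun a =>
    single_mem_supported (s := {b | key b = key a ∧ deg b = deg a}) ⟨rfl, rfl⟩ 1
  let emb : ∀ p : K × ℕ, ((I p.1 p.2 ⊕ (J p.1 p.2 ⊕ I p.1 (p.2 + 1))) →₀ k) →ₗ[k] (Λ →₀ k) :=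
    fun p => linExt fun i => Finsupp.single ⟨p, i⟩ 1
  let φ : Γ → Λ →₀ k := fun a => emb (key a, deg a) ((b (key a) (deg a)).repr ⟨_, mem a⟩)
  have hφ : ∀ (p : K × ℕ) (v : Γ →₀ k) (hv : v ∈ piece k key deg p.1 p.2),
      linExt φ v = emb p ((b p.1 p.2).repr ⟨v, hv⟩) := by
    rintro ⟨κ, n⟩ v hv
    obtain ⟨f, hf⟩ : ∃ f : (Γ →₀ k) →ₗ[k] (Λ →₀ k), ∀ v (hv : v ∈ piece k key deg κ n),
        f v = emb (κ, n) ((b κ n).repr ⟨v, hv⟩) := by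
      obtain ⟨f, hf⟩ := LinearMap.exists_extend (p := piece k key deg κ n)
        (emb (κ, n) ∘ₗ (b κ n).repr.toLinearMap)
      exact ⟨f, fun v hv => congrArg (fun g => g ⟨v, hv⟩) hf⟩
    rw [← hf v hv]
    refine eq_on_supported _ _ ?_ hv
    rintro a ⟨rfl, rfl⟩
    rw [linExt_single, one_smul, hf _ (mem a)]
  have hφψ : ∀ x, linExt φ (ψ x) = Finsupp.single x 1 := by
    rintro ⟨p, i⟩
    rw [hφ p (ψ ⟨p, i⟩) (b p.1 p.2 i).2]
    simp [ψ, emb]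
  have hemb : ∀ p v, linExt ψ (emb p v) = ((b p.1 p.2).repr.symm v : Γ →₀ k) := by
    intro p v
    refine linearMap_eq_of_single (f := linExt ψ ∘ₗ emb p)
      (g := (piece k key deg p.1 p.2).subtype ∘ₗ (b p.1 p.2).repr.symm.toLinearMap)
      (fun i => ?_) v
    simp [emb, ψ]
  have hembs : ∀ p v, ∀ x ∈ (emb p v).support, x.1 = p := by
    intro p v
    have : emb p v ∈ Finsupp.supported k k {x : Λ | x.1 = p} := by
      refine supported_induction (s := Set.univ) _ (fun i _ => ?_) (by simp)
      simp only [emb, linExt_single, one_smul]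
      exact single_mem_supported (s := {x : Λ | x.1 = p}) rfl 1
    exact fun x hx => (Finsupp.mem_supported _ _).1 this hx
  have hψψ : ∀ v, linExt ψ (linExt φ v) = v := by
    intro v
    refine linearMap_eq_of_single (f := linExt ψ ∘ₗ linExt φ) (g := LinearMap.id) (fun a => ?_) v
    simp [φ, hemb]
  let s : Λ → Λ →₀ k
    | ⟨_, Sum.inl _⟩ => 0
    | ⟨_, Sum.inr (Sum.inl _)⟩ => 0
    | ⟨p, Sum.inr (Sum.inr i)⟩ => Finsupp.single ⟨(p.1, p.2 + 1), Sum.inl i⟩ 1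
  let harm : Set Λ := {x | ∃ p j, x = ⟨p, Sum.inr (Sum.inl j)⟩}
  have d1 : ∀ κ n i, linExt φ (linExt d (ψ ⟨(κ, n + 1), Sum.inl i⟩))
      = Finsupp.single ⟨(κ, n), Sum.inr (Sum.inr i)⟩ 1 := by
    intro κ n i
    rw [← hφψ ⟨(κ, n), Sum.inr (Sum.inr i)⟩]
    simp only [ψ]
    rw [hB, hu]
  have d2 : ∀ p j, linExt φ (linExt d (ψ ⟨p, Sum.inr (Sum.inl j)⟩)) = 0 := by
    intro p j
    simp only [ψ]
    rw [hh, map_zero]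
  have d3 : ∀ p j, linExt φ (linExt d (ψ ⟨p, Sum.inr (Sum.inr j)⟩)) = 0 := by
    intro p j
    simp only [ψ]
    rw [hB, linExt_sq hdd, map_zero]
  refine
    { key' := fun x => x.1.1
      deg' := fun x => x.1.2
      d' := fun x => linExt φ (linExt d (ψ x))
      s := s
      harm := harm
      ψ := ψ
      φ := φ
      ψφ := fun a => ?_
      φψ := hφψ
      ψ_hom := fun x a ha => (Finsupp.mem_supported _ _).1 (b x.1.1 x.1.2 x.2).2 ha
      φ_hom := fun a x hx => ?_
      comm := fun a => ?_
      d'_hom := ?_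
      d'_harm := ?_
      s_hom := ?_
      s_d := ?_ }
  · simpa using hψψ (Finsupp.single a 1)
  · have := hembs _ _ x hx
    rw [this]
    exact ⟨rfl, rfl⟩
  · have h2 : ∀ v, linExt (fun x => linExt φ (linExt d (ψ x))) v
        = linExt φ (linExt d (linExt ψ v)) := fun v =>
      linearMap_eq_of_single (g := linExt φ ∘ₗ linExt d ∘ₗ linExt ψ) (fun x => by simp) v
    have h3 := hψψ (Finsupp.single a 1)
    rw [linExt_single, one_smul] at h3
    rw [h2, h3]
    simp
  · rintro ⟨⟨κ, n⟩, i | j | i⟩ y hy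
    · cases n with
      | zero => exact ((hI κ).false i).elim
      | succ n =>
        rw [d1] at hy
        have := Finsupp.support_single_subset hy
        rw [Finset.mem_singleton] at this
        subst this
        refine ⟨rfl, rfl, ?_⟩
        rintro ⟨p, j, h⟩
        cases h
    · rw [d2] at hy; simp at hy
    · rw [d3] at hy; simp at hy
  · rintro _ ⟨p, j, rfl⟩
    exact d2 p j
  · rintro ⟨⟨κ, n⟩, i | j | i⟩ y hy
    · simp [s] at hy
    · simp [s] at hy
    · have := Finsupp.support_single_subset hy
      rw [Finset.mem_singleton] at this
      subst this
      refine ⟨rfl, rfl, ?_⟩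
      rintro ⟨p, j, h⟩
      cases h
  · rintro ⟨⟨κ, n⟩, i | j | i⟩ hx
    · cases n with
      | zero => exact ((hI κ).false i).elim
      | succ n => rw [d1]; simp [s]
    · exact absurd ⟨_, _, rfl⟩ hx
    · rw [d3, map_zero, add_zero]
      simp only [s, linExt_single, one_smul]
      exact d1 κ n i

end NormalForm

end MonomialRings

namespace MonomialRings

section HarmonicCount

variable {k : Type*} [Field k] {Γ Λ K : Type*}

lemma finite_of_finiteDimensional_supported {ι : Type*} {s : Set ι}
    (h : FiniteDimensional k ↥(Finsupp.supported k k s)) : s.Finite := by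
  have : FiniteDimensional k (s →₀ k) :=
    Module.Finite.equiv (Finsupp.supportedEquivFinsupp (M := k) (R := k) s)
  exact Module.Finite.finite_basis (Finsupp.basisSingleOne (R := k) (ι := s))

/-- If the differential vanishes on the basis elements in `H` and is contractible on the others,
then the homology is counted by the elements of `H`. -/
lemma homDim_eq_ncard {ι : Type*} (D h : (ι →₀ k) →ₗ[k] (ι →₀ k)) (H p₁ p₂ : Set ι)
    (hf₁ : p₁.Finite) (hf₂ : p₂.Finite)
    (hD₂ : ∀ a ∈ p₂, D (Finsupp.single a 1) ∈ Finsupp.supported k k (p₁ \ H))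
    (hDH : ∀ a ∈ H, D (Finsupp.single a 1) = 0) (hDD : ∀ x, D (D x) = 0)
    (hh : ∀ a ∈ p₁ \ H, h (Finsupp.single a 1) ∈ Finsupp.supported k k p₂)
    (hDh : ∀ a ∈ p₁ \ H, D (h (Finsupp.single a 1)) + h (D (Finsupp.single a 1))
      = Finsupp.single a 1) :
    homDim D (Finsupp.supported k k p₁) (Finsupp.supported k k p₂) = (p₁ ∩ H).ncard := by
  have := finiteDimensional_supported (k := k) hf₂
  have := finiteDimensional_supported (k := k) (hf₁.inter_of_left H)
  have hQ : ∀ x ∈ Finsupp.supported k k (p₁ \ H), D x = 0 →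
      x ∈ (Finsupp.supported k k p₂).map D := by
    intro x hx hDx
    refine ⟨h x, supported_induction h hh hx, ?_⟩
    have := eq_on_supported (D ∘ₗ h + h ∘ₗ D) LinearMap.id (fun a ha => by simpa using hDh a ha) hx
    simpa [hDx] using this
  have hG : ∀ x ∈ Finsupp.supported k k (p₁ ∩ H), D x = 0 := fun x hx =>
    eq_on_supported D 0 (fun a ha => by simpa using hDH a ha.2) hx
  have hle : (Finsupp.supported k k p₂).map D ≤ Finsupp.supported k k (p₁ \ H) := by
    rintro _ ⟨x, hx, rfl⟩
    exact supported_induction D hD₂ hx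
  have key : Finsupp.supported k k p₁ ⊓ LinearMap.ker D
      = Finsupp.supported k k (p₁ ∩ H) ⊔ (Finsupp.supported k k p₂).map D := by
    apply le_antisymm
    · rintro x ⟨hx, hDx⟩
      rw [supported_sup_of_partition (Set.inter_union_sdiff p₁ H).symm] at hx
      obtain ⟨g, hg, q, hq, rfl⟩ := Submodule.mem_sup.1 hx
      have : D q = 0 := by
        have h2 : D (g + q) = 0 := hDx
        rwa [map_add, hG g hg, zero_add] at h2
      exact Submodule.add_mem_sup hg (hQ q hq this)
    · refine sup_le (fun x hx => ⟨Finsupp.supported_mono Set.inter_subset_left hx, hG x hx⟩) ?_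
      rintro _ ⟨x, hx, rfl⟩
      exact ⟨Finsupp.supported_mono Set.sdiff_subset (hle ⟨x, hx, rfl⟩), hDD x⟩
  have hdis : Disjoint (Finsupp.supported k k (p₁ ∩ H)) ((Finsupp.supported k k p₂).map D) :=
    (disjoint_supported (Set.disjoint_left.2 fun a ha hb => hb.2 ha.2)).mono_right hle
  rw [homDim, key, finrank_sup_of_disjoint _ _ hdis, finrank_supported (hf₁.inter_of_left H)]
  push_cast
  ring

/-- The letterwise extension to lists of a map into combinations of letters. -/
def lmapAux (ψ : Γ → Λ →₀ k) : List Γ → (List Λ →₀ k)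
  | [] => Finsupp.single [] 1
  | a :: l => consS (ψ a) (lmapAux ψ l)

/-- The letterwise extension to lists of a map into combinations of letters. -/
def lmap (ψ : Γ → Λ →₀ k) : (List Γ →₀ k) →ₗ[k] (List Λ →₀ k) := linExt (lmapAux ψ)

lemma lmap_nil (ψ : Γ → Λ →₀ k) : lmap ψ (Finsupp.single [] 1) = Finsupp.single [] 1 := by
  simp [lmap, lmapAux]

lemma lmap_consL (ψ : Γ → Λ →₀ k) (a : Γ) (x : List Γ →₀ k) :
    lmap ψ (consL a x) = consS (ψ a) (lmap ψ x) := by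
  refine linearMap_eq_of_single (f := lmap ψ ∘ₗ consL a) (g := consS (ψ a) ∘ₗ lmap ψ)
    (fun l => ?_) x
  simp [lmap, lmapAux]

lemma lmap_consS (ψ : Γ → Λ →₀ k) (v : Γ →₀ k) (x : List Γ →₀ k) :
    lmap ψ (consS v x) = consS (linExt ψ v) (lmap ψ x) := by
  refine linearMap_eq_of_single (f := lmap ψ ∘ₗ consS.flip x)
    (g := consS.flip (lmap ψ x) ∘ₗ linExt ψ) (fun a => ?_) v
  simp [lmap_consL]

lemma list_ext {E : Type*} [AddCommGroup E] [Module k E] {f g : (List Γ →₀ k) →ₗ[k] E}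
    (h0 : f (Finsupp.single [] 1) = g (Finsupp.single [] 1))
    (h1 : ∀ a (l : List Γ), f (Finsupp.single l 1) = g (Finsupp.single l 1) →
      f (consL a (Finsupp.single l 1)) = g (consL a (Finsupp.single l 1))) (x : List Γ →₀ k) :
    f x = g x := by
  refine linearMap_eq_of_single (fun l => ?_) x
  induction l with
  | nil => exact h0
  | cons a l ih => simpa using h1 a l ih

lemma lmap_lmap {ψ : Γ → Λ →₀ k} {φ : Λ → Γ →₀ k} (h : ∀ a, linExt φ (ψ a) = Finsupp.single a 1)
    (x : List Γ →₀ k) : lmap φ (lmap ψ x) = x := by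
  refine list_ext (f := lmap φ ∘ₗ lmap ψ) (g := LinearMap.id) (by simp [lmap_nil])
    (fun a l ih => ?_) x
  simp only [LinearMap.comp_apply, LinearMap.id_apply] at ih ⊢
  rw [lmap_consL, lmap_consS, h, ih]
  simp

lemma der_consS {d : Γ → Γ →₀ k} {e : ℕ → k} {deg : Γ → ℕ} {n : ℕ} {v : Γ →₀ k}
    (hv : ∀ a ∈ v.support, deg a = n) (x : List Γ →₀ k) :
    der d (fun a => e (deg a)) (consS v x)
      = -consS (linExt d v) x + e n • consS v (der d (fun a => e (deg a)) x) := by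
  refine eq_on_supported (s := {a | deg a = n}) (der d (fun a => e (deg a)) ∘ₗ consS.flip x)
    (-(consS.flip x ∘ₗ linExt d) + e n • consS.flip (der d (fun a => e (deg a)) x))
    (fun a ha => ?_) (x := v) ?_
  · have ha' : deg a = n := ha
    simp [der_cons, ha']
  · rw [Finsupp.mem_supported]
    exact hv

lemma lmap_der {d : Γ → Γ →₀ k} {d' : Λ → Λ →₀ k} {e : ℕ → k} {deg : Γ → ℕ} {deg' : Λ → ℕ}
    {φ : Γ → Λ →₀ k} (hφ : ∀ a, ∀ x ∈ (φ a).support, deg' x = deg a)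
    (hc : ∀ a, linExt φ (d a) = linExt d' (φ a)) (x : List Γ →₀ k) :
    lmap φ (der d (fun a => e (deg a)) x) = der d' (fun a => e (deg' a)) (lmap φ x) := by
  refine list_ext (f := lmap φ ∘ₗ der d fun a => e (deg a))
    (g := (der d' fun a => e (deg' a)) ∘ₗ lmap φ) (by simp [lmap_nil])
    (fun a l ih => ?_) x
  simp only [LinearMap.comp_apply] at ih ⊢
  rw [der_cons, lmap_consL, der_consS (hφ a), ← ih, map_add, map_neg, map_smul, lmap_consS,
    lmap_consL, hc]

lemma der_der {d : Γ → Γ →₀ k} {e : ℕ → k} {deg : Γ → ℕ} (he : ∀ n, e (n + 1) = -e n)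
    (hd : ∀ a, ∀ b ∈ (d a).support, deg b + 1 = deg a) (hdd : ∀ a, linExt d (d a) = 0)
    (x : List Γ →₀ k) : der d (fun a => e (deg a)) (der d (fun a => e (deg a)) x) = 0 := by
  refine list_ext (f := (der d fun a => e (deg a)) ∘ₗ der d fun a => e (deg a)) (g := 0) (by simp)
      (fun a l ih => ?_) x
  simp only [LinearMap.comp_apply, LinearMap.zero_apply] at ih ⊢
  by_cases ha : deg a = 0
  · have : d a = 0 := by
      rw [← Finsupp.support_eq_empty, Finset.eq_empty_iff_forall_notMem]
      intro b hb
      have := hd a b hb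
      omega
    rw [der_cons, this, map_zero, LinearMap.zero_apply, neg_zero, zero_add, map_smul, der_cons,
      this, ih]
    simp
  · obtain ⟨n, hn⟩ := Nat.exists_eq_succ_of_ne_zero ha
    have h1 : ∀ b ∈ (d a).support, deg b = n := fun b hb => by have := hd a b hb; omega
    rw [der_cons, map_add, map_neg, map_smul, der_consS h1, der_cons, hdd, ih, hn, he]
    simp

/-- The lists of letters with given key sequence and total shifted degree. -/
def listPiece (key : Γ → K) (deg : Γ → ℕ) (A : Set (List K)) (i : ℕ) : Set (List Γ) :=
  {L | L.map key ∈ A ∧ (L.map fun a => deg a + 1).sum = i}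

lemma lmap_mem_supported {key : Γ → K} {deg : Γ → ℕ} {key' : Λ → K} {deg' : Λ → ℕ}
    {φ : Γ → Λ →₀ k} (hφ : ∀ a, ∀ x ∈ (φ a).support, key' x = key a ∧ deg' x = deg a)
    {A : Set (List K)} {i : ℕ} {x : List Γ →₀ k}
    (hx : x ∈ Finsupp.supported k k (listPiece key deg A i)) :
    lmap φ x ∈ Finsupp.supported k k (listPiece key' deg' A i) := by
  have main : ∀ L : List Γ, lmap φ (Finsupp.single L 1) ∈ Finsupp.supported k k
      {L' : List Λ | L'.map key' = L.map key ∧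
        (L'.map fun a => deg' a + 1).sum = (L.map fun a => deg a + 1).sum} := by
    intro L
    induction L with
    | nil =>
      rw [lmap_nil]
      exact single_mem_supported (s := {L' : List Λ | L'.map key' = ([] : List Γ).map key ∧
        (L'.map fun a => deg' a + 1).sum = (([] : List Γ).map fun a => deg a + 1).sum}) ⟨rfl, rfl⟩ 1
    | cons a L ih =>
      rw [← consL_single, lmap_consL]
      refine consS_mem_supported (fun b hb l hl => ?_) ih
      obtain ⟨h1, h2⟩ := hφ a b hb
      exact ⟨by simp [h1, hl.1], by simp [h2, hl.2]⟩
  refine supported_induction _ (fun L hL => ?_) hx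
  refine Finsupp.supported_mono ?_ (main L)
  rintro L' ⟨h1, h2⟩
  exact ⟨h1 ▸ hL.1, h2 ▸ hL.2⟩

variable {d : Γ → Γ →₀ k} {key : Γ → K} {deg : Γ → ℕ}

namespace NormalForm

variable (X : NormalForm d key deg Λ)

lemma map_supported (A : Set (List K)) (i : ℕ) :
    Finsupp.supported k k (listPiece X.key' X.deg' A i)
      = (Finsupp.supported k k (listPiece key deg A i)).map (lmap X.φ) := by
  apply le_antisymm
  · intro y hy
    exact ⟨lmap X.ψ y, lmap_mem_supported (fun x a ha => X.ψ_hom x a ha) hy, lmap_lmap X.φψ y⟩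
  · rintro _ ⟨x, hx, rfl⟩
    exact lmap_mem_supported X.φ_hom hx

lemma finite_listPiece {A : Set (List K)} {i : ℕ} (h : (listPiece key deg A i).Finite) :
    (listPiece X.key' X.deg' A i).Finite := by
  have := finiteDimensional_supported (k := k) h
  refine finite_of_finiteDimensional_supported (k := k) ?_
  rw [X.map_supported]
  infer_instance

lemma piece_eq_map (κ : K) (n : ℕ) :
    piece k X.key' X.deg' κ n = (piece k key deg κ n).map (linExt X.φ) := by
  have h1 : ∀ x, linExt X.φ (linExt X.ψ x) = x := fun x =>
    linearMap_eq_of_single (f := linExt X.φ ∘ₗ linExt X.ψ) (g := LinearMap.id)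
      (fun a => by simp [X.φψ]) x
  apply le_antisymm
  · intro y hy
    refine ⟨linExt X.ψ y, supported_induction _ (fun a ha => ?_) hy, h1 y⟩
    rw [linExt_single, one_smul, piece, Finsupp.mem_supported]
    intro b hb
    obtain ⟨h1, h2⟩ := X.ψ_hom a b hb
    exact ⟨h1.trans ha.1, h2.trans ha.2⟩
  · rintro _ ⟨x, hx, rfl⟩
    refine supported_induction _ (fun a ha => ?_) hx
    rw [linExt_single, one_smul, piece, Finsupp.mem_supported]
    intro b hb
    obtain ⟨h1, h2⟩ := X.φ_hom a b hb
    exact ⟨h1.trans ha.1, h2.trans ha.2⟩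

lemma finite_piece {κ : K} {n : ℕ} (h : {a | key a = κ ∧ deg a = n}.Finite) :
    {a | X.key' a = κ ∧ X.deg' a = n}.Finite := by
  have : FiniteDimensional k (piece k key deg κ n) := finiteDimensional_supported h
  refine finite_of_finiteDimensional_supported (k := k) ?_
  have := X.piece_eq_map κ n
  rw [piece] at this
  rw [this]
  infer_instance

lemma linExt_ψφ (x : Γ →₀ k) : linExt X.ψ (linExt X.φ x) = x :=
  linearMap_eq_of_single (f := linExt X.ψ ∘ₗ linExt X.φ) (g := LinearMap.id)
    (fun a => by simp [X.ψφ]) x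

lemma linExt_comm (x : Γ →₀ k) : linExt X.φ (linExt d x) = linExt X.d' (linExt X.φ x) :=
  linearMap_eq_of_single (f := linExt X.φ ∘ₗ linExt d) (g := linExt X.d' ∘ₗ linExt X.φ)
    (fun a => by simp [X.comm]) x

lemma d'_d' (hdd : ∀ a, linExt d (d a) = 0) (x : Λ) : linExt X.d' (X.d' x) = 0 := by
  have h1 : X.d' x = linExt X.d' (linExt X.φ (X.ψ x)) := by rw [X.φψ]; simp
  rw [h1, ← linExt_comm, ← linExt_comm, linExt_sq hdd, map_zero]

theorem letter_count (hdd : ∀ a, linExt d (d a) = 0)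
    (hfin : ∀ κ n, {a | key a = κ ∧ deg a = n}.Finite) (κ : K) (n : ℕ) :
    homDim (linExt d) (piece k key deg κ n) (piece k key deg κ (n + 1))
      = ({a | X.key' a = κ ∧ X.deg' a = n} ∩ X.harm).ncard := by
  rw [← homDim_transport (linExt X.φ) (linExt d) (linExt X.d') _ _ ⊤ _ _
    (X.piece_eq_map κ n) (X.piece_eq_map κ (n + 1)) le_top (fun _ _ => trivial)
    (fun _ _ => trivial) (fun x _ h => by rw [← X.linExt_ψφ x, h, map_zero])
    (fun x _ => X.linExt_comm x) (fun x _ => X.linExt_comm x)]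
  refine homDim_eq_ncard (linExt X.d') (linExt X.s) X.harm _ _ (X.finite_piece (hfin κ n))
    (X.finite_piece (hfin κ (n + 1))) ?_ ?_ (fun x => linExt_sq (X.d'_d' hdd) x) ?_ ?_
  · rintro a ⟨h1, h2⟩
    rw [linExt_single, one_smul, Finsupp.mem_supported]
    intro b hb
    obtain ⟨h3, h4, h5⟩ := X.d'_hom a b hb
    exact ⟨⟨h3.trans h1, by omega⟩, h5⟩
  · intro a ha
    simp [X.d'_harm a ha]
  · rintro a ⟨⟨h1, h2⟩, -⟩
    rw [linExt_single, one_smul, Finsupp.mem_supported]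
    intro b hb
    obtain ⟨h3, h4, -⟩ := X.s_hom a b hb
    exact ⟨h3.trans h1, by omega⟩
  · rintro a ⟨-, h⟩
    simpa using X.s_d a h

/-- The contracting homotopy on lists with a non-harmonic letter. -/
def listHomAux (e : ℕ → k) : List Λ → (List Λ →₀ k)
  | [] => 0
  | a :: l => if a ∈ X.harm then e (X.deg' a) • consL a (listHomAux e l)
      else -consS (X.s a) (Finsupp.single l 1)

/-- The contracting homotopy on lists with a non-harmonic letter. -/
def listHom (e : ℕ → k) : (List Λ →₀ k) →ₗ[k] (List Λ →₀ k) := linExt (X.listHomAux e)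

lemma listHom_harm (e : ℕ → k) {a : Λ} (ha : a ∈ X.harm) (x : List Λ →₀ k) :
    X.listHom e (consL a x) = e (X.deg' a) • consL a (X.listHom e x) := by
  refine linearMap_eq_of_single (f := X.listHom e ∘ₗ consL a)
    (g := e (X.deg' a) • consL a ∘ₗ X.listHom e) (fun l => ?_) x
  simp [listHom, listHomAux, ha]

lemma listHom_not_harm (e : ℕ → k) {a : Λ} (ha : a ∉ X.harm) (x : List Λ →₀ k) :
    X.listHom e (consL a x) = -consS (X.s a) x := by
  refine linearMap_eq_of_single (f := X.listHom e ∘ₗ consL a)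
    (g := -consS (X.s a)) (fun l => ?_) x
  simp [listHom, listHomAux, ha]

lemma listHom_consS (e : ℕ → k) {v : Λ →₀ k} (hv : ∀ a ∈ v.support, a ∉ X.harm)
    (x : List Λ →₀ k) : X.listHom e (consS v x) = -consS (linExt X.s v) x := by
  refine eq_on_supported (s := {a | a ∉ X.harm}) (X.listHom e ∘ₗ consS.flip x)
    (-(consS.flip x ∘ₗ linExt X.s)) (fun a ha => ?_) (x := v) ?_
  · simp [X.listHom_not_harm e ha]
  · rw [Finsupp.mem_supported]
    exact hv

lemma listHom_spec {e : ℕ → k} (he : ∀ n, e (n + 1) = -e n) (he2 : ∀ n, e n * e n = 1)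
    (L : List Λ) (hL : ¬ ∀ a ∈ L, a ∈ X.harm) :
    der X.d' (fun a => e (X.deg' a)) (X.listHom e (Finsupp.single L 1))
      + X.listHom e (der X.d' (fun a => e (X.deg' a)) (Finsupp.single L 1))
      = Finsupp.single L 1 := by
  induction L with
  | nil => simp at hL
  | cons a l ih =>
    rw [← consL_single]
    by_cases ha : a ∈ X.harm
    · have hl : ¬ ∀ b ∈ l, b ∈ X.harm := fun h => hL (by simpa [ha] using h)
      have ih := ih hl
      rw [X.listHom_harm e ha, der_cons, map_smul, der_cons, X.d'_harm a ha]
      simp only [map_zero, LinearMap.zero_apply, neg_zero, zero_add, map_smul]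
      rw [X.listHom_harm e ha, smul_smul, smul_smul, he2, one_smul, one_smul, ← map_add, ih]
    · rw [X.listHom_not_harm e ha, der_cons, map_neg,
        der_consS (n := X.deg' a + 1) (fun b hb => (X.s_hom a b hb).2.1), map_add, map_neg,
            map_smul,
        X.listHom_not_harm e ha, X.listHom_consS e (fun b hb => (X.d'_hom a b hb).2.2), he]
      have h := congrArg (fun v => consS v (Finsupp.single l (1 : k))) (X.s_d a ha)
      simp only [map_add, LinearMap.add_apply, consS_single, one_smul] at h
      linear_combination (norm := module) h

lemma listHom_mem (e : ℕ → k) (L : List Λ) :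
    X.listHom e (Finsupp.single L 1) ∈ Finsupp.supported k k
      {L' : List Λ | L'.map X.key' = L.map X.key' ∧
        (L'.map fun a => X.deg' a + 1).sum = (L.map fun a => X.deg' a + 1).sum + 1} := by
  induction L with
  | nil => simp [listHom, listHomAux]
  | cons a L ih =>
    rw [← consL_single]
    by_cases ha : a ∈ X.harm
    · rw [X.listHom_harm e ha]
      refine Submodule.smul_mem _ _ (consL_mem_supported (fun l hl => ?_) ih)
      exact ⟨by simp [hl.1], by simp [hl.2]; ring⟩
    · rw [X.listHom_not_harm e ha]
      refine Submodule.neg_mem _ (consS_mem_supported (s := {L}) (fun b hb l hl => ?_)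
        (single_mem_supported (Set.mem_singleton L) 1))
      obtain ⟨h1, h2, -⟩ := X.s_hom a b hb
      rw [Set.mem_singleton_iff] at hl
      subst hl
      exact ⟨by simp [h1], by simp [h2]; ring⟩

lemma der_mem (e : ℕ → k) (L : List Λ) :
    der X.d' (fun a => e (X.deg' a)) (Finsupp.single L 1) ∈ Finsupp.supported k k
      {L' : List Λ | (L'.map X.key' = L.map X.key' ∧
        (L'.map fun a => X.deg' a + 1).sum + 1 = (L.map fun a => X.deg' a + 1).sum) ∧
        ¬ ∀ a ∈ L', a ∈ X.harm} := by
  induction L with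
  | nil => simp
  | cons a L ih =>
    rw [← consL_single, der_cons]
    refine add_mem (Submodule.neg_mem _ (consS_mem_supported (s := {L}) (fun b hb l hl => ?_)
        (single_mem_supported (Set.mem_singleton L) 1)))
      (Submodule.smul_mem _ _ (consL_mem_supported (fun l hl => ?_) ih))
    · obtain ⟨h1, h2, h3⟩ := X.d'_hom a b hb
      rw [Set.mem_singleton_iff] at hl
      subst hl
      refine ⟨⟨by simp [h1], by simp [← h2]; ring⟩, fun h => h3 (h b (by simp))⟩
    · refine ⟨⟨by simp [hl.1.1], by simp [← hl.1.2]; ring⟩, fun h => hl.2 fun b hb => h b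
          (by simp [hb])⟩

lemma der_harm (e : ℕ → k) {L : List Λ} (hL : ∀ a ∈ L, a ∈ X.harm) :
    der X.d' (fun a => e (X.deg' a)) (Finsupp.single L 1) = 0 := by
  induction L with
  | nil => simp
  | cons a L ih =>
    rw [← consL_single, der_cons, X.d'_harm a (hL a (by simp)), ih fun b hb => hL b (by simp [hb])]
    simp

theorem list_count {e : ℕ → k} (he : ∀ n, e (n + 1) = -e n) (he2 : ∀ n, e n * e n = 1)
    (hdd : ∀ a, linExt d (d a) = 0) {A : Set (List K)} {i : ℕ}
    (h1 : (listPiece key deg A i).Finite) (h2 : (listPiece key deg A (i + 1)).Finite) :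
    homDim (der d (fun a => e (deg a))) (Finsupp.supported k k (listPiece key deg A i))
        (Finsupp.supported k k (listPiece key deg A (i + 1)))
      = (listPiece X.key' X.deg' A i ∩ {L | ∀ a ∈ L, a ∈ X.harm}).ncard := by
  have hc : ∀ x, lmap X.φ (der d (fun a => e (deg a)) x)
      = der X.d' (fun a => e (X.deg' a)) (lmap X.φ x) :=
    lmap_der (fun a x hx => (X.φ_hom a x hx).2) X.comm
  rw [← homDim_transport (lmap X.φ) (der d (fun a => e (deg a)))
    (der X.d' (fun a => e (X.deg' a))) _ _ ⊤ _ _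
    (X.map_supported A i) (X.map_supported A (i + 1)) le_top (fun _ _ => trivial)
    (fun _ _ => trivial) (fun x _ h => by rw [← lmap_lmap X.ψφ x, h, map_zero])
    (fun x _ => hc x) (fun x _ => hc x)]
  refine homDim_eq_ncard _ (X.listHom e) {L | ∀ a ∈ L, a ∈ X.harm} _ _ (X.finite_listPiece h1)
    (X.finite_listPiece h2) ?_ (fun L hL => X.der_harm e hL)
    (fun x => der_der he (fun a b hb => (X.d'_hom a b hb).2.1) (X.d'_d' hdd) x) ?_
    (fun L hL => X.listHom_spec he he2 L hL.2)
  · rintro L ⟨hA, hi⟩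
    refine Finsupp.supported_mono ?_ (X.der_mem e L)
    rintro L' ⟨⟨h3, h4⟩, h5⟩
    exact ⟨⟨h3 ▸ hA, by omega⟩, h5⟩
  · rintro L ⟨⟨hA, hi⟩, -⟩
    refine Finsupp.supported_mono ?_ (X.listHom_mem e L)
    rintro L' ⟨h3, h4⟩
    exact ⟨h3 ▸ hA, by omega⟩

end NormalForm

/-- The homology of the derivation on lists is counted by lists of harmonic letters. -/
theorem exists_harmonic_letters.{u} {K : Type u} (d : Γ → Γ →₀ k) (key : Γ → K) (deg : Γ → ℕ)
    (hd : ∀ a, ∀ b ∈ (d a).support, key b = key a ∧ deg b + 1 = deg a)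
    (hdd : ∀ a, linExt d (d a) = 0) (hfin : ∀ κ n, {a | key a = κ ∧ deg a = n}.Finite) :
    ∃ (Λ : Type u) (key' : Λ → K) (deg' : Λ → ℕ),
      (∀ κ n, {a | key' a = κ ∧ deg' a = n}.Finite) ∧
      (∀ κ n, homDim (linExt d) (piece k key deg κ n) (piece k key deg κ (n + 1))
        = {a | key' a = κ ∧ deg' a = n}.ncard) ∧
      ∀ (e : ℕ → k), (∀ n, e (n + 1) = -e n) → (∀ n, e n * e n = 1) →
        ∀ (A : Set (List K)) (i : ℕ), (listPiece key deg A i).Finite →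
          (listPiece key deg A (i + 1)).Finite →
          homDim (der d (fun a => e (deg a))) (Finsupp.supported k k (listPiece key deg A i))
            (Finsupp.supported k k (listPiece key deg A (i + 1)))
          = (listPiece key' deg' A i).ncard := by
  obtain ⟨I, J, ⟨X⟩⟩ := exists_normalForm hd hdd hfin
  refine ⟨X.harm, fun a => X.key' a, fun a => X.deg' a, fun κ n => ?_, fun κ n => ?_,
    fun e he he2 A i h1 h2 => ?_⟩
  · exact (X.finite_piece (hfin κ n)).preimage Subtype.val_injective.injOn
  · rw [X.letter_count hdd hfin,
      ← Set.ncard_image_of_injective {a : X.harm | X.key' a = κ ∧ X.deg' a = n}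
        Subtype.val_injective]
    congr 2
    ext a
    constructor
    · rintro ⟨h, ha⟩
      exact ⟨⟨a, ha⟩, h, rfl⟩
    · rintro ⟨b, hb, rfl⟩
      exact ⟨hb, b.2⟩
  · rw [X.list_count he he2 hdd h1 h2, ← Set.ncard_image_of_injective (listPiece _ _ A i)
      (List.map_injective_iff.2 (Subtype.val_injective (p := (· ∈ X.harm))))]
    congr 2
    ext L
    constructor
    · rintro ⟨h, hL⟩
      lift L to List X.harm using hL
      exact ⟨L, by simpa [listPiece, Function.comp_def] using h, rfl⟩
    · rintro ⟨L, h, rfl⟩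
      refine ⟨by simpa [listPiece, Function.comp_def] using h, ?_⟩
      intro a ha
      obtain ⟨b, -, rfl⟩ := List.mem_map.1 ha
      exact b.2

end HarmonicCount

end MonomialRings

namespace MonomialRings

section Components

variable {t : ℕ}

lemma NCF.symm {a b : Mon (Fin t)} (h : NCF a b) : NCF b a := by
  obtain ⟨i, h1, h2⟩ := h
  exact ⟨i, h2, h1⟩

lemma ncf_self {a : Mon (Fin t)} (h : a ≠ 0) : NCF a a := by
  obtain ⟨i, hi⟩ := Function.ne_iff.1 h
  exact ⟨i, hi, hi⟩

lemma NCF.mono {a b a' b' : Mon (Fin t)} (h : NCF a b) (ha : a ≤ a') (hb : b ≤ b') :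
    NCF a' b' := by
  obtain ⟨i, h1, h2⟩ := h
  exact ⟨i, (lt_of_lt_of_le (Nat.pos_of_ne_zero h1) (ha i)).ne',
    (lt_of_lt_of_le (Nat.pos_of_ne_zero h2) (hb i)).ne'⟩

lemma ncf_of_le {a b : Mon (Fin t)} (h : a ≠ 0) (hb : a ≤ b) : NCF a b :=
  (ncf_self h).mono le_rfl hb

lemma le_mlcm {S : Finset (Mon (Fin t))} {s : Mon (Fin t)} (h : s ∈ S) : s ≤ mlcm S :=
  Finset.le_sup (f := id) h

lemma mlcm_le {S : Finset (Mon (Fin t))} {x : Mon (Fin t)} (h : ∀ s ∈ S, s ≤ x) : mlcm S ≤ x :=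
  Finset.sup_le h

lemma mlcm_mono {S T : Finset (Mon (Fin t))} (h : S ⊆ T) : mlcm S ≤ mlcm T :=
  mlcm_le fun _ hs => le_mlcm (h hs)

lemma mlcm_union (S T : Finset (Mon (Fin t))) : mlcm (S ∪ T) = mlcm S ⊔ mlcm T :=
  Finset.sup_union

lemma mlcm_apply (S : Finset (Mon (Fin t))) (i : Fin t) : mlcm S i = S.sup fun s => s i := by
  simp [mlcm, Finset.sup_apply]

lemma exists_of_ncf_mlcm {S : Finset (Mon (Fin t))} {a : Mon (Fin t)} (h : NCF a (mlcm S)) :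
    ∃ s ∈ S, NCF a s := by
  obtain ⟨i, h1, h2⟩ := h
  by_contra hc
  push Not at hc
  apply h2
  rw [mlcm_apply, ← Nat.le_zero, Finset.sup_le_iff]
  intro s hs
  by_contra h3
  exact hc s hs ⟨i, h1, by omega⟩

lemma ConnIn.refl {S : Finset (Mon (Fin t))} {a : Mon (Fin t)} (h : a ∈ S) : ConnIn S a a :=
  ⟨h, h, .refl⟩

lemma ConnIn.trans {S : Finset (Mon (Fin t))} {a b c : Mon (Fin t)} (h : ConnIn S a b)
    (h' : ConnIn S b c) : ConnIn S a c :=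
  ⟨h.1, h'.2.1, h.2.2.trans h'.2.2⟩

lemma ConnIn.symm {S : Finset (Mon (Fin t))} {a b : Mon (Fin t)} (h : ConnIn S a b) :
    ConnIn S b a :=
  haveI : Std.Symm fun u v => u ∈ S ∧ v ∈ S ∧ mAdj u v :=
    ⟨fun _ _ hxy => ⟨hxy.2.1, hxy.1, hxy.2.2.1.symm, hxy.2.2.2.symm⟩⟩
  ⟨h.2.1, h.1, (Relation.ReflTransGen.stdSymm (r := fun u v => u ∈ S ∧ v ∈ S ∧ mAdj u v)).symm
    _ _ h.2.2⟩

lemma ConnIn.mono {S T : Finset (Mon (Fin t))} {a b : Mon (Fin t)} (h : ConnIn S a b)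
    (hST : S ⊆ T) : ConnIn T a b :=
  ⟨hST h.1, hST h.2.1, Relation.ReflTransGen.mono
    (fun _ _ hxy => ⟨hST hxy.1, hST hxy.2.1, hxy.2.2⟩) _ _ h.2.2⟩

lemma connIn_of_ncf {S : Finset (Mon (Fin t))} {a b : Mon (Fin t)} (ha : a ∈ S) (hb : b ∈ S)
    (h : NCF a b) : ConnIn S a b := by
  by_cases hab : a = b
  · exact hab ▸ .refl ha
  · exact ⟨ha, hb, .single ⟨ha, hb, hab, h⟩⟩

/-- A property stable under common factors propagates along paths. -/
lemma ConnIn.induction {S : Finset (Mon (Fin t))} {a b : Mon (Fin t)} (h : ConnIn S a b)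
    {p : Mon (Fin t) → Prop} (ha : p a) (hp : ∀ u ∈ S, ∀ v ∈ S, NCF u v → p u → p v) : p b := by
  obtain ⟨-, -, h⟩ := h
  induction h with
  | refl => exact ha
  | tail _ h2 ih => exact hp _ h2.1 _ h2.2.1 h2.2.2.2 ih

lemma mem_compOf {S : Finset (Mon (Fin t))} {a b : Mon (Fin t)} :
    b ∈ compOf S a ↔ ConnIn S a b := by
  rw [compOf, Finset.mem_filter, and_iff_right_iff_imp]
  exact fun h => h.2.1

lemma connIn_compOf {S : Finset (Mon (Fin t))} {a b : Mon (Fin t)} (h : ConnIn S a b) :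
    ConnIn (compOf S a) a b := by
  refine (h.induction (p := fun x => ConnIn S a x ∧ ConnIn (compOf S a) a x)
    ⟨.refl h.1, .refl (mem_compOf.2 (.refl h.1))⟩ ?_).2
  rintro u hu v hv huv ⟨h1, h2⟩
  have h3 := h1.trans (connIn_of_ncf hu hv huv)
  exact ⟨h3, h2.trans (connIn_of_ncf (mem_compOf.2 h1) (mem_compOf.2 h3) huv)⟩

lemma isConnected_compOf {S : Finset (Mon (Fin t))} {a : Mon (Fin t)} (h : a ∈ S) :
    IsConnected (compOf S a) :=
  ⟨⟨a, mem_compOf.2 (.refl h)⟩, fun _ hx _ hy =>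
    (connIn_compOf (mem_compOf.1 hx)).symm.trans (connIn_compOf (mem_compOf.1 hy))⟩

lemma compOf_eq {S : Finset (Mon (Fin t))} {a b : Mon (Fin t)} (h : ConnIn S a b) :
    compOf S a = compOf S b := by
  ext x
  rw [mem_compOf, mem_compOf]
  exact ⟨fun hx => h.symm.trans hx, fun hx => h.trans hx⟩

/-- The least common multiples of the connected components. -/
def cl (S : Finset (Mon (Fin t))) : Finset (Mon (Fin t)) := (components S).image mlcm

/-- The elements of `S` dividing `x`. -/
def below (S : Finset (Mon (Fin t))) (x : Mon (Fin t)) : Finset (Mon (Fin t)) :=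
  S.filter (· ≤ x)

lemma mem_below {S : Finset (Mon (Fin t))} {x s : Mon (Fin t)} : s ∈ below S x ↔ s ∈ S ∧ s ≤ x :=
  Finset.mem_filter

lemma below_subset (S : Finset (Mon (Fin t))) (x : Mon (Fin t)) : below S x ⊆ S :=
  Finset.filter_subset _ _

/-- A set of monomials is pairwise coprime. -/
def Coprime (C : Finset (Mon (Fin t))) : Prop := ∀ x ∈ C, ∀ y ∈ C, NCF x y → x = y

/-- `C` is the set of least common multiples of the connected components of `S`. -/
structure Decomp (S C : Finset (Mon (Fin t))) : Prop where
  coprime : Coprime C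
  cover : ∀ s ∈ S, ∃ x ∈ C, s ≤ x
  conn : ∀ x ∈ C, IsConnected (below S x)
  lcm : ∀ x ∈ C, mlcm (below S x) = x

lemma below_mlcm_compOf {S : Finset (Mon (Fin t))} (h0 : 0 ∉ S) {a : Mon (Fin t)} :
    below S (mlcm (compOf S a)) = compOf S a := by
  ext s
  rw [mem_below]
  constructor
  · rintro ⟨h1, h2⟩
    obtain ⟨x, hx, hsx⟩ := exists_of_ncf_mlcm (ncf_of_le (fun h => h0 (h ▸ h1)) h2)
    rw [mem_compOf] at hx ⊢
    exact hx.trans (connIn_of_ncf hx.2.1 h1 hsx.symm)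
  · intro h
    exact ⟨(mem_compOf.1 h).2.1, le_mlcm h⟩

lemma mem_components {S A : Finset (Mon (Fin t))} :
    A ∈ components S ↔ ∃ a ∈ S, compOf S a = A := by
  simp [components]

lemma mem_cl {S : Finset (Mon (Fin t))} {x : Mon (Fin t)} :
    x ∈ cl S ↔ ∃ a ∈ S, mlcm (compOf S a) = x := by
  simp [cl, components]

lemma decomp_cl {S : Finset (Mon (Fin t))} (h0 : 0 ∉ S) : Decomp S (cl S) where
  coprime x hx y hy h := by
    obtain ⟨a, ha, rfl⟩ := mem_cl.1 hx
    obtain ⟨b, hb, rfl⟩ := mem_cl.1 hy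
    obtain ⟨s, hs, h1⟩ := exists_of_ncf_mlcm h
    obtain ⟨r, hr, h2⟩ := exists_of_ncf_mlcm h1.symm
    rw [mem_compOf] at hs hr
    rw [compOf_eq (hr.trans ((connIn_of_ncf hr.2.1 hs.2.1 h2.symm).trans hs.symm))]
  cover s hs := ⟨_, mem_cl.2 ⟨s, hs, rfl⟩, le_mlcm (mem_compOf.2 (.refl hs))⟩
  conn x hx := by
    obtain ⟨a, ha, rfl⟩ := mem_cl.1 hx
    rw [below_mlcm_compOf h0]
    exact isConnected_compOf ha
  lcm x hx := by
    obtain ⟨a, ha, rfl⟩ := mem_cl.1 hx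
    rw [below_mlcm_compOf h0]

namespace Decomp

variable {S C C' T : Finset (Mon (Fin t))}

lemma eq_of_le (h : Decomp S C) (h0 : 0 ∉ S) {x y s : Mon (Fin t)} (hs : s ∈ S) (hx : x ∈ C)
    (hy : y ∈ C) (hsx : s ≤ x) (hsy : s ≤ y) : x = y :=
  h.coprime x hx y hy ((ncf_self fun hs0 => h0 (hs0 ▸ hs)).mono hsx hsy)

/-- A connected subset lies below one element of the decomposition. -/
lemma exists_le_of_connected (h : Decomp S C) {U : Finset (Mon (Fin t))} (hU : IsConnected U)
    (hUS : ∀ u ∈ U, ∃ x ∈ C, u ≤ x) : ∃ x ∈ C, ∀ u ∈ U, u ≤ x := by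
  obtain ⟨a, ha⟩ := hU.1
  obtain ⟨x, hx, hax⟩ := hUS a ha
  refine ⟨x, hx, fun u hu => (hU.2 a ha u hu).induction (p := fun u => u ≤ x) hax ?_⟩
  intro u _ v hv huv hux
  obtain ⟨y, hy, hvy⟩ := hUS v hv
  rwa [h.coprime x hx y hy (huv.mono hux hvy)]

lemma subset (h : Decomp S C) (h0 : 0 ∉ S) (h' : Decomp S C') : C ⊆ C' := by
  intro x hx
  obtain ⟨y, hy, hxy⟩ := h'.exists_le_of_connected (h.conn x hx)
    (fun u hu => h'.cover u (below_subset _ _ hu))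
  obtain ⟨z, hz, hyz⟩ := h.exists_le_of_connected (h'.conn y hy)
    (fun u hu => h.cover u (below_subset _ _ hu))
  obtain ⟨s, hs⟩ := (h.conn x hx).1
  have hs' := mem_below.1 hs
  have hzx : z = x := h.eq_of_le h0 hs'.1 hz hx (hyz s (mem_below.2 ⟨hs'.1, hxy s hs⟩)) hs'.2
  have : x = y := by
    apply le_antisymm
    · rw [← h.lcm x hx]
      exact mlcm_le hxy
    · rw [← h'.lcm y hy, ← hzx]
      exact mlcm_le hyz
  rwa [this]

lemma eq_cl (h : Decomp S C) (h0 : 0 ∉ S) : cl S = C :=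
  ((decomp_cl h0).subset h0 h).antisymm (h.subset h0 (decomp_cl h0))

lemma sup_eq (h : Decomp S C) : mlcm S = mlcm C := by
  apply le_antisymm
  · refine mlcm_le fun s hs => ?_
    obtain ⟨x, hx, hsx⟩ := h.cover s hs
    exact hsx.trans (le_mlcm hx)
  · refine mlcm_le fun x hx => ?_
    rw [← h.lcm x hx]
    exact mlcm_mono (below_subset _ _)

end Decomp

lemma Coprime.sum_eq {C : Finset (Mon (Fin t))} (h : Coprime C) : ∑ x ∈ C, x = mlcm C := by
  induction C using Finset.induction_on with
  | empty => rfl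
  | insert a C ha ih =>
    have hC : Coprime C := fun x hx y hy =>
      h x (Finset.mem_insert_of_mem hx) y (Finset.mem_insert_of_mem hy)
    rw [Finset.sum_insert ha, ih hC, Finset.insert_eq, mlcm_union]
    have : mlcm {a} = a := by simp [mlcm]
    rw [this]
    funext i
    have : a i = 0 ∨ mlcm C i = 0 := by
      by_contra hc
      push Not at hc
      obtain ⟨s, hs, h1⟩ := exists_of_ncf_mlcm (a := a) (S := C) ⟨i, hc⟩
      exact ha ((h a (Finset.mem_insert_self _ _) s (Finset.mem_insert_of_mem hs) h1) ▸ hs)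
    simp only [Pi.add_apply, Pi.sup_apply]
    omega

lemma mdeg_add (a b : Mon (Fin t)) : mdeg (a + b) = mdeg a + mdeg b := by
  simp [mdeg, Finset.sum_add_distrib]

lemma mdeg_zero : mdeg (0 : Mon (Fin t)) = 0 := by simp [mdeg]

lemma mdeg_sum {ι : Type*} (s : Finset ι) (f : ι → Mon (Fin t)) :
    mdeg (∑ i ∈ s, f i) = ∑ i ∈ s, mdeg (f i) := by
  induction s using Finset.induction_on with
  | empty => simp [mdeg_zero]
  | insert a s ha ih => rw [Finset.sum_insert ha, Finset.sum_insert ha, mdeg_add, ih]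

lemma mdeg_mono {a b : Mon (Fin t)} (h : a ≤ b) : mdeg a ≤ mdeg b :=
  Finset.sum_le_sum fun i _ => h i

lemma eq_of_mdeg_le {a b : Mon (Fin t)} (h : a ≤ b) (h' : mdeg b ≤ mdeg a) : a = b := by
  funext i
  exact (Finset.sum_eq_sum_iff_of_le (fun i _ => h i)).1 (le_antisymm (mdeg_mono h) h') i
    (Finset.mem_univ i)

lemma ncomp_eq_card_cl {S : Finset (Mon (Fin t))} (h0 : 0 ∉ S) : ncomp S = (cl S).card := by
  rw [cl, ncomp, Finset.card_image_of_injOn]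
  intro A hA B hB hAB
  obtain ⟨a, ha, rfl⟩ := mem_components.1 (Finset.mem_coe.1 hA)
  obtain ⟨b, hb, rfl⟩ := mem_components.1 (Finset.mem_coe.1 hB)
  have hAB' : mlcm (compOf S a) = mlcm (compOf S b) := hAB
  exact (below_mlcm_compOf h0).symm.trans (hAB' ▸ below_mlcm_compOf h0)

/-- Refining a coprime set of monomials of degree at least two strictly lowers `∑ (r|x| - 1)`. -/
lemma refine_lt {C C' : Finset (Mon (Fin t))} (hC' : Coprime C')
    (h2 : ∀ x ∈ C, 2 ≤ mdeg x) (h2' : ∀ x ∈ C', 2 ≤ mdeg x)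
    (href : ∀ y ∈ C', ∃ x ∈ C, y ≤ x) (hne : C' ≠ C) {r : ℤ} (hr : 1 ≤ r) :
    ∑ y ∈ C', (r * mdeg y - 1) < ∑ x ∈ C, (r * mdeg x - 1) := by
  have hnz : ∀ x ∈ C', x ≠ 0 := by
    rintro x hx rfl
    have := h2' 0 hx
    rw [mdeg_zero] at this
    omega
  choose! f hfC hf using href
  have hfib : ∀ x ∈ C, mdeg (∑ y ∈ C' with f y = x, y) ≤ mdeg x := by
    intro x hx
    apply mdeg_mono
    rw [Coprime.sum_eq fun a ha b hb => hC' a (Finset.mem_filter.1 ha).1 b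
        (Finset.mem_filter.1 hb).1]
    refine mlcm_le fun y hy => ?_
    rw [Finset.mem_filter] at hy
    exact hy.2 ▸ hf y hy.1
  have key : ∀ x ∈ C, ∑ y ∈ C' with f y = x, (r * (mdeg y : ℤ) - 1) ≤ r * mdeg x - 1 ∧
      (r * (mdeg x : ℤ) - 1 ≤ ∑ y ∈ C' with f y = x, (r * (mdeg y : ℤ) - 1) →
        {y ∈ C' | f y = x} = {x}) := by
    intro x hx
    have h3 := hfib x hx
    rw [mdeg_sum] at h3
    have h4 : ∑ y ∈ C' with f y = x, (r * (mdeg y : ℤ) - 1)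
        = r * ((∑ y ∈ C' with f y = x, mdeg y : ℕ) : ℤ) - ({y ∈ C' | f y = x}).card := by
      rw [Finset.sum_sub_distrib, ← Finset.mul_sum]
      simp
    have hx2 : (2 : ℤ) ≤ mdeg x := by exact_mod_cast h2 x hx
    have h3' : ((∑ y ∈ C' with f y = x, mdeg y : ℕ) : ℤ) ≤ mdeg x := by exact_mod_cast h3
    have h5 : r * ((∑ y ∈ C' with f y = x, mdeg y : ℕ) : ℤ) ≤ r * mdeg x :=
      mul_le_mul_of_nonneg_left h3' (by omega)
    rw [h4]
    rcases Nat.eq_zero_or_pos ({y ∈ C' | f y = x}).card with h6 | h6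
    · rw [Finset.card_eq_zero] at h6
      rw [h6]
      simp only [Finset.sum_empty, Finset.card_empty, Nat.cast_zero, mul_zero, sub_zero]
      constructor
      · nlinarith
      · intro h7
        nlinarith
    · refine ⟨by omega, fun h7 => ?_⟩
      have h8 : ({y ∈ C' | f y = x}).card = 1 := by omega
      obtain ⟨y, hy⟩ := Finset.card_eq_one.1 h8
      rw [hy] at h7 ⊢
      have hy' : y ∈ ({y ∈ C' | f y = x}) := by rw [hy]; simp
      rw [Finset.mem_filter] at hy'
      simp only [Finset.sum_singleton, Finset.card_singleton, Nat.cast_one] at h7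
      have h9 : (mdeg x : ℤ) ≤ mdeg y := by
        by_contra h10
        push Not at h10
        nlinarith
      rw [eq_of_mdeg_le (hy'.2 ▸ hf y hy'.1 : y ≤ x) (by exact_mod_cast h9)]
  have hsum := Finset.sum_fiberwise_of_maps_to hfC (fun y => r * (mdeg y : ℤ) - 1)
  rw [← hsum]
  refine lt_of_le_of_ne (Finset.sum_le_sum fun x hx => (key x hx).1) fun heq => hne ?_
  have h6 := (Finset.sum_eq_sum_iff_of_le fun x hx => (key x hx).1).1 heq
  ext y
  constructor
  · intro hy
    have := (key (f y) (hfC y hy)).2 (h6 _ (hfC y hy)).ge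
    have h7 : y ∈ ({z ∈ C' | f z = f y}) := by simp [hy]
    rw [this, Finset.mem_singleton] at h7
    rw [h7]
    exact hfC y hy
  · intro hy
    have := (key y hy).2 (h6 _ hy).ge
    have h7 : y ∈ ({z ∈ C' | f z = y}) := by rw [this]; simp
    exact (Finset.mem_filter.1 h7).1

end Components

end MonomialRings

namespace MonomialRings

lemma card_add_card_le {A A' B E : Type*} [Fintype A] [Fintype A'] [Fintype B] [Fintype E]
    (a : E → A) (a' : E → A') (p : B → A ⊕ A')
    (h : ∀ w : A ⊕ A' → ℚ, (∀ e, w (.inl (a e)) = w (.inr (a' e))) → (∀ b, w (p b) = 0) → w = 0) :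
    Fintype.card A + Fintype.card A' ≤ Fintype.card B + Fintype.card E := by
  let F : (A ⊕ A' → ℚ) →ₗ[ℚ] (B → ℚ) × (E → ℚ) :=
    { toFun := fun w => (fun b => w (p b), fun e => w (.inl (a e)) - w (.inr (a' e)))
      map_add' := fun w w' => by
        ext x <;> simp
        ring
      map_smul' := fun c w => by
        ext x <;> simp
        ring }
  have hF : Function.Injective F := by
    rw [← LinearMap.ker_eq_bot, LinearMap.ker_eq_bot']
    intro w hw
    rw [Prod.ext_iff] at hw
    exact h w (fun e => sub_eq_zero.1 (congrFun hw.2 e)) (fun b => congrFun hw.1 b)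
  have := LinearMap.finrank_le_finrank_of_injective hF
  simpa using this

section Combine

variable {t : ℕ}

lemma zero_notMem_of_subset {S T : Finset (Mon (Fin t))} (h0 : 0 ∉ S) (h : T ⊆ S) : 0 ∉ T :=
  fun h' => h0 (h h')

lemma zero_notMem_union {S T : Finset (Mon (Fin t))} (h0 : 0 ∉ S) (h : 0 ∉ T) : 0 ∉ S ∪ T := by
  rw [Finset.mem_union]
  tauto

/-- Variables dividing both monomials. -/
def shared (a b : Mon (Fin t)) : Finset (Fin t) := Finset.univ.filter fun i => a i ≠ 0 ∧ b i ≠ 0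

lemma mem_shared {a b : Mon (Fin t)} {i : Fin t} : i ∈ shared a b ↔ a i ≠ 0 ∧ b i ≠ 0 := by
  simp [shared]

lemma exists_mem_cl_apply_ne {S : Finset (Mon (Fin t))} (h0 : 0 ∉ S) {i : Fin t}
    (h : mlcm S i ≠ 0) : ∃ x ∈ cl S, x i ≠ 0 := by
  by_contra hc
  push Not at hc
  apply h
  rw [(decomp_cl h0).sup_eq, mlcm_apply, ← Nat.le_zero, Finset.sup_le_iff]
  exact fun x hx => (hc x hx).le

lemma le_mlcm_of_mem_cl {S : Finset (Mon (Fin t))} (h0 : 0 ∉ S) {x : Mon (Fin t)}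
    (h : x ∈ cl S) : x ≤ mlcm S := by
  rw [(decomp_cl h0).sup_eq]
  exact le_mlcm h

lemma mem_shared_of_mem_cl {S S' : Finset (Mon (Fin t))} (h0 : 0 ∉ S) (h0' : 0 ∉ S')
    {x y : Mon (Fin t)} (hx : x ∈ cl S) (hy : y ∈ cl S') {i : Fin t} (hxi : x i ≠ 0)
    (hyi : y i ≠ 0) : i ∈ shared (mlcm S) (mlcm S') :=
  mem_shared.2 ⟨(lt_of_lt_of_le (Nat.pos_of_ne_zero hxi) (le_mlcm_of_mem_cl h0 hx i)).ne',
    (lt_of_lt_of_le (Nat.pos_of_ne_zero hyi) (le_mlcm_of_mem_cl h0' hy i)).ne'⟩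

theorem card_cl_add_card_cl_le {S S' : Finset (Mon (Fin t))} (h0 : 0 ∉ S) (h0' : 0 ∉ S') :
    (cl S).card + (cl S').card
      ≤ (cl (S ∪ S')).card + (shared (mlcm S) (mlcm S')).card := by
  have hD := decomp_cl h0
  have hD' := decomp_cl h0'
  have hU := decomp_cl (zero_notMem_union h0 h0')
  have hA : ∀ i : shared (mlcm S) (mlcm S'), ∃ x : cl S, x.1 i.1 ≠ 0 := fun i => by
    obtain ⟨x, hx, hi⟩ := exists_mem_cl_apply_ne h0 (mem_shared.1 i.2).1
    exact ⟨⟨x, hx⟩, hi⟩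
  have hA' : ∀ i : shared (mlcm S) (mlcm S'), ∃ x : cl S', x.1 i.1 ≠ 0 := fun i => by
    obtain ⟨x, hx, hi⟩ := exists_mem_cl_apply_ne h0' (mem_shared.1 i.2).2
    exact ⟨⟨x, hx⟩, hi⟩
  choose a ha using hA
  choose a' ha' using hA'
  let P : Mon (Fin t) → cl S ⊕ cl S' → Prop := fun s x =>
    Sum.elim (fun x => s ∈ S ∧ s ≤ x.1) (fun x => s ∈ S' ∧ s ≤ x.1) x
  have hp : ∀ b : cl (S ∪ S'), ∃ q : cl S ⊕ cl S', ∃ s, (s ∈ S ∪ S' ∧ s ≤ b.1) ∧ P s q :=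
      fun b => by
    obtain ⟨s, hs⟩ := (hU.conn b.1 b.2).1
    rw [mem_below] at hs
    rcases Finset.mem_union.1 hs.1 with h | h
    · obtain ⟨x, hx, hsx⟩ := hD.cover s h
      exact ⟨.inl ⟨x, hx⟩, s, hs, h, hsx⟩
    · obtain ⟨x, hx, hsx⟩ := hD'.cover s h
      exact ⟨.inr ⟨x, hx⟩, s, hs, h, hsx⟩
  choose p hp using hp
  have := card_add_card_le a a' p ?_
  · simpa using this
  intro w hw hwp
  have hmix : ∀ (x : cl S) (y : cl S'), NCF x.1 y.1 → w (.inl x) = w (.inr y) := by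
    rintro x y ⟨i, hi, hi'⟩
    let e : shared (mlcm S) (mlcm S') := ⟨i, mem_shared_of_mem_cl h0 h0' x.2 y.2 hi hi'⟩
    have h1 : a e = x := Subtype.ext (hD.coprime _ (a e).2 _ x.2 ⟨i, ha e, hi⟩)
    have h2 : a' e = y := Subtype.ext (hD'.coprime _ (a' e).2 _ y.2 ⟨i, ha' e, hi'⟩)
    rw [← h1, ← h2, hw]
  have hstep : ∀ u v q r, NCF u v → P u q → P v r → w q = 0 → w r = 0 := by
    rintro u v (q | q) (r | r) huv ⟨-, hq⟩ ⟨-, hr⟩ h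
    · rwa [← show q = r from Subtype.ext (hD.coprime _ q.2 _ r.2 (huv.mono hq hr))]
    · rwa [← hmix q r (huv.mono hq hr)]
    · rwa [hmix r q (huv.mono hq hr).symm]
    · rwa [← show q = r from Subtype.ext (hD'.coprime _ q.2 _ r.2 (huv.mono hq hr))]
  have hex : ∀ s ∈ S ∪ S', ∃ q, P s q := fun s hs => by
    rcases Finset.mem_union.1 hs with h | h
    · obtain ⟨x, hx, hsx⟩ := hD.cover s h
      exact ⟨.inl ⟨x, hx⟩, h, hsx⟩
    · obtain ⟨x, hx, hsx⟩ := hD'.cover s h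
      exact ⟨.inr ⟨x, hx⟩, h, hsx⟩
  have hall : ∀ s ∈ S ∪ S', ∃ q, P s q ∧ w q = 0 := fun s hs => by
    obtain ⟨b, hb, hsb⟩ := hU.cover s hs
    obtain ⟨r, hr, hP⟩ := hp ⟨b, hb⟩
    refine ((hU.conn b hb).2 r (mem_below.2 hr) s (mem_below.2 ⟨hs, hsb⟩)).induction
      (p := fun u => ∃ q, P u q ∧ w q = 0) ⟨_, hP, hwp _⟩ ?_
    rintro u - v hv huv ⟨q, hq, hwq⟩
    obtain ⟨r, hr⟩ := hex v (mem_below.1 hv).1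
    exact ⟨r, hr, hstep u v q r huv hq hr hwq⟩
  have hself : ∀ s ∈ S ∪ S', NCF s s := fun s hs =>
    ncf_self fun h => zero_notMem_union h0 h0' (h ▸ hs)
  funext q
  rcases q with x | x
  · obtain ⟨s, hs⟩ := (hD.conn x.1 x.2).1
    have hsU := Finset.mem_union_left S' (mem_below.1 hs).1
    obtain ⟨q, hq, hwq⟩ := hall s hsU
    exact hstep s s q (.inl x) (hself s hsU) hq (mem_below.1 hs) hwq
  · obtain ⟨s, hs⟩ := (hD'.conn x.1 x.2).1
    have hsU := Finset.mem_union_right S (mem_below.1 hs).1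
    obtain ⟨q, hq, hwq⟩ := hall s hsU
    exact hstep s s q (.inr x) (hself s hsU) hq (mem_below.1 hs) hwq

lemma mdeg_add_mdeg_mlcm (a b : Mon (Fin t)) :
    mdeg (a ⊔ b) + mdeg (a ⊓ b) = mdeg a + mdeg b := by
  rw [← mdeg_add, ← mdeg_add]
  congr 1
  funext i
  simp only [Pi.add_apply, Pi.sup_apply, Pi.inf_apply]
  omega

lemma card_shared_le (a b : Mon (Fin t)) : (shared a b).card ≤ mdeg (a ⊓ b) := by
  rw [Finset.card_eq_sum_ones, mdeg]
  refine (Finset.sum_le_sum fun i hi => ?_).trans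
    (Finset.sum_le_univ_sum_of_nonneg fun _ => by simp)
  have := mem_shared.1 hi
  simp only [Pi.inf_apply]
  omega

lemma mdeg_inf_pos {a b : Mon (Fin t)} (h : NCF a b) : 0 < mdeg (a ⊓ b) := by
  obtain ⟨i, h1, h2⟩ := h
  exact (Finset.card_pos.2 ⟨i, mem_shared.2 ⟨h1, h2⟩⟩).trans_le (card_shared_le a b)

/-- Refinement of the component monomials under inclusion. -/
lemma cl_refine {S T : Finset (Mon (Fin t))} (h0 : 0 ∉ S) (h : T ⊆ S) :
    ∀ y ∈ cl T, ∃ x ∈ cl S, y ≤ x := by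
  intro y hy
  have hD := decomp_cl (zero_notMem_of_subset h0 h)
  obtain ⟨x, hx, hyx⟩ := (decomp_cl h0).exists_le_of_connected (hD.conn y hy)
    fun u hu => (decomp_cl h0).cover u (h (below_subset _ _ hu))
  refine ⟨x, hx, ?_⟩
  rw [← hD.lcm y hy]
  exact mlcm_le hyx

lemma sum_cl {S : Finset (Mon (Fin t))} (h0 : 0 ∉ S) : ∑ x ∈ cl S, x = mlcm S := by
  rw [(decomp_cl h0).coprime.sum_eq, (decomp_cl h0).sup_eq]

lemma two_le_mdeg_of_mem_cl {S : Finset (Mon (Fin t))} (h0 : 0 ∉ S) (h2 : ∀ s ∈ S, 2 ≤ mdeg s)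
    {x : Mon (Fin t)} (hx : x ∈ cl S) : 2 ≤ mdeg x := by
  obtain ⟨s, hs⟩ := ((decomp_cl h0).conn x hx).1
  rw [mem_below] at hs
  exact (h2 s hs.1).trans (mdeg_mono hs.2)

lemma zero_notMem_of_two_le {S : Finset (Mon (Fin t))} (h2 : ∀ s ∈ S, 2 ≤ mdeg s) : 0 ∉ S :=
  fun h => by
    have := h2 0 h
    rw [mdeg_zero] at this
    omega

lemma sum_cl_sub {S : Finset (Mon (Fin t))} (h0 : 0 ∉ S) (r : ℤ) :
    ∑ x ∈ cl S, (r * mdeg x - 1) = r * mdeg (mlcm S) - (cl S).card := by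
  rw [Finset.sum_sub_distrib, ← Finset.mul_sum, ← sum_cl h0, mdeg_sum]
  simp

lemma cl_lt {S T : Finset (Mon (Fin t))} (h2 : ∀ s ∈ S, 2 ≤ mdeg s) (h : T ⊆ S)
    (hne : cl T ≠ cl S) {r : ℤ} (hr : 1 ≤ r) :
    r * mdeg (mlcm T) - (cl T).card < r * mdeg (mlcm S) - (cl S).card := by
  have h0 := zero_notMem_of_two_le h2
  have h0' := zero_notMem_of_subset h0 h
  rw [← sum_cl_sub h0, ← sum_cl_sub h0']
  exact refine_lt (decomp_cl h0').coprime (fun x => two_le_mdeg_of_mem_cl h0 h2)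
    (fun x => two_le_mdeg_of_mem_cl h0' fun s hs => h2 s (h hs)) (cl_refine h0 h) hne hr

lemma cl_union {S S' : Finset (Mon (Fin t))} (h0 : 0 ∉ S) (h0' : 0 ∉ S')
    (h : ¬ NCF (mlcm S) (mlcm S')) : cl (S ∪ S') = cl S ∪ cl S' := by
  have key : ∀ (A B : Finset (Mon (Fin t))), 0 ∉ B → ¬ NCF (mlcm A) (mlcm B) →
      ∀ x ≤ mlcm A, below (A ∪ B) x = below A x := by
    intro A B hB hAB x hx
    ext s
    rw [mem_below, mem_below, Finset.mem_union]
    refine ⟨?_, fun hs => ⟨.inl hs.1, hs.2⟩⟩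
    rintro ⟨hs | hs, hsx⟩
    · exact ⟨hs, hsx⟩
    · exact absurd ((ncf_self fun h0 => hB (h0 ▸ hs)).mono (hsx.trans hx) (le_mlcm hs)) hAB
  refine Decomp.eq_cl ⟨?_, ?_, ?_, ?_⟩ (zero_notMem_union h0 h0')
  · intro x hx y hy hxy
    rcases Finset.mem_union.1 hx with hx | hx <;> rcases Finset.mem_union.1 hy with hy | hy
    · exact (decomp_cl h0).coprime x hx y hy hxy
    · exact absurd (hxy.mono (le_mlcm_of_mem_cl h0 hx) (le_mlcm_of_mem_cl h0' hy)) h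
    · exact absurd (hxy.symm.mono (le_mlcm_of_mem_cl h0 hy) (le_mlcm_of_mem_cl h0' hx)) h
    · exact (decomp_cl h0').coprime x hx y hy hxy
  · intro s hs
    rcases Finset.mem_union.1 hs with hs | hs
    · obtain ⟨x, hx, hsx⟩ := (decomp_cl h0).cover s hs
      exact ⟨x, Finset.mem_union_left _ hx, hsx⟩
    · obtain ⟨x, hx, hsx⟩ := (decomp_cl h0').cover s hs
      exact ⟨x, Finset.mem_union_right _ hx, hsx⟩
  all_goals
    intro x hx
    rcases Finset.mem_union.1 hx with hx | hx
    · rw [key S S' h0' h x (le_mlcm_of_mem_cl h0 hx)]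
      first
        | exact (decomp_cl h0).conn x hx
        | exact (decomp_cl h0).lcm x hx
    · rw [Finset.union_comm, key S' S h0 (fun h' => h h'.symm) x (le_mlcm_of_mem_cl h0' hx)]
      first
        | exact (decomp_cl h0').conn x hx
        | exact (decomp_cl h0').lcm x hx

lemma cl_below {S : Finset (Mon (Fin t))} (h0 : 0 ∉ S) {x : Mon (Fin t)} (hx : x ∈ cl S) :
    cl (below S x) = {x} := by
  have hb : below (below S x) x = below S x := by
    ext s
    simp only [mem_below]
    tauto
  refine Decomp.eq_cl ⟨?_, ?_, ?_, ?_⟩ (zero_notMem_of_subset h0 (below_subset _ _))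
  · intro y hy z hz _
    rw [Finset.mem_singleton.1 hy, Finset.mem_singleton.1 hz]
  · exact fun s hs => ⟨x, Finset.mem_singleton_self x, (mem_below.1 hs).2⟩
  · intro y hy
    rw [Finset.mem_singleton.1 hy, hb]
    exact (decomp_cl h0).conn x hx
  · intro y hy
    rw [Finset.mem_singleton.1 hy, hb]
    exact (decomp_cl h0).lcm x hx

lemma cl_sdiff_below {S : Finset (Mon (Fin t))} (h0 : 0 ∉ S) {x : Mon (Fin t)} (hx : x ∈ cl S) :
    cl (S \ below S x) = (cl S).erase x := by
  have hD := decomp_cl h0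
  have hb : ∀ y ∈ (cl S).erase x, below (S \ below S x) y = below S y := by
    intro y hy
    rw [Finset.mem_erase] at hy
    ext s
    simp only [mem_below, Finset.mem_sdiff]
    refine ⟨fun h => ⟨h.1.1, h.2⟩, fun h => ⟨⟨h.1, fun h' => ?_⟩, h.2⟩⟩
    exact hy.1 (hD.eq_of_le h0 h.1 hy.2 hx h.2 h'.2)
  refine Decomp.eq_cl ⟨?_, ?_, ?_, ?_⟩ (zero_notMem_of_subset h0 Finset.sdiff_subset)
  · exact fun y hy z hz => hD.coprime y (Finset.mem_of_mem_erase hy) z (Finset.mem_of_mem_erase hz)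
  · intro s hs
    rw [Finset.mem_sdiff] at hs
    obtain ⟨y, hy, hsy⟩ := hD.cover s hs.1
    refine ⟨y, Finset.mem_erase.2 ⟨?_, hy⟩, hsy⟩
    rintro rfl
    exact hs.2 (mem_below.2 ⟨hs.1, hsy⟩)
  · intro y hy
    rw [hb y hy]
    exact hD.conn y (Finset.mem_of_mem_erase hy)
  · intro y hy
    rw [hb y hy]
    exact hD.lcm y (Finset.mem_of_mem_erase hy)

lemma cl_empty : cl (∅ : Finset (Mon (Fin t))) = ∅ := by simp [cl, components]

lemma cl_eq_empty {S : Finset (Mon (Fin t))} : cl S = ∅ ↔ S = ∅ := by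
  simp [cl, components]

/-- The elements of `M` dividing one of the component monomials. -/
def clOf (M C : Finset (Mon (Fin t))) : Finset (Mon (Fin t)) := M.filter fun m => ∃ x ∈ C, m ≤ x

lemma mem_clOf {M C : Finset (Mon (Fin t))} {m : Mon (Fin t)} :
    m ∈ clOf M C ↔ m ∈ M ∧ ∃ x ∈ C, m ≤ x := Finset.mem_filter

lemma subset_clOf {M S : Finset (Mon (Fin t))} (h0 : 0 ∉ S) (h : S ⊆ M) : S ⊆ clOf M (cl S) :=
  fun s hs => mem_clOf.2 ⟨h hs, (decomp_cl h0).cover s hs⟩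

lemma cl_clOf {M S : Finset (Mon (Fin t))} (h0 : 0 ∉ M) (h : S ⊆ M) :
    cl (clOf M (cl S)) = cl S := by
  have hS := zero_notMem_of_subset h0 h
  have hD := decomp_cl hS
  refine Decomp.eq_cl ⟨hD.coprime, fun s hs => (mem_clOf.1 hs).2, ?_, ?_⟩
    (zero_notMem_of_subset h0 (Finset.filter_subset _ _))
  · intro x hx
    have hsub : below S x ⊆ below (clOf M (cl S)) x := fun s hs =>
      mem_below.2 ⟨subset_clOf hS h (mem_below.1 hs).1, (mem_below.1 hs).2⟩
    have hreach : ∀ m ∈ below (clOf M (cl S)) x, ∃ s ∈ below S x,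
        ConnIn (below (clOf M (cl S)) x) m s := by
      intro m hm
      have hm' := mem_below.1 hm
      have hm0 : m ≠ 0 := fun h' => h0 (h' ▸ (mem_clOf.1 hm'.1).1)
      have : NCF m (mlcm (below S x)) := by
        rw [hD.lcm x hx]
        exact ncf_of_le hm0 hm'.2
      obtain ⟨s, hs, hms⟩ := exists_of_ncf_mlcm this
      exact ⟨s, hs, connIn_of_ncf hm (hsub hs) hms⟩
    refine ⟨(hD.conn x hx).1.mono hsub, fun a ha b hb => ?_⟩
    obtain ⟨s, hs, h1⟩ := hreach a ha
    obtain ⟨r, hr, h2⟩ := hreach b hb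
    exact h1.trans ((((hD.conn x hx).2 s hs r hr).mono hsub).trans h2.symm)
  · intro x hx
    apply le_antisymm
    · exact mlcm_le fun s hs => (mem_below.1 hs).2
    · conv_lhs => rw [← hD.lcm x hx]
      exact mlcm_mono fun s hs =>
        mem_below.2 ⟨subset_clOf hS h (mem_below.1 hs).1, (mem_below.1 hs).2⟩

lemma clOf_mem_satSets {M S : Finset (Mon (Fin t))} (h0 : 0 ∉ M) (h : S ⊆ M) (hne : S.Nonempty) :
    clOf M (cl S) ∈ satSets M := by
  have hS := zero_notMem_of_subset h0 h
  have hsub : clOf M (cl S) ⊆ M := Finset.filter_subset _ _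
  rw [satSets, Finset.mem_filter, Finset.mem_powerset]
  refine ⟨hsub, hne.mono (subset_clOf hS h), hsub, fun m hm T hT hTc hmT => ?_⟩
  obtain ⟨x, hx, hTx⟩ := (decomp_cl hS).exists_le_of_connected hTc
    fun u hu => (mem_clOf.1 (hT hu)).2
  exact mem_clOf.2 ⟨hm, x, hx, hmT.trans (mlcm_le hTx)⟩

lemma clOf_cl_of_mem_satSets {M S : Finset (Mon (Fin t))} (h0 : 0 ∉ M) (h : S ∈ satSets M) :
    clOf M (cl S) = S := by
  rw [satSets, Finset.mem_filter, Finset.mem_powerset] at h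
  obtain ⟨hSM, -, -, hsat⟩ := h
  have hS := zero_notMem_of_subset h0 hSM
  refine Finset.Subset.antisymm (fun m hm => ?_) (subset_clOf hS hSM)
  obtain ⟨hmM, x, hx, hmx⟩ := mem_clOf.1 hm
  refine hsat m hmM (below S x) (below_subset _ _) ((decomp_cl hS).conn x hx) ?_
  rwa [(decomp_cl hS).lcm x hx]

lemma inter_compOf {S T : Finset (Mon (Fin t))} (hT : T ⊆ S) (h0 : 0 ∉ S) {a : Mon (Fin t)} :
    compOf S a ∩ T = below T (mlcm (compOf S a)) := by
  ext s
  rw [← below_mlcm_compOf h0, Finset.mem_inter, mem_below, mem_below, below_mlcm_compOf h0]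
  constructor
  · rintro ⟨⟨-, h⟩, h'⟩
    exact ⟨h', h⟩
  · rintro ⟨h, h'⟩
    exact ⟨⟨hT h, h'⟩, h⟩

lemma notMem_dprime_iff {S T : Finset (Mon (Fin t))} (h0 : 0 ∉ S) (hT : T ⊆ S) :
    T ∉ dprime S ↔ cl T = cl S := by
  have h0T := zero_notMem_of_subset h0 hT
  have hDS := decomp_cl h0
  have key : T ∉ dprime S ↔ mlcm T = mlcm S ∧ ∀ C ∈ components S, IsConnected (C ∩ T) := by
    rw [dprime]
    simp only [Set.mem_ofPred, hT, true_and, not_or, not_not, not_exists, not_and]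
    congr!
  rw [key]
  constructor
  · rintro ⟨hm, hC⟩
    refine Decomp.eq_cl ⟨hDS.coprime, fun s hs => hDS.cover s (hT hs), ?_, ?_⟩ h0T
    · intro x hx
      obtain ⟨a, ha, rfl⟩ := mem_cl.1 hx
      rw [← inter_compOf hT h0]
      exact hC _ (mem_components.2 ⟨a, ha, rfl⟩)
    · intro x hx
      apply le_antisymm (mlcm_le fun s hs => (mem_below.1 hs).2)
      intro i
      by_cases hi : x i = 0
      · rw [hi]
        exact Nat.zero_le _
      have h1 : x i ≤ T.sup fun s => s i := by
        rw [← mlcm_apply, hm]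
        exact le_mlcm_of_mem_cl h0 hx i
      have hTne : T.Nonempty := by
        rw [Finset.nonempty_iff_ne_empty]
        rintro rfl
        simp at h1
        exact hi h1
      obtain ⟨s, hs, hsi⟩ := Finset.exists_mem_eq_sup T hTne fun s => s i
      replace h1 : x i ≤ s i := h1.trans hsi.le
      obtain ⟨y, hy, hsy⟩ := hDS.cover s (hT hs)
      have hyx : y = x := hDS.coprime y hy x hx
        ⟨i, by have h3 : s i ≤ y i := hsy i; omega, hi⟩
      exact h1.trans (le_mlcm (S := below T x) (mem_below.2 ⟨hs, hyx ▸ hsy⟩) i)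
  · intro h
    have hDT := decomp_cl h0T
    refine ⟨by rw [hDT.sup_eq, hDS.sup_eq, h], fun C hC => ?_⟩
    obtain ⟨a, ha, rfl⟩ := mem_components.1 hC
    rw [inter_compOf hT h0]
    apply hDT.conn
    rw [h]
    exact mem_cl.2 ⟨a, ha, rfl⟩

end Combine

end MonomialRings

namespace MonomialRings

section Signs

variable {V : Type*}

/-- Removal of an element from a finite set. -/
def eraseV (F : Finset V) (s : V) : Finset V := F.erase s

lemma mem_eraseV {F : Finset V} {s x : V} : x ∈ eraseV F s ↔ x ≠ s ∧ x ∈ F := Finset.mem_erase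

lemma card_eraseV {F : Finset V} {s : V} (h : s ∈ F) : (eraseV F s).card + 1 = F.card :=
  Finset.card_erase_add_one h

lemma eraseV_subset (F : Finset V) (s : V) : eraseV F s ⊆ F := Finset.erase_subset _ _

/-- The number of elements of `F` above `x`. -/
def upIn (F : Finset V) (x : V) : ℕ := (F.filter fun y => (vOrd V).lt x y).card

/-- The number of inversions between two finite sets. -/
def inversions (S T : Finset V) : ℕ := ∑ a ∈ S, rankIn T a

lemma vOrd_lt_trichotomy (x y : V) :
    (vOrd V).lt x y ∧ x ≠ y ∧ ¬ (vOrd V).lt y x ∨ ¬ (vOrd V).lt x y ∧ x = y ∧ ¬ (vOrd V).lt y x ∨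
      ¬ (vOrd V).lt x y ∧ x ≠ y ∧ (vOrd V).lt y x := by
  let := vOrd V
  change x < y ∧ x ≠ y ∧ ¬ y < x ∨ ¬ x < y ∧ x = y ∧ ¬ y < x ∨ ¬ x < y ∧ x ≠ y ∧ y < x
  rcases lt_trichotomy x y with h | h | h
  · exact .inl ⟨h, h.ne, h.not_gt⟩
  · exact .inr (.inl ⟨h ▸ lt_irrefl x, h, h ▸ lt_irrefl x⟩)
  · exact .inr (.inr ⟨h.not_gt, h.ne', h⟩)

lemma card_filter_union {S T U : Finset V} (hU : ∀ x, x ∈ U ↔ x ∈ S ∨ x ∈ T)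
    (hd : ∀ x ∈ S, x ∉ T) (p : V → Prop) :
    (U.filter p).card = (S.filter p).card + (T.filter p).card := by
  rw [show U = S ∪ T by ext; simp [hU], Finset.filter_union, Finset.card_union_of_disjoint]
  rw [Finset.disjoint_left]
  intro x hx hx'
  exact hd x (Finset.mem_filter.1 hx).1 (Finset.mem_filter.1 hx').1

lemma rankIn_union {S T U : Finset V} (hU : ∀ x, x ∈ U ↔ x ∈ S ∨ x ∈ T)
    (hd : ∀ x ∈ S, x ∉ T) (s : V) : rankIn U s = rankIn S s + rankIn T s :=
  card_filter_union hU hd _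

lemma inversions_union_left {S T U : Finset V} (hU : ∀ x, x ∈ U ↔ x ∈ S ∨ x ∈ T)
    (hd : ∀ x ∈ S, x ∉ T) (W : Finset V) :
    inversions U W = inversions S W + inversions T W := by
  rw [show U = S ∪ T by ext; simp [hU], inversions, Finset.sum_union (Finset.disjoint_left.2 hd)]
  rfl

lemma inversions_union_right {S T U : Finset V} (hU : ∀ x, x ∈ U ↔ x ∈ S ∨ x ∈ T)
    (hd : ∀ x ∈ S, x ∉ T) (W : Finset V) :
    inversions W U = inversions W S + inversions W T := by
  rw [inversions, inversions, inversions, ← Finset.sum_add_distrib]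
  exact Finset.sum_congr rfl fun s _ => rankIn_union hU hd s

lemma mem_iff_eraseV {F : Finset V} {s : V} (h : s ∈ F) (x : V) :
    x ∈ F ↔ x ∈ eraseV F s ∨ x ∈ ({s} : Finset V) := by
  rw [mem_eraseV, Finset.mem_singleton]
  by_cases hx : x = s <;> simp [hx, h]

lemma eraseV_disjoint (F : Finset V) (s : V) : ∀ x ∈ eraseV F s, x ∉ ({s} : Finset V) := by
  intro x hx
  rw [mem_eraseV] at hx
  simpa using hx.1

lemma inversions_eraseV_left {S : Finset V} {s : V} (h : s ∈ S) (T : Finset V) :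
    inversions S T = inversions (eraseV S s) T + rankIn T s := by
  rw [inversions_union_left (mem_iff_eraseV h) (eraseV_disjoint S s)]
  simp [inversions]

lemma rankIn_singleton (s x : V) : rankIn {s} x = if (vOrd V).lt s x then 1 else 0 := by
  rw [rankIn, Finset.filter_singleton]
  split_ifs <;> rfl

lemma inversions_eraseV_right {T : Finset V} {s : V} (h : s ∈ T) (S : Finset V) :
    inversions S T = inversions S (eraseV T s) + upIn S s := by
  rw [inversions_union_right (mem_iff_eraseV h) (eraseV_disjoint T s)]
  congr 1
  rw [inversions, upIn, Finset.card_filter]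
  exact Finset.sum_congr rfl fun a _ => rankIn_singleton s a

lemma rankIn_eraseV {S : Finset V} {s : V} (h : s ∈ S) (x : V) :
    rankIn S x = rankIn (eraseV S s) x + if (vOrd V).lt s x then 1 else 0 := by
  rw [rankIn_union (mem_iff_eraseV h) (eraseV_disjoint S s), rankIn_singleton]

lemma rankIn_eraseV_self {S : Finset V} {s : V} (h : s ∈ S) :
    rankIn S s = rankIn (eraseV S s) s := by
  have h2 := rankIn_eraseV h s
  rwa [if_neg (letI := vOrd V; lt_irrefl s), add_zero] at h2

lemma rankIn_add_upIn_of_notMem {S : Finset V} {s : V} (h : s ∉ S) :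
    rankIn S s + upIn S s = S.card := by
  rw [rankIn, upIn, Finset.card_filter, Finset.card_filter, ← Finset.sum_add_distrib,
    Finset.card_eq_sum_ones]
  refine Finset.sum_congr rfl fun x hx => ?_
  have hne : x ≠ s := fun h' => h (h' ▸ hx)
  rcases vOrd_lt_trichotomy x s with ⟨h1, h2, h3⟩ | ⟨h1, h2, h3⟩ | ⟨h1, h2, h3⟩
  · simp [h1, h3]
  · exact absurd h2 hne
  · simp [h1, h3]

lemma rankIn_add_upIn_of_mem {S : Finset V} {s : V} (h : s ∈ S) :
    rankIn S s + upIn (eraseV S s) s + 1 = S.card := by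
  have h1 := rankIn_add_upIn_of_notMem (S := eraseV S s) (s := s) (by simp [mem_eraseV])
  have h2 := rankIn_eraseV_self h
  have h3 := card_eraseV h
  omega

end Signs

section Letters

variable {t : ℕ} {M : Finset (Mon (Fin t))}

/-- Basis elements of the augmentation ideal of the Taylor algebra: `deg` is the multidegree and
`face` the exterior part. -/
@[ext] structure Letter (M : Finset (Mon (Fin t))) where
  /-- the multidegree -/
  deg : Mon (Fin t)
  /-- the exterior part -/
  face : Finset (Mon (Fin t))
  deg_ne : deg ≠ 0
  face_sub : face ⊆ M
  le_deg : mlcm face ≤ deg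

namespace Letter

/-- The product of letters, up to sign. -/
def mul (a b : Letter M) : Letter M where
  deg := a.deg + b.deg
  face := a.face ∪ b.face
  deg_ne h := a.deg_ne (by
    funext i
    have := congrFun h i
    simp only [Pi.add_apply, Pi.zero_apply] at this ⊢
    omega)
  face_sub := Finset.union_subset a.face_sub b.face_sub
  le_deg := by
    rw [mlcm_union]
    exact sup_le (a.le_deg.trans fun i => Nat.le_add_right _ _)
      (b.le_deg.trans fun i => Nat.le_add_left _ _)

/-- Removal of an exterior generator. -/
def er (a : Letter M) (s : Mon (Fin t)) : Letter M where
  deg := a.deg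
  face := eraseV a.face s
  deg_ne := a.deg_ne
  face_sub := (eraseV_subset _ _).trans a.face_sub
  le_deg := (mlcm_mono (eraseV_subset _ _)).trans a.le_deg

lemma mem_mul {a b : Letter M} (x : Mon (Fin t)) :
    x ∈ (a.mul b).face ↔ x ∈ a.face ∨ x ∈ b.face := Finset.mem_union

lemma mem_er {a : Letter M} {s x : Mon (Fin t)} : x ∈ (a.er s).face ↔ x ≠ s ∧ x ∈ a.face :=
  mem_eraseV

lemma mul_assoc (a b e : Letter M) : (a.mul b).mul e = a.mul (b.mul e) :=
  Letter.ext (add_assoc _ _ _) (Finset.union_assoc _ _ _)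

lemma er_er (a : Letter M) (s r : Mon (Fin t)) : (a.er s).er r = (a.er r).er s := by
  refine Letter.ext rfl ?_
  ext x
  simp only [mem_er]
  tauto

/-- The exterior parts have no common element. -/
def Disj (a b : Letter M) : Prop := ∀ x ∈ a.face, x ∉ b.face

variable (k : Type*) [Field k]

/-- The structure constants of the Taylor algebra. -/
def c (a b : Letter M) : k := if a.Disj b then (-1) ^ inversions a.face b.face else 0

/-- The sign of a letter in the bar construction. -/
def sign (n : ℕ) : k := (-1) ^ (n + 1)

/-- The part of the Taylor differential given by a condition on the removed generators. -/
def dF (φ : Finset (Mon (Fin t)) → Mon (Fin t) → Prop) (a : Letter M) : Letter M →₀ k :=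
  ∑ s ∈ a.face.filter (φ a.face), (-1 : k) ^ rankIn a.face s • Finsupp.single (a.er s) 1

variable {k}

lemma c_assoc (a b e : Letter M) :
    c k a b * c k (a.mul b) e = c k b e * c k a (b.mul e) := by
  simp only [c]
  have hd : a.Disj b ∧ (a.mul b).Disj e ↔ b.Disj e ∧ a.Disj (b.mul e) := by
    simp only [Disj, mem_mul]
    constructor
    · rintro ⟨h1, h2⟩
      exact ⟨fun x hx => h2 x (.inr hx), fun x hx => by
        have := h1 x hx
        have := h2 x (.inl hx)
        tauto⟩
    · rintro ⟨h1, h2⟩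
      exact ⟨fun x hx => fun hx' => h2 x hx (.inl hx'), fun x hx hx' => by
        rcases hx with hx | hx
        · exact h2 x hx (.inr hx')
        · exact h1 x hx hx'⟩
  by_cases h : a.Disj b ∧ (a.mul b).Disj e
  · have h' := hd.1 h
    rw [if_pos h.1, if_pos h.2, if_pos h'.1, if_pos h'.2, ← pow_add, ← pow_add,
      inversions_union_left mem_mul h.1, inversions_union_right mem_mul h'.1]
    congr 1
    have : inversions a.face e.face + inversions b.face e.face
      = inversions b.face e.face + inversions a.face e.face := add_comm _ _
    omega
  · have h' : ¬ (b.Disj e ∧ a.Disj (b.mul e)) := fun h2 => h (hd.2 h2)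
    rw [not_and_or] at h
    rw [show (if a.Disj b then (-1 : k) ^ inversions a.face b.face else 0)
        * (if (a.mul b).Disj e then (-1 : k) ^ inversions (a.mul b).face e.face else 0) = 0 by
      rcases h with h | h <;> simp [h]]
    rw [not_and_or] at h'
    rcases h' with h' | h' <;> simp [h']

lemma mem_support_dF {φ : Finset (Mon (Fin t)) → Mon (Fin t) → Prop} {a b : Letter M}
    (h : b ∈ (dF k φ a).support) : ∃ s ∈ a.face, φ a.face s ∧ b = a.er s := by
  by_contra hc
  push Not at hc
  rw [Finsupp.mem_support_iff] at h
  apply h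
  rw [dF, Finsupp.finsetSum_apply]
  refine Finset.sum_eq_zero fun s hs => ?_
  rw [Finset.mem_filter] at hs
  rw [Finsupp.smul_apply, Finsupp.single_eq_of_ne, smul_zero]
  exact fun h => hc s hs.1 hs.2 h

lemma linExt_dF {E : Type*} [AddCommGroup E] [Module k E] (f : Letter M → E)
    (φ : Finset (Mon (Fin t)) → Mon (Fin t) → Prop) (a : Letter M) :
    linExt f (dF k φ a)
      = ∑ s ∈ a.face.filter (φ a.face), (-1 : k) ^ rankIn a.face s • f (a.er s) := by
  rw [dF, map_sum]
  refine Finset.sum_congr rfl fun s _ => ?_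
  rw [map_smul, linExt_single, one_smul]

lemma dF_dF {φ : Finset (Mon (Fin t)) → Mon (Fin t) → Prop}
    (hφ : ∀ S ⊆ M, ∀ s ∈ S, ∀ r ∈ S, φ S s → φ (eraseV S s) r → φ S r ∧ φ (eraseV S r) s)
    (a : Letter M) : linExt (dF k φ) (dF k φ a) = 0 := by
  rw [linExt_dF]
  simp_rw [dF, Finset.smul_sum, smul_smul, ← pow_add]
  rw [Finset.sum_sigma']
  refine Finset.sum_involution (fun p _ => ⟨p.2, p.1⟩) ?_ ?_ ?_ ?_
  · rintro ⟨s, r⟩ h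
    simp only [Finset.mem_sigma, Finset.mem_filter, mem_er] at h
    obtain ⟨⟨hs, -⟩, ⟨hrs, hr⟩, -⟩ := h
    have h1 := rankIn_eraseV hs r
    have h2 := rankIn_eraseV hr s
    simp only [er_er a r s]
    rw [← add_smul]
    have : (-1 : k) ^ (rankIn a.face s + rankIn (a.er s).face r)
        + (-1) ^ (rankIn a.face r + rankIn (a.er r).face s) = 0 := by
      change (-1 : k) ^ (rankIn a.face s + rankIn (eraseV a.face s) r)
        + (-1) ^ (rankIn a.face r + rankIn (eraseV a.face r) s) = 0
      rcases vOrd_lt_trichotomy s r with ⟨h3, h4, h5⟩ | ⟨h3, h4, h5⟩ | ⟨h3, h4, h5⟩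
      · rw [if_pos h3] at h1
        rw [if_neg h5] at h2
        rw [h1, h2]
        ring
      · exact absurd h4.symm hrs
      · rw [if_neg h3] at h1
        rw [if_pos h5] at h2
        rw [h1, h2]
        ring
    rw [this, zero_smul]
  · rintro ⟨s, r⟩ h - heq
    simp only [Finset.mem_sigma, Finset.mem_filter, mem_er] at h
    simp only [Sigma.mk.injEq] at heq
    exact h.2.1.1 heq.1
  · rintro ⟨s, r⟩ h
    simp only [Finset.mem_sigma, Finset.mem_filter, mem_er] at h ⊢
    obtain ⟨⟨hs, h1⟩, ⟨hrs, hr⟩, h2⟩ := h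
    obtain ⟨h3, h4⟩ := hφ a.face a.face_sub s hs r hr h1 h2
    exact ⟨⟨hr, h3⟩, ⟨hrs.symm, hs⟩, h4⟩
  · rintro ⟨s, r⟩ h
    rfl

lemma Disj.er_left {a b : Letter M} (h : a.Disj b) (s : Mon (Fin t)) : (a.er s).Disj b :=
  fun x hx => h x (mem_er.1 hx).2

lemma Disj.er_right {a b : Letter M} (h : a.Disj b) (s : Mon (Fin t)) : a.Disj (b.er s) :=
  fun x hx hx' => h x hx (mem_er.1 hx').2

lemma er_mul {a b : Letter M} (h : a.Disj b) {s : Mon (Fin t)} (hs : s ∈ a.face) :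
    (a.mul b).er s = (a.er s).mul b := by
  refine Letter.ext rfl ?_
  ext x
  simp only [mem_er, mem_mul]
  have := h s hs
  constructor
  · tauto
  · rintro (h1 | h1)
    · tauto
    · exact ⟨fun h2 => this (h2 ▸ h1), .inr h1⟩

lemma mul_er {a b : Letter M} (h : a.Disj b) {s : Mon (Fin t)} (hs : s ∈ b.face) :
    (a.mul b).er s = a.mul (b.er s) := by
  refine Letter.ext rfl ?_
  ext x
  simp only [mem_er, mem_mul]
  constructor
  · tauto
  · rintro (h1 | h1)
    · exact ⟨fun h2 => h s (h2 ▸ h1) hs, .inl h1⟩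
    · tauto

lemma neg_one_pow_eq {m n : ℕ} (h : Even (m + n)) : (-1 : k) ^ m = (-1) ^ n := by
  rcases Nat.even_or_odd m with hm | hm
  · rw [hm.neg_one_pow, ((Nat.even_add.1 h).1 hm).neg_one_pow]
  · rw [hm.neg_one_pow, Odd.neg_one_pow]
    rw [← Nat.not_even_iff_odd] at hm ⊢
    exact fun h' => hm ((Nat.even_add.1 h).2 h')

lemma neg_one_pow_add {m n : ℕ} (h : Odd (m + n)) : (-1 : k) ^ m + (-1) ^ n = 0 := by
  have := neg_one_pow_eq (k := k) (m := m) (n := n + 1) (by rw [← add_assoc]; exact h.add_one)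
  rw [this, pow_succ]
  ring

/-- The Leibniz rule for disjoint exterior parts. -/
lemma leibniz_of_disj {φ : Finset (Mon (Fin t)) → Mon (Fin t) → Prop} {a b : Letter M}
    {c' : Letter M → Letter M → k} (h : a.Disj b) (hc : c' a b = c k a b)
    (hcl : ∀ s ∈ a.face, c' (a.er s) b = c k (a.er s) b)
    (hcr : ∀ s ∈ b.face, c' a (b.er s) = c k a (b.er s))
    (hl : ∀ s ∈ a.face, φ (a.mul b).face s ↔ φ a.face s)
    (hr : ∀ s ∈ b.face, φ (a.mul b).face s ↔ φ b.face s) :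
    c' a b • dF k φ (a.mul b) = mulR c' mul b (dF k φ a)
      - sign k a.face.card • mulL c' mul a (dF k φ b) := by
  rw [hc, mulR, mulL, linExt_dF, linExt_dF, dF]
  have hsplit : (a.mul b).face.filter (φ (a.mul b).face)
      = a.face.filter (φ a.face) ∪ b.face.filter (φ b.face) := by
    ext s
    simp only [Finset.mem_filter, Finset.mem_union, mem_mul]
    constructor
    · rintro ⟨h1 | h1, h2⟩
      · exact .inl ⟨h1, (hl s h1).1 h2⟩
      · exact .inr ⟨h1, (hr s h1).1 h2⟩
    · rintro (⟨h1, h2⟩ | ⟨h1, h2⟩)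
      · exact ⟨.inl h1, (hl s h1).2 h2⟩
      · exact ⟨.inr h1, (hr s h1).2 h2⟩
  rw [hsplit, Finset.sum_union (Finset.disjoint_left.2 fun s hs hs' =>
    h s (Finset.mem_filter.1 hs).1 (Finset.mem_filter.1 hs').1), smul_add, sub_eq_add_neg,
    Finset.smul_sum, Finset.smul_sum, Finset.smul_sum, ← Finset.sum_neg_distrib]
  congr 1
  · refine Finset.sum_congr rfl fun s hs => ?_
    have hs := (Finset.mem_filter.1 hs).1
    rw [hcl s hs, c, c, if_pos h, if_pos (h.er_left s), er_mul h hs, Finsupp.smul_single,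
      Finsupp.smul_single, Finsupp.smul_single]
    simp only [smul_eq_mul, mul_one]
    rw [← pow_add, ← pow_add]
    congr 1
    apply neg_one_pow_eq
    have h1 : inversions a.face b.face = inversions (a.er s).face b.face + rankIn b.face s :=
      inversions_eraseV_left hs _
    have h2 := rankIn_union mem_mul h s
    rw [h1, h2]
    exact ⟨inversions (a.er s).face b.face + rankIn b.face s + rankIn a.face s, by ring⟩
  · refine Finset.sum_congr rfl fun s hs => ?_
    have hs := (Finset.mem_filter.1 hs).1
    have hsa : s ∉ a.face := fun h' => h s h' hs
    rw [hcr s hs, c, c, if_pos h, if_pos (h.er_right s), mul_er h hs, Finsupp.smul_single,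
      Finsupp.smul_single, Finsupp.smul_single, Finsupp.smul_single, ← Finsupp.single_neg]
    simp only [smul_eq_mul, mul_one, sign]
    rw [← pow_add, ← pow_add, ← pow_add]
    congr 1
    rw [eq_neg_iff_add_eq_zero]
    apply neg_one_pow_add
    have h1 : inversions a.face b.face = inversions a.face (b.er s).face + upIn a.face s :=
      inversions_eraseV_right hs _
    have h2 := rankIn_union mem_mul h s
    have h3 := rankIn_add_upIn_of_notMem hsa
    rw [h1, h2, ← h3]
    exact ⟨inversions a.face (b.er s).face + upIn a.face s + rankIn a.face s + rankIn b.face s,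
      by ring⟩

/-- The Leibniz rule of the Taylor algebra. -/
lemma leibniz (a b : Letter M) :
    c k a b • dF k (fun _ _ => True) (a.mul b) = mulR (c k) mul b (dF k (fun _ _ => True) a)
      - sign k a.face.card • mulL (c k) mul a (dF k (fun _ _ => True) b) := by
  by_cases h : a.Disj b
  · exact leibniz_of_disj h rfl (fun _ _ => rfl) (fun _ _ => rfl) (fun _ _ => Iff.rfl)
      fun _ _ => Iff.rfl
  rw [c, if_neg h, zero_smul, mulR, mulL, linExt_dF, linExt_dF]
  simp only [Finset.filter_true]
  simp only [Disj, not_forall, not_not] at h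
  obtain ⟨s, hsa, hsb⟩ := h
  have hne : ∀ r ≠ s, ¬ (a.er r).Disj b ∧ ¬ a.Disj (b.er r) := fun r hr =>
    ⟨fun h => h s (mem_er.2 ⟨hr.symm, hsa⟩) hsb, fun h => h s hsa (mem_er.2 ⟨hr.symm, hsb⟩)⟩
  rw [Finset.sum_eq_single_of_mem s hsa fun r _ hr => by simp [c, (hne r hr).1],
    Finset.sum_eq_single_of_mem s hsb fun r _ hr => by simp [c, (hne r hr).2]]
  have hiff : (a.er s).Disj b ↔ a.Disj (b.er s) := by
    simp only [Disj, mem_er]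
    constructor
    · exact fun h x hx hx' => h x ⟨hx'.1, hx⟩ hx'.2
    · exact fun h x hx hx' => h x hx.2 ⟨hx.1, hx'⟩
  by_cases h' : (a.er s).Disj b
  · have hm : (a.er s).mul b = a.mul (b.er s) := by
      refine Letter.ext rfl ?_
      ext x
      simp only [mem_er, mem_mul]
      by_cases hx : x = s
      · simp [hx, hsa, hsb]
      · simp [hx]
    rw [c, c, if_pos h', if_pos (hiff.1 h'), hm, Finsupp.smul_single, Finsupp.smul_single,
      Finsupp.smul_single, sign, ← Finsupp.single_sub]
    simp only [smul_eq_mul]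
    rw [← pow_add, ← pow_add, ← pow_add, eq_comm, Finsupp.single_eq_zero, sub_eq_zero]
    apply neg_one_pow_eq
    have h1 : inversions (a.er s).face b.face
        = inversions (a.er s).face (b.er s).face + upIn (a.er s).face s :=
      inversions_eraseV_right hsb _
    have h2 : inversions a.face (b.er s).face
        = inversions (a.er s).face (b.er s).face + rankIn (b.er s).face s :=
      inversions_eraseV_left hsa _
    have h3 := rankIn_add_upIn_of_mem hsa
    have h4 : rankIn b.face s = rankIn (b.er s).face s := rankIn_eraseV_self hsb
    change rankIn a.face s + upIn (a.er s).face s + 1 = a.face.card at h3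
    rw [h1, h2, h4, ← h3]
    exact ⟨rankIn a.face s + upIn (a.er s).face s + rankIn (b.er s).face s
      + inversions (a.er s).face (b.er s).face + 1, by ring⟩
  · simp [c, h', show ¬ a.Disj (b.er s) from fun h => h' (hiff.2 h)]

end Letter

end Letters

end MonomialRings

namespace MonomialRings

section Types

variable {t : ℕ} {M : Finset (Mon (Fin t))}

/-- The monomial of a variable. -/
def unitMon (i : Fin t) : Mon (Fin t) := Pi.single i 1

lemma mdeg_unitMon (i : Fin t) : mdeg (unitMon i) = 1 := by simp [mdeg, unitMon]

/-- The multiset of variables whose product is a given monomial. -/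
def units (β : Mon (Fin t)) : Multiset (Mon (Fin t)) := ∑ i, β i • {unitMon i}

lemma units_add (β β' : Mon (Fin t)) : units (β + β') = units β + units β' := by
  simp [units, add_nsmul, Finset.sum_add_distrib]

lemma sum_units (β : Mon (Fin t)) : (units β).sum = β := by
  rw [units, ← Multiset.coe_sumAddMonoidHom, map_sum]
  funext j
  simp [unitMon, Finset.sum_apply, Pi.single_apply, Multiset.sum_nsmul]

lemma card_units (β : Mon (Fin t)) : (units β).card = mdeg β := by
  simp [units, mdeg]

lemma mem_units {β x : Mon (Fin t)} : x ∈ units β ↔ ∃ i, β i ≠ 0 ∧ x = unitMon i := by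
  simp [units, Multiset.mem_sum, Multiset.mem_nsmul]

lemma mdeg_of_mem_units {β x : Mon (Fin t)} (h : x ∈ units β) : mdeg x = 1 := by
  obtain ⟨i, -, rfl⟩ := mem_units.1 h
  exact mdeg_unitMon i

lemma units_of_mdeg_eq_one {x : Mon (Fin t)} (h : mdeg x = 1) : units x = {x} := by
  obtain ⟨y, hy⟩ := Multiset.card_eq_one.1 ((card_units x).trans h)
  have := sum_units x
  rw [hy, Multiset.sum_singleton] at this
  rw [hy, this]

lemma exists_filter_units (p : Mon (Fin t) → Prop) (β : Mon (Fin t)) :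
    ∃ β', (units β).filter p = units β' := by
  refine ⟨fun i => if p (unitMon i) then β i else 0, ?_⟩
  have h : ∀ s : Finset (Fin t), Multiset.filter p (∑ i ∈ s, β i • {unitMon i})
      = ∑ i ∈ s, (if p (unitMon i) then β i else 0) • ({unitMon i} : Multiset (Mon (Fin t))) := by
    intro s
    induction s using Finset.induction_on with
    | empty => simp
    | insert i s hi ih =>
      rw [Finset.sum_insert hi, Finset.sum_insert hi, Multiset.filter_add, ih,
        Multiset.filter_nsmul, Multiset.filter_singleton]
      split_ifs <;> simp
  exact h _

namespace Letter

/-- The part of the multidegree of a letter not accounted for by its exterior part. -/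
def rem (a : Letter M) : Mon (Fin t) := a.deg - mlcm a.face

/-- The type of a letter: component monomials together with variables. -/
def type (a : Letter M) : Multiset (Mon (Fin t)) := (cl a.face).val + units a.rem

lemma mlcm_add_rem (a : Letter M) : mlcm a.face + a.rem = a.deg := by
  funext i
  have : mlcm a.face i ≤ a.deg i := a.le_deg i
  simp only [rem, Pi.add_apply, Pi.sub_apply]
  omega

lemma rem_eq {a : Letter M} {ρ : Mon (Fin t)} (h : a.deg = mlcm a.face + ρ) : a.rem = ρ := by
  rw [rem, h]
  funext i
  simp

lemma zero_notMem (h2 : ∀ m ∈ M, 2 ≤ mdeg m) (a : Letter M) : 0 ∉ a.face :=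
  zero_notMem_of_two_le fun s hs => h2 s (a.face_sub hs)

lemma mem_type {a : Letter M} {x : Mon (Fin t)} :
    x ∈ a.type ↔ x ∈ cl a.face ∨ x ∈ units a.rem := by
  rw [type, Multiset.mem_add, Finset.mem_val]

lemma sum_type (h2 : ∀ m ∈ M, 2 ≤ mdeg m) (a : Letter M) : a.type.sum = a.deg := by
  rw [type, Multiset.sum_add, sum_units, ← mlcm_add_rem, ← sum_cl (a.zero_notMem h2)]
  exact congrArg (· + a.rem) (by rw [Finset.sum_eq_multiset_sum, Multiset.map_id'])

lemma two_le_of_mem_cl (h2 : ∀ m ∈ M, 2 ≤ mdeg m) {a : Letter M} {x : Mon (Fin t)}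
    (h : x ∈ cl a.face) : 2 ≤ mdeg x :=
  two_le_mdeg_of_mem_cl (a.zero_notMem h2) (fun s hs => h2 s (a.face_sub hs)) h

lemma one_le_of_mem_type (h2 : ∀ m ∈ M, 2 ≤ mdeg m) {a : Letter M} {x : Mon (Fin t)}
    (h : x ∈ a.type) : 1 ≤ mdeg x := by
  rcases mem_type.1 h with h | h
  · have := two_le_of_mem_cl h2 h
    omega
  · rw [mdeg_of_mem_units h]

lemma ne_zero_of_mem_type (h2 : ∀ m ∈ M, 2 ≤ mdeg m) {a : Letter M} {x : Mon (Fin t)}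
    (h : x ∈ a.type) : x ≠ 0 := by
  rintro rfl
  have := one_le_of_mem_type h2 h
  rw [mdeg_zero] at this
  omega

lemma type_ne_zero (h2 : ∀ m ∈ M, 2 ≤ mdeg m) (a : Letter M) : a.type ≠ 0 := by
  intro h
  have := sum_type h2 a
  rw [h, Multiset.sum_zero] at this
  exact a.deg_ne this.symm

/-- Two types whose occurrences commute. -/
def Commute (x y : Mon (Fin t)) : Prop := mdeg x = 1 ∨ mdeg y = 1 ∨ ¬ NCF x y

lemma Commute.symm {x y : Mon (Fin t)} (h : Commute x y) : Commute y x := by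
  rcases h with h | h | h
  · exact .inr (.inl h)
  · exact .inl h
  · exact .inr (.inr fun h' => h h'.symm)

/-- The exterior parts have coprime least common multiples. -/
def Cop (a b : Letter M) : Prop := ¬ NCF (mlcm a.face) (mlcm b.face)

lemma Cop.disj (h2 : ∀ m ∈ M, 2 ≤ mdeg m) {a b : Letter M} (h : a.Cop b) : a.Disj b := by
  intro x hx hx'
  have h0 : x ≠ 0 := fun h0 => a.zero_notMem h2 (h0 ▸ hx)
  exact h ((ncf_self h0).mono (le_mlcm hx) (le_mlcm hx'))

lemma cop_iff (h2 : ∀ m ∈ M, 2 ≤ mdeg m) {a b : Letter M} :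
    a.Cop b ↔ ∀ x ∈ a.type, ∀ y ∈ b.type, Commute x y := by
  constructor
  · intro h x hx y hy
    rcases mem_type.1 hx with hx | hx
    · rcases mem_type.1 hy with hy | hy
      · exact .inr (.inr fun h' => h (h'.mono (le_mlcm_of_mem_cl (a.zero_notMem h2) hx)
          (le_mlcm_of_mem_cl (b.zero_notMem h2) hy)))
      · exact .inr (.inl (mdeg_of_mem_units hy))
    · exact .inl (mdeg_of_mem_units hx)
  · rintro h ⟨i, h1, h3⟩
    obtain ⟨x, hx, hxi⟩ := exists_mem_cl_apply_ne (a.zero_notMem h2) h1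
    obtain ⟨y, hy, hyi⟩ := exists_mem_cl_apply_ne (b.zero_notMem h2) h3
    have hx2 := two_le_of_mem_cl h2 hx
    have hy2 := two_le_of_mem_cl h2 hy
    rcases h x (mem_type.2 (.inl hx)) y (mem_type.2 (.inl hy)) with h | h | h
    · omega
    · omega
    · exact h ⟨i, hxi, hyi⟩

lemma cl_mul (h2 : ∀ m ∈ M, 2 ≤ mdeg m) {a b : Letter M} (h : a.Cop b) :
    cl (a.mul b).face = cl a.face ∪ cl b.face :=
  cl_union (a.zero_notMem h2) (b.zero_notMem h2) h

lemma Cop.disjoint_cl (h2 : ∀ m ∈ M, 2 ≤ mdeg m) {a b : Letter M} (h : a.Cop b) :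
    Disjoint (cl a.face) (cl b.face) := by
  rw [Finset.disjoint_left]
  intro x hx hx'
  exact h ((ncf_self (ne_zero_of_mem_type h2 (mem_type.2 (.inl hx)))).mono
    (le_mlcm_of_mem_cl (a.zero_notMem h2) hx) (le_mlcm_of_mem_cl (b.zero_notMem h2) hx'))

lemma mlcm_mul {a b : Letter M} (h : a.Cop b) :
    mlcm (a.mul b).face = mlcm a.face + mlcm b.face := by
  change mlcm (a.face ∪ b.face) = _
  rw [mlcm_union]
  funext i
  have : mlcm a.face i = 0 ∨ mlcm b.face i = 0 := by
    by_contra hc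
    push Not at hc
    exact h ⟨i, hc⟩
  simp only [Pi.sup_apply, Pi.add_apply]
  omega

lemma type_mul (h2 : ∀ m ∈ M, 2 ≤ mdeg m) {a b : Letter M} (h : a.Cop b) :
    (a.mul b).type = a.type + b.type := by
  have hr : (a.mul b).rem = a.rem + b.rem := rem_eq (by
    rw [mlcm_mul h]
    change a.deg + b.deg = _
    rw [← mlcm_add_rem a, ← mlcm_add_rem b]
    abel)
  rw [type, hr, units_add, cl_mul h2 h, ← Finset.disjUnion_eq_union _ _ (h.disjoint_cl h2), type,
    type]
  change ((cl a.face).val + (cl b.face).val) + _ = _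
  abel

/-- Removing the generator does not change the component monomials. -/
def Keeps (S : Finset (Mon (Fin t))) (s : Mon (Fin t)) : Prop := cl (eraseV S s) = cl S

lemma rem_er {a : Letter M} (h2 : ∀ m ∈ M, 2 ≤ mdeg m) {s : Mon (Fin t)} (h : Keeps a.face s) :
    (a.er s).rem = a.rem := by
  apply rem_eq
  rw [(decomp_cl ((a.er s).zero_notMem h2)).sup_eq, show cl (a.er s).face = cl a.face from h,
    ← (decomp_cl (a.zero_notMem h2)).sup_eq, mlcm_add_rem]
  rfl

lemma type_er {a : Letter M} (h2 : ∀ m ∈ M, 2 ≤ mdeg m) {s : Mon (Fin t)}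
    (h : Keeps a.face s) : (a.er s).type = a.type := by
  rw [type, rem_er h2 h, show cl (a.er s).face = cl a.face from h, type]

lemma Cop.er_left {a b : Letter M} (h : a.Cop b) (s : Mon (Fin t)) : (a.er s).Cop b :=
  fun h' => h (h'.mono (mlcm_mono (eraseV_subset _ _)) le_rfl)

lemma Cop.symm {a b : Letter M} (h : a.Cop b) : b.Cop a := fun h' => h (NCF.symm h')

lemma Cop.er_right {a b : Letter M} (h : a.Cop b) (s : Mon (Fin t)) : a.Cop (b.er s) :=
  (h.symm.er_left s).symm

lemma union_right_cancel {A B C : Finset (Mon (Fin t))} (hA : Disjoint A C) (hB : Disjoint B C) :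
    A ∪ C = B ∪ C ↔ A = B := by
  refine ⟨fun h => ?_, fun h => h ▸ rfl⟩
  rw [Finset.disjoint_left] at hA hB
  ext x
  have := Finset.ext_iff.1 h x
  simp only [Finset.mem_union] at this
  have h1 := hA (a := x)
  have h2 := hB (a := x)
  tauto

lemma keeps_mul_left (h2 : ∀ m ∈ M, 2 ≤ mdeg m) {a b : Letter M} (h : a.Cop b)
    {s : Mon (Fin t)} (hs : s ∈ a.face) : Keeps (a.mul b).face s ↔ Keeps a.face s := by
  change cl ((a.mul b).er s).face = _ ↔ cl (a.er s).face = _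
  rw [er_mul (h.disj h2) hs, cl_mul h2 h, cl_mul h2 (h.er_left s),
    union_right_cancel ((h.er_left s).disjoint_cl h2) (h.disjoint_cl h2)]

lemma keeps_mul_right (h2 : ∀ m ∈ M, 2 ≤ mdeg m) {a b : Letter M} (h : a.Cop b)
    {s : Mon (Fin t)} (hs : s ∈ b.face) : Keeps (a.mul b).face s ↔ Keeps b.face s := by
  change cl ((a.mul b).er s).face = _ ↔ cl (b.er s).face = _
  rw [mul_er (h.disj h2) hs, cl_mul h2 h, cl_mul h2 (h.er_right s), Finset.union_comm,
    Finset.union_comm (cl a.face),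
    union_right_cancel ((h.er_right s).disjoint_cl h2).symm (h.disjoint_cl h2).symm]

lemma keeps_of_keeps {S : Finset (Mon (Fin t))} (h2 : ∀ s ∈ S, 2 ≤ mdeg s) {s r : Mon (Fin t)}
    (h : Keeps S s) (h' : Keeps (eraseV S s) r) : Keeps S r ∧ Keeps (eraseV S r) s := by
  have hcomm : eraseV (eraseV S r) s = eraseV (eraseV S s) r := by
    ext x
    simp only [mem_eraseV]
    tauto
  have hall : cl (eraseV (eraseV S r) s) = cl S := by
    rw [hcomm]
    exact h'.trans h
  have hr : cl (eraseV S r) = cl S := by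
    have h0 := zero_notMem_of_two_le h2
    have h2' : ∀ x ∈ eraseV S r, 2 ≤ mdeg x := fun x hx => h2 x (eraseV_subset _ _ hx)
    have h0' := zero_notMem_of_two_le h2'
    have h0'' := zero_notMem_of_subset h0' (eraseV_subset _ s)
    by_contra hne
    have h3 := cl_lt h2 (eraseV_subset S r) hne (le_refl 1)
    have h4 : cl (eraseV (eraseV S r) s) ≠ cl (eraseV S r) := fun h => hne (h.symm.trans hall)
    have h5 := cl_lt h2' (eraseV_subset _ s) h4 (le_refl 1)
    rw [(decomp_cl h0'').sup_eq, hall, ← (decomp_cl h0).sup_eq] at h5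
    omega
  exact ⟨hr, hall.trans hr.symm⟩

variable (k : Type*) [Field k]

/-- The structure constants restricted to coprime products. -/
def cm (a b : Letter M) : k := if a.Cop b then c k a b else 0

variable {k}

lemma c_ne_zero {a b : Letter M} (h : a.Disj b) : c k a b ≠ 0 := by
  rw [c, if_pos h]
  exact pow_ne_zero _ (neg_ne_zero.2 one_ne_zero)

lemma cm_ne_zero (h2 : ∀ m ∈ M, 2 ≤ mdeg m) {a b : Letter M} : cm k a b ≠ 0 ↔ a.Cop b := by
  rw [cm]
  by_cases h : a.Cop b
  · rw [if_pos h]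
    exact ⟨fun _ => h, fun _ => c_ne_zero (h.disj h2)⟩
  · simp [h]

lemma cm_assoc (a b e : Letter M) :
    cm k a b * cm k (a.mul b) e = cm k b e * cm k a (b.mul e) := by
  have hiff : a.Cop b ∧ (a.mul b).Cop e ↔ b.Cop e ∧ a.Cop (b.mul e) := by
    have h1 : mlcm (a.mul b).face = mlcm a.face ⊔ mlcm b.face := mlcm_union _ _
    have h2 : mlcm (b.mul e).face = mlcm b.face ⊔ mlcm e.face := mlcm_union _ _
    simp only [Cop, NCF, h1, h2, Pi.sup_apply, not_exists, not_and_or, not_not]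
    constructor
    · rintro ⟨h3, h4⟩
      refine ⟨fun i => ?_, fun i => ?_⟩ <;> have h3 := h3 i <;> have h4 := h4 i <;> omega
    · rintro ⟨h3, h4⟩
      refine ⟨fun i => ?_, fun i => ?_⟩ <;> have h3 := h3 i <;> have h4 := h4 i <;> omega
  have hl : cm k a b * cm k (a.mul b) e
      = if a.Cop b ∧ (a.mul b).Cop e then c k a b * c k (a.mul b) e else 0 := by
    by_cases h : a.Cop b <;> by_cases h' : (a.mul b).Cop e <;> simp [cm, h, h']
  have hr : cm k b e * cm k a (b.mul e)
      = if b.Cop e ∧ a.Cop (b.mul e) then c k b e * c k a (b.mul e) else 0 := by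
    by_cases h : b.Cop e <;> by_cases h' : a.Cop (b.mul e) <;> simp [cm, h, h']
  rw [hl, hr, c_assoc, if_congr hiff rfl rfl]

lemma sign_sq (n : ℕ) : sign k n * sign k n = 1 := by
  rw [sign, ← pow_add]
  exact Even.neg_one_pow ⟨_, rfl⟩

lemma sign_succ (n : ℕ) : sign k (n + 1) = -sign k n := by
  rw [sign, sign, pow_succ]
  ring

lemma sign_add (m n : ℕ) : sign k (m + n) = -(sign k m * sign k n) := by
  simp only [sign, pow_add, pow_succ]
  ring

lemma Disj.card_mul {a b : Letter M} (h : a.Disj b) :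
    (a.mul b).face.card = a.face.card + b.face.card :=
  Finset.card_union_of_disjoint (Finset.disjoint_left.2 h)

lemma card_er {a : Letter M} {s : Mon (Fin t)} (hs : s ∈ a.face) :
    (a.er s).face.card + 1 = a.face.card := card_eraseV hs

end Letter

end Types

end MonomialRings

namespace MonomialRings

namespace Letter

variable {t : ℕ} {M : Finset (Mon (Fin t))}

lemma sum_parts {S : Finset (Mon (Fin t))} (h0 : 0 ∉ S) (β : Mon (Fin t)) :
    ((cl S).val + units β).sum = mlcm S + β := by
  rw [Multiset.sum_add, sum_units, ← sum_cl h0]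
  exact congrArg (· + β) (by rw [Finset.sum_eq_multiset_sum, Multiset.map_id'])

/-- The letter with a given exterior part and remaining multidegree. -/
def ofParts (S : Finset (Mon (Fin t))) (hS : S ⊆ M) (β : Mon (Fin t)) (h : mlcm S + β ≠ 0) :
    Letter M where
  deg := mlcm S + β
  face := S
  deg_ne := h
  face_sub := hS
  le_deg := fun _ => Nat.le_add_right _ _

lemma type_ofParts {S : Finset (Mon (Fin t))} {hS : S ⊆ M} {β : Mon (Fin t)}
    {h : mlcm S + β ≠ 0} : (ofParts S hS β h).type = (cl S).val + units β := by
  rw [type, rem_eq (a := ofParts S hS β h) rfl]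
  rfl

lemma mdeg_eq_one_of_commute {x : Mon (Fin t)} (h : Commute x x) (hx : x ≠ 0) : mdeg x = 1 := by
  rcases h with h | h | h
  · exact h
  · exact h
  · exact absurd (ncf_self hx) h

lemma face_eq_empty (h2 : ∀ m ∈ M, 2 ≤ mdeg m) {a : Letter M} {x : Mon (Fin t)}
    (hx : mdeg x = 1) (h : ∀ y ∈ a.type, y = x) : a.face = ∅ := by
  rw [← cl_eq_empty, Finset.eq_empty_iff_forall_notMem]
  intro y hy
  have := two_le_of_mem_cl h2 hy
  rw [h y (mem_type.2 (.inl hy))] at this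
  omega

lemma sum_ne_zero {s : Multiset (Mon (Fin t))} {x : Mon (Fin t)} (hx : x ∈ s) (h : x ≠ 0) :
    s.sum ≠ 0 := by
  obtain ⟨s', rfl⟩ := Multiset.exists_cons_of_mem hx
  rw [Multiset.sum_cons]
  intro h'
  apply h
  funext i
  have := congrFun h' i
  simp only [Pi.add_apply, Pi.zero_apply] at this ⊢
  omega

lemma exists_split (h2 : ∀ m ∈ M, 2 ≤ mdeg m) {a : Letter M} {x : Mon (Fin t)}
    (hx : x ∈ a.type) (hne : ¬ ∀ y ∈ a.type, y = x) :
    ∃ b g : Letter M, a = b.mul g ∧ b.Cop g ∧ x ∉ b.type ∧ ∀ y ∈ g.type, y = x := by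
  have h0 := a.zero_notMem h2
  have hcl : cl (below a.face x) = (cl a.face).filter (· = x) ∧
      cl (a.face \ below a.face x) = (cl a.face).filter (¬ · = x) := by
    by_cases hxc : x ∈ cl a.face
    · rw [cl_below h0 hxc, cl_sdiff_below h0 hxc]
      constructor <;> ext y
      · simp only [Finset.mem_singleton, Finset.mem_filter]
        exact ⟨fun h => ⟨h ▸ hxc, h⟩, fun h => h.2⟩
      · simp only [Finset.mem_erase, Finset.mem_filter]
        tauto
    · have hx1 : mdeg x = 1 := mdeg_of_mem_units ((mem_type.1 hx).resolve_left hxc)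
      have hb : below a.face x = ∅ := by
        rw [Finset.eq_empty_iff_forall_notMem]
        intro s hs
        rw [mem_below] at hs
        have h3 := mdeg_mono hs.2
        have h4 := h2 s (a.face_sub hs.1)
        omega
      rw [hb, Finset.sdiff_empty, cl_empty]
      constructor <;> ext y
      · simp only [Finset.notMem_empty, Finset.mem_filter, false_iff]
        exact fun h => hxc (h.2 ▸ h.1)
      · simp only [Finset.mem_filter]
        exact ⟨fun h => ⟨h, fun h' => hxc (h' ▸ h)⟩, fun h => h.1⟩
  obtain ⟨β₁, hβ₁⟩ := exists_filter_units (fun y => ¬ y = x) a.rem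
  obtain ⟨β₂, hβ₂⟩ := exists_filter_units (fun y => y = x) a.rem
  have hsub₂ : below a.face x ⊆ M := (below_subset _ _).trans a.face_sub
  have hsub₁ : a.face \ below a.face x ⊆ M := Finset.sdiff_subset.trans a.face_sub
  have h0₂ := zero_notMem_of_subset h0 (below_subset a.face x)
  have h0₁ := zero_notMem_of_subset h0 (Finset.sdiff_subset (s := a.face) (t := below a.face x))
  have ht₁ : (cl (a.face \ below a.face x)).val + units β₁ = a.type.filter (¬ · = x) := by
    rw [hcl.2, ← hβ₁, type, Multiset.filter_add, Finset.filter_val]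
    congr!
  have ht₂ : (cl (below a.face x)).val + units β₂ = a.type.filter (· = x) := by
    rw [hcl.1, ← hβ₂, type, Multiset.filter_add, Finset.filter_val]
    congr!
  push Not at hne
  obtain ⟨y, hy, hyx⟩ := hne
  have hne₁ : mlcm (a.face \ below a.face x) + β₁ ≠ 0 := by
    rw [← sum_parts h0₁, ht₁]
    exact sum_ne_zero (Multiset.mem_filter.2 ⟨hy, hyx⟩) (ne_zero_of_mem_type h2 hy)
  have hne₂ : mlcm (below a.face x) + β₂ ≠ 0 := by
    rw [← sum_parts h0₂, ht₂]
    exact sum_ne_zero (Multiset.mem_filter.2 ⟨hx, rfl⟩) (ne_zero_of_mem_type h2 hx)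
  refine ⟨ofParts _ hsub₁ β₁ hne₁, ofParts _ hsub₂ β₂ hne₂, ?_, ?_, ?_, ?_⟩
  · apply Letter.ext
    · change a.deg = (mlcm _ + β₁) + (mlcm _ + β₂)
      rw [← sum_parts h0₁, ← sum_parts h0₂, ht₁, ht₂, ← Multiset.sum_add, ← sum_type h2 a,
        add_comm, Multiset.filter_add_not]
    · exact (Finset.sdiff_union_of_subset (below_subset _ _)).symm
  · rw [cop_iff h2, type_ofParts, type_ofParts, ht₁, ht₂]
    intro u hu v hv
    rw [Multiset.mem_filter] at hu hv
    obtain ⟨hv, rfl⟩ := hv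
    rcases mem_type.1 hu.1 with hu' | hu'
    · rcases mem_type.1 hv with hv' | hv'
      · exact .inr (.inr fun h' => hu.2 ((decomp_cl h0).coprime u hu' v hv' h'))
      · exact .inr (.inl (mdeg_of_mem_units hv'))
    · exact .inl (mdeg_of_mem_units hu')
  · rw [type_ofParts, ht₁]
    simp
  · rw [type_ofParts, ht₂]
    intro y hy
    exact (Multiset.mem_filter.1 hy).2

lemma le_of_mem_face (h2 : ∀ m ∈ M, 2 ≤ mdeg m) {a : Letter M} {s : Mon (Fin t)}
    (hs : s ∈ a.face) : ∃ x ∈ a.type, s ≤ x ∧ x ∈ cl a.face := by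
  obtain ⟨x, hx, hsx⟩ := (decomp_cl (a.zero_notMem h2)).cover s hs
  exact ⟨x, mem_type.2 (.inl hx), hsx, hx⟩

lemma split_eq (h2 : ∀ m ∈ M, 2 ≤ mdeg m) {x : Mon (Fin t)} {b g : Letter M}
    (h : b.Cop g) (hb : x ∉ b.type) (hg : ∀ y ∈ g.type, y = x) :
    g.deg = ((b.mul g).type.count x) • x ∧ g.face = below (b.mul g).face x ∧
      ∀ s, s ∈ b.face ↔ s ∈ (b.mul g).face ∧ s ∉ g.face := by
  have hd := h.disj h2
  refine ⟨?_, ?_, fun s => ?_⟩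
  · rw [type_mul h2 h, Multiset.count_add, Multiset.count_eq_zero_of_notMem hb, zero_add,
      ← sum_type h2 g]
    conv_lhs => rw [Multiset.eq_replicate_card.2 hg]
    rw [Multiset.sum_replicate]
    congr 1
    rw [Multiset.count_eq_card.2 fun y hy => (hg y hy).symm]
  · ext s
    rw [mem_below, mem_mul]
    constructor
    · intro hs
      obtain ⟨y, hy, hsy, -⟩ := le_of_mem_face h2 hs
      exact ⟨.inr hs, hg y hy ▸ hsy⟩
    · rintro ⟨hs | hs, hsx⟩
      · exfalso
        obtain ⟨y, hy, hsy, hyc⟩ := le_of_mem_face h2 hs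
        obtain ⟨z, hz⟩ := Multiset.exists_mem_of_ne_zero (g.type_ne_zero h2)
        obtain rfl := hg z hz
        have hs0 : s ≠ 0 := fun h0 => b.zero_notMem h2 (h0 ▸ hs)
        have hsd := h2 s (b.face_sub hs)
        rcases (cop_iff h2).1 h y hy z hz with h1 | h1 | h1
        · have := two_le_of_mem_cl h2 hyc
          omega
        · have := mdeg_mono hsx
          omega
        · exact h1 ((ncf_self hs0).mono hsy hsx)
      · exact hs
  · rw [mem_mul]
    constructor
    · exact fun hs => ⟨.inl hs, hd s hs⟩
    · tauto

lemma split_unique (h2 : ∀ m ∈ M, 2 ≤ mdeg m) {x : Mon (Fin t)} {b g b' g' : Letter M}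
    (he : b.mul g = b'.mul g') (h : b.Cop g) (h' : b'.Cop g') (hb : x ∉ b.type)
    (hg : ∀ y ∈ g.type, y = x) (hb' : x ∉ b'.type) (hg' : ∀ y ∈ g'.type, y = x) :
    b = b' ∧ g = g' := by
  obtain ⟨h3, h4, h5⟩ := split_eq h2 h hb hg
  obtain ⟨h3', h4', h5'⟩ := split_eq h2 h' hb' hg'
  have hgg : g = g' := Letter.ext (by rw [h3, h3', he]) (by rw [h4, h4', he])
  refine ⟨Letter.ext ?_ ?_, hgg⟩
  · have h6 : b.deg + g.deg = b'.deg + g'.deg := congrArg Letter.deg he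
    rw [hgg] at h6
    exact add_right_cancel h6
  · ext s
    rw [h5, h5', he, hgg]

lemma exists_pure_split (h2 : ∀ m ∈ M, 2 ≤ mdeg m) {a : Letter M} {x : Mon (Fin t)}
    (h : ∀ y ∈ a.type, y = x) (hc : a.type.card ≠ 1) :
    ∃ b g : Letter M, a = b.mul g ∧ b.Cop g ∧ b.type.card = 1 := by
  have hr := Multiset.eq_replicate_card.2 h
  have hx : x ∈ a.type := by
    obtain ⟨y, hy⟩ := Multiset.exists_mem_of_ne_zero (a.type_ne_zero h2)
    exact h y hy ▸ hy
  have hxc : x ∉ cl a.face := by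
    intro hxc
    apply hc
    have hu : units a.rem = 0 := by
      rw [Multiset.eq_zero_iff_forall_notMem]
      intro y hy
      have h1 := mdeg_of_mem_units hy
      have h3 := two_le_of_mem_cl h2 hxc
      rw [h y (mem_type.2 (.inr hy))] at h1
      omega
    rw [type, hu, add_zero, Finset.card_val, Finset.card_eq_one]
    refine ⟨x, Finset.eq_singleton_iff_unique_mem.2 ⟨hxc, fun y hy => ?_⟩⟩
    exact h y (mem_type.2 (.inl hy))
  have hx1 : mdeg x = 1 := mdeg_of_mem_units ((mem_type.1 hx).resolve_left hxc)
  have hf := face_eq_empty h2 hx1 h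
  obtain ⟨n, hn⟩ : ∃ n, a.type.card = n + 2 := by
    have : a.type.card ≠ 0 := fun h => a.type_ne_zero h2 (Multiset.card_eq_zero.1 h)
    exact ⟨a.type.card - 2, by omega⟩
  have hx0 := ne_zero_of_mem_type h2 hx
  have hm : mlcm (∅ : Finset (Mon (Fin t))) = 0 := rfl
  have hs : ∀ n : ℕ, mlcm (∅ : Finset (Mon (Fin t))) + (n + 1) • x ≠ 0 := by
    intro n
    rw [hm, zero_add, ← Multiset.sum_replicate]
    exact sum_ne_zero (Multiset.mem_replicate.2 ⟨by omega, rfl⟩) hx0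
  refine ⟨ofParts ∅ (Finset.empty_subset _) ((0 + 1) • x) (hs 0),
    ofParts ∅ (Finset.empty_subset _) ((n + 1) • x) (hs n), ?_, ?_, ?_⟩
  · apply Letter.ext
    · change a.deg = (0 + (0 + 1) • x) + (0 + (n + 1) • x)
      rw [← sum_type h2 a, hr, hn, Multiset.sum_replicate]
      module
    · rw [hf]
      rfl
  · rintro ⟨i, hi, -⟩
    exact hi rfl
  · rw [type_ofParts, cl_empty, zero_add, one_smul, units_of_mdeg_eq_one hx1]
    rfl

lemma pure_split_unique (h2 : ∀ m ∈ M, 2 ≤ mdeg m) {x : Mon (Fin t)} {b g b' g' : Letter M}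
    (he : b.mul g = b'.mul g') (h : b.Cop g) (hb : ∀ y ∈ b.type, y = x)
    (hg : ∀ y ∈ g.type, y = x) (hb' : ∀ y ∈ b'.type, y = x) (hg' : ∀ y ∈ g'.type, y = x)
    (hc : b.type.card = 1) (hc' : b'.type.card = 1) : b = b' ∧ g = g' := by
  obtain ⟨y, hy⟩ := Multiset.exists_mem_of_ne_zero (b.type_ne_zero h2)
  obtain ⟨z, hz⟩ := Multiset.exists_mem_of_ne_zero (g.type_ne_zero h2)
  have hcom := (cop_iff h2).1 h y hy z hz
  have hx0 := ne_zero_of_mem_type h2 hy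
  rw [hb y hy, hg z hz] at hcom
  rw [hb y hy] at hx0
  have hx1 := mdeg_eq_one_of_commute hcom hx0
  have hdeg : ∀ e : Letter M, (∀ y ∈ e.type, y = x) → e.type.card = 1 → e.deg = x := by
    intro e he hce
    rw [← sum_type h2 e, Multiset.eq_replicate_card.2 he, hce, Multiset.sum_replicate, one_smul]
  have hbb : b = b' := Letter.ext ((hdeg b hb hc).trans (hdeg b' hb' hc').symm)
    ((face_eq_empty h2 hx1 hb).trans (face_eq_empty h2 hx1 hb').symm)
  refine ⟨hbb, Letter.ext ?_ ((face_eq_empty h2 hx1 hg).trans (face_eq_empty h2 hx1 hg').symm)⟩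
  have h6 : b.deg + g.deg = b'.deg + g'.deg := congrArg Letter.deg he
  rw [hbb] at h6
  exact add_left_cancel h6

variable (k : Type*) [Field k]

/-- The coprime products and the component-preserving part of the Taylor differential. -/
def splitData (h2 : ∀ m ∈ M, 2 ≤ mdeg m) : SplitData k (Letter M) (Mon (Fin t)) where
  τ := type
  sz a := a.face.card
  ε a := sign k a.face.card
  c := cm k
  mul := mul
  d := dF k Keeps
  comm := Commute
  comm_symm := Commute.symm
  τ_ne := type_ne_zero h2
  ε_sq a := sign_sq _
  c_ne := (cm_ne_zero h2).trans (cop_iff h2)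
  τ_mul h := type_mul h2 ((cm_ne_zero h2).1 h)
  sz_mul h := (((cm_ne_zero h2).1 h).disj h2).card_mul
  ε_mul h := by
    rw [(((cm_ne_zero h2).1 h).disj h2).card_mul, sign_add]
  mul_assoc := mul_assoc
  c_assoc := cm_assoc
  d_ε h := by
    obtain ⟨s, hs, -, rfl⟩ := mem_support_dF h
    rw [← card_er hs, sign_succ, neg_neg]
  d_τ h := by
    obtain ⟨s, -, hs, rfl⟩ := mem_support_dF h
    exact type_er h2 hs
  leibniz {a b} h := by
    have h := (cm_ne_zero h2).1 h
    exact leibniz_of_disj (h.disj h2) (if_pos h) (fun s _ => if_pos (h.er_left s))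
      (fun s _ => if_pos (h.er_right s)) (fun s hs => keeps_mul_left h2 h hs)
      fun s hs => keeps_mul_right h2 h hs
  d_pure {a x} hx h := by
    obtain ⟨y, hy⟩ := Multiset.exists_mem_of_ne_zero (a.type_ne_zero h2)
    have h0 := ne_zero_of_mem_type h2 hy
    rw [h y hy] at h0
    rw [dF, face_eq_empty h2 (mdeg_eq_one_of_commute hx h0) h, Finset.filter_empty,
      Finset.sum_empty]
  split_exists hx hne := by
    obtain ⟨b, g, h, hc, h'⟩ := exists_split h2 hx hne
    exact ⟨b, g, h, (cm_ne_zero h2).2 hc, h'⟩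
  split_unique he h h' := split_unique h2 he ((cm_ne_zero h2).1 h) ((cm_ne_zero h2).1 h')
  pure_split_exists h hc := by
    obtain ⟨b, g, h, hc, h'⟩ := exists_pure_split h2 h hc
    exact ⟨b, g, h, (cm_ne_zero h2).2 hc, h'⟩
  pure_split_unique he h _ := pure_split_unique h2 he ((cm_ne_zero h2).1 h)

end Letter

end MonomialRings

namespace MonomialRings

namespace SplitData

variable {k Γ Θ : Type*} [Field k] (X : SplitData k Γ Θ)

lemma length_le (L : List Γ) : L.length ≤ ((L.map X.τ).sum).card := by
  induction L with
  | nil => simp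
  | cons a l ih =>
    have : 1 ≤ (X.τ a).card := Nat.one_le_iff_ne_zero.2 fun h => X.τ_ne a
        (Multiset.card_eq_zero.1 h)
    rw [List.map_cons, List.sum_cons, Multiset.card_add, List.length_cons]
    omega

/-- The amount by which the total weight of the letters exceeds the length of the list. -/
def excess (L : List Γ) : ℕ := ((L.map X.τ).sum).card - L.length

lemma excess_add_length (L : List Γ) : X.excess L + L.length = ((L.map X.τ).sum).card :=
  Nat.sub_add_cancel (X.length_le L)

lemma excess_of_inv {L L' : List Γ} (h : X.inv L' = X.inv L) :
    X.excess L' + L'.length = X.excess L + L.length := by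
  rw [excess_add_length, excess_add_length]
  simp only [inv, Prod.mk.injEq] at h
  rw [h.2.1]

lemma excess_of_map {L L' : List Γ} (h : L'.map X.τ = L.map X.τ) : X.excess L' = X.excess L := by
  have : L'.length = L.length := by simpa using congrArg List.length h
  rw [excess, excess, h, this]

/-- A filtered differential on lists whose associated graded operator is the derivation and whose
next term is the product of letters. -/
structure Perturbation (D : (List Γ →₀ k) →ₗ[k] (List Γ →₀ k)) (pc : ℕ → Set (List Γ))
    (w : Multiset Θ → ℕ) : Prop where
  sq : ∀ x, D (D x) = 0
  finite : ∀ n, (pc n).Finite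
  zero : pc 0 = ∅
  inv : ∀ {L L' n m}, L ∈ pc n → X.inv L' = X.inv L → n + L'.length = m + L.length → L' ∈ pc m
  dr_mem : ∀ {L n}, L ∈ pc (n + 1) → X.dr (Finsupp.single L 1) ∈ Finsupp.supported k k (pc n)
  rest : ∀ {L n}, L ∈ pc (n + 1) →
    D (Finsupp.single L 1) - X.dr (Finsupp.single L 1) - X.bm (Finsupp.single L 1)
      ∈ Finsupp.supported k k {L' | L' ∈ pc n ∧ X.excess L < X.excess L' ∧
        w (L.map X.τ).sum < w (L'.map X.τ).sum}

namespace Perturbation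

variable {X} {D : (List Γ →₀ k) →ₗ[k] (List Γ →₀ k)} {pc : ℕ → Set (List Γ)} {w : Multiset Θ → ℕ}

/-- Lists of excess at least `p`. -/
def fil (X : SplitData k Γ Θ) (pc : ℕ → Set (List Γ)) (p n : ℕ) : Set (List Γ) :=
  {L | L ∈ pc n ∧ p ≤ X.excess L}

/-- Lists of excess equal to `p`. -/
def gr (X : SplitData k Γ Θ) (pc : ℕ → Set (List Γ)) (p n : ℕ) : Set (List Γ) :=
  {L | L ∈ pc n ∧ X.excess L = p}

lemma dr_excess (P : X.Perturbation D pc w) {L : List Γ} {n : ℕ} (h : L ∈ pc (n + 1)) :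
    X.dr (Finsupp.single L 1)
    ∈ Finsupp.supported k k {L' | L' ∈ pc n ∧ X.excess L' = X.excess L} := by
  have := Submodule.mem_inf.2 ⟨P.dr_mem h, X.dr_mem_supported L⟩
  rw [← Finsupp.supported_inter] at this
  refine Finsupp.supported_mono ?_ this
  exact fun L' hL' => ⟨hL'.1, X.excess_of_map hL'.2⟩

lemma sub_dr_mem (P : X.Perturbation D pc w) {L : List Γ} {n : ℕ} (h : L ∈ pc (n + 1)) :
    D (Finsupp.single L 1) - X.dr (Finsupp.single L 1)
      ∈ Finsupp.supported k k {L' | L' ∈ pc n ∧ X.excess L < X.excess L'} := by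
  have h1 := Finsupp.supported_mono (M := k) (R := k)
    (t := {L' | L' ∈ pc n ∧ X.excess L < X.excess L'}) (fun L' hL' => by
      refine ⟨P.inv h hL'.1 ?_, ?_⟩
      · have := hL'.2
        omega
      · have := X.excess_of_inv hL'.1
        have := hL'.2
        omega) (X.bm_mem_supported L)
  have h2 := Finsupp.supported_mono (M := k) (R := k)
    (t := {L' | L' ∈ pc n ∧ X.excess L < X.excess L'}) (fun L' hL' => ⟨hL'.1, hL'.2.1⟩) (P.rest h)
  have := Submodule.add_mem _ h2 h1
  rwa [sub_add_cancel] at this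

lemma D_mem (P : X.Perturbation D pc w) {L : List Γ} {n : ℕ} (h : L ∈ pc (n + 1)) :
    D (Finsupp.single L 1)
    ∈ Finsupp.supported k k {L' | L' ∈ pc n ∧ X.excess L ≤ X.excess L'} := by
  have h1 := Finsupp.supported_mono (M := k) (R := k)
    (t := {L' | L' ∈ pc n ∧ X.excess L ≤ X.excess L'}) (fun L' hL' => ⟨hL'.1, hL'.2.ge⟩)
    (P.dr_excess h)
  have h2 := Finsupp.supported_mono (M := k) (R := k)
    (t := {L' | L' ∈ pc n ∧ X.excess L ≤ X.excess L'}) (fun L' hL' => ⟨hL'.1, hL'.2.le⟩)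
    (P.sub_dr_mem h)
  have := Submodule.add_mem _ h2 h1
  rwa [sub_add_cancel] at this

lemma D_mem_fil (P : X.Perturbation D pc w) {p n : ℕ} {x : List Γ →₀ k}
    (hx : x ∈ Finsupp.supported k k (fil X pc p (n + 1))) :
    D x ∈ Finsupp.supported k k (fil X pc p n) := by
  refine supported_induction D (fun L hL => ?_) hx
  refine Finsupp.supported_mono ?_ (P.D_mem hL.1)
  exact fun L' hL' => ⟨hL'.1, hL.2.trans hL'.2⟩

variable [Nonempty Θ]

lemma hom_mem (P : X.Perturbation D pc w) {L : List Γ} {n : ℕ} (h : L ∈ pc n) :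
    X.hom (Finsupp.single L 1)
    ∈ Finsupp.supported k k {L' | L' ∈ pc (n + 1) ∧ X.excess L' + 1 = X.excess L ∧
        w (L'.map X.τ).sum = w (L.map X.τ).sum} := by
  refine Finsupp.supported_mono ?_ (X.hom_mem_like L)
  refine fun L' hL' => ⟨P.inv h hL'.1 ?_, ?_, ?_⟩
  · have := hL'.2
    omega
  · have := X.excess_of_inv hL'.1
    have := hL'.2
    omega
  · have := hL'.1
    simp only [SplitData.inv, Prod.mk.injEq] at this
    rw [this.2.1]

lemma homotopy_triangular (P : X.Perturbation D pc w) {p n : ℕ} {L : List Γ}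
    (hL : L ∈ fil X pc (p + 1) n) :
    D (X.hom (Finsupp.single L 1)) + X.hom (D (Finsupp.single L 1)) - Finsupp.single L 1
      ∈ Finsupp.supported k k {L' | L' ∈ fil X pc (p + 1) n ∧
        toLex (w (L.map X.τ).sum, X.rho L) < toLex (w (L'.map X.τ).sum, X.rho L')} := by
  obtain ⟨hL, hp⟩ := hL
  cases n with
  | zero =>
    rw [P.zero] at hL
    exact absurd hL (Set.notMem_empty _)
  | succ n =>
    set T := Finsupp.supported k k {L' | L' ∈ fil X pc (p + 1) (n + 1) ∧
        toLex (w (L.map X.τ).sum, X.rho L) < toLex (w (L'.map X.τ).sum, X.rho L')} with hT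
    let R : (List Γ →₀ k) →ₗ[k] (List Γ →₀ k) := D - X.dr - X.bm
    have hR : ∀ x, R x = D x - X.dr x - X.bm x := fun x => rfl
    have h1 : X.bm (X.hom (Finsupp.single L 1)) + X.hom (X.bm (Finsupp.single L 1))
        - Finsupp.single L 1 ∈ T := by
      have hlt : L.length < ((L.map X.τ).sum).card := by
        have := X.excess_add_length L
        omega
      refine Finsupp.supported_mono ?_ (X.hom_triangular L hlt)
      rintro L' ⟨⟨h1, h2⟩, h3⟩
      have h4 := X.excess_of_inv h1
      refine ⟨⟨P.inv hL h1 (by omega), by omega⟩, ?_⟩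
      simp only [SplitData.inv, Prod.mk.injEq] at h1
      rw [Prod.Lex.toLex_lt_toLex, h1.2.1]
      exact .inr ⟨rfl, h3⟩
    have h2 : R (X.hom (Finsupp.single L 1)) ∈ T := by
      refine supported_induction R (fun L' hL' => ?_) (P.hom_mem hL)
      refine Finsupp.supported_mono ?_ (P.rest hL'.1)
      rintro L'' ⟨h3, h4, h5⟩
      have h6 := hL'.2.1
      refine ⟨⟨h3, by omega⟩, ?_⟩
      rw [hL'.2.2] at h5
      rw [Prod.Lex.toLex_lt_toLex]
      exact .inl h5
    have h3 : X.hom (R (Finsupp.single L 1)) ∈ T := by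
      refine supported_induction X.hom (fun L' hL' => ?_) (P.rest hL)
      refine Finsupp.supported_mono ?_ (P.hom_mem hL'.1)
      rintro L'' ⟨h3, h4, h5⟩
      have h6 := hL'.2.1
      have h7 := hL'.2.2
      refine ⟨⟨h3, by omega⟩, ?_⟩
      rw [Prod.Lex.toLex_lt_toLex]
      exact .inl (by rw [h5]; exact h7)
    have h4 := X.dr_hom (Finsupp.single L 1)
    have h5 : D (X.hom (Finsupp.single L 1)) + X.hom (D (Finsupp.single L 1)) - Finsupp.single L 1
        = (X.bm (X.hom (Finsupp.single L 1)) + X.hom (X.bm (Finsupp.single L 1))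
          - Finsupp.single L 1) + R (X.hom (Finsupp.single L 1)) + X.hom (R (Finsupp.single L 1))
          + (X.dr (X.hom (Finsupp.single L 1)) + X.hom (X.dr (Finsupp.single L 1))) := by
      rw [hR, hR, map_sub, map_sub]
      abel
    rw [h5, h4, add_zero]
    exact T.add_mem (T.add_mem h1 h2) h3

lemma exact_fil (P : X.Perturbation D pc w) {p n : ℕ} {x : List Γ →₀ k}
    (hx : x ∈ Finsupp.supported k k (fil X pc (p + 1) n)) (hDx : D x = 0) :
    ∃ y ∈ Finsupp.supported k k (fil X pc p (n + 1)), D y = x := by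
  cases n with
  | zero =>
    refine ⟨0, Submodule.zero_mem _, ?_⟩
    have : fil X pc (p + 1) 0 = ∅ := by
      rw [fil, P.zero]
      simp
    rw [this, Finsupp.supported_empty, Submodule.mem_bot] at hx
    rw [hx, map_zero]
  | succ n =>
    refine bounds_of_triangular_homotopy (s₀ := fil X pc (p + 1) n) (s₁ := fil X pc (p + 1) (n + 1))
      ((P.finite _).subset fun _ h => h.1) ((P.finite _).subset fun _ h => h.1) D X.hom
      (fun L => toLex (w (L.map X.τ).sum, X.rho L)) P.sq
      (fun L hL => P.D_mem_fil (single_mem_supported hL 1))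
      (fun L hL => ?_)
      (fun L hL => P.homotopy_triangular hL) (fun L hL => P.homotopy_triangular hL) x hx hDx
    refine Finsupp.supported_mono ?_ (P.hom_mem hL.1)
    refine fun L' hL' => ⟨hL'.1, ?_⟩
    have h1 := hL.2
    have h2 := hL'.2.1
    omega

lemma homDim_gr (P : X.Perturbation D pc w) (p n : ℕ) :
    homDim X.dr (Finsupp.supported k k (gr X pc p (n + 1))) (Finsupp.supported k k
        (gr X pc p (n + 2)))
      = homDim D (Finsupp.supported k k (fil X pc p (n + 1)))
          (Finsupp.supported k k (fil X pc p (n + 2)))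
        + homDim D (Finsupp.supported k k (fil X pc (p + 1) n))
          (Finsupp.supported k k (fil X pc (p + 1) (n + 1))) := by
  have hfin : ∀ n, (fil X pc p n).Finite := fun n => (P.finite n).subset fun _ h => h.1
  have := finiteDimensional_supported (k := k) (hfin (n + 1))
  have := finiteDimensional_supported (k := k) (hfin (n + 2))
  have hpart : ∀ n, fil X pc p n = gr X pc p n ∪ fil X pc (p + 1) n := by
    intro n
    ext L
    simp only [fil, gr, Set.mem_union, Set.mem_ofPred]
    constructor
    · rintro ⟨h1, h2⟩
      rcases h2.eq_or_lt with h | h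
      · exact .inl ⟨h1, h.symm⟩
      · exact .inr ⟨h1, h⟩
    · rintro (⟨h1, h2⟩ | ⟨h1, h2⟩)
      · exact ⟨h1, h2.ge⟩
      · exact ⟨h1, by omega⟩
  have hdis : ∀ n, Disjoint (Finsupp.supported k k (gr X pc p n))
      (Finsupp.supported k k (fil X pc (p + 1) n)) := by
    intro n
    apply disjoint_supported
    rw [Set.disjoint_left]
    intro L h1 h2
    have h1 := h1.2
    have h2 := h2.2
    omega
  have hdr : ∀ n, ∀ x ∈ Finsupp.supported k k (gr X pc p (n + 1)),
      X.dr x ∈ Finsupp.supported k k (gr X pc p n) := by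
    intro n x hx
    refine supported_induction X.dr (fun L hL => ?_) hx
    refine Finsupp.supported_mono ?_ (P.dr_excess hL.1)
    exact fun L' hL' => ⟨hL'.1, hL'.2.trans hL.2⟩
  have hsub : ∀ n, ∀ x ∈ Finsupp.supported k k (gr X pc p (n + 1)),
      D x - X.dr x ∈ Finsupp.supported k k (fil X pc (p + 1) n) := by
    intro n x hx
    refine supported_induction (D - X.dr) (fun L hL => ?_) hx
    refine Finsupp.supported_mono ?_ (P.sub_dr_mem hL.1)
    refine fun L' hL' => ⟨hL'.1, ?_⟩
    have h1 := hL.2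
    have h2 := hL'.2
    omega
  exact homDim_graded_piece D X.dr _ _ (Finsupp.supported k k (fil X pc (p + 1) n))
    (Finsupp.supported k k (fil X pc (p + 1) (n + 1)))
    (Finsupp.supported k k (fil X pc (p + 1) (n + 2))) (Finsupp.supported k k (gr X pc p n))
    (Finsupp.supported k k (gr X pc p (n + 1))) (Finsupp.supported k k (gr X pc p (n + 2)))
    (supported_sup_of_partition (hpart _)) (supported_sup_of_partition (hpart _))
    (hdis _) (hdis _) (hdis _) P.sq (fun x hx => P.D_mem_fil hx) (fun x hx => P.D_mem_fil hx)
    (hdr _) (hdr _) (hsub _) (hsub _) (fun x hx h => P.exact_fil hx h)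
    fun x hx h => P.exact_fil hx h

lemma homDim_fil (P : X.Perturbation D pc w) (p n : ℕ) :
    homDim D (Finsupp.supported k k (fil X pc p n)) (Finsupp.supported k k (fil X pc p (n + 1)))
      = ∑ q ∈ Finset.range n, (-1 : ℤ) ^ q *
        homDim X.dr (Finsupp.supported k k (gr X pc (p + q) (n - q)))
          (Finsupp.supported k k (gr X pc (p + q) (n - q + 1))) := by
  induction n generalizing p with
  | zero =>
    have h0 : fil X pc p 0 = ∅ := by
      rw [fil, P.zero]
      simp
    refine homDim_eq_zero D _ _ (fun x hx => P.D_mem_fil hx) P.sq fun x hx _ => ?_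
    rw [h0, Finsupp.supported_empty, Submodule.mem_bot] at hx
    exact ⟨0, Submodule.zero_mem _, by rw [hx, map_zero]⟩
  | succ n ih =>
    have h := P.homDim_gr p n
    rw [ih] at h
    rw [Finset.sum_range_succ']
    simp only [pow_zero, one_mul, add_zero, Nat.sub_zero]
    rw [h]
    simp only [pow_succ, Nat.succ_sub_succ_eq_sub, mul_neg, mul_one, neg_mul,
      Finset.sum_neg_distrib, add_assoc, add_comm 1]
    abel

/-- The homology of a perturbation in terms of the homology of the derivation. -/
theorem homDim_eq (P : X.Perturbation D pc w) (n : ℕ) :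
    homDim D (Finsupp.supported k k (pc n)) (Finsupp.supported k k (pc (n + 1)))
      = ∑ q ∈ Finset.range n, (-1 : ℤ) ^ q *
        homDim X.dr (Finsupp.supported k k (gr X pc q (n - q)))
          (Finsupp.supported k k (gr X pc q (n - q + 1))) := by
  have h : ∀ n, fil X pc 0 n = pc n := fun n => by simp [fil]
  have := P.homDim_fil 0 n
  simpa only [h, zero_add] using this

end Perturbation

end SplitData

end MonomialRings

namespace MonomialRings

section Supports

variable {k : Type*} [Field k] {Γ : Type*}

lemma der_add (d d' : Γ → Γ →₀ k) (ε : Γ → k) (x : List Γ →₀ k) :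
    der (fun a => d a + d' a) ε x = der d ε x + der d' ε x := by
  refine linearMap_eq_of_single (f := der (fun a => d a + d' a) ε) (g := der d ε + der d' ε)
    (fun l => ?_) x
  induction l with
  | nil => simp
  | cons a l ih =>
    rw [← consL_single, LinearMap.add_apply, der_cons, der_cons, der_cons, ih, LinearMap.add_apply,
      map_add, map_add, LinearMap.add_apply]
    module

lemma mulHead_add (c c' : Γ → Γ → k) (mul : Γ → Γ → Γ) (a : Γ) (x : List Γ →₀ k) :
    mulHead (fun a b => c a b + c' a b) mul a x = mulHead c mul a x + mulHead c' mul a x := by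
  refine linearMap_eq_of_single (f := mulHead (fun a b => c a b + c' a b) mul a)
    (g := mulHead c mul a + mulHead c' mul a) (fun l => ?_) x
  cases l with
  | nil => simp
  | cons b l =>
    rw [← consL_single, LinearMap.add_apply, mulHead_cons, mulHead_cons, mulHead_cons, add_smul]

lemma barMul_add (c c' : Γ → Γ → k) (mul : Γ → Γ → Γ) (ε : Γ → k) (x : List Γ →₀ k) :
    barMul (fun a b => c a b + c' a b) mul ε x = barMul c mul ε x + barMul c' mul ε x := by
  refine linearMap_eq_of_single (f := barMul (fun a b => c a b + c' a b) mul ε)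
    (g := barMul c mul ε + barMul c' mul ε) (fun l => ?_) x
  induction l with
  | nil => simp
  | cons a l ih =>
    rw [← consL_single, LinearMap.add_apply, barMul_cons, barMul_cons, barMul_cons, ih,
      LinearMap.add_apply, map_add, mulHead_add]
    module

lemma der_mem_supported (d : Γ → Γ →₀ k) (ε : Γ → k) (L : List Γ) :
    der d ε (Finsupp.single L 1) ∈ Finsupp.supported k k
      {L' | ∃ l₁ a l₂ b, L = l₁ ++ a :: l₂ ∧ b ∈ (d a).support ∧ L' = l₁ ++ b :: l₂} := by
  induction L with
  | nil => simp
  | cons a l ih =>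
    rw [← consL_single, der_cons]
    refine Submodule.add_mem _ (Submodule.neg_mem _ ?_) (Submodule.smul_mem _ _ ?_)
    · refine consS_mem_supported (s := {l}) ?_ (single_mem_supported (Set.mem_singleton l) 1)
      rintro b hb _ rfl
      exact ⟨[], a, _, b, rfl, hb, rfl⟩
    · refine consL_mem_supported ?_ ih
      rintro _ ⟨l₁, a', l₂, b, rfl, hb, rfl⟩
      exact ⟨a :: l₁, a', l₂, b, rfl, hb, rfl⟩

lemma barMul_mem_supported (c : Γ → Γ → k) (mul : Γ → Γ → Γ) (ε : Γ → k) (L : List Γ) :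
    barMul c mul ε (Finsupp.single L 1) ∈ Finsupp.supported k k
      {L' | ∃ l₁ a b l₂, L = l₁ ++ a :: b :: l₂ ∧ c a b ≠ 0 ∧ L' = l₁ ++ mul a b :: l₂} := by
  induction L with
  | nil => simp
  | cons a l ih =>
    rw [← consL_single, barMul_cons]
    refine Submodule.add_mem _ (Submodule.smul_mem _ _ ?_) (Submodule.smul_mem _ _ ?_)
    · refine consL_mem_supported ?_ ih
      rintro _ ⟨l₁, a', b, l₂, rfl, hb, rfl⟩
      exact ⟨a :: l₁, a', b, l₂, rfl, hb, rfl⟩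
    · refine mulHead_mem_supported (s := {l}) ?_ (single_mem_supported (Set.mem_singleton l) 1)
      rintro b l' rfl hc
      exact ⟨[], a, b, l', rfl, hc, rfl⟩

end Supports

namespace Letter

variable {t : ℕ} {M : Finset (Mon (Fin t))}

lemma card_type (a : Letter M) :
    a.type.card + mdeg (mlcm a.face) = (cl a.face).card + mdeg a.deg := by
  rw [← mlcm_add_rem a, mdeg_add, type, Multiset.card_add, card_units, Finset.card_val]
  ring

/-- The weight counting variables twice and other monomials once. -/
def weight (s : Multiset (Mon (Fin t))) : ℕ := (s.map fun x => if mdeg x = 1 then 2 else 1).sum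

lemma weight_add (s s' : Multiset (Mon (Fin t))) : weight (s + s') = weight s + weight s' := by
  simp [weight]

lemma weight_type (h2 : ∀ m ∈ M, 2 ≤ mdeg m) (a : Letter M) :
    weight a.type + 2 * mdeg (mlcm a.face) = (cl a.face).card + 2 * mdeg a.deg := by
  have h1 : weight (cl a.face).val = (cl a.face).card := by
    rw [weight, Multiset.map_congr rfl (g := fun _ => 1)]
    · simp
    · intro x hx
      have := two_le_of_mem_cl h2 hx
      rw [if_neg (by omega)]
  have h3 : weight (units a.rem) = 2 * mdeg a.rem := by
    rw [weight, Multiset.map_congr rfl (g := fun _ => 2)]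
    · simp [card_units, mul_comm]
    · intro x hx
      rw [if_pos (mdeg_of_mem_units hx)]
  rw [← mlcm_add_rem a, mdeg_add, type, weight_add, h1, h3]
  ring

lemma type_er_lt (h2 : ∀ m ∈ M, 2 ≤ mdeg m) {a : Letter M} {s : Mon (Fin t)}
    (h : ¬ Keeps a.face s) :
    a.type.card < (a.er s).type.card ∧ weight a.type < weight (a.er s).type := by
  have hs : ∀ s ∈ a.face, 2 ≤ mdeg s := fun s hs => h2 s (a.face_sub hs)
  have h1 := cl_lt hs (eraseV_subset a.face s) h (r := 1) le_rfl
  have h3 := cl_lt hs (eraseV_subset a.face s) h (r := 2) (by norm_num)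
  have h4 := card_type a
  have h5 := card_type (a.er s)
  have h6 := weight_type h2 a
  have h7 := weight_type h2 (a.er s)
  change _ + mdeg (mlcm (eraseV a.face s)) = (cl (eraseV a.face s)).card + mdeg a.deg at h5
  change _ + 2 * mdeg (mlcm (eraseV a.face s)) = (cl (eraseV a.face s)).card + 2 * mdeg a.deg at h7
  omega

lemma type_mul_lt (h2 : ∀ m ∈ M, 2 ≤ mdeg m) {a b : Letter M} (h : ¬ a.Cop b) :
    a.type.card + b.type.card ≤ (a.mul b).type.card ∧
      weight a.type + weight b.type < weight (a.mul b).type := by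
  have h1 := card_cl_add_card_cl_le (a.zero_notMem h2) (b.zero_notMem h2)
  have h3 := card_shared_le (mlcm a.face) (mlcm b.face)
  have h4 := mdeg_inf_pos (not_not.1 h)
  have h5 := mdeg_add_mdeg_mlcm (mlcm a.face) (mlcm b.face)
  rw [← mlcm_union] at h5
  have h6 := card_type a
  have h7 := card_type b
  have h8 := card_type (a.mul b)
  have h9 := weight_type h2 a
  have h10 := weight_type h2 b
  have h11 := weight_type h2 (a.mul b)
  change _ + mdeg (mlcm (a.face ∪ b.face)) = (cl (a.face ∪ b.face)).card + mdeg (a.deg + b.deg) at h8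
  change _ + 2 * mdeg (mlcm (a.face ∪ b.face))
    = (cl (a.face ∪ b.face)).card + 2 * mdeg (a.deg + b.deg) at h11
  rw [mdeg_add] at h8 h11
  omega

variable (k : Type*) [Field k]

/-- The differential of the bar construction of the Taylor resolution. -/
def tbar : (List (Letter M) →₀ k) →ₗ[k] (List (Letter M) →₀ k) :=
  der (dF k fun _ _ => True) (fun a => sign k a.face.card)
    + barMul (c k) mul fun a => sign k a.face.card

lemma tbar_nil (r : k) : tbar k (Finsupp.single ([] : List (Letter M)) r) = 0 := by
  simp [tbar]

lemma tbar_cons (a : Letter M) (x : List (Letter M) →₀ k) : tbar k (consL a x)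
    = -consS (dF k (fun _ _ => True) a) x + sign k a.face.card • consL a (tbar k x)
      + sign k a.face.card • mulHead (c k) mul a x := by
  simp only [tbar, LinearMap.add_apply, der_cons, barMul_cons, map_add, smul_add]
  abel

theorem tbar_tbar (x : List (Letter M) →₀ k) : tbar k (tbar k x) = 0 := by
  refine der_add_barMul_sq _ _ _ _ (fun a => sign_sq _) ?_ ?_ ?_ leibniz mul_assoc c_assoc x
  · intro a b hb
    obtain ⟨s, hs, -, rfl⟩ := mem_support_dF hb
    rw [← card_er hs, sign_succ, neg_neg]
  · exact fun a => dF_dF (fun _ _ _ _ _ _ _ _ => ⟨trivial, trivial⟩) a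
  · intro a b h
    have : a.Disj b := by
      by_contra h'
      exact h (if_neg h')
    rw [this.card_mul, sign_add]

variable (M) in
/-- Lists of letters of given multidegree and homological degree `n - 1`. -/
def lists (α : Mon (Fin t)) (n : ℕ) : Set (List (Letter M)) :=
  {L | (L.map deg).sum = α ∧ (L.map fun a => a.face.card + 1).sum + 1 = n}


lemma finite_deg_sum (α : Mon (Fin t)) : {L : List (Letter M) | (L.map deg).sum = α}.Finite := by
  have hA : {a : Letter M | a.deg ≤ α}.Finite := by
    refine Set.Finite.of_finite_image (f := fun a => (a.deg, a.face))
      (((Set.finite_Iic α).prod M.powerset.finite_toSet).subset ?_) ?_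
    · rintro _ ⟨a, ha, rfl⟩
      exact ⟨ha, by simpa using a.face_sub⟩
    · intro a _ b _ h
      simp only [Prod.mk.injEq] at h
      exact Letter.ext h.1 h.2
  have hle : ∀ L : List (Letter M), ∀ a ∈ L, a.deg ≤ (L.map deg).sum := fun L a ha =>
    List.le_sum_of_mem (List.mem_map_of_mem ha)
  have hlen : ∀ L : List (Letter M), L.length ≤ mdeg (L.map deg).sum := by
    intro L
    induction L with
    | nil => simp
    | cons a l ih =>
      have : mdeg a.deg ≠ 0 := fun h => a.deg_ne (by
        rw [mdeg, Finset.sum_eq_zero_iff] at h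
        exact funext fun i => h i (Finset.mem_univ i))
      rw [List.map_cons, List.sum_cons, mdeg_add, List.length_cons]
      omega
  have := hA.to_subtype
  refine ((List.finite_length_le {a : Letter M | a.deg ≤ α} (mdeg α)).image
    (List.map Subtype.val)).subset ?_
  intro L hL
  have hL : (L.map deg).sum = α := hL
  refine ⟨L.attach.map fun a => ⟨a.1, (hle L a.1 a.2).trans hL.le⟩, ?_, ?_⟩
  · have := hlen L
    rw [hL] at this
    change (L.attach.map _).length ≤ _
    simpa using this
  · simp

lemma lists_finite (α : Mon (Fin t)) (n : ℕ) : (lists M α n).Finite :=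
  (finite_deg_sum α).subset fun _ h => h.1

lemma sum_type_list (h2 : ∀ m ∈ M, 2 ≤ mdeg m) (L : List (Letter M)) :
    (L.map type).sum.sum = (L.map deg).sum := by
  induction L with
  | nil => simp
  | cons a l ih => simp [ih, sum_type h2]

lemma sum_succ_eq {A : Type*} (f : A → ℕ) (L : List A) :
    (L.map fun a => f a + 1).sum = (L.map f).sum + L.length := by
  induction L with
  | nil => rfl
  | cons a l ih =>
    simp only [List.map_cons, List.sum_cons, List.length_cons, ih]
    ring

theorem perturbation (h2 : ∀ m ∈ M, 2 ≤ mdeg m) (α : Mon (Fin t)) :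
    (splitData k h2).Perturbation (tbar k) (lists M α) weight where
  sq := tbar_tbar k
  finite := lists_finite α
  zero := by
    ext L
    simp [lists]
  inv {L L' n m} hL h hn := by
    obtain ⟨rfl, rfl⟩ := hL
    simp only [SplitData.inv, Prod.mk.injEq, splitData] at h
    refine ⟨?_, ?_⟩
    · rw [← sum_type_list h2, ← sum_type_list h2, h.2.1]
    · rw [sum_succ_eq] at hn ⊢
      rw [h.2.2]
      omega
  dr_mem {L n} hL := by
    refine Finsupp.supported_mono ?_ (der_mem_supported _ _ L)
    rintro _ ⟨l₁, a, l₂, b, rfl, hb, rfl⟩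
    obtain ⟨s, hs, -, rfl⟩ := mem_support_dF hb
    obtain ⟨rfl, h⟩ := hL
    have := card_er hs
    refine ⟨by simp [er], ?_⟩
    simp only [List.map_append, List.map_cons, List.sum_append, List.sum_cons] at h ⊢
    omega
  rest {L n} hL := by
    have e1 : (fun a : Letter M => dF k (fun _ _ => True) a)
        = fun a => dF k Keeps a + dF k (fun S s => ¬ Keeps S s) a := by
      funext a
      rw [dF, dF, dF, Finset.sum_filter_add_sum_filter_not, Finset.filter_true]
    have e2 : c k (M := M) = fun a b => cm k a b + (if a.Cop b then 0 else c k a b) := by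
      funext a b
      rw [cm]
      split_ifs <;> simp
    have e3 : tbar k (Finsupp.single L 1) - (splitData k h2).dr (Finsupp.single L 1)
        - (splitData k h2).bm (Finsupp.single L 1)
        = der (dF k fun S s => ¬ Keeps S s) (fun a => sign k a.face.card) (Finsupp.single L 1)
          + barMul (fun a b => if a.Cop b then 0 else c k a b) mul
            (fun a => sign k a.face.card) (Finsupp.single L 1) := by
      have e4 := barMul_add (cm k (M := M)) (fun a b => if a.Cop b then 0 else c k a b) mul
        (fun a => sign k a.face.card) (Finsupp.single L 1)
      rw [← e2] at e4
      rw [tbar, LinearMap.add_apply, e4]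
      rw [show (dF k fun _ _ => True) = _ from e1, der_add]
      simp only [SplitData.dr, SplitData.bm, splitData]
      abel
    rw [e3]
    have hexc := (splitData k h2).excess_add_length
    simp only [splitData] at hexc
    refine Submodule.add_mem _ ?_ ?_
    · refine Finsupp.supported_mono ?_ (der_mem_supported _ _ L)
      rintro _ ⟨l₁, a, l₂, b, rfl, hb, rfl⟩
      obtain ⟨s, hs, hk, rfl⟩ := mem_support_dF hb
      have h3 := type_er_lt h2 hk
      have h4 := hexc (l₁ ++ a :: l₂)
      have h5 := hexc (l₁ ++ a.er s :: l₂)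
      obtain ⟨rfl, h⟩ := hL
      have := card_er hs
      simp only [List.map_append, List.map_cons, List.sum_append, List.sum_cons,
        Multiset.card_add, List.length_append, List.length_cons] at h h4 h5
      refine ⟨⟨by simp [er], ?_⟩, ?_, ?_⟩
      · simp only [List.map_append, List.map_cons, List.sum_append, List.sum_cons]
        omega
      · simp only [splitData]
        omega
      · simp only [splitData, List.map_append, List.map_cons, List.sum_append, List.sum_cons,
          weight_add]
        omega
    · refine Finsupp.supported_mono ?_ (barMul_mem_supported _ _ _ L)
      rintro _ ⟨l₁, a, b, l₂, rfl, hc, rfl⟩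
      have hcop : ¬ a.Cop b := fun h => hc (if_pos h)
      have hdis : a.Disj b := by
        by_contra h
        rw [if_neg hcop, c, if_neg h] at hc
        exact hc rfl
      have h3 := type_mul_lt h2 hcop
      have h4 := hexc (l₁ ++ a :: b :: l₂)
      have h5 := hexc (l₁ ++ a.mul b :: l₂)
      obtain ⟨rfl, h⟩ := hL
      have := hdis.card_mul
      simp only [List.map_append, List.map_cons, List.sum_append, List.sum_cons,
        Multiset.card_add, List.length_append, List.length_cons] at h h4 h5
      refine ⟨⟨by simp [mul, add_assoc], ?_⟩, ?_, ?_⟩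
      · simp only [List.map_append, List.map_cons, List.sum_append, List.sum_cons]
        omega
      · simp only [splitData]
        omega
      · simp only [splitData, List.map_append, List.map_cons, List.sum_append, List.sum_cons,
          weight_add]
        omega

end Letter

end MonomialRings

namespace MonomialRings

namespace Letter

variable {t : ℕ} {M : Finset (Mon (Fin t))} {k : Type*} [Field k]

/-- Insertion of an exterior generator. -/
def ins (a : Letter M) (s : Mon (Fin t)) (hs : s ∈ M) (hle : s ≤ a.deg) : Letter M where
  deg := a.deg
  face := a.face ∪ {s}
  deg_ne := a.deg_ne
  face_sub := Finset.union_subset a.face_sub (Finset.singleton_subset_iff.2 hs)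
  le_deg := by
    rw [mlcm_union]
    exact sup_le a.le_deg (by simpa [mlcm] using hle)

lemma mem_ins {a : Letter M} {s : Mon (Fin t)} {hs : s ∈ M} {hle : s ≤ a.deg} {x : Mon (Fin t)} :
    x ∈ (a.ins s hs hle).face ↔ x ∈ a.face ∨ x = s := by
  simp [ins, or_comm]

variable (k) in
/-- Exterior multiplication by a generator that depends only on the multidegree. -/
def cone (v : Mon (Fin t) → Mon (Fin t)) (a : Letter M) : Letter M →₀ k :=
  if h : (v a.deg ∈ M ∧ v a.deg ≤ a.deg) ∧ v a.deg ∉ a.face then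
    Finsupp.single (a.ins (v a.deg) h.1.1 h.1.2) ((-1) ^ rankIn a.face (v a.deg))
  else 0

lemma mem_support_cone {v : Mon (Fin t) → Mon (Fin t)} {a b : Letter M}
    (h : b ∈ (cone k v a).support) : b.deg = a.deg ∧ b.face.card = a.face.card + 1 ∧
      ∀ x ∈ b.face, x ∈ a.face ∨ x = v a.deg := by
  rw [cone] at h
  split_ifs at h with h'
  · obtain rfl := Finset.mem_singleton.1 (Finsupp.support_single_subset h)
    refine ⟨rfl, ?_, fun x hx => mem_ins.1 hx⟩
    rw [ins, Finset.card_union_of_disjoint (Finset.disjoint_singleton_right.2 h'.2),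
      Finset.card_singleton]
  · simp at h

lemma cone_homotopy {v : Mon (Fin t) → Mon (Fin t)} {a : Letter M}
    (hM : v a.deg ∈ M) (hle : v a.deg ≤ a.deg) :
    linExt (dF k fun _ _ => True) (cone k v a) + linExt (cone k v) (dF k (fun _ _ => True) a)
      = Finsupp.single a 1 := by
  rw [linExt_dF]
  simp only [Finset.filter_true]
  by_cases hv : v a.deg ∈ a.face
  · rw [cone, dif_neg (fun h => h.2 hv), map_zero, zero_add,
      Finset.sum_eq_single_of_mem _ hv]
    · have h1 : v (a.er (v a.deg)).deg ∉ (a.er (v a.deg)).face := by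
        rw [mem_er]
        exact fun h => h.1 rfl
      rw [cone, dif_pos ⟨⟨hM, hle⟩, h1⟩, Finsupp.smul_single, smul_eq_mul]
      have h2 : rankIn a.face (v a.deg) = rankIn (a.er (v a.deg)).face (v a.deg) :=
        rankIn_eraseV_self hv
      change Finsupp.single _ (_ * (-1) ^ rankIn (a.er (v a.deg)).face (v a.deg)) = _
      rw [h2, ← pow_add, Even.neg_one_pow ⟨_, rfl⟩]
      congr 1
      refine Letter.ext rfl ?_
      ext x
      rw [mem_ins, mem_er]
      change (x ≠ v a.deg ∧ _) ∨ x = v a.deg ↔ _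
      by_cases hx : x = v a.deg <;> simp [hx, hv]
    · intro s hs hne
      rw [cone, dif_neg, smul_zero]
      exact fun h => h.2 (mem_er.2 ⟨hne.symm, hv⟩)
  · have hb : ∃ b, b = a.ins _ hM hle := ⟨_, rfl⟩
    obtain ⟨b, hb⟩ := hb
    have hmem : v a.deg ∈ b.face := by rw [hb, mem_ins]; exact .inr rfl
    have hbe : b.er (v a.deg) = a := by
      rw [hb]
      refine Letter.ext rfl ?_
      ext x
      rw [mem_er, mem_ins]
      by_cases hx : x = v a.deg <;> simp [hx, hv]
    have hrk : rankIn b.face (v a.deg) = rankIn a.face (v a.deg) := by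
      have h := rankIn_eraseV_self hmem
      change _ = rankIn (b.er (v a.deg)).face _ at h
      rw [h, hbe]
    have hset : b.face.erase (v a.deg) = a.face := by
      ext x
      rw [Finset.mem_erase, hb, mem_ins]
      by_cases hx : x = v a.deg <;> simp [hx, hv]
    have hca : cone k v a = Finsupp.single b ((-1) ^ rankIn a.face (v a.deg)) := by
      rw [cone, dif_pos ⟨⟨hM, hle⟩, hv⟩, hb]
    rw [hca, linExt_single, dF, Finset.filter_true, ← Finset.add_sum_erase _ _ hmem, hset, smul_add,
      smul_smul, hrk, ← pow_add, Even.neg_one_pow ⟨_, rfl⟩, one_smul, hbe, add_assoc,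
          Finset.smul_sum,
      ← Finset.sum_add_distrib, Finset.sum_eq_zero, add_zero]
    intro s hs
    have hne : s ≠ v a.deg := fun h => hv (h ▸ hs)
    have h1 : v (a.er s).deg ∉ (a.er s).face := fun h => hv (mem_er.1 h).2
    have h2 : b.er s = (a.er s).ins _ hM hle := by
      rw [hb]
      refine Letter.ext rfl ?_
      ext x
      rw [mem_er, mem_ins]
      refine Iff.trans ?_ (mem_ins (a := a.er s) (hle := hle)).symm
      rw [mem_er]
      by_cases hx : x = v a.deg
      · simp [hx, hne.symm]
      · simp [hx]
    rw [cone, dif_pos ⟨⟨hM, hle⟩, h1⟩]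
    change _ + _ • Finsupp.single ((a.er s).ins _ hM hle)
      ((-1) ^ rankIn (a.er s).face (v a.deg)) = 0
    rw [h2, Finsupp.smul_single, Finsupp.smul_single, Finsupp.smul_single, ← Finsupp.single_add,
      Finsupp.single_eq_zero]
    simp only [smul_eq_mul, mul_one]
    rw [← pow_add, ← pow_add]
    apply neg_one_pow_add
    have h3 : rankIn a.face (v a.deg) = rankIn (a.er s).face (v a.deg)
      + if (vOrd (Mon (Fin t))).lt s (v a.deg) then 1 else 0 := rankIn_eraseV hs _
    have h4 : rankIn b.face s = rankIn (b.er (v a.deg)).face s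
      + if (vOrd (Mon (Fin t))).lt (v a.deg) s then 1 else 0 := rankIn_eraseV hmem _
    rw [hbe] at h4
    rw [h3, h4]
    rcases vOrd_lt_trichotomy s (v a.deg) with ⟨h5, h6, h7⟩ | ⟨h5, h6, h7⟩ | ⟨h5, h6, h7⟩
    · rw [if_pos h5, if_neg h7]
      exact ⟨rankIn (a.er s).face (v a.deg) + rankIn a.face s, by ring⟩
    · exact absurd h6 hne
    · rw [if_neg h5, if_pos h7]
      exact ⟨rankIn (a.er s).face (v a.deg) + rankIn a.face s, by ring⟩

end Letter

end MonomialRings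

namespace MonomialRings

lemma add_mem_upperSet {σ : Type*} {M : Finset (Mon σ)} {a : Mon σ} (h : a ∈ upperSet M)
    (b : Mon σ) : a + b ∈ upperSet M := by
  obtain ⟨m, hm, hle⟩ := h
  exact ⟨m, hm, fun i => (hle i).trans (Nat.le_add_right _ _)⟩

namespace Letter

variable {t : ℕ} {M : Finset (Mon (Fin t))} {k : Type*} [Field k]

lemma face_eq_empty_of_notMem {a : Letter M} (h : a.deg ∉ upperSet M) : a.face = ∅ := by
  rw [Finset.eq_empty_iff_forall_notMem]
  exact fun m hm => h ⟨m, a.face_sub hm, (le_mlcm hm).trans a.le_deg⟩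

variable (M) in
/-- Lists with a letter whose multidegree lies in the ideal. -/
def idealLists : Set (List (Letter M)) := {L | ∃ a ∈ L, a.deg ∈ upperSet M}

lemma cons_mem_idealLists {a : Letter M} {L : List (Letter M)} :
    a :: L ∈ idealLists M ↔ a.deg ∈ upperSet M ∨ L ∈ idealLists M := by
  change (∃ b ∈ a :: L, _) ↔ _ ∨ (∃ b ∈ L, _)
  simp

/-- The contraction on the first letter lying in the ideal. -/
def foldAux (v : Mon (Fin t) → Mon (Fin t)) : List (Letter M) → (List (Letter M) →₀ k)
  | [] => 0
  | a :: l => if a.deg ∈ upperSet M then -consS (cone k v a) (Finsupp.single l 1)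
      else -consL a (foldAux v l)

variable (k) in
/-- The linear extension of the contraction on the first letter lying in the ideal. -/
def fold (v : Mon (Fin t) → Mon (Fin t)) :
    (List (Letter M) →₀ k) →ₗ[k] (List (Letter M) →₀ k) := linExt (foldAux v)

lemma fold_cons_of_mem (v : Mon (Fin t) → Mon (Fin t)) {a : Letter M} (ha : a.deg ∈ upperSet M)
    (x : List (Letter M) →₀ k) : fold k v (consL a x) = -consS (cone k v a) x := by
  refine linearMap_eq_of_single (f := fold k v ∘ₗ consL a) (g := -consS (cone k v a))
    (fun l => ?_) x
  simp [fold, foldAux, ha]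

lemma fold_cons_of_notMem (v : Mon (Fin t) → Mon (Fin t)) {a : Letter M}
    (ha : a.deg ∉ upperSet M) (x : List (Letter M) →₀ k) :
    fold k v (consL a x) = -consL a (fold k v x) := by
  refine linearMap_eq_of_single (f := fold k v ∘ₗ consL a) (g := -(consL a ∘ₗ fold k v))
    (fun l => ?_) x
  simp [fold, foldAux, ha]

lemma fold_mem (v : Mon (Fin t) → Mon (Fin t)) (L : List (Letter M)) :
    fold k v (Finsupp.single L 1) ∈ Finsupp.supported k k {L' | L' ∈ idealLists M ∧
      L'.length = L.length ∧ (L'.map deg).sum = (L.map deg).sum ∧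
      (L'.map fun a => a.face.card + 1).sum = (L.map fun a => a.face.card + 1).sum + 1} := by
  induction L with
  | nil => simp [fold, foldAux]
  | cons a l ih =>
    rw [← consL_single]
    by_cases ha : a.deg ∈ upperSet M
    · rw [fold_cons_of_mem v ha]
      refine Submodule.neg_mem _ (consS_mem_supported (s := {l}) ?_
        (single_mem_supported (Set.mem_singleton l) 1))
      rintro b hb _ rfl
      obtain ⟨h1, h2, -⟩ := mem_support_cone hb
      refine ⟨cons_mem_idealLists.2 (.inl (h1 ▸ ha)), by simp, by simp [h1], ?_⟩
      simp only [List.map_cons, List.sum_cons, h2]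
      ring
    · rw [fold_cons_of_notMem v ha]
      refine Submodule.neg_mem _ (consL_mem_supported ?_ ih)
      rintro L' ⟨h1, h2, h3, h4⟩
      refine ⟨cons_mem_idealLists.2 (.inr h1), by simp [h2], by simp [h3], ?_⟩
      simp only [List.map_cons, List.sum_cons, h4]
      ring

lemma tbar_consS (a : k) (y : Letter M →₀ k) (x : List (Letter M) →₀ k)
    (hy : ∀ b ∈ y.support, sign k b.face.card = a) :
    tbar k (consS y x) = -consS (linExt (dF k fun _ _ => True) y) x + a • consS y (tbar k x)
      + a • (linExt (fun b => mulHead (c k) mul b x) :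
        (Letter M →₀ k) →ₗ[k] (List (Letter M) →₀ k)) y := by
  have := eq_on_supported (s := {b : Letter M | sign k b.face.card = a}) (tbar k ∘ₗ consS.flip x)
    (-(consS.flip x ∘ₗ linExt (dF k fun _ _ => True)) + a • consS.flip (tbar k x) +
      a • (linExt (fun b => mulHead (c k) mul b x) :
        (Letter M →₀ k) →ₗ[k] (List (Letter M) →₀ k))) (x := y) ?_ ?_
  · simpa using this
  · intro b hb
    have hb : sign k b.face.card = a := hb
    simp [tbar_cons, hb]
  · exact fun b hb => hy b hb

lemma fold_consS (v : Mon (Fin t) → Mon (Fin t)) (y : Letter M →₀ k)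
    (x : List (Letter M) →₀ k) (hy : ∀ b ∈ y.support, b.deg ∈ upperSet M) :
    fold k v (consS y x) = -consS (linExt (cone k v) y) x := by
  have := eq_on_supported (s := {b : Letter M | b.deg ∈ upperSet M}) (fold k v ∘ₗ consS.flip x)
    (-(consS.flip x ∘ₗ linExt (cone k v))) (x := y) ?_ ?_
  · simpa using this
  · intro b hb
    have hb : b.deg ∈ upperSet M := hb
    simp [fold_cons_of_mem v hb]
  · exact fun b hb => hy b hb

lemma fold_homotopy {v : Mon (Fin t) → Mon (Fin t)}
    (hv : ∀ γ ∈ upperSet M, v γ ∈ M ∧ v γ ≤ γ) {L : List (Letter M)} (hL : L ∈ idealLists M) :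
    tbar k (fold k v (Finsupp.single L 1)) + fold k v (tbar k (Finsupp.single L 1))
        - Finsupp.single L 1
      ∈ Finsupp.supported k k {L' | L' ∈ idealLists M ∧ L'.length < L.length} := by
  induction L with
  | nil => obtain ⟨a, ha, -⟩ := hL; simp at ha
  | cons a l ih =>
    rw [← consL_single]
    by_cases ha : a.deg ∈ upperSet M
    · obtain ⟨hM, hle⟩ := hv _ ha
      have hcone := cone_homotopy (k := k) hM hle
      have hdF : ∀ b ∈ (dF k (fun _ _ => True) a).support, b.deg ∈ upperSet M := by
        intro b hb
        obtain ⟨s, -, -, rfl⟩ := mem_support_dF hb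
        exact ha
      have hsg : ∀ b ∈ (cone k v a).support, sign k b.face.card = -sign k a.face.card := by
        intro b hb
        rw [(mem_support_cone hb).2.1, sign_succ]
      rw [fold_cons_of_mem v ha, map_neg, tbar_consS _ _ _ hsg, tbar_cons, map_add, map_add,
          map_neg,
        map_smul, map_smul, fold_consS v _ _ hdF, fold_cons_of_mem v ha]
      have hcone' := congrArg (fun y => consS y (Finsupp.single l (1 : k))) hcone
      simp only [map_add, LinearMap.add_apply, consS_single, one_smul] at hcone'
      rw [← hcone']
      have e : ∀ (A B C X Y : List (Letter M) →₀ k) (s : k), -(-A + -s • B + -s • X)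
          + (- -C + s • -B + s • Y) - (A + C) = s • X + s • Y := by
        intros
        module
      rw [e]
      refine Submodule.add_mem _ (Submodule.smul_mem _ _ ?_) (Submodule.smul_mem _ _ ?_)
      · refine supported_induction (s := {b : Letter M | b.deg = a.deg}) _ (fun b hb => ?_)
          (fun b hb => (mem_support_cone hb).1)
        have hb : b.deg = a.deg := hb
        rw [linExt_single, one_smul]
        refine mulHead_mem_supported (s := {l}) ?_ (single_mem_supported (Set.mem_singleton l) 1)
        rintro b' l' rfl -
        refine ⟨cons_mem_idealLists.2 (.inl ?_), by simp⟩
        exact add_mem_upperSet (hb ▸ ha) _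
      · refine supported_induction (s := {L' | L' ∈ idealLists M ∧ L'.length = l.length}) _
          (fun L' hL' => Finsupp.supported_mono ?_ (fold_mem v L')) ?_
        · rintro L'' ⟨h1, h2, -⟩
          refine ⟨h1, ?_⟩
          rw [h2, hL'.2]
          simp
        · refine mulHead_mem_supported (s := {l}) ?_ (single_mem_supported (Set.mem_singleton l) 1)
          rintro b' l' rfl -
          exact ⟨cons_mem_idealLists.2 (.inl (add_mem_upperSet ha _)), rfl⟩
    · have hl : l ∈ idealLists M := (cons_mem_idealLists.1 hL).resolve_left ha
      have hf := face_eq_empty_of_notMem ha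
      have hd : dF k (fun _ _ => True) a = 0 := by simp [dF, hf]
      have hs : sign k a.face.card = -1 := by simp [hf, sign]
      rw [fold_cons_of_notMem v ha, map_neg, tbar_cons, tbar_cons, hd, hs, map_add, map_add,
          map_neg,
        map_smul, map_smul, fold_cons_of_notMem v ha]
      have e : consL a (tbar k (fold k v (Finsupp.single l 1)))
          + consL a (fold k v (tbar k (Finsupp.single l 1))) - consL a (Finsupp.single l (1 : k))
          = consL a (tbar k (fold k v (Finsupp.single l 1)) + fold k v (tbar k (Finsupp.single l 1))
            - Finsupp.single l 1) := by
        simp only [map_add, map_sub]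
      have e2 : ∀ (A B C X Y : List (Letter M) →₀ k), -(-0 + (-1 : k) • A + (-1 : k) • X)
          + (fold k v (-0) + (-1 : k) • -B + (-1 : k) • Y) - C =
            (A + B - C) + X + (-1 : k) • Y := by
        intros
        rw [neg_zero, map_zero]
        module
      simp only [map_zero, LinearMap.zero_apply, neg_zero] at e2 ⊢
      rw [e2, e]
      refine Submodule.add_mem _ (Submodule.add_mem _ ?_ ?_) (Submodule.smul_mem _ _ ?_)
      · refine consL_mem_supported ?_ (ih hl)
        rintro L' ⟨h1, h2⟩
        exact ⟨cons_mem_idealLists.2 (.inr h1), by simpa using h2⟩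
      · refine mulHead_mem_supported (s := {L' | L' ∈ idealLists M ∧ L'.length = l.length}) ?_
          (Finsupp.supported_mono ?_ (fold_mem v l))
        swap
        · rintro L' ⟨h1, h2, -⟩
          exact ⟨h1, h2⟩
        rintro b l' ⟨h1, h2⟩ -
        refine ⟨?_, by simp at h2 ⊢; omega⟩
        rcases cons_mem_idealLists.1 h1 with h | h
        · refine cons_mem_idealLists.2 (.inl ?_)
          change a.deg + b.deg ∈ _
          rw [add_comm]
          exact add_mem_upperSet h _
        · exact cons_mem_idealLists.2 (.inr h)
      · refine supported_induction (s := {L' | L' ∈ idealLists M ∧ L'.length = l.length}) _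
          (fun L' hL' => Finsupp.supported_mono ?_ (fold_mem v L')) ?_
        · rintro L'' ⟨h1, h2, -⟩
          refine ⟨h1, ?_⟩
          rw [h2, hL'.2]
          simp
        · refine mulHead_mem_supported (s := {l}) ?_ (single_mem_supported (Set.mem_singleton l) 1)
          rintro b l' rfl -
          refine ⟨?_, rfl⟩
          rcases cons_mem_idealLists.1 hl with h | h
          · refine cons_mem_idealLists.2 (.inl ?_)
            change a.deg + b.deg ∈ _
            rw [add_comm]
            exact add_mem_upperSet h _
          · exact cons_mem_idealLists.2 (.inr h)

end Letter

end MonomialRings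

namespace MonomialRings

section BarRecursion

variable {σ : Type*} {k : Type*} [Field k]

/-- The term of the bar differential that multiplies a monomial to the head of a list. -/
def headTerm (k : Type*) [Field k] (J : Set (Mon σ)) (a : Mon σ) :
    List (Mon σ) → (List (Mon σ) →₀ k)
  | [] => 0
  | b :: l => if a + b ∉ J then Finsupp.single ((a + b) :: l) 1 else 0

lemma barAux_cons (J : Set (Mon σ)) (a : Mon σ) (l : List (Mon σ)) :
    barAux k J (a :: l) = -consL a (barAux k J l) - headTerm k J a l := by
  cases l with
  | nil => simp [barAux, headTerm]
  | cons b l =>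
    rw [barAux, barAux, show (a :: b :: l).length - 1 = ((b :: l).length - 1) + 1 by simp,
      Finset.sum_range_succ', map_sum, ← Finset.sum_neg_distrib, sub_eq_add_neg]
    congr 1
    · refine Finset.sum_congr rfl fun j _ => ?_
      simp only [List.getD_cons_succ]
      split_ifs
      · simp
      · have h : mergeAt (a :: b :: l) (j + 1) = a :: mergeAt (b :: l) j := by
          simp [mergeAt]
        rw [h, map_smul, consL_single, pow_succ]
        module
    · simp only [headTerm, List.getD_cons_zero, List.getD_cons_succ, mergeAt]
      split_ifs <;> simp

end BarRecursion

namespace Letter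

variable {t : ℕ} {M : Finset (Mon (Fin t))} (k : Type*) [Field k]

lemma tbar_mem (L : List (Letter M)) : tbar k (Finsupp.single L 1) ∈ Finsupp.supported k k
    {L' | (L ∈ idealLists M → L' ∈ idealLists M) ∧ (L'.map deg).sum = (L.map deg).sum ∧
      (L'.map fun a => a.face.card + 1).sum + 1 = (L.map fun a => a.face.card + 1).sum} := by
  have happ : ∀ (l₁ l₂ : List (Letter M)),
      l₁ ++ l₂ ∈ idealLists M ↔ l₁ ∈ idealLists M ∨ l₂ ∈ idealLists M := by
    intro l₁ l₂
    induction l₁ with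
    | nil =>
      have : ([] : List (Letter M)) ∉ idealLists M := by
        rintro ⟨a, ha, -⟩
        simp at ha
      simp [this]
    | cons a l ih => rw [List.cons_append, cons_mem_idealLists, cons_mem_idealLists, ih, or_assoc]
  rw [tbar, LinearMap.add_apply]
  refine Submodule.add_mem _ ?_ ?_
  · refine Finsupp.supported_mono ?_ (der_mem_supported _ _ L)
    rintro _ ⟨l₁, a, l₂, b, rfl, hb, rfl⟩
    obtain ⟨s, hs, -, rfl⟩ := mem_support_dF hb
    have := card_er hs
    refine ⟨?_, by simp [er], ?_⟩
    · rw [happ, happ, cons_mem_idealLists, cons_mem_idealLists]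
      exact id
    · simp only [List.map_append, List.map_cons, List.sum_append, List.sum_cons]
      omega
  · refine Finsupp.supported_mono ?_ (barMul_mem_supported _ _ _ L)
    rintro _ ⟨l₁, a, b, l₂, rfl, hc, rfl⟩
    have hdis : a.Disj b := by
      by_contra h
      rw [c, if_neg h] at hc
      exact hc rfl
    have := hdis.card_mul
    refine ⟨?_, by simp [mul, add_assoc], ?_⟩
    · rw [happ, happ, cons_mem_idealLists, cons_mem_idealLists, cons_mem_idealLists]
      rintro (h | h | h | h)
      · exact .inl h
      · exact .inr (.inl (add_mem_upperSet h _))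
      · refine .inr (.inl ?_)
        change a.deg + b.deg ∈ _
        rw [add_comm]
        exact add_mem_upperSet h _
      · exact .inr (.inr h)
    · simp only [List.map_append, List.map_cons, List.sum_append, List.sum_cons]
      omega

variable (M) in
/-- Lists with a letter in the ideal. -/
def badLists (α : Mon (Fin t)) (n : ℕ) : Set (List (Letter M)) := lists M α n ∩ idealLists M

variable (M) in
/-- Lists without letters in the ideal. -/
def goodLists (α : Mon (Fin t)) (n : ℕ) : Set (List (Letter M)) := lists M α n ∩ (idealLists M)ᶜ

lemma tbar_mem_lists {α : Mon (Fin t)} {n : ℕ} {x : List (Letter M) →₀ k}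
    (hx : x ∈ Finsupp.supported k k (lists M α (n + 1))) :
    tbar k x ∈ Finsupp.supported k k (lists M α n) := by
  refine supported_induction _ (fun L hL => Finsupp.supported_mono ?_ (tbar_mem k L)) hx
  rintro L' ⟨-, h1, h2⟩
  obtain ⟨rfl, h⟩ := hL
  exact ⟨h1, by omega⟩

lemma tbar_mem_badLists {α : Mon (Fin t)} {n : ℕ} {x : List (Letter M) →₀ k}
    (hx : x ∈ Finsupp.supported k k (badLists M α (n + 1))) :
    tbar k x ∈ Finsupp.supported k k (badLists M α n) := by
  refine supported_induction _ (fun L hL => Finsupp.supported_mono ?_ (tbar_mem k L)) hx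
  rintro L' ⟨h0, h1, h2⟩
  obtain ⟨⟨rfl, h⟩, h'⟩ := hL
  exact ⟨⟨h1, by omega⟩, h0 h'⟩

lemma lists_zero (α : Mon (Fin t)) : lists M α 0 = ∅ := by
  ext L
  simp [lists]

lemma exact_badLists {α : Mon (Fin t)} {n : ℕ} {x : List (Letter M) →₀ k}
    (hx : x ∈ Finsupp.supported k k (badLists M α n)) (hDx : tbar k x = 0) :
    ∃ y ∈ Finsupp.supported k k (badLists M α (n + 1)), tbar k y = x := by
  cases n with
  | zero =>
    refine ⟨0, Submodule.zero_mem _, ?_⟩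
    rw [badLists, lists_zero, Set.empty_inter, Finsupp.supported_empty, Submodule.mem_bot] at hx
    rw [hx, map_zero]
  | succ n =>
    have hv : ∀ γ : Mon (Fin t), ∃ m, γ ∈ upperSet M → m ∈ M ∧ m ≤ γ := by
      intro γ
      by_cases h : γ ∈ upperSet M
      · obtain ⟨m, hm, hle⟩ := h
        exact ⟨m, fun _ => ⟨hm, hle⟩⟩
      · exact ⟨0, fun h' => absurd h' h⟩
    choose v hv using hv
    have hh : ∀ n, ∀ x ∈ Finsupp.supported k k (badLists M α n),
        fold k v x ∈ Finsupp.supported k k (badLists M α (n + 1)) := by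
      intro n x hx
      refine supported_induction _ (fun L hL => Finsupp.supported_mono ?_ (fold_mem v L)) hx
      rintro L' ⟨h0, -, h1, h2⟩
      obtain ⟨⟨rfl, h⟩, h'⟩ := hL
      exact ⟨⟨h1, by omega⟩, h0⟩
    have hu : ∀ n, ∀ L ∈ badLists M α n, tbar k (fold k v (Finsupp.single L 1))
        + fold k v (tbar k (Finsupp.single L 1)) - Finsupp.single L 1
        ∈ Finsupp.supported k k
          {L' | L' ∈ badLists M α n ∧ -(L.length : ℤ) < -(L'.length : ℤ)} := by
      intro n L hL
      have hs := single_mem_supported hL (1 : k)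
      have h1 : tbar k (fold k v (Finsupp.single L 1))
          + fold k v (tbar k (Finsupp.single L 1)) - Finsupp.single L 1
          ∈ Finsupp.supported k k (badLists M α n) := by
        refine Submodule.sub_mem _ (Submodule.add_mem _ (tbar_mem_badLists k (hh _ _ hs)) ?_) hs
        cases n with
        | zero => rw [badLists, lists_zero, Set.empty_inter] at hL; exact absurd hL id
        | succ n => exact hh _ _ (tbar_mem_badLists k hs)
      have h2 := fold_homotopy (k := k) hv hL.2
      have h3 := Submodule.mem_inf.2 ⟨h1, h2⟩
      rw [← Finsupp.supported_inter] at h3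
      refine Finsupp.supported_mono ?_ h3
      rintro L' ⟨h4, -, h5⟩
      exact ⟨h4, by omega⟩
    exact bounds_of_triangular_homotopy (s₀ := badLists M α n) (s₁ := badLists M α (n + 1))
      ((lists_finite _ _).subset fun _ h => h.1) ((lists_finite _ _).subset fun _ h => h.1)
      (tbar k) (fold k v) (fun L => -(L.length : ℤ)) (tbar_tbar k)
      (fun L hL => tbar_mem_badLists k (single_mem_supported hL 1))
      (fun L hL => hh _ _ (single_mem_supported hL 1)) (hu n) (hu (n + 1)) x hx hDx

/-- The projection to the span of the lists without letters in the ideal. -/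
def goodProj : (List (Letter M) →₀ k) →ₗ[k] (List (Letter M) →₀ k) :=
  linExt fun L => if L ∈ idealLists M then 0 else Finsupp.single L 1

lemma goodProj_mem {α : Mon (Fin t)} {n : ℕ} {x : List (Letter M) →₀ k}
    (hx : x ∈ Finsupp.supported k k (lists M α n)) :
    goodProj k x ∈ Finsupp.supported k k (goodLists M α n) := by
  refine supported_induction _ (fun L hL => ?_) hx
  rw [goodProj, linExt_single, one_smul]
  split_ifs with h
  · exact Submodule.zero_mem _
  · have hb : L ∈ goodLists M α n := ⟨hL, h⟩
    exact single_mem_supported hb 1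

lemma sub_goodProj_mem {α : Mon (Fin t)} {n : ℕ} {x : List (Letter M) →₀ k}
    (hx : x ∈ Finsupp.supported k k (lists M α n)) :
    x - goodProj k x ∈ Finsupp.supported k k (badLists M α n) := by
  refine supported_induction (LinearMap.id - goodProj k) (fun L hL => ?_) hx
  rw [LinearMap.sub_apply, goodProj, linExt_single, one_smul]
  split_ifs with h
  · have hb : L ∈ badLists M α n := ⟨hL, h⟩
    simpa using single_mem_supported hb (1 : k)
  · simp

lemma goodProj_eq_zero {α : Mon (Fin t)} {n : ℕ} {x : List (Letter M) →₀ k}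
    (hx : x ∈ Finsupp.supported k k (badLists M α n)) : goodProj k x = 0 := by
  refine eq_on_supported (goodProj k) 0 (fun L hL => ?_) hx
  rw [goodProj, linExt_single, one_smul, if_pos hL.2]
  rfl

lemma goodProj_sq {α : Mon (Fin t)} {n : ℕ} {x : List (Letter M) →₀ k}
    (hx : x ∈ Finsupp.supported k k (lists M α (n + 2))) :
    goodProj k (tbar k (goodProj k (tbar k x))) = 0 := by
  have h1 := tbar_mem_badLists k (sub_goodProj_mem k (tbar_mem_lists k hx))
  have h2 := goodProj_eq_zero k h1
  rw [map_sub, tbar_tbar, zero_sub, map_neg, neg_eq_zero] at h2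
  exact h2

lemma lists_eq_union (α : Mon (Fin t)) (n : ℕ) :
    lists M α n = goodLists M α n ∪ badLists M α n := by
  ext L
  by_cases h : L ∈ idealLists M <;> simp [goodLists, badLists, h]

lemma disjoint_goodLists (α : Mon (Fin t)) (n : ℕ) :
    Disjoint (goodLists M α n) (badLists M α n) :=
  Set.disjoint_left.2 fun _ h h' => h.2 h'.2

/-- Forgetting the exterior parts. -/
def forget : (List (Letter M) →₀ k) →ₗ[k] (List (Mon (Fin t)) →₀ k) :=
  linExt fun L => Finsupp.single (L.map deg) 1

lemma forget_goodProj_consL {a : Letter M} (ha : a.deg ∉ upperSet M)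
    (x : List (Letter M) →₀ k) :
    forget k (goodProj k (consL a x)) = consL a.deg (forget k (goodProj k x)) := by
  refine linearMap_eq_of_single (f := forget k ∘ₗ goodProj k ∘ₗ consL a)
    (g := consL a.deg ∘ₗ forget k ∘ₗ goodProj k) (fun l => ?_) x
  simp only [LinearMap.comp_apply, consL_single, goodProj, linExt_single, one_smul,
    cons_mem_idealLists, ha, false_or]
  split_ifs <;> simp [forget]

lemma forget_tbar {L : List (Letter M)} (hL : L ∉ idealLists M) :
    forget k (goodProj k (tbar k (Finsupp.single L 1)))
      = barD k (upperSet M) (forget k (Finsupp.single L 1)) := by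
  have hb : ∀ l, barD k (upperSet M) (Finsupp.single l 1) = barAux k (upperSet M) l := by
    intro l
    rw [barD, Finsupp.linearCombination_single, one_smul]
  simp only [forget, linExt_single, one_smul, hb]
  induction L with
  | nil => simp [tbar_nil, barAux]
  | cons a l ih =>
    rw [cons_mem_idealLists, not_or] at hL
    have hf := face_eq_empty_of_notMem hL.1
    have hd : dF k (fun _ _ => True) a = 0 := by simp [dF, hf]
    have hs : sign k a.face.card = -1 := by simp [hf, sign]
    have h1 := forget_goodProj_consL k hL.1 (tbar k (Finsupp.single l 1))
    simp only [forget] at h1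
    rw [← consL_single, tbar_cons, hd, hs, map_zero, LinearMap.zero_apply, neg_zero, zero_add,
      map_add, map_add, map_smul, map_smul, map_smul, map_smul, h1, ih hL.2, List.map_cons,
      barAux_cons, sub_eq_add_neg, neg_one_smul, neg_one_smul]
    congr 2
    cases l with
    | nil => simp [headTerm]
    | cons b l =>
      have hL2 := hL.2
      rw [cons_mem_idealLists, not_or] at hL2
      have hc : c k a b = 1 := by
        have : a.Disj b := fun x hx => by simp [hf] at hx
        simp [c, this, inversions, hf]
      rw [← consL_single, mulHead_cons, hc, one_smul, consL_single, goodProj, linExt_single,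
        one_smul]
      simp only [cons_mem_idealLists, hL2.2, or_false, List.map_cons, headTerm]
      change linExt _ (if a.deg + b.deg ∈ upperSet M then _ else _) = _
      by_cases h : a.deg + b.deg ∈ upperSet M
      · simp [h]
      · simp [h, mul]

lemma forget_goodProj_tbar {x : List (Letter M) →₀ k}
    (hx : x ∈ Finsupp.supported k k (idealLists M)ᶜ) :
    forget k (goodProj k (tbar k x)) = barD k (upperSet M) (forget k x) := by
  refine eq_on_supported (s := (idealLists M)ᶜ) (forget k ∘ₗ goodProj k ∘ₗ tbar k)
    (barD k (upperSet M) ∘ₗ forget k) ?_ hx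
  intro L hL
  simp only [LinearMap.comp_apply]
  exact forget_tbar k hL

lemma forget_injOn {x : List (Letter M) →₀ k}
    (hx : x ∈ Finsupp.supported k k (idealLists M)ᶜ) (h : forget k x = 0) : x = 0 := by
  have hinj : Set.InjOn (List.map (deg (M := M))) (idealLists M)ᶜ := by
    intro L hL L' hL' h
    induction L generalizing L' with
    | nil => exact (List.map_eq_nil_iff.1 h.symm).symm
    | cons a l ih =>
      cases L' with
      | nil => simp at h
      | cons b l' =>
        rw [Set.mem_compl_iff, cons_mem_idealLists, not_or] at hL hL'
        simp only [List.map_cons, List.cons.injEq] at h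
        rw [ih hL.2 hL'.2 h.2, Letter.ext h.1
          ((face_eq_empty_of_notMem hL.1).trans (face_eq_empty_of_notMem hL'.1).symm)]
  have e : ∀ x, forget k x = Finsupp.mapDomain (List.map (deg (M := M))) x := by
    intro x
    refine linearMap_eq_of_single (f := forget k) (g := Finsupp.lmapDomain k k _) (fun L => ?_) x
    simp [forget]
  rw [e] at h
  refine Finsupp.mapDomain_injOn _ hinj hx (by simp) ?_
  rw [h, Finsupp.mapDomain_zero]

lemma map_forget_goodLists (α : Mon (Fin t)) (i : ℕ) :
    (Finsupp.supported k k (goodLists M α (i + 1))).map (forget k)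
      = barSub k (upperSet M) i α := by
  have hlen : ∀ L : List (Letter M), L ∉ idealLists M →
      (L.map fun a => a.face.card + 1).sum = L.length := by
    intro L hL
    induction L with
    | nil => rfl
    | cons a l ih =>
      rw [cons_mem_idealLists, not_or] at hL
      rw [List.map_cons, List.sum_cons, ih hL.2, face_eq_empty_of_notMem hL.1, Finset.card_empty,
        List.length_cons]
      ring
  rw [Finsupp.supported_eq_span_single, Submodule.map_span, barSub, Set.image_image]
  congr 1
  ext y
  simp only [forget, linExt_single, one_smul, Set.mem_image]
  constructor
  · rintro ⟨L, ⟨⟨rfl, h1⟩, h2⟩, rfl⟩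
    refine ⟨_, ⟨?_, rfl, ?_⟩, rfl⟩
    · rw [hlen L h2] at h1
      simpa using h1
    · intro β hβ
      obtain ⟨a, ha, rfl⟩ := List.mem_map.1 hβ
      exact ⟨a.deg_ne, fun h => h2 ⟨a, ha, h⟩⟩
  · rintro ⟨l, ⟨rfl, rfl, h⟩, rfl⟩
    have : l ∈ Set.range (List.map (deg (M := M))) := by
      rw [Set.range_list_map]
      intro β hβ
      exact ⟨⟨β, ∅, (h β hβ).1, by simp, by simp [mlcm]⟩, rfl⟩
    obtain ⟨L, rfl⟩ := this
    have hL : L ∉ idealLists M := by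
      rintro ⟨a, ha, h'⟩
      exact (h _ (List.mem_map_of_mem ha)).2 h'
    refine ⟨L, ⟨⟨rfl, ?_⟩, hL⟩, rfl⟩
    rw [hlen L hL, List.length_map]

/-- The bar construction of the Taylor algebra computes the Tor spaces. -/
theorem torDim_eq (i : ℕ) (α : Mon (Fin t)) : (torDim k (upperSet M) i α : ℤ)
    = homDim (tbar k) (Finsupp.supported k k (lists M α (i + 1)))
        (Finsupp.supported k k (lists M α (i + 2))) := by
  have hle : ∀ n, Finsupp.supported k k (goodLists M α n)
      ≤ Finsupp.supported k k (lists M α n) := fun n =>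
    Finsupp.supported_mono (Set.inter_subset_left)
  have hU : ∀ n, Finsupp.supported k k (goodLists M α n)
      ≤ Finsupp.supported k k (idealLists M)ᶜ := fun n =>
    Finsupp.supported_mono (Set.inter_subset_right)
  have hmem : ∀ n, ∀ x ∈ Finsupp.supported k k (goodLists M α (n + 1)),
      (goodProj k ∘ₗ tbar k) x ∈ Finsupp.supported k k (goodLists M α n) := fun n x hx =>
    goodProj_mem k (tbar_mem_lists k (hle _ hx))
  have hcomm : ∀ n, ∀ x ∈ Finsupp.supported k k (goodLists M α n),
      forget k ((goodProj k ∘ₗ tbar k) x) = barD k (upperSet M) (forget k x) := fun n x hx =>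
    forget_goodProj_tbar k (hU n hx)
  have := finiteDimensional_supported (k := k) (lists_finite (M := M) α (i + 1))
  have := finiteDimensional_supported (k := k) (lists_finite (M := M) α (i + 2))
  have h1 := homDim_graded_piece (tbar k) (goodProj k ∘ₗ tbar k)
    (Finsupp.supported k k (lists M α (i + 1))) (Finsupp.supported k k (lists M α (i + 2)))
    (Finsupp.supported k k (badLists M α i)) (Finsupp.supported k k (badLists M α (i + 1)))
    (Finsupp.supported k k (badLists M α (i + 2))) (Finsupp.supported k k (goodLists M α i))
    (Finsupp.supported k k (goodLists M α (i + 1))) (Finsupp.supported k k (goodLists M α (i + 2)))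
    (supported_sup_of_partition (lists_eq_union α (i + 1)))
    (supported_sup_of_partition (lists_eq_union α (i + 2)))
    (disjoint_supported (disjoint_goodLists α i))
    (disjoint_supported (disjoint_goodLists α (i + 1)))
    (disjoint_supported (disjoint_goodLists α (i + 2))) (tbar_tbar k)
    (fun x hx => tbar_mem_badLists k hx) (fun x hx => tbar_mem_badLists k hx)
    (hmem i) (hmem (i + 1)) (fun x hx => sub_goodProj_mem k (tbar_mem_lists k (hle _ hx)))
    (fun x hx => sub_goodProj_mem k (tbar_mem_lists k (hle _ hx))) ?_ ?_
  · have h2 : homDim (tbar k) (Finsupp.supported k k (badLists M α i))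
        (Finsupp.supported k k (badLists M α (i + 1))) = 0 :=
      homDim_eq_zero _ _ _ (fun x hx => tbar_mem_badLists k hx) (tbar_tbar k)
        fun x hx h => exact_badLists k hx h
    rw [h2, add_zero] at h1
    rw [← h1]
    have h3 := homDim_transport (forget k) (goodProj k ∘ₗ tbar k) (barD k (upperSet M))
      (Finsupp.supported k k (goodLists M α (i + 1)))
      (Finsupp.supported k k (goodLists M α (i + 2))) (Finsupp.supported k k (idealLists M)ᶜ) _ _
      (map_forget_goodLists k α i).symm (map_forget_goodLists k α (i + 1)).symm (hU (i + 1))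
      (fun x hx => hU i (hmem i x hx)) (fun x hx => hU (i + 1) (hmem (i + 1) x hx))
      (fun x hx h => forget_injOn k hx h) (hcomm (i + 1)) (hcomm (i + 2))
    rw [← h3]
    have hfd : FiniteDimensional k ↥(Finsupp.supported k k (goodLists M α (i + 1))) :=
      finiteDimensional_supported ((lists_finite α (i + 1)).subset Set.inter_subset_left)
    have : FiniteDimensional k ↥(barSub k (upperSet M) i α) := by
      rw [← map_forget_goodLists k α i]
      exact Module.Finite.map _ _
    refine homDim_toNat _ _ _ ?_ ?_
    · intro y hy
      rw [← map_forget_goodLists k α (i + 1)] at hy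
      obtain ⟨x, hx, rfl⟩ := hy
      rw [← hcomm _ x hx, ← map_forget_goodLists k α i]
      exact ⟨_, hmem _ x hx, rfl⟩
    · intro y hy
      rw [← map_forget_goodLists k α (i + 1)] at hy
      obtain ⟨x, hx, rfl⟩ := hy
      rw [← hcomm _ x hx, ← hcomm _ _ (hmem _ x hx)]
      have := goodProj_sq k (hle _ hx)
      simp only [LinearMap.comp_apply, this, map_zero]
  · intro x hx h
    obtain ⟨y, hy, h'⟩ := exact_badLists k hx h
    exact ⟨y, Finsupp.supported_mono Set.inter_subset_left hy, h'⟩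
  · intro x hx h
    obtain ⟨y, hy, h'⟩ := exact_badLists k hx h
    exact ⟨y, Finsupp.supported_mono Set.inter_subset_left hy, h'⟩

end Letter

end MonomialRings

namespace MonomialRings

namespace Letter

variable {t : ℕ} {M : Finset (Mon (Fin t))} {k : Type*} [Field k]

/-- Letters of multidegree `γ` with exterior part in `S` of cardinality `n`. -/
def atDeg (M : Finset (Mon (Fin t))) (γ : Mon (Fin t)) (S : Finset (Mon (Fin t))) (n : ℕ) :
    Set (Letter M) :=
  {a | a.deg = γ ∧ a.face ⊆ S ∧ a.face.card = n}

/-- Those letters in `atDeg M γ S n` with component monomials different from those of `S`. -/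
def small (M : Finset (Mon (Fin t))) (γ : Mon (Fin t)) (S : Finset (Mon (Fin t))) (n : ℕ) :
    Set (Letter M) :=
  {a | a ∈ atDeg M γ S n ∧ cl a.face ≠ cl S}

/-- Those letters in `atDeg M γ S n` with the same component monomials as `S`. -/
def big (M : Finset (Mon (Fin t))) (γ : Mon (Fin t)) (S : Finset (Mon (Fin t))) (n : ℕ) :
    Set (Letter M) :=
  {a | (a.deg, cl a.face) = (γ, cl S) ∧ a.face.card = n}

variable {γ : Mon (Fin t)} {S : Finset (Mon (Fin t))} {n : ℕ}

lemma atDeg_finite (γ : Mon (Fin t)) (S : Finset (Mon (Fin t))) (n : ℕ) :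
    (atDeg M γ S n).Finite := by
  refine Set.Finite.of_finite_image (f := fun a => a.face) (S.powerset.finite_toSet.subset ?_) ?_
  · rintro _ ⟨a, ha, rfl⟩
    exact Finset.mem_coe.2 (Finset.mem_powerset.2 ha.2.1)
  · intro a ha b hb h
    exact Letter.ext (ha.1.trans hb.1.symm) h

lemma small_subset : small M γ S n ⊆ atDeg M γ S n := fun _ h => h.1

lemma big_subset (h2 : ∀ m ∈ M, 2 ≤ mdeg m) (hS : S ∈ satSets M) :
    big M γ S n ⊆ atDeg M γ S n := by
  rintro a ⟨h, hn⟩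
  rw [Prod.mk.injEq] at h
  refine ⟨h.1, ?_, hn⟩
  have := subset_clOf (a.zero_notMem h2) a.face_sub
  rwa [h.2, clOf_cl_of_mem_satSets (zero_notMem_of_two_le h2) hS] at this

lemma atDeg_eq_union (h2 : ∀ m ∈ M, 2 ≤ mdeg m) (hS : S ∈ satSets M) :
    atDeg M γ S n = big M γ S n ∪ small M γ S n := by
  ext a
  constructor
  · intro h
    by_cases hc : cl a.face = cl S
    · exact .inl ⟨by rw [h.1, hc], h.2.2⟩
    · exact .inr ⟨h, hc⟩
  · rintro (h | h)
    · exact big_subset h2 hS h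
    · exact h.1

lemma disjoint_big_small : Disjoint (big M γ S n) (small M γ S n) := by
  rw [Set.disjoint_left]
  rintro a ⟨h, -⟩ h'
  exact h'.2 (Prod.mk.inj h).2

lemma subset_of_mem_satSets (hS : S ∈ satSets M) : S ⊆ M := by
  rw [satSets, Finset.mem_filter, Finset.mem_powerset] at hS
  exact hS.1

lemma nonempty_of_mem_satSets (hS : S ∈ satSets M) : S.Nonempty := by
  rw [satSets, Finset.mem_filter, Finset.mem_powerset] at hS
  exact hS.2.1

lemma cl_eq_of_subset {T T' : Finset (Mon (Fin t))} (h2 : ∀ m ∈ S, 2 ≤ mdeg m) (hT : T' ⊆ T)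
    (hTS : T ⊆ S) (h : cl T' = cl S) : cl T = cl S := by
  have h0 := zero_notMem_of_two_le h2
  have hm : mlcm T' = mlcm S := by
    rw [(decomp_cl (zero_notMem_of_subset h0 (hT.trans hTS))).sup_eq, h, ← (decomp_cl h0).sup_eq]
  by_contra hc
  have h1 := cl_lt h2 hTS hc le_rfl
  have h3 : cl T' ≠ cl T := fun h' => hc (h'.symm.trans h)
  have h4 := cl_lt (fun s hs => h2 s (hTS hs)) hT h3 le_rfl
  rw [hm, h] at h4
  exact lt_asymm h1 h4

lemma er_mem_atDeg {a : Letter M} (ha : a ∈ atDeg M γ S (n + 1)) {s : Mon (Fin t)}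
    (hs : s ∈ a.face) : a.er s ∈ atDeg M γ S n := by
  refine ⟨ha.1, (eraseV_subset _ _).trans ha.2.1, ?_⟩
  have h1 := card_er hs
  have h3 := ha.2.2
  omega

lemma er_mem_small (h2 : ∀ m ∈ M, 2 ≤ mdeg m) (hS : S ∈ satSets M) {a : Letter M}
    (ha : a ∈ small M γ S (n + 1)) {s : Mon (Fin t)} (hs : s ∈ a.face) : a.er s ∈ small M γ S n :=
  ⟨er_mem_atDeg ha.1 hs, fun h => ha.2 (cl_eq_of_subset
    (fun m hm => h2 m (subset_of_mem_satSets hS hm)) (eraseV_subset _ _) ha.1.2.1 h)⟩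

lemma linExt_dF_mem {φ : Finset (Mon (Fin t)) → Mon (Fin t) → Prop} {s u : Set (Letter M)}
    (h : ∀ a ∈ s, ∀ x ∈ a.face, φ a.face x → a.er x ∈ u) {x : Letter M →₀ k}
    (hx : x ∈ Finsupp.supported k k s) : linExt (dF k φ) x ∈ Finsupp.supported k k u := by
  refine supported_induction (s := s) (W := Finsupp.supported k k u) (linExt (dF k φ)) ?_ hx
  intro a ha
  rw [linExt_single, one_smul, dF]
  refine Submodule.sum_mem _ fun y hy => Submodule.smul_mem _ _ ?_
  rw [Finset.mem_filter] at hy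
  exact single_mem_supported (k := k) (h a ha y hy.1 hy.2) 1

lemma linExt_dF_sub_mem (h2 : ∀ m ∈ M, 2 ≤ mdeg m) (hS : S ∈ satSets M) {x : Letter M →₀ k}
    (hx : x ∈ Finsupp.supported k k (big M γ S (n + 1))) :
    linExt (dF k fun _ _ => True) x - linExt (dF k Keeps) x
      ∈ Finsupp.supported k k (small M γ S n) := by
  rw [← LinearMap.sub_apply]
  refine supported_induction (s := big M γ S (n + 1)) (W := Finsupp.supported k k (small M γ S n))
    (linExt (dF k fun _ _ => True) - linExt (dF k Keeps)) ?_ hx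
  intro a ha
  rw [LinearMap.sub_apply, linExt_single, linExt_single, one_smul, one_smul, dF, dF,
      Finset.sum_filter,
    Finset.sum_filter, ← Finset.sum_sub_distrib]
  refine Submodule.sum_mem _ fun y hy => ?_
  by_cases hk : Keeps a.face y
  · simp [hk]
  · simp only [hk, if_true, if_false, sub_zero]
    refine Submodule.smul_mem _ _ (single_mem_supported ?_ 1)
    refine ⟨er_mem_atDeg (big_subset h2 hS ha) hy, fun h => hk ?_⟩
    exact Eq.trans h (Prod.mk.inj ha.1).2.symm

lemma cone_on_atDeg {s : Mon (Fin t)} (hsM : s ∈ M) (hsγ : s ≤ γ) {x : Letter M →₀ k}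
    (hx : x ∈ Finsupp.supported k k (atDeg M γ S n)) :
    linExt (dF k fun _ _ => True) (linExt (cone k fun _ => s) x)
      + linExt (cone k fun _ => s) (linExt (dF k fun _ _ => True) x) = x := by
  rw [← LinearMap.comp_apply, ← LinearMap.comp_apply, ← LinearMap.add_apply]
  refine eq_on_supported (s := atDeg M γ S n) (linExt (dF k fun _ _ => True) ∘ₗ
    linExt (cone k fun _ => s) + linExt (cone k fun _ => s) ∘ₗ linExt (dF k fun _ _ => True))
    LinearMap.id ?_ hx
  intro a ha
  rw [LinearMap.add_apply, LinearMap.comp_apply, LinearMap.comp_apply, linExt_single,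
    linExt_single, one_smul, one_smul]
  exact cone_homotopy (v := fun _ => s) hsM (by rw [ha.1]; exact hsγ)

lemma exact_atDeg (hS : S ∈ satSets M) (hγ : mlcm S ≤ γ)
    {x : Letter M →₀ k} (hx : x ∈ Finsupp.supported k k (atDeg M γ S n))
    (h : linExt (dF k fun _ _ => True) x = 0) :
    ∃ y ∈ Finsupp.supported k k (atDeg M γ S (n + 1)), linExt (dF k fun _ _ => True) y = x := by
  obtain ⟨s, hs⟩ := nonempty_of_mem_satSets hS
  have hsM := subset_of_mem_satSets hS hs
  have hsγ : s ≤ γ := (le_mlcm hs).trans hγ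
  refine ⟨linExt (cone k fun _ => s) x, ?_, ?_⟩
  · refine supported_induction (s := atDeg M γ S n)
      (W := Finsupp.supported k k (atDeg M γ S (n + 1))) (linExt (cone k fun _ => s)) ?_ hx
    intro a ha
    rw [linExt_single, one_smul, Finsupp.mem_supported]
    intro b hb
    obtain ⟨h1, h3, h4⟩ := mem_support_cone hb
    refine ⟨h1.trans ha.1, fun y hy => ?_, by rw [h3, ha.2.2]⟩
    rcases h4 y hy with h | rfl
    · exact ha.2.1 h
    · exact hs
  · have key := cone_on_atDeg hsM hsγ hx
    rwa [h, map_zero, add_zero] at key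

lemma linExt_dF_sq (x : Letter M →₀ k) :
    linExt (dF k fun _ _ => True) (linExt (dF k fun _ _ => True) x) = 0 := by
  rw [← LinearMap.comp_apply]
  refine linearMap_eq_of_single (f := linExt (dF k fun _ _ => True) ∘ₗ
    linExt (dF k (M := M) fun _ _ => True)) (g := (0 : (Letter M →₀ k) →ₗ[k] _)) (fun a => ?_) x
  rw [LinearMap.comp_apply, linExt_single, one_smul]
  exact dF_dF (fun _ _ _ _ _ _ _ _ => ⟨trivial, trivial⟩) a

end Letter

end MonomialRings

namespace MonomialRings

namespace Letter

variable {t : ℕ} {M : Finset (Mon (Fin t))} (k : Type*) [Field k]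
variable {γ : Mon (Fin t)} {S : Finset (Mon (Fin t))} {n : ℕ}

/-- The passage from letters to simplices. -/
def toFace (M : Finset (Mon (Fin t))) : (Letter M →₀ k) →ₗ[k] (Finset (Mon (Fin t)) →₀ k) :=
  Finsupp.lmapDomain k k face

variable {k}

lemma toFace_single (a : Letter M) (c : k) :
    toFace k M (Finsupp.single a c) = Finsupp.single a.face c := Finsupp.mapDomain_single

lemma toFace_dF (x : Letter M →₀ k) :
    toFace k M (linExt (dF k fun _ _ => True) x) = bdry k _ (toFace k M x) := by
  rw [← LinearMap.comp_apply, ← LinearMap.comp_apply]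
  refine linearMap_eq_of_single (f := toFace k M ∘ₗ linExt (dF k fun _ _ => True))
    (g := bdry k _ ∘ₗ toFace k M) (fun a => ?_) x
  rw [LinearMap.comp_apply, LinearMap.comp_apply, linExt_single, one_smul, toFace_single, dF,
    map_sum, bdry, Finsupp.linearCombination_single, one_smul, bdryAux]
  simp only [Finset.filter_true]
  refine Finset.sum_congr rfl fun s _ => ?_
  rw [map_smul, toFace_single]
  rfl

lemma toFace_injOn {x : Letter M →₀ k} (hx : x ∈ Finsupp.supported k k {a : Letter M | a.deg = γ})
    (h : toFace k M x = 0) : x = 0 := by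
  refine Finsupp.mapDomain_injOn {a : Letter M | a.deg = γ} (f := face) ?_ hx (by simp) ?_
  · intro a ha b hb hab
    exact Letter.ext (ha.trans hb.symm) hab
  · rw [Finsupp.mapDomain_zero]
    exact h

lemma chainSub_eq_map (h2 : ∀ m ∈ M, 2 ≤ mdeg m) (hS : S ∈ satSets M) (hγ : mlcm S ≤ γ) :
    chainSub k (dprime S) n = (Finsupp.supported k k (small M γ S n)).map (toFace k M) := by
  have h0 : 0 ∉ S := zero_notMem_of_subset (zero_notMem_of_two_le h2) (subset_of_mem_satSets hS)
  rw [toFace, Finsupp.lmapDomain_supported, chainSub, ← Finsupp.supported_eq_span_single]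
  congr 1
  ext F
  constructor
  · rintro ⟨hF, hn⟩
    have hγ0 : γ ≠ 0 := by
      rintro rfl
      obtain ⟨s, hs⟩ := nonempty_of_mem_satSets hS
      have : s ≤ 0 := (le_mlcm hs).trans hγ
      exact h0 (le_antisymm this (fun _ => Nat.zero_le _) ▸ hs)
    refine ⟨⟨γ, F, hγ0, hF.1.trans (subset_of_mem_satSets hS), (mlcm_mono hF.1).trans hγ⟩,
      ⟨⟨rfl, hF.1, hn⟩, fun h => (notMem_dprime_iff h0 hF.1).2 h hF⟩, rfl⟩
  · rintro ⟨a, ⟨⟨-, hs, hn⟩, hc⟩, rfl⟩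
    exact ⟨by_contra fun h => hc ((notMem_dprime_iff h0 hs).1 h), hn⟩

lemma homDim_small (h2 : ∀ m ∈ M, 2 ≤ mdeg m) (hS : S ∈ satSets M) (hγ : mlcm S ≤ γ) :
    homDim (linExt (dF k fun _ _ => True)) (Finsupp.supported k k (small M γ S n))
      (Finsupp.supported k k (small M γ S (n + 1))) = hdim k (dprime S) n := by
  have hd : ∀ n, ∀ x ∈ Finsupp.supported k k (small M γ S (n + 1)),
      linExt (dF k fun _ _ => True) x ∈ Finsupp.supported k k (small M γ S n) :=
    fun n x hx => linExt_dF_mem (fun a ha s hs _ => er_mem_small h2 hS ha hs) hx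
  have hsub : ∀ n, Finsupp.supported k k (small M γ S n)
      ≤ Finsupp.supported k k {a : Letter M | a.deg = γ} :=
    fun n => Finsupp.supported_mono fun a ha => ha.1.1
  have hU : ∀ n, ∀ x ∈ Finsupp.supported k k (small M γ S n),
      linExt (dF k fun _ _ => True) x ∈ Finsupp.supported k k {a : Letter M | a.deg = γ} :=
    fun n x hx => linExt_dF_mem (s := small M γ S n) (fun a ha s hs _ => ha.1.1) hx
  rw [← homDim_transport (toFace k M) (linExt (dF k fun _ _ => True)) (bdry k _)
    (Finsupp.supported k k (small M γ S n)) (Finsupp.supported k k (small M γ S (n + 1)))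
    (Finsupp.supported k k {a : Letter M | a.deg = γ}) _ _ (chainSub_eq_map h2 hS hγ)
    (chainSub_eq_map h2 hS hγ) (hsub n) (hU n) (hU (n + 1)) (fun x hx h => toFace_injOn hx h)
    (fun x _ => toFace_dF x) (fun x _ => toFace_dF x)]
  have hfd : FiniteDimensional k ↥(Finsupp.supported k k (small M γ S n)) :=
    finiteDimensional_supported ((atDeg_finite γ S n).subset small_subset)
  have : FiniteDimensional k ↥(chainSub k (dprime S) n) := by
    rw [chainSub_eq_map h2 hS hγ]
    exact Module.Finite.map _ _
  rw [← homDim_toNat]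
  · rfl
  · intro y hy
    rw [chainSub_eq_map h2 hS hγ] at hy ⊢
    obtain ⟨x, hx, rfl⟩ := hy
    exact ⟨_, hd n x hx, toFace_dF x⟩
  · intro y hy
    rw [chainSub_eq_map h2 hS hγ] at hy
    obtain ⟨x, hx, rfl⟩ := hy
    rw [← toFace_dF, ← toFace_dF, linExt_dF_sq, map_zero]

/-- The homology of a local piece of the associated graded Taylor differential. -/
theorem homDim_big (h2 : ∀ m ∈ M, 2 ≤ mdeg m) (hS : S ∈ satSets M) (hγ : mlcm S ≤ γ) :
    homDim (linExt (dF k Keeps)) (Finsupp.supported k k (big M γ S (n + 1)))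
      (Finsupp.supported k k (big M γ S (n + 2))) = hdim k (dprime S) n := by
  have hfd : ∀ n, FiniteDimensional k ↥(Finsupp.supported k k (atDeg M γ S n)) :=
    fun n => finiteDimensional_supported (atDeg_finite γ S n)
  have hP : ∀ n, Finsupp.supported k k (atDeg M γ S n)
      = Finsupp.supported k k (big M γ S n) ⊔ Finsupp.supported k k (small M γ S n) :=
    fun n => supported_sup_of_partition (atDeg_eq_union h2 hS)
  have hdis : ∀ n, Disjoint (Finsupp.supported k k (big M γ S n))
      (Finsupp.supported k k (small M γ S n)) :=
    fun n => disjoint_supported disjoint_big_small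
  have hQ : ∀ n, ∀ x ∈ Finsupp.supported k k (small M γ S (n + 1)),
      linExt (dF k fun _ _ => True) x ∈ Finsupp.supported k k (small M γ S n) :=
    fun n x hx => linExt_dF_mem (fun a ha s hs _ => er_mem_small h2 hS ha hs) hx
  have hA : ∀ n, ∀ x ∈ Finsupp.supported k k (atDeg M γ S (n + 1)),
      linExt (dF k fun _ _ => True) x ∈ Finsupp.supported k k (atDeg M γ S n) :=
    fun n x hx => linExt_dF_mem (fun a ha s hs _ => er_mem_atDeg ha hs) hx
  have hG : ∀ n, ∀ x ∈ Finsupp.supported k k (big M γ S (n + 1)),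
      linExt (dF k Keeps) x ∈ Finsupp.supported k k (big M γ S n) := by
    refine fun n x hx => linExt_dF_mem (s := big M γ S (n + 1)) (fun a ha s hs h => ?_) hx
    have h1 := card_er hs
    have h3 := ha.2
    refine ⟨?_, by omega⟩
    rw [← ha.1]
    exact Prod.ext rfl h
  have hex : ∀ n, ∀ x ∈ Finsupp.supported k k (small M γ S n),
      linExt (dF k fun _ _ => True) x = 0 → ∃ y ∈ Finsupp.supported k k (atDeg M γ S (n + 1)),
        linExt (dF k fun _ _ => True) y = x :=
    fun n x hx h => exact_atDeg hS hγ (Finsupp.supported_mono small_subset hx) h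
  have := hfd (n + 1)
  have := hfd (n + 2)
  rw [homDim_graded_piece (linExt (dF k fun _ _ => True)) (linExt (dF k Keeps))
    (Finsupp.supported k k (atDeg M γ S (n + 1))) (Finsupp.supported k k (atDeg M γ S (n + 2)))
    (Finsupp.supported k k (small M γ S n)) (Finsupp.supported k k (small M γ S (n + 1)))
    (Finsupp.supported k k (small M γ S (n + 2))) (Finsupp.supported k k (big M γ S n))
    (Finsupp.supported k k (big M γ S (n + 1))) (Finsupp.supported k k (big M γ S (n + 2)))
    (hP _) (hP _) (hdis _) (hdis _) (hdis _) linExt_dF_sq (hQ _) (hQ _) (hG _) (hG _)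
    (fun x hx => linExt_dF_sub_mem h2 hS hx) (fun x hx => linExt_dF_sub_mem h2 hS hx)
    (hex _) (hex _), homDim_small h2 hS hγ, homDim_eq_zero, zero_add]
  · exact hA _
  · exact linExt_dF_sq
  · exact fun x hx h => exact_atDeg hS hγ hx h

end Letter

end MonomialRings

namespace MonomialRings

section ListSeries

variable {σ Λ : Type*} {v : Λ → σ →₀ ℕ}

lemma finite_list_sum_eq (hv : ∀ a, v a ≠ 0) (hfin : ∀ e, {a | v a = e}.Finite) (e : σ →₀ ℕ) :
    {L : List Λ | (L.map v).sum = e}.Finite := by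
  induction e using WellFoundedLT.induction with
  | ind e ih =>
    have h : ({[]} ∪ ⋃ p ∈ {p | p ∈ Finset.HasAntidiagonal.antidiagonal e ∧ p.2 < e},
        Set.image2 List.cons {a | v a = p.1} {L : List Λ | (L.map v).sum = p.2}).Finite := by
      refine (Set.finite_singleton _).union (Set.Finite.biUnion' ?_ ?_)
      · exact (Finset.HasAntidiagonal.antidiagonal e).finite_toSet.subset fun p hp => hp.1
      · exact fun p hp => (hfin _).image2 _ (ih _ hp.2)
    refine h.subset ?_
    rintro (_ | ⟨a, L⟩) hL
    · exact .inl rfl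
    · have hL' : v a + (L.map v).sum = e := by simpa using hL
      refine .inr (Set.mem_biUnion (x := (v a, (L.map v).sum)) ⟨?_, ?_⟩ ⟨a, rfl, L, rfl, rfl⟩)
      · simpa using hL'
      · change (L.map v).sum < e
        rw [← hL']
        exact lt_add_of_pos_left _ (pos_iff_ne_zero.2 (hv a))

/-- The generating series of a weighted set with finite fibres. -/
def genSeries {ι : Type*} (w : ι → σ →₀ ℕ) (hfin : ∀ e, {a | w a = e}.Finite) (s : ι → ℤ) :
    MvPowerSeries σ ℤ :=
  fun e => ∑ a ∈ (hfin e).toFinset, s a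

lemma coeff_genSeries {ι : Type*} (w : ι → σ →₀ ℕ) (hfin : ∀ e, {a | w a = e}.Finite) (s : ι → ℤ)
    (e : σ →₀ ℕ) : MvPowerSeries.coeff e (genSeries w hfin s) = ∑ a ∈ (hfin e).toFinset, s a := rfl

/-- Lists of letters are enumerated by a geometric series. -/
theorem genSeries_list (hv : ∀ a, v a ≠ 0) (hfin : ∀ e, {a | v a = e}.Finite) (s : Λ → ℤ) :
    (1 - genSeries v hfin s) * genSeries (fun L : List Λ => (L.map v).sum)
      (finite_list_sum_eq hv hfin) (fun L => (L.map s).prod) = 1 := by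
  rw [sub_mul, one_mul, sub_eq_iff_eq_add]
  ext e
  rw [map_add, MvPowerSeries.coeff_mul, coeff_genSeries]
  simp only [coeff_genSeries]
  have hset : (finite_list_sum_eq hv hfin e).toFinset
      = (if e = 0 then {[]} else ∅) ∪ ((Finset.HasAntidiagonal.antidiagonal e).sigma fun p =>
        (hfin p.1).toFinset ×ˢ (finite_list_sum_eq hv hfin p.2).toFinset).image
          fun x => x.2.1 :: x.2.2 := by
    ext L
    rw [Finset.mem_union, Finset.mem_image, Set.Finite.mem_toFinset]
    cases L with
    | nil =>
      simp only [Set.mem_ofPred, List.map_nil, List.sum_nil]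
      by_cases h : e = 0 <;> simp [h, eq_comm]
    | cons a L =>
      have h1 : a :: L ∉ (if e = 0 then ({[]} : Finset (List Λ)) else ∅) := by
        split_ifs <;> simp
      simp only [h1, false_or, Set.mem_ofPred, List.map_cons, List.sum_cons]
      constructor
      · intro h
        exact ⟨⟨(v a, (L.map v).sum), (a, L)⟩, by simp [h], rfl⟩
      · rintro ⟨⟨p, b, L'⟩, h, h'⟩
        simp only [List.cons.injEq] at h'
        obtain ⟨rfl, rfl⟩ := h'
        simp only [Finset.mem_sigma, Finset.mem_product,
          Set.Finite.mem_toFinset, Set.mem_ofPred] at h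
        rw [h.2.1, h.2.2, Finset.HasAntidiagonal.mem_antidiagonal.1 h.1]
  rw [hset, Finset.sum_union, Finset.sum_image, Finset.sum_sigma]
  · congr 1
    · rw [MvPowerSeries.coeff_one]
      split_ifs <;> simp
    · refine Finset.sum_congr rfl fun p _ => ?_
      rw [Finset.sum_mul_sum, ← Finset.sum_product']
      simp
  · rintro ⟨p, b, L⟩ h ⟨p', b', L'⟩ h' hh
    simp only [List.cons.injEq] at hh
    obtain ⟨rfl, rfl⟩ := hh
    simp only [Finset.coe_sigma, Set.mem_sigma_iff, Finset.mem_coe, Finset.mem_product,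
      Set.Finite.mem_toFinset, Set.mem_ofPred] at h h'
    have : p = p' := Prod.ext (h.2.1.symm.trans h'.2.1) (h.2.2.symm.trans h'.2.2)
    subst this
    rfl
  · rw [Finset.disjoint_left]
    intro L hL h
    obtain ⟨x, -, rfl⟩ := Finset.mem_image.1 h
    split_ifs at hL <;> simp at hL

end ListSeries

section Units

variable {t : ℕ}

/-- The coefficients of the inverse of `∏ i ∈ T, (1 + x_i z)`. -/
def invProd (T : Finset (Fin t)) : MvPowerSeries (Option (Fin t)) ℤ :=
  fun e => if e none = ∑ i ∈ T, e (some i) ∧ ∀ i ∉ T, e (some i) = 0 then (-1) ^ e none else 0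

lemma coeff_invProd (T : Finset (Fin t)) (e : Option (Fin t) →₀ ℕ) :
    MvPowerSeries.coeff e (invProd T)
      = if e none = ∑ i ∈ T, e (some i) ∧ ∀ i ∉ T, e (some i) = 0 then (-1) ^ e none else 0 := rfl

lemma X_mul_X_eq (i : Fin t) :
    (MvPowerSeries.X (some i) * MvPowerSeries.X none : MvPowerSeries (Option (Fin t)) ℤ)
      = MvPowerSeries.monomial (Finsupp.single (some i) 1 + Finsupp.single none 1) 1 := by
  rw [MvPowerSeries.X, MvPowerSeries.X, MvPowerSeries.monomial_mul_monomial, one_mul]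

lemma mul_invProd_insert {T : Finset (Fin t)} {i : Fin t} (hi : i ∉ T) :
    (1 + MvPowerSeries.X (some i) * MvPowerSeries.X none) * invProd (insert i T)
      = invProd T := by
  ext e
  have hs : ∀ f : Option (Fin t) →₀ ℕ,
      ∑ j ∈ insert i T, f (some j) = f (some i) + ∑ j ∈ T, f (some j) :=
    fun f => Finset.sum_insert hi
  rw [add_mul, one_mul, map_add, X_mul_X_eq, MvPowerSeries.coeff_monomial_mul, one_mul]
  simp only [coeff_invProd, hs]
  by_cases h0 : e (some i) = 0
  · rw [if_neg (c := _ ≤ e), add_zero, h0, zero_add]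
    · congr 1
      apply propext
      refine and_congr_right fun _ => ⟨fun h j hj => ?_, fun h j hj => ?_⟩
      · by_cases hji : j = i
        · rw [hji, h0]
        · exact h j (by simp [hji, hj])
      · exact h j fun h' => hj (Finset.mem_insert_of_mem h')
    · intro h
      have := h (some i)
      simp [h0] at this
  · rw [if_neg (c := e none = ∑ j ∈ T, e (some j) ∧ ∀ j ∉ T, e (some j) = 0)
        (fun h => h0 (h.2 i hi))]
    by_cases hz : e none = 0
    · rw [if_neg (fun h => h0 (by omega)), if_neg (c := _ ≤ e), add_zero]
      intro h
      have := h none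
      simp [hz] at this
    · rw [if_pos (c := _ ≤ e)]
      · obtain ⟨e', he'⟩ : ∃ e' : Option (Fin t) →₀ ℕ,
            e' = e - (Finsupp.single (some i) 1 + Finsupp.single none 1) := ⟨_, rfl⟩
        have h1 : e' none + 1 = e none := by
          simp [he']
          omega
        have h2 : e' (some i) + 1 = e (some i) := by
          simp [he']
          omega
        have h3 : ∀ j, j ≠ i → e' (some j) = e (some j) := by
          intro j hj
          simp [he', hj.symm]
        rw [← he']
        have h4 : ∑ j ∈ T, e' (some j) = ∑ j ∈ T, e (some j) :=
          Finset.sum_congr rfl fun j hj => h3 j fun h => hi (h ▸ hj)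
        have h5 : (∀ j ∉ insert i T, e' (some j) = 0) ↔ ∀ j ∉ insert i T, e (some j) = 0 :=
          forall₂_congr fun j hj => by
            rw [h3 j fun h => hj (h ▸ Finset.mem_insert_self _ _)]
        simp only [h4, h5, ← h1, ← h2]
        have h6 : e' none + 1 = e' (some i) + 1 + ∑ j ∈ T, e (some j)
            ↔ e' none = e' (some i) + ∑ j ∈ T, e (some j) := by omega
        simp only [h6]
        split_ifs
        · ring
        · ring
      · intro o
        rcases o with _ | j
        · simp
          omega
        · by_cases hj : j = i
          · subst hj
            simp
            omega
          · simp [Ne.symm hj]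

lemma prod_mul_invProd (T : Finset (Fin t)) :
    (∏ i ∈ T, (1 + MvPowerSeries.X (some i) * MvPowerSeries.X none)) * invProd T = 1 := by
  induction T using Finset.induction_on with
  | empty =>
    ext e
    rw [Finset.prod_empty, one_mul, coeff_invProd, MvPowerSeries.coeff_one]
    by_cases h : e = 0
    · simp [h]
    · rw [if_neg h, if_neg]
      rintro ⟨h1, h2⟩
      apply h
      ext o
      rcases o with _ | j
      · simpa using h1
      · exact h2 j (by simp)
  | insert i T hi ih =>
    rw [Finset.prod_insert hi, mul_comm (1 + _), mul_assoc, mul_invProd_insert hi, ih]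

end Units

end MonomialRings

namespace MonomialRings

namespace Letter

variable {t : ℕ} {M : Finset (Mon (Fin t))} (k : Type*) [Field k]

/-- The multidegree and the component monomials of a letter. -/
def key (a : Letter M) : Mon (Fin t) × Finset (Mon (Fin t)) := (a.deg, cl a.face)

/-- The size of the type of a letter in terms of its key. -/
def keyCard (κ : Mon (Fin t) × Finset (Mon (Fin t))) : ℕ := κ.2.card + mdeg (κ.1 - mlcm κ.2)

lemma card_type_eq_keyCard (h2 : ∀ m ∈ M, 2 ≤ mdeg m) (a : Letter M) :
    a.type.card = keyCard a.key := by
  rw [type, Multiset.card_add, card_units, Finset.card_val, keyCard, rem,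
    (decomp_cl (a.zero_notMem h2)).sup_eq]
  rfl

/-- Key sequences of total degree `α` and excess `q`. -/
def keySet (α : Mon (Fin t)) (q : ℕ) : Set (List (Mon (Fin t) × Finset (Mon (Fin t)))) :=
  {l | (l.map Prod.fst).sum = α ∧ (l.map fun κ => keyCard κ - 1).sum = q}

lemma sum_keyCard_sub_one (h2 : ∀ m ∈ M, 2 ≤ mdeg m) (L : List (Letter M)) :
    (L.map fun a => keyCard a.key - 1).sum + L.length = ((L.map type).sum).card := by
  induction L with
  | nil => rfl
  | cons a L ih =>
    have h1 : 0 < a.type.card := Multiset.card_pos.2 (a.type_ne_zero h2)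
    simp only [List.map_cons, List.sum_cons, List.length_cons, Multiset.card_add, ← ih,
      ← card_type_eq_keyCard h2]
    omega

lemma gr_eq_listPiece (h2 : ∀ m ∈ M, 2 ≤ mdeg m) (α : Mon (Fin t)) (q m : ℕ) :
    SplitData.Perturbation.gr (splitData k h2) (lists M α) q (m + 1)
      = listPiece key (fun a : Letter M => a.face.card) (keySet α q) m := by
  ext L
  have h1 : (splitData k h2).excess L = (L.map fun a => keyCard a.key - 1).sum := by
    have h3 := (splitData k h2).excess_add_length L
    have h4 := sum_keyCard_sub_one h2 L
    have h5 : (L.map (splitData k h2).τ).sum.card = (L.map type).sum.card := rfl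
    omega
  change ((L.map deg).sum = α ∧ (L.map fun a => a.face.card + 1).sum + 1 = m + 1) ∧
    (splitData k h2).excess L = q ↔ (((L.map key).map Prod.fst).sum = α ∧
      ((L.map key).map fun κ => keyCard κ - 1).sum = q) ∧
      (L.map fun a => a.face.card + 1).sum = m
  rw [h1, List.map_map, List.map_map, Nat.add_right_cancel_iff]
  exact and_right_comm

lemma dF_keeps_sq (h2 : ∀ m ∈ M, 2 ≤ mdeg m) (a : Letter M) :
    linExt (dF k Keeps) (dF k Keeps a) = 0 :=
  dF_dF (fun _ hS _ _ _ _ h h' => keeps_of_keeps (fun m hm => h2 m (hS hm)) h h') a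

lemma linExt_dF_keeps_sq (h2 : ∀ m ∈ M, 2 ≤ mdeg m) (x : Letter M →₀ k) :
    linExt (dF k Keeps) (linExt (dF k Keeps) x) = 0 := by
  rw [← LinearMap.comp_apply]
  refine linearMap_eq_of_single (f := linExt (dF k Keeps) ∘ₗ
    linExt (dF k (M := M) Keeps)) (g := (0 : (Letter M →₀ k) →ₗ[k] _)) (fun a => ?_) x
  rw [LinearMap.comp_apply, linExt_single, one_smul]
  exact dF_keeps_sq k h2 a

lemma keeps_support {a b : Letter M} (h : b ∈ (dF k Keeps a).support) :
    b.key = a.key ∧ b.face.card + 1 = a.face.card := by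
  obtain ⟨s, hs, hk, rfl⟩ := mem_support_dF h
  exact ⟨Prod.ext rfl hk, card_er hs⟩

lemma finite_key_card (κ : Mon (Fin t) × Finset (Mon (Fin t))) (n : ℕ) :
    {a : Letter M | a.key = κ ∧ a.face.card = n}.Finite := by
  refine (atDeg_finite κ.1 M n).subset ?_
  rintro a ⟨rfl, h⟩
  exact ⟨rfl, a.face_sub, h⟩

/-- The bar homology is counted by lists of harmonic letters. -/
theorem exists_harmonic (h2 : ∀ m ∈ M, 2 ≤ mdeg m) :
    ∃ (Λ : Type) (key' : Λ → Mon (Fin t) × Finset (Mon (Fin t))) (deg' : Λ → ℕ),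
      (∀ κ n, {a | key' a = κ ∧ deg' a = n}.Finite) ∧
      (∀ κ n, homDim (linExt (dF k Keeps)) (piece k key (fun a : Letter M => a.face.card) κ n)
        (piece k key (fun a : Letter M => a.face.card) κ (n + 1))
        = {a | key' a = κ ∧ deg' a = n}.ncard) ∧
      ∀ α i, (torDim k (upperSet M) i α : ℤ) = ∑ q ∈ Finset.range (i + 1), (-1 : ℤ) ^ q *
        (listPiece key' deg' (keySet α q) (i - q)).ncard := by
  obtain ⟨Λ, key', deg', hfin, hcount, hlist⟩ := exists_harmonic_letters (dF k Keeps)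
    (key (M := M)) (fun a => a.face.card) (fun a b h => keeps_support k h) (dF_keeps_sq k h2)
    finite_key_card
  refine ⟨Λ, key', deg', hfin, hcount, fun α i => ?_⟩
  have : Nonempty (Mon (Fin t)) := ⟨0⟩
  have hf : ∀ q m, (listPiece key (fun a : Letter M => a.face.card) (keySet α q) m).Finite := by
    intro q m
    rw [← gr_eq_listPiece k h2]
    exact (lists_finite α (m + 1)).subset fun L hL => hL.1
  rw [torDim_eq, (perturbation k h2 α).homDim_eq]
  refine Finset.sum_congr rfl fun q hq => ?_
  have hq' : i + 1 - q = i - q + 1 := by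
    have := Finset.mem_range.1 hq
    omega
  rw [← hlist (sign k) sign_succ sign_sq (keySet α q) (i - q) (hf _ _) (hf _ _), hq',
    gr_eq_listPiece, gr_eq_listPiece]
  rfl

variable {k}

lemma homDim_piece_of_isEmpty (h2 : ∀ m ∈ M, 2 ≤ mdeg m)
    {κ : Mon (Fin t) × Finset (Mon (Fin t))} {n : ℕ}
    (h : ∀ a : Letter M, a.key = κ → a.face.card ≠ n) :
    homDim (linExt (dF k Keeps)) (piece k key (fun a : Letter M => a.face.card) κ n)
        (piece k key (fun a : Letter M => a.face.card) κ (n + 1)) = 0 := by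
  refine homDim_eq_zero _ _ _ (fun y hy => ?_) (linExt_dF_keeps_sq k h2) fun x hx _ => ?_
  · exact linExt_mem_piece (fun a b h => keeps_support k h) hy
  · refine ⟨0, zero_mem _, ?_⟩
    rw [map_zero]
    have hs : {a : Letter M | a.key = κ ∧ a.face.card = n} = ∅ := by
      ext a
      simp only [Set.mem_ofPred, Set.mem_empty_iff_false, iff_false, not_and]
      exact h a
    rw [piece, hs, Finsupp.supported_empty] at hx
    exact ((Submodule.mem_bot k).1 hx).symm

lemma homDim_piece_empty {γ : Mon (Fin t)} (hγ : γ ≠ 0) :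
    homDim (linExt (dF k Keeps)) (piece k key (fun a : Letter M => a.face.card) (γ, ∅) 0)
        (piece k key (fun a : Letter M => a.face.card) (γ, ∅) 1) = 1 := by
  have h1 : {a : Letter M | a.key = (γ, ∅) ∧ a.face.card = 1} = ∅ := by
    ext a
    simp only [Set.mem_ofPred, Set.mem_empty_iff_false, iff_false, not_and]
    intro h
    have : a.face = ∅ := cl_eq_empty.1 (Prod.mk.inj h).2
    simp [this]
  have h0 : {a : Letter M | a.key = (γ, ∅) ∧ a.face.card = 0}
      = {⟨γ, ∅, hγ, Finset.empty_subset _, by simp [mlcm]⟩} := by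
    ext a
    simp only [Set.mem_ofPred, Set.mem_singleton_iff]
    constructor
    · rintro ⟨h, h'⟩
      exact Letter.ext (Prod.mk.inj h).1 (Finset.card_eq_zero.1 h')
    · rintro rfl
      exact ⟨Prod.ext rfl cl_empty, rfl⟩
  have hker : piece k key (fun a : Letter M => a.face.card) (γ, ∅) 0
      ≤ LinearMap.ker (linExt (dF k Keeps)) := by
    intro x hx
    rw [piece] at hx
    rw [LinearMap.mem_ker]
    refine (Submodule.mem_bot k).1 (supported_induction (W := ⊥) _ (fun a ha => ?_) hx)
    rw [linExt_single, one_smul, Submodule.mem_bot, dF, Finset.card_eq_zero.1 ha.2,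
      Finset.filter_empty, Finset.sum_empty]
  rw [homDim, inf_eq_left.2 hker, piece, piece, h1, Finsupp.supported_empty, Submodule.map_bot,
    finrank_bot, finrank_supported, h0, Set.ncard_singleton]
  · rfl
  · rw [h0]
    exact Set.finite_singleton _

lemma homDim_piece_zero (h2 : ∀ m ∈ M, 2 ≤ mdeg m) {γ : Mon (Fin t)}
    {S : Finset (Mon (Fin t))} (hne : S.Nonempty) :
    homDim (linExt (dF k Keeps)) (piece k key (fun a : Letter M => a.face.card) (γ, cl S) 0)
        (piece k key (fun a : Letter M => a.face.card) (γ, cl S) 1) = 0 := by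
  refine homDim_piece_of_isEmpty h2 fun a h h0 => hne.ne_empty ?_
  rw [← cl_eq_empty, ← (Prod.mk.inj h).2, cl_eq_empty]
  exact Finset.card_eq_zero.1 h0

end Letter

lemma hdim_eq_zero (k : Type*) [Field k] {V : Type*} {Δ : Set (Finset V)} {n : ℕ}
    (h : ∀ F ∈ Δ, F.card ≠ n) : hdim k Δ n = 0 := by
  have hs : {F | F ∈ Δ ∧ F.card = n} = ∅ := by
    ext F
    simp only [Set.mem_ofPred, Set.mem_empty_iff_false, iff_false, not_and]
    exact h F
  rw [hdim, cycles, chainSub, hs, Set.image_empty, Submodule.span_empty, bot_inf_eq, finrank_bot,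
    Nat.zero_sub]

end MonomialRings

namespace MonomialRings

namespace Letter

variable {t : ℕ} {M : Finset (Mon (Fin t))} (k : Type*) [Field k]

/-- The number of harmonic letters with a given key and a given number of vertices. -/
def harmonicCount (M : Finset (Mon (Fin t))) (κ : Mon (Fin t) × Finset (Mon (Fin t))) (n : ℕ) : ℤ :=
  homDim (linExt (dF k Keeps)) (piece k key (fun a : Letter M => a.face.card) κ n)
    (piece k key (fun a : Letter M => a.face.card) κ (n + 1))

lemma harmonicCount_empty (h2 : ∀ m ∈ M, 2 ≤ mdeg m) {γ : Mon (Fin t)} (hγ : γ ≠ 0) (n : ℕ) :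
    harmonicCount k M (γ, ∅) n = if n = 0 then 1 else 0 := by
  split_ifs with h
  · subst h
    exact homDim_piece_empty hγ
  · refine homDim_piece_of_isEmpty h2 fun a ha h' => h ?_
    rw [← h', cl_eq_empty.1 (Prod.mk.inj ha).2, Finset.card_empty]

lemma harmonicCount_cl_zero (h2 : ∀ m ∈ M, 2 ≤ mdeg m) {γ : Mon (Fin t)}
    {S : Finset (Mon (Fin t))} (hS : S ∈ satSets M) : harmonicCount k M (γ, cl S) 0 = 0 :=
  homDim_piece_zero h2 (nonempty_of_mem_satSets hS)

lemma harmonicCount_cl_succ (h2 : ∀ m ∈ M, 2 ≤ mdeg m) {γ : Mon (Fin t)}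
    {S : Finset (Mon (Fin t))} (hS : S ∈ satSets M) (hγ : mlcm S ≤ γ) (n : ℕ) :
    harmonicCount k M (γ, cl S) (n + 1) = hdim k (dprime S) n :=
  homDim_big h2 hS hγ

variable {k}

lemma key_of_harmonicCount_ne_zero (h2 : ∀ m ∈ M, 2 ≤ mdeg m)
    {κ : Mon (Fin t) × Finset (Mon (Fin t))} {n : ℕ} (h : harmonicCount k M κ n ≠ 0) :
    κ.1 ≠ 0 ∧ (κ.2 = ∅ ∨ ∃ S ∈ satSets M, κ.2 = cl S ∧ mlcm S ≤ κ.1) := by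
  obtain ⟨a, rfl⟩ : ∃ a : Letter M, a.key = κ := by
    by_contra! h'
    exact h (homDim_piece_of_isEmpty h2 fun a ha => (h' a ha).elim)
  refine ⟨a.deg_ne, or_iff_not_imp_left.2 fun hne => ?_⟩
  have h0 := zero_notMem_of_two_le h2
  have hface : a.face.Nonempty := Finset.nonempty_iff_ne_empty.2 fun h' => hne (cl_eq_empty.2 h')
  have hcl : cl (clOf M (cl a.face)) = cl a.face := cl_clOf h0 a.face_sub
  have hmem := clOf_mem_satSets h0 a.face_sub hface
  refine ⟨_, hmem, hcl.symm, ?_⟩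
  rw [(decomp_cl (zero_notMem_of_subset h0 (subset_of_mem_satSets hmem))).sup_eq, hcl,
    ← (decomp_cl (a.zero_notMem h2)).sup_eq]
  exact a.le_deg

end Letter

section Exponents

variable {t : ℕ}

@[simp] lemma expOf_none (α : Mon (Fin t)) (d : ℕ) : expOf α d none = d := rfl

@[simp] lemma expOf_some (α : Mon (Fin t)) (d : ℕ) (i : Fin t) : expOf α d (some i) = α i := rfl

lemma eq_expOf (e : Option (Fin t) →₀ ℕ) : e = expOf (fun i => e (some i)) (e none) := by
  ext o
  cases o <;> rfl

lemma expOf_inj {α β : Mon (Fin t)} {d d' : ℕ} : expOf α d = expOf β d' ↔ α = β ∧ d = d' := by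
  refine ⟨fun h => ⟨funext fun i => ?_, ?_⟩, fun h => by rw [h.1, h.2]⟩
  · simpa using DFunLike.congr_fun h (some i)
  · simpa using DFunLike.congr_fun h none

lemma expOf_le {α β : Mon (Fin t)} {d d' : ℕ} : expOf α d ≤ expOf β d' ↔ α ≤ β ∧ d ≤ d' := by
  refine ⟨fun h => ⟨fun i => h (some i), h none⟩, fun h o => ?_⟩
  cases o with
  | none => exact h.2
  | some i => exact h.1 i

lemma expOf_sub (α β : Mon (Fin t)) (d d' : ℕ) :
    expOf α d - expOf β d' = expOf (α - β) (d - d') := by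
  ext o
  cases o <;> rfl

lemma expOf_add (α β : Mon (Fin t)) (d d' : ℕ) :
    expOf α d + expOf β d' = expOf (α + β) (d + d') := by
  ext o
  cases o <;> rfl

lemma expOf_zero : expOf (0 : Mon (Fin t)) 0 = 0 := by
  ext o
  cases o <;> rfl

lemma coeff_invProd_expOf (γ : Mon (Fin t)) (i : ℕ) :
    MvPowerSeries.coeff (expOf γ i) (invProd Finset.univ) = if i = mdeg γ then (-1) ^ i else 0 := by
  rw [coeff_invProd]
  refine if_congr ?_ rfl rfl
  simp [mdeg]

lemma coeff_invProd_mul_bFormula (k : Type*) [Field k] (M : Finset (Mon (Fin t))) (γ : Mon (Fin t))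
    (i : ℕ) :
    MvPowerSeries.coeff (expOf γ i)
        (invProd Finset.univ * (bFormula k M : MvPowerSeries (Option (Fin t)) ℤ))
      = (if i = mdeg γ then (-1) ^ i else 0) + ∑ S ∈ satSets M, ∑ n ∈ Finset.range (S.card + 1),
        if mlcm S ≤ γ ∧ ncomp S + n + 1 ≤ i then
          (if i - (ncomp S + n + 1) = mdeg (γ - mlcm S) then (-1) ^ (i - (ncomp S + n + 1)) else 0)
            * ((-1) ^ ncomp S * (hdim k (dprime S) n : ℤ))
        else 0 := by
  have hb : (bFormula k M : MvPowerSeries (Option (Fin t)) ℤ) = 1 + ∑ S ∈ satSets M,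
      ∑ n ∈ Finset.range (S.card + 1), MvPowerSeries.monomial (expOf (mlcm S) (ncomp S + n + 1))
        ((-1 : ℤ) ^ (ncomp S) * (hdim k (dprime S) n : ℤ)) := by
    rw [← MvPolynomial.coeToMvPowerSeries.ringHom_apply, bFormula]
    simp only [map_add, map_one, map_sum, MvPolynomial.coeToMvPowerSeries.ringHom_apply,
      MvPolynomial.coe_monomial]
  rw [hb, mul_add, mul_one, map_add, coeff_invProd_expOf, Finset.mul_sum, map_sum]
  congr 1
  refine Finset.sum_congr rfl fun S _ => ?_
  rw [Finset.mul_sum, map_sum]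
  refine Finset.sum_congr rfl fun n _ => ?_
  rw [MvPowerSeries.coeff_mul_monomial, expOf_sub, coeff_invProd_expOf]
  simp only [expOf_le]

end Exponents

end MonomialRings

namespace MonomialRings

namespace Letter

variable {t : ℕ} {M : Finset (Mon (Fin t))} (k : Type*) [Field k]

/-- The possible second components of the key of a letter. -/
def types (M : Finset (Mon (Fin t))) : Finset (Finset (Mon (Fin t))) :=
  insert ∅ ((satSets M).image cl)

/-- The contribution of the key `κ` to the signed count of letters in homological degree `i`. -/
def keyTerm (M : Finset (Mon (Fin t))) (κ : Mon (Fin t) × Finset (Mon (Fin t))) (i : ℕ) : ℤ :=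
  if keyCard κ - 1 + 1 ≤ i then
    (-1) ^ (keyCard κ - 1) * harmonicCount k M κ (i - (keyCard κ - 1 + 1)) else 0

lemma sum_types (h2 : ∀ m ∈ M, 2 ≤ mdeg m) (f : Finset (Mon (Fin t)) → ℤ) :
    ∑ C ∈ types M, f C = f ∅ + ∑ S ∈ satSets M, f (cl S) := by
  have h0 := zero_notMem_of_two_le h2
  rw [types, Finset.sum_insert, Finset.sum_image]
  · intro S hS S' hS' h
    rw [← clOf_cl_of_mem_satSets h0 hS, ← clOf_cl_of_mem_satSets h0 hS', h]
  · intro h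
    obtain ⟨S, hS, h⟩ := Finset.mem_image.1 h
    exact (nonempty_of_mem_satSets hS).ne_empty (cl_eq_empty.1 h)

lemma mdeg_pos {γ : Mon (Fin t)} (h : γ ≠ 0) : 0 < mdeg γ := by
  refine Nat.pos_of_ne_zero fun h' => h (funext fun i => ?_)
  rw [mdeg, Finset.sum_eq_zero_iff] at h'
  exact h' i (Finset.mem_univ i)

lemma mlcm_empty : mlcm (∅ : Finset (Mon (Fin t))) = 0 := Finset.sup_empty

lemma keyTerm_empty (h2 : ∀ m ∈ M, 2 ≤ mdeg m) {γ : Mon (Fin t)} (hγ : γ ≠ 0) (i : ℕ) :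
    keyTerm k M (γ, ∅) i = -(if i = mdeg γ then (-1) ^ i else 0) := by
  have h1 := mdeg_pos hγ
  have hW : keyCard (γ, (∅ : Finset (Mon (Fin t)))) = mdeg γ := by
    rw [keyCard, mlcm_empty, Finset.card_empty, zero_add, tsub_zero]
  obtain ⟨d, hd⟩ : ∃ d, mdeg γ = d + 1 := ⟨mdeg γ - 1, by omega⟩
  rw [keyTerm, hW, harmonicCount_empty k h2 hγ, hd, Nat.add_sub_cancel]
  by_cases hi : i = d + 1
  · rw [if_pos hi.ge, if_pos (by omega), if_pos hi, hi]
    ring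
  · rw [if_neg (c := i = d + 1) hi, neg_zero]
    split_ifs with h h'
    · omega
    · ring
    · rfl

lemma keyTerm_cl (h2 : ∀ m ∈ M, 2 ≤ mdeg m) {γ : Mon (Fin t)} {S : Finset (Mon (Fin t))}
    (hS : S ∈ satSets M) (i : ℕ) :
    keyTerm k M (γ, cl S) i = -∑ n ∈ Finset.range (S.card + 1),
      if mlcm S ≤ γ ∧ ncomp S + n + 1 ≤ i then
        (if i - (ncomp S + n + 1) = mdeg (γ - mlcm S) then (-1) ^ (i - (ncomp S + n + 1)) else 0)
          * ((-1) ^ ncomp S * (hdim k (dprime S) n : ℤ))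
      else 0 := by
  have h0 := zero_notMem_of_two_le h2
  have h0S := zero_notMem_of_subset h0 (subset_of_mem_satSets hS)
  by_cases hγ : mlcm S ≤ γ
  · obtain ⟨d, hd⟩ : ∃ d, mdeg (γ - mlcm S) = d := ⟨_, rfl⟩
    have hpos : 0 < ncomp S := by
      rw [ncomp_eq_card_cl h0S, Finset.card_pos, Finset.nonempty_iff_ne_empty, Ne, cl_eq_empty]
      exact (nonempty_of_mem_satSets hS).ne_empty
    obtain ⟨c, hc⟩ : ∃ c, ncomp S = c + 1 := ⟨ncomp S - 1, by omega⟩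
    have hW : keyCard (γ, cl S) = c + d + 1 := by
      rw [keyCard, ← ncomp_eq_card_cl h0S, ← (decomp_cl h0S).sup_eq, hd, hc]
      omega
    rw [keyTerm, hW, Nat.add_sub_cancel, hd, hc]
    by_cases hi : c + d + 2 ≤ i
    · obtain ⟨n, rfl⟩ := Nat.exists_eq_add_of_le' hi
      rw [if_pos (by omega), show n + (c + d + 2) - (c + d + 1) = n + 1 by omega,
        harmonicCount_cl_succ k h2 hS hγ, Finset.sum_eq_single n]
      · rw [if_pos ⟨hγ, by omega⟩, show n + (c + d + 2) - (c + 1 + n + 1) = d by omega,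
          if_pos rfl]
        ring
      · intro n' _ hn'
        split_ifs with h h'
        · omega
        · rw [zero_mul]
        · rfl
      · intro hn
        rw [hdim_eq_zero k (Δ := dprime S) (n := n)]
        · simp
        · intro F hF hn'
          have := Finset.card_le_card hF.1
          simp at hn
          omega
    · rw [Finset.sum_eq_zero, neg_zero]
      · split_ifs with h
        · rw [show i - (c + d + 1) = 0 by omega, harmonicCount_cl_zero k h2 hS, mul_zero]
        · rfl
      · intro n _
        split_ifs with h h'
        · omega
        · rw [zero_mul]
        · rfl
  · have h : ∀ n, harmonicCount k M (γ, cl S) n = 0 := by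
      intro n
      by_contra h
      obtain ⟨-, h | ⟨S', hS', h, hle⟩⟩ := key_of_harmonicCount_ne_zero h2 h
      · exact (nonempty_of_mem_satSets hS).ne_empty (cl_eq_empty.1 h)
      · have h : cl S = cl S' := h
        rw [← clOf_cl_of_mem_satSets h0 hS', ← h, clOf_cl_of_mem_satSets h0 hS] at hle
        exact hγ hle
    rw [keyTerm, h, mul_zero, ite_self]
    simp [hγ]

lemma keyTerm_zero (h2 : ∀ m ∈ M, 2 ≤ mdeg m) (C : Finset (Mon (Fin t))) (i : ℕ) :
    keyTerm k M (0, C) i = 0 := by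
  have h : ∀ n, harmonicCount k M (0, C) n = 0 := by
    intro n
    by_contra h
    exact (key_of_harmonicCount_ne_zero h2 h).1 rfl
  rw [keyTerm, h, mul_zero, ite_self]

/-- The denominator in terms of the signed counts of letters. -/
theorem coeff_invProd_mul_bFormula_eq (h2 : ∀ m ∈ M, 2 ≤ mdeg m) (γ : Mon (Fin t)) (i : ℕ) :
    MvPowerSeries.coeff (expOf γ i)
        (invProd Finset.univ * (bFormula k M : MvPowerSeries (Option (Fin t)) ℤ))
      = MvPowerSeries.coeff (expOf γ i) 1 - ∑ C ∈ types M, keyTerm k M (γ, C) i := by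
  rw [coeff_invProd_mul_bFormula, MvPowerSeries.coeff_one, ← expOf_zero]
  simp only [expOf_inj]
  by_cases hγ : γ = 0
  · subst hγ
    have hS : ∀ S ∈ satSets M, ¬ mlcm S ≤ 0 := by
      intro S hS h
      obtain ⟨s, hs⟩ := nonempty_of_mem_satSets hS
      have h3 := mdeg_mono ((le_mlcm hs).trans h)
      have h4 := h2 s (subset_of_mem_satSets hS hs)
      rw [mdeg_zero] at h3
      omega
    rw [Finset.sum_eq_zero fun C _ => keyTerm_zero k h2 C i, sub_zero, Finset.sum_eq_zero, add_zero,
      mdeg_zero]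
    · by_cases hi : i = 0 <;> simp [hi]
    · intro S h
      simp [hS S h]
  · rw [sum_types h2, keyTerm_empty k h2 hγ,
      Finset.sum_congr rfl fun S hS => keyTerm_cl k h2 hS i, Finset.sum_neg_distrib,
      if_neg (c := γ = 0 ∧ i = 0) fun h => hγ h.1]
    ring

end Letter

end MonomialRings

namespace MonomialRings

section ListPiece

variable {t : ℕ} {Λ : Type*} (key' : Λ → Mon (Fin t) × Finset (Mon (Fin t))) (deg' : Λ → ℕ)

/-- The weight of a harmonic letter in the denominator. -/
def weight (a : Λ) : Option (Fin t) →₀ ℕ :=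
  expOf (key' a).1 (deg' a + 1 + (Letter.keyCard (key' a) - 1))

/-- The sign of a harmonic letter in the denominator. -/
def weightSign (a : Λ) : ℤ := (-1) ^ (Letter.keyCard (key' a) - 1)

lemma weight_ne_zero (a : Λ) : weight key' deg' a ≠ 0 := by
  intro h
  have := DFunLike.congr_fun h none
  simp [weight] at this

lemma sum_weight (L : List Λ) : (L.map (weight key' deg')).sum
    = expOf ((L.map key').map Prod.fst).sum ((L.map fun a => deg' a + 1).sum
      + ((L.map key').map fun κ => Letter.keyCard κ - 1).sum) := by
  induction L with
  | nil => exact expOf_zero.symm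
  | cons a L ih =>
    simp only [List.map_cons, List.sum_cons, ih]
    rw [weight, expOf_add]
    congr 1
    omega

lemma prod_weightSign (L : List Λ) : (L.map (weightSign key')).prod
    = (-1) ^ ((L.map key').map fun κ => Letter.keyCard κ - 1).sum := by
  induction L with
  | nil => simp
  | cons a L ih =>
    simp only [List.map_cons, List.prod_cons, List.sum_cons, ih, pow_add]
    rfl

/-- Signed enumeration of lists of letters by their excess. -/
lemma sum_prod_weightSign {γ : Mon (Fin t)} {i : ℕ}
    (hf : {L : List Λ | (L.map (weight key' deg')).sum = expOf γ i}.Finite) :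
    ∑ L ∈ hf.toFinset, (L.map (weightSign key')).prod = ∑ q ∈ Finset.range (i + 1),
      (-1 : ℤ) ^ q * (listPiece key' deg' (Letter.keySet γ q) (i - q)).ncard := by
  have hmem : ∀ L, L ∈ hf.toFinset ↔ ((L.map key').map Prod.fst).sum = γ ∧
      (L.map fun a => deg' a + 1).sum
        + ((L.map key').map fun κ => Letter.keyCard κ - 1).sum = i := by
    intro L
    rw [Set.Finite.mem_toFinset, Set.mem_ofPred, sum_weight, expOf_inj]
  rw [← Finset.sum_fiberwise_of_maps_to (t := Finset.range (i + 1))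
    (g := fun L => ((L.map key').map fun κ => Letter.keyCard κ - 1).sum)]
  · refine Finset.sum_congr rfl fun q hq => ?_
    have hq' := Finset.mem_range.1 hq
    have hset : listPiece key' deg' (Letter.keySet γ q) (i - q) = ↑(hf.toFinset.filter fun L =>
        ((L.map key').map fun κ => Letter.keyCard κ - 1).sum = q) := by
      ext L
      rw [Finset.mem_coe, Finset.mem_filter, hmem]
      change (((L.map key').map Prod.fst).sum = γ ∧
        ((L.map key').map fun κ => Letter.keyCard κ - 1).sum = q) ∧
        (L.map fun a => deg' a + 1).sum = i - q ↔ _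
      constructor
      · rintro ⟨⟨h1, h2⟩, h3⟩
        exact ⟨⟨h1, by omega⟩, h2⟩
      · rintro ⟨⟨h1, h2⟩, h3⟩
        exact ⟨⟨h1, h3⟩, by omega⟩
    rw [hset, Set.ncard_coe_finset, Finset.sum_congr rfl (g := fun _ => (-1 : ℤ) ^ q)]
    · rw [Finset.sum_const, nsmul_eq_mul, mul_comm]
    · intro L hL
      rw [prod_weightSign, (Finset.mem_filter.1 hL).2]
  · intro L hL
    have := ((hmem L).1 hL).2
    exact Finset.mem_range.2 (by omega)

end ListPiece

section Letters

variable {t : ℕ} {M : Finset (Mon (Fin t))} {k : Type*} [Field k] {Λ : Type*}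
  {key' : Λ → Mon (Fin t) × Finset (Mon (Fin t))} {deg' : Λ → ℕ}

lemma snd_mem_types (h2 : ∀ m ∈ M, 2 ≤ mdeg m)
    (hfin : ∀ κ n, {a | key' a = κ ∧ deg' a = n}.Finite)
    (hcount : ∀ κ n, Letter.harmonicCount k M κ n = {a | key' a = κ ∧ deg' a = n}.ncard) (a : Λ) :
    (key' a).2 ∈ Letter.types M := by
  have h : Letter.harmonicCount k M (key' a) (deg' a) ≠ 0 := by
    rw [hcount, Nat.cast_ne_zero]
    exact ((Set.ncard_pos (hfin _ _)).2 ⟨a, rfl, rfl⟩).ne'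
  obtain ⟨-, h | ⟨S, hS, h, -⟩⟩ := Letter.key_of_harmonicCount_ne_zero h2 h
  · rw [h]
    exact Finset.mem_insert_self _ _
  · rw [h]
    exact Finset.mem_insert_of_mem (Finset.mem_image_of_mem _ hS)

lemma finite_weight (htypes : ∀ a, (key' a).2 ∈ Letter.types M)
    (hfin : ∀ κ n, {a | key' a = κ ∧ deg' a = n}.Finite) (e : Option (Fin t) →₀ ℕ) :
    {a | weight key' deg' a = e}.Finite := by
  have h : (⋃ p ∈ (Letter.types M ×ˢ Finset.range (e none) : Finset _),
      {a | key' a = ((fun i => e (some i)), p.1) ∧ deg' a = p.2}).Finite :=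
    Set.Finite.biUnion (Finset.finite_toSet _) fun p _ => hfin _ _
  refine h.subset ?_
  rintro a rfl
  refine Set.mem_biUnion (x := ((key' a).2, deg' a)) ?_ ⟨rfl, rfl⟩
  rw [Finset.mem_coe, Finset.mem_product, Finset.mem_range]
  refine ⟨htypes a, ?_⟩
  change deg' a < deg' a + 1 + _
  omega

lemma sum_weightSign (htypes : ∀ a, (key' a).2 ∈ Letter.types M)
    (hcount : ∀ κ n, Letter.harmonicCount k M κ n = {a | key' a = κ ∧ deg' a = n}.ncard)
    {γ : Mon (Fin t)} {i : ℕ} (hf : {a | weight key' deg' a = expOf γ i}.Finite) :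
    ∑ a ∈ hf.toFinset, weightSign key' a = ∑ C ∈ Letter.types M, Letter.keyTerm k M (γ, C) i := by
  have hmem : ∀ a, a ∈ hf.toFinset ↔ (key' a).1 = γ ∧
      deg' a + 1 + (Letter.keyCard (key' a) - 1) = i := by
    intro a
    rw [Set.Finite.mem_toFinset, Set.mem_ofPred, weight, expOf_inj]
  rw [← Finset.sum_fiberwise_of_maps_to (t := Letter.types M) (g := fun a => (key' a).2)
    fun a _ => htypes a]
  refine Finset.sum_congr rfl fun C _ => ?_
  have hset : ∀ a, a ∈ hf.toFinset.filter (fun a => (key' a).2 = C) ↔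
      key' a = (γ, C) ∧ deg' a + 1 + (Letter.keyCard (γ, C) - 1) = i := by
    intro a
    rw [Finset.mem_filter, hmem]
    constructor
    · rintro ⟨⟨rfl, h⟩, rfl⟩
      exact ⟨rfl, h⟩
    · rintro ⟨h1, h2⟩
      rw [h1]
      exact ⟨⟨rfl, h2⟩, rfl⟩
  rw [Letter.keyTerm]
  split_ifs with h
  · have hset' : {a | key' a = (γ, C) ∧ deg' a = i - (Letter.keyCard (γ, C) - 1 + 1)}
        = ↑(hf.toFinset.filter fun a => (key' a).2 = C) := by
      ext a
      rw [Finset.mem_coe, hset]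
      refine and_congr_right fun _ => ?_
      omega
    rw [hcount, hset', Set.ncard_coe_finset,
      Finset.sum_congr rfl (g := fun _ => (-1 : ℤ) ^ (Letter.keyCard (γ, C) - 1))]
    · rw [Finset.sum_const, nsmul_eq_mul, mul_comm]
    · intro a ha
      rw [weightSign, ((hset a).1 ha).1]
  · refine Finset.sum_eq_zero fun a ha => ?_
    have := ((hset a).1 ha).2
    omega

end Letters

/-- The polynomial `bFormula` is a denominator of the Poincaré series. -/
theorem isDenominator_bFormula (k : Type*) [Field k] {t : ℕ} {M : Finset (Mon (Fin t))}
    (h2 : ∀ m ∈ M, 2 ≤ mdeg m) : IsDenominator k (upperSet M) (bFormula k M) := by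
  obtain ⟨Λ, key', deg', hfin, hcount, htor⟩ := Letter.exists_harmonic k h2
  have htypes := snd_mem_types h2 hfin hcount
  have hw := finite_weight htypes hfin
  have hgeom := genSeries_list (weight_ne_zero key' deg') hw (weightSign key')
  have hP : genSeries (fun L : List Λ => (L.map (weight key' deg')).sum)
      (finite_list_sum_eq (weight_ne_zero key' deg') hw)
      (fun L => (L.map (weightSign key')).prod) = poincareSeries k (upperSet M) := by
    ext e
    obtain ⟨γ, i, rfl⟩ : ∃ γ i, e = expOf γ i := ⟨_, _, eq_expOf e⟩
    rw [coeff_genSeries, sum_prod_weightSign]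
    exact (htor γ i).symm
  have hA : invProd Finset.univ * (bFormula k M : MvPowerSeries (Option (Fin t)) ℤ)
      = 1 - genSeries (weight key' deg') hw (weightSign key') := by
    ext e
    obtain ⟨γ, i, rfl⟩ : ∃ γ i, e = expOf γ i := ⟨_, _, eq_expOf e⟩
    rw [Letter.coeff_invProd_mul_bFormula_eq k h2, map_sub, coeff_genSeries,
      sum_weightSign htypes hcount]
  rw [hP, ← hA] at hgeom
  have h := congrArg ((∏ i : Fin t, (1 + MvPowerSeries.X (some i) * MvPowerSeries.X none)) * ·)
      hgeom
  simpa only [IsDenominator, ← mul_assoc, prod_mul_invProd, one_mul, mul_one] using h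

lemma expSet_eq_upperSet {t : ℕ} {k : Type*} [Field k] {M : Finset (Mon (Fin t))}
    {I : Ideal (MvPolynomial (Fin t) k)} (h : IsMonomialIdealOf M I) : expSet I = upperSet M := by
  ext β
  have hI : I = Ideal.span ((fun s => MvPolynomial.monomial s (1 : k)) ''
      (Finsupp.equivFunOnFinite.symm '' (M : Set (Mon (Fin t))))) := by
    rw [Set.image_image]
    exact h
  rw [expSet, Set.mem_ofPred, hI, MvPolynomial.mem_ideal_span_monomial_image]
  rw [MvPolynomial.support_monomial, if_neg one_ne_zero]
  simp only [Finset.mem_singleton, forall_eq, Set.exists_mem_image, upperSet, Set.mem_ofPred]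
  rfl

lemma IsDenominator.unique {k : Type*} [Field k] {t : ℕ} {J : Set (Mon (Fin t))}
    {b b' : MvPolynomial (Option (Fin t)) ℤ} (hb : IsDenominator k J b)
    (hb' : IsDenominator k J b') : b = b' := by
  have hP : poincareSeries k J ≠ 0 := by
    intro h
    have h1 := prod_mul_invProd (Finset.univ : Finset (Fin t))
    rw [← hb, h, mul_zero, zero_mul] at h1
    exact zero_ne_one h1
  exact MvPolynomial.coe_injective _ _ (mul_right_cancel₀ hP (hb.trans hb'.symm))

end MonomialRings

open MonomialRings

/-- **Theorem (Poincaré series of monomial rings).**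
Let `k` be a field and `I` the ideal of `Q = k[x₁,…,x_t]` generated by a minimal set `M`
of monomials of degree at least 2, and `R = Q/I`.  The denominator `b_R(x,z)` of the
multigraded Poincaré series of `R` is
`b_R(x,z) = 1 + ∑_{S ∈ sat(M)} m_S (-z)^{c(S)+2} H̃(Δ'_S;k)(z)`. -/
theorem poincare_series_denominator_formula
    (t : ℕ) (k : Type) [Field k]
    (M : Finset (Mon (Fin t)))
    (I : Ideal (MvPolynomial (Fin t) k))
    (hgen : IsMonomialIdealOf M I)
    (hmin : IsAntichain' M)
    (hdeg : ∀ m ∈ M, 2 ≤ mdeg m)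
    (b : MvPolynomial (Option (Fin t)) ℤ)
    (hb : IsDenominator k (expSet I) b) :
    b = bFormula k M := by
  rw [expSet_eq_upperSet hgen] at hb
  exact hb.unique (isDenominator_bFormula k hdeg)
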